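/- For all reals χ, Δ > 1 and μ > 0 there exists n₀ such that the following holds for every n ≥ n₀. Let H be an 𝓕_cr(⌈χ⌉, √n/log n)-tiling on n vertices with crit(H) ≤ χ and Δ(H) ≤ Δ, and let G be a graph on n vertices whose degree sequence is (χ,μ)-strong. Then H is a subgraph of G. -/

import Mathlib

open scoped Classical

namespace Paper

noncomputable section

variable {V : Type} [Fintype V]

/-- The degree of a vertex, via `Set.ncard`. -/
def ndeg (G : SimpleGraph V) (v : V) : ℕ := (G.neighborSet v).ncard

/-- A proper colouring with colours `0, …, k-1`. -/
def ProperCol (G : SimpleGraph V) (k : ℕ) (C : V → ℕ) : Prop :=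
  (∀ v, C v < k) ∧ ∀ ⦃u v⦄, G.Adj u v → C u ≠ C v

/-- A topological colouring with colours `0, …, k-1`: every edge is monochromatic. -/
def TopCol (G : SimpleGraph V) (k : ℕ) (C : V → ℕ) : Prop :=
  (∀ v, C v < k) ∧ ∀ ⦃u v⦄, G.Adj u v → C u = C v

/-- The size of the `i`-th colour class of a colouring. -/
def classCard (C : V → ℕ) (i : ℕ) : ℕ := {v | C v = i}.ncard

/-- The chromatic number, as a natural number. -/
def chromNum (G : SimpleGraph V) : ℕ := G.chromaticNumber.toNat

/-- The size of the smallest colour class of a colouring with `k` colours. -/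
def minClassCard (C : V → ℕ) (k : ℕ) : ℕ := sInf {a | ∃ i < k, a = classCard C i}

/-- The minimum, over proper `χ(G)`-colourings, of the size of the smallest colour class. -/
def alphaNat (G : SimpleGraph V) : ℕ :=
  sInf {a | ∃ C, ProperCol G (chromNum G) C ∧ a = minClassCard C (chromNum G)}

/-- `α(G)`: minimum proportion of vertices in a single colour class over proper
`χ(G)`-colourings. -/
def alphaR (G : SimpleGraph V) : ℝ := (alphaNat G : ℝ) / (Fintype.card V : ℝ)

/-- The critical chromatic number `crit(G) = (χ(G) − 1)/(1 − α(G))`. -/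
def critR (G : SimpleGraph V) : ℝ := ((chromNum G : ℝ) - 1) / (1 - alphaR G)

/-- `𝒟(G)`: values `||φ⁻¹(0)| − |φ⁻¹(1)||` over proper `χ(G)`-colourings `φ`. -/
def DSet (G : SimpleGraph V) : Set ℕ :=
  {d | ∃ C, ProperCol G (chromNum G) C ∧
    d = ((classCard C 0 : ℤ) - (classCard C 1 : ℤ)).natAbs}

/-- The set `S ⊆ ℕ` has greatest common divisor `1`.  (Elements `0` are immaterial, and this
fails when `S ⊆ {0}`, matching the convention `gcd = ∞` in that case.) -/
def GcdOne (S : Set ℕ) : Prop := ∃ T : Finset ℕ, ↑T ⊆ S ∧ T.gcd id = 1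

/-- The orders of the connected components of `G`. -/
def compOrders (G : SimpleGraph V) : Set ℕ :=
  {m | ∃ c : G.ConnectedComponent, m = c.supp.ncard}

/-- Membership in the class `𝓕_cr`. -/
def IsFcr (G : SimpleGraph V) : Prop :=
  (G.chromaticNumber = 2 ∧ GcdOne (DSet G) ∧ GcdOne (compOrders G)) ∨
  (3 ≤ G.chromaticNumber ∧ GcdOne (DSet G))

/-- `H` is a tiling whose tiles satisfy the (isomorphism-invariant) predicate `tile`:
the vertex set partitions into parts with no edges of `H` between distinct parts, each part
inducing a graph satisfying `tile`. -/
def IsTiling (H : SimpleGraph V) (tile : ∀ (W : Type) [Fintype W], SimpleGraph W → Prop) : Prop :=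
  ∃ P : Set (Set V), Setoid.IsPartition P ∧
    (∀ p ∈ P, ∀ q ∈ P, p ≠ q → ∀ u ∈ p, ∀ v ∈ q, ¬ H.Adj u v) ∧
    ∀ p ∈ P, tile ↥p (H.induce p)

/-- Tiles of order at most `w`. -/
def TileLe (w : ℕ) (W : Type) [Fintype W] (F : SimpleGraph W) : Prop := Fintype.card W ≤ w

/-- Tiles in `𝓕(k, w)`: properly `k`-colourable of order at most `w` (real bound `w`). -/
def TileCol (k : ℕ) (w : ℝ) (W : Type) [Fintype W] (F : SimpleGraph W) : Prop :=
  F.Colorable k ∧ (Fintype.card W : ℝ) ≤ w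

/-- Tiles in `𝓕_cr(k, w)` (real bound `w`). -/
def TileFcr (k : ℕ) (w : ℝ) (W : Type) [Fintype W] (F : SimpleGraph W) : Prop :=
  IsFcr F ∧ F.Colorable k ∧ (Fintype.card W : ℝ) ≤ w

/-- Tiles in `𝓕_c(k, w)` (real bound `w`). -/
def TileFc (k : ℕ) (w : ℝ) (W : Type) [Fintype W] (F : SimpleGraph W) : Prop :=
  GcdOne (compOrders F) ∧ F.Colorable k ∧ (Fintype.card W : ℝ) ≤ w

/-- Tiles isomorphic to a fixed graph `F₀`. -/
def TileIso {m : ℕ} (F₀ : SimpleGraph (Fin m)) (W : Type) [Fintype W]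
    (F : SimpleGraph W) : Prop :=
  Nonempty (F ≃g F₀)

/-- `G` contains a copy of `H` as a (not necessarily induced) subgraph. -/
def ContainsCopy {V' : Type} (G : SimpleGraph V) (H : SimpleGraph V') : Prop :=
  ∃ f : V' → V, Function.Injective f ∧ ∀ ⦃u v⦄, H.Adj u v → G.Adj (f u) (f v)

/-- `H` is properly `(k, s)`-flexi-chromatic. -/
def ProperlyFlexi (H : SimpleGraph V) (k s : ℕ) : Prop :=
  ∃ φ, ProperCol H k φ ∧ ∀ w : Fin k → ℤ, ∑ i, w i = 0 → (∀ i, |w i| ≤ (s : ℤ)) →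
    ∃ φ', ProperCol H k φ' ∧
      ∀ i : Fin k, (classCard φ (i : ℕ) : ℤ) - classCard φ' (i : ℕ) = w i

/-- `H` is topologically `(k, s)`-flexi-chromatic. -/
def TopFlexi (H : SimpleGraph V) (k s : ℕ) : Prop :=
  ∃ φ, TopCol H k φ ∧ ∀ w : Fin k → ℤ, ∑ i, w i = 0 → (∀ i, |w i| ≤ (s : ℤ)) →
    ∃ φ', TopCol H k φ' ∧
      ∀ i : Fin k, (classCard φ (i : ℕ) : ℤ) - classCard φ' (i : ℕ) = w i

/-- `A` is a union of connected components of `H` (the vertex set of a subtiling). -/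
def CompClosed (H : SimpleGraph V) (A : Set V) : Prop :=
  ∀ ⦃u v⦄, H.Reachable u v → u ∈ A → v ∈ A

/-- `H` contains `t` pairwise disjoint properly `(k, s)`-flexi-chromatic subtilings together
with one further disjoint topologically `(ℓ, s')`-flexi-chromatic subtiling, each of order at
most `w'`. -/
def HasFlexiSubtilings (H : SimpleGraph V) (t ℓ k s s' w' : ℕ) : Prop :=
  ∃ (A : Fin t → Set V) (B : Set V),
    (∀ i, CompClosed H (A i)) ∧ CompClosed H B ∧
    (∀ i j, i ≠ j → Disjoint (A i) (A j)) ∧ (∀ i, Disjoint (A i) B) ∧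
    (∀ i, (A i).ncard ≤ w') ∧ B.ncard ≤ w' ∧
    (∀ i, ProperlyFlexi (H.induce (A i)) k s) ∧
    TopFlexi (H.induce B) ℓ s'

/-- `H ∈ ℋ(n, w, Δ; χ; t, ℓ, w')`. -/
def InH (H : SimpleGraph V) (n w : ℕ) (Δ χ : ℝ) (t ℓ w' : ℕ) : Prop :=
  Fintype.card V ≤ n ∧ (∀ v, (ndeg H v : ℝ) ≤ Δ) ∧ IsTiling H (TileLe w) ∧
  critR H ≤ χ ∧ HasFlexiSubtilings H t ℓ ⌈χ⌉₊ (⌈χ⌉₊ * w) w w'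

/-- The tight adjacency graph `T(J)` on the edge set `E` of a `k`-uniform hypergraph. -/
def TGraph (k : ℕ) (E : Set (Finset V)) : SimpleGraph ↥E :=
  SimpleGraph.fromRel fun e f => ((e : Finset V) ∩ (f : Finset V)).card = k - 1

/-- The number of tight components. -/
def tightCount (k : ℕ) (E : Set (Finset V)) : ℕ := Nat.card (TGraph k E).ConnectedComponent

/-- The vertex support of a tight component. -/
def tcSupp (k : ℕ) (E : Set (Finset V)) (c : (TGraph k E).ConnectedComponent) : Set V :=
  {v | ∃ e : ↥E, (TGraph k E).connectedComponentMk e = c ∧ v ∈ (e : Finset V)}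

/-- The loose adjacency graph `L(J)` on the tight components. -/
def LGraph (k : ℕ) (E : Set (Finset V)) : SimpleGraph (TGraph k E).ConnectedComponent :=
  SimpleGraph.fromRel fun c c' => (tcSupp k E c ∩ tcSupp k E c').Nonempty

/-- The number of loose components. -/
def looseCount (k : ℕ) (E : Set (Finset V)) : ℕ := Nat.card (LGraph k E).ConnectedComponent

/-- `(t, ℓ)`-connectedness: some vertex-spanning subhypergraph has at most `t` tight
components and at most `ℓ` loose components. -/
def ConnectedTL (k : ℕ) (E : Set (Finset V)) (t ℓ : ℕ) : Prop :=
  ∃ E' ⊆ E, (∀ v : V, ∃ e ∈ E', v ∈ e) ∧ tightCount k E' ≤ t ∧ looseCount k E' ≤ ℓ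

/-- Every vertex is linked to some edge. -/
def Linked (k : ℕ) (E : Set (Finset V)) : Prop :=
  ∀ v : V, ∃ f ∈ E, v ∉ f ∧ ∃ e ∈ E, v ∈ e ∧ (e ∩ f).card = k - 1

/-- `ω` is a fractional `F`-tiling of `G`. -/
def IsFracTiling {α : Type} [Fintype α] (F : SimpleGraph α) (G : SimpleGraph V)
    (ω : (F →g G) → ℝ) : Prop :=
  (∀ θ, 0 ≤ ω θ ∧ ω θ ≤ 1) ∧
  ∀ v : V, (∑ᶠ θ : F →g G, ω θ * ({u | θ u = v}.ncard : ℝ)) ≤ 1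

/-- The weight of a fractional tiling. -/
def fracWeight {α : Type} [Fintype α] (F : SimpleGraph α) (G : SimpleGraph V)
    (ω : (F →g G) → ℝ) : ℝ :=
  (Fintype.card α : ℝ) * ∑ᶠ θ : F →g G, ω θ

/-- For a rational `q > 1`, the numerator `a` in `q = ⌊q⌋ + a/b`. -/
def aB (q : ℚ) : ℕ := (q - (⌊q⌋ : ℚ)).num.toNat

/-- For a rational `q > 1`, the denominator `b` in `q = ⌊q⌋ + a/b`. -/
def bB (q : ℚ) : ℕ := (q - (⌊q⌋ : ℚ)).den

/-- The bottle graph `B_q`: complete `⌈q⌉`-partite with one part of size `a` and the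
remaining `⌈q⌉ − 1` parts of size `b`. -/
def Bgraph (q : ℚ) : SimpleGraph (Σ i : Fin ⌈q⌉₊, Fin (if (i : ℕ) = 0 then aB q else bB q)) :=
  SimpleGraph.completeMultipartiteGraph fun i : Fin ⌈q⌉₊ => Fin (if (i : ℕ) = 0 then aB q else bB q)

/-- `G` is a `(q, ρ; t, ℓ)`-tiling framework. -/
def TilingFramework (G : SimpleGraph V) (q : ℚ) (ρ : ℝ) (t ℓ : ℕ) : Prop :=
  (∃ ω, IsFracTiling (Bgraph q) G ω ∧
      (1 - ρ) * (Fintype.card V : ℝ) ≤ fracWeight (Bgraph q) G ω) ∧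
  ConnectedTL ⌈q⌉₊ (G.cliqueSet ⌈q⌉₊) t ℓ ∧
  Linked ⌈q⌉₊ (G.cliqueSet ⌈q⌉₊)

/-- `G'` (on the vertex set `S`) is an `(ε, d)`-approximation of `G`. -/
def IsApprox (G : SimpleGraph V) (ε d : ℝ) (S : Set V) (G' : SimpleGraph ↥S) : Prop :=
  G' ≤ G.induce S ∧ (1 - ε) * (Fintype.card V : ℝ) ≤ (S.ncard : ℝ) ∧
  ∀ v : ↥S, (ndeg G (v : V) : ℝ) - d * (Fintype.card V : ℝ) ≤ (ndeg G' v : ℝ)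

/-- `G` is `μ`-robustly a `(q, ρ; t, ℓ)`-tiling framework. -/
def RobustFramework (G : SimpleGraph V) (μ : ℝ) (q : ℚ) (ρ : ℝ) (t ℓ : ℕ) : Prop :=
  ∀ (S : Set V) (G' : SimpleGraph ↥S), IsApprox G μ μ S G' → TilingFramework G' q ρ t ℓ

/-- `α(χ) = 1 − (⌈χ⌉ − 1)/χ`. -/
def alphaOf (χ : ℝ) : ℝ := 1 - ((⌈χ⌉₊ : ℝ) - 1) / χ

/-- The degree sequence of `G` is `(χ, μ)`-strong. -/
def DegSeqStrong (G : SimpleGraph V) (χ μ : ℝ) : Prop :=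
  ∃ e : Fin (Fintype.card V) ≃ V,
    (∀ i j, i ≤ j → ndeg G (e i) ≤ ndeg G (e j)) ∧
    ∀ i : Fin (Fintype.card V), ((i : ℕ) + 1 : ℝ) ≤ (Fintype.card V : ℝ) / χ →
      (1 - 1 / χ - alphaOf χ) * (Fintype.card V : ℝ) + χ * alphaOf χ * ((i : ℕ) + 1) +
          μ * (Fintype.card V : ℝ) ≤ (ndeg G (e i) : ℝ)

/-- `G` is uniformly `(ρ, d)`-dense. -/
def UniformlyDense (G : SimpleGraph V) (ρ d : ℝ) : Prop :=
  ∀ U : Set V, d * (U.ncard : ℝ) ^ 2 / 2 - ρ * (Fintype.card V : ℝ) ^ 2 ≤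
    ((G.induce U).edgeSet.ncard : ℝ)

/-- `p`-approximately `(k, s)`-flexi-chromatic with central colouring `φ`, generic in the
kind of colouring `Col` (proper or topological). -/
def ApproxFlexiWith {V : Type} (Col : ℕ → (V → ℕ) → Prop) (k s p : ℕ) (φ : V → ℕ) : Prop :=
  Col k φ ∧ ∀ w : Fin k → ℤ, ∑ i, w i = 0 → (∀ i, |w i| ≤ (s : ℤ)) →
    ∃ φ', Col k φ' ∧
      ∀ i : Fin k, |(classCard φ (i : ℕ) : ℤ) - classCard φ' (i : ℕ) - w i| ≤ (p : ℤ)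

/-- The vertex support of a hypergraph edge set. -/
def hsupp (E : Set (Finset V)) : Set V := {v | ∃ e ∈ E, v ∈ e}

/-- The reachability graph `ℛ(T)` on the vertex set of `T`. -/
def RGraph (k : ℕ) (T : Set (Finset V)) : SimpleGraph ↥(hsupp T) :=
  SimpleGraph.fromRel fun x y => ∃ e ∈ T, ∃ f ∈ T,
    (x : V) ∈ e ∧ (x : V) ∉ f ∧ (y : V) ∈ f ∧ (y : V) ∉ e ∧ (e ∩ f).card = k - 1

end

/-- Farkas' lemma for a finite family of vectors. -/
theorem farkas_alternative {E : Type} [AddCommGroup E] [Module ℝ E] (m : ℕ) :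
    ∀ (a : Fin m → E) (b : E), (∃ c : Fin m → ℝ, (∀ i, 0 ≤ c i) ∧ ∑ i, c i • a i = b) ∨
      ∃ y : E →ₗ[ℝ] ℝ, (∀ i, 0 ≤ y (a i)) ∧ y b < 0 := by
  induction m with
  | zero =>
    intro a b
    by_cases hb : b = 0
    · left; exact ⟨fun _ => 0, fun i => i.elim0, by simp [hb]⟩
    · right
      obtain ⟨f, hf⟩ : ∃ f : Module.Dual ℝ E, f b ≠ 0 := by
        by_contra h
        push Not at h
        exact hb ((Module.forall_dual_apply_eq_zero_iff ℝ b).1 h)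
      refine ⟨-(f b) • f, fun i => i.elim0, ?_⟩
      have : 0 < f b * f b := mul_self_pos.2 hf
      simp only [LinearMap.smul_apply, smul_eq_mul]
      linarith
  | succ m ih =>
    intro a b
    rcases ih (fun i => a i.castSucc) b with ⟨c, hc, hcb⟩ | ⟨y, hy, hyb⟩
    · left
      refine ⟨Fin.snoc c 0, ?_, ?_⟩
      · intro i
        refine Fin.lastCases ?_ (fun i => ?_) i <;> simp [hc]
      · simp [Fin.sum_univ_castSucc, hcb]
    by_cases hym : 0 ≤ y (a (Fin.last m))
    · right
      exact ⟨y, fun i => Fin.lastCases hym hy i, hyb⟩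
    push Not at hym
    set e := a (Fin.last m) with he
    have hne : y e ≠ 0 := hym.ne
    rcases ih (fun i => a i.castSucc - (y (a i.castSucc) / y e) • e) (b - (y b / y e) • e) with
      ⟨c, hc, hcb⟩ | ⟨y', hy', hyb'⟩
    · left
      refine ⟨Fin.snoc c (y b / y e - ∑ i, c i * (y (a i.castSucc) / y e)), ?_, ?_⟩
      · intro i
        refine Fin.lastCases ?_ (fun i => ?_) i
        · simp only [Fin.snoc_last]
          have h1 : 0 ≤ y b / y e := (div_pos_of_neg_of_neg hyb hym).le
          have h2 : ∑ i, c i * (y (a i.castSucc) / y e) ≤ 0 := by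
            apply Finset.sum_nonpos
            intro i _
            exact mul_nonpos_of_nonneg_of_nonpos (hc i)
              (div_nonpos_of_nonneg_of_nonpos (hy i) hym.le)
          linarith
        · simp [hc]
      · simp only [Fin.sum_univ_castSucc, Fin.snoc_castSucc, Fin.snoc_last]
        simp only [smul_sub, Finset.sum_sub_distrib, smul_smul, ← Finset.sum_smul] at hcb
        rw [sub_smul, ← he]
        have := sub_eq_sub_iff_add_eq_add.1 hcb
        rw [add_sub, this]
        abel
    · right
      refine ⟨y' - (y' e / y e) • y, ?_, ?_⟩
      · intro i
        refine Fin.lastCases ?_ (fun i => ?_) i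
        · simp only [← he, LinearMap.sub_apply, LinearMap.smul_apply, smul_eq_mul]
          field_simp
          simp
        · have := hy' i
          simp only [map_sub, map_smul, smul_eq_mul] at this
          simp only [LinearMap.sub_apply, LinearMap.smul_apply, smul_eq_mul]
          convert this using 1
          ring
      · simp only [map_sub, map_smul, smul_eq_mul] at hyb'
        simp only [LinearMap.sub_apply, LinearMap.smul_apply, smul_eq_mul]
        convert hyb' using 1
        ring

theorem farkas_fintype {E σ : Type} [AddCommGroup E] [Module ℝ E] [Fintype σ]
    (a : σ → E) (b : E) : (∃ c : σ → ℝ, (∀ i, 0 ≤ c i) ∧ ∑ i, c i • a i = b) ∨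
      ∃ y : E →ₗ[ℝ] ℝ, (∀ i, 0 ≤ y (a i)) ∧ y b < 0 := by
  let e := Fintype.equivFin σ
  rcases farkas_alternative _ (fun i => a (e.symm i)) b with ⟨c, hc, hcb⟩ | ⟨y, hy, hyb⟩
  · left
    refine ⟨fun i => c (e i), fun i => hc _, ?_⟩
    rw [← hcb, ← e.sum_comp]
    simp
  · right
    exact ⟨y, fun i => by simpa using hy (e i), hyb⟩

/-- Linear programming duality with complementary slackness: vectors `v s` with nonnegative
coordinates and coordinate sum one, values `val s`. Among the nonnegative representations of
`T` there is one together with a dual certificate. -/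
theorem exists_optimal_representation {ι σ : Type} [Fintype ι] [Fintype σ]
    (v : σ → ι → ℝ) (val : σ → ℝ) (hv1 : ∀ s, ∑ j, v s j = 1)
    (T : ι → ℝ) (ω₀ : σ → ℝ) (hω₀ : ∀ s, 0 ≤ ω₀ s) (hω₀T : ∀ j, ∑ s, ω₀ s * v s j = T j) :
    ∃ (ω : σ → ℝ) (y : ι → ℝ), (∀ s, 0 ≤ ω s) ∧ (∀ j, ∑ s, ω s * v s j = T j) ∧
      (∀ s, ∑ j, v s j * y j ≤ - val s) ∧ (∀ s, 0 < ω s → ∑ j, v s j * y j = - val s) := by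
  set tot := ∑ j, T j
  let K : Set (σ → ℝ) := {ω | (∀ s, 0 ≤ ω s) ∧ ∀ j, ∑ s, ω s * v s j = T j}
  have hKsub : K ⊆ Set.Icc (0 : σ → ℝ) (fun _ => tot) := by
    rintro ω ⟨h0, hT⟩
    refine ⟨h0, fun s => ?_⟩
    have : tot = ∑ s, ω s := by
      simp only [tot, ← hT]
      rw [Finset.sum_comm]
      simp [← Finset.mul_sum, hv1]
    rw [this]
    exact Finset.single_le_sum (fun s _ => h0 s) (Finset.mem_univ s)
  have hKcl : IsClosed K := by
    have : K = (⋂ s, {ω | 0 ≤ ω s}) ∩ ⋂ j, {ω | ∑ s, ω s * v s j = T j} := by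
      ext ω; simp [K]
    rw [this]
    refine IsClosed.inter (isClosed_iInter fun s => ?_) (isClosed_iInter fun j => ?_)
    · exact isClosed_le continuous_const (continuous_apply s)
    · exact isClosed_eq (by fun_prop) continuous_const
  have hKc : IsCompact K := isCompact_Icc.of_isClosed_subset hKcl hKsub
  obtain ⟨ω, hωK, hmax⟩ := hKc.exists_isMaxOn (f := fun ω : σ → ℝ => ∑ s, ω s * val s)
    ⟨ω₀, hω₀, hω₀T⟩ (by fun_prop)
  let supp := {s // 0 < ω s}
  let a : σ ⊕ supp → (ι → ℝ) × ℝ := Sum.elim (fun s => (v s, val s)) (fun s => -(v s, val s))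
  rcases farkas_fintype a (0, 1) with ⟨c, hc, hcb⟩ | ⟨y, hy, hyb⟩
  · exfalso
    rw [Fintype.sum_sum_type] at hcb
    let d : σ → ℝ := fun s => c (Sum.inl s) - (if h : 0 < ω s then c (Sum.inr ⟨s, h⟩) else 0)
    have hd : ∑ s, d s • ((v s, val s) : (ι → ℝ) × ℝ) = (0, 1) := by
      rw [← hcb]
      simp only [d, a, sub_smul, Finset.sum_sub_distrib, Sum.elim_inl, Sum.elim_inr, smul_neg,
        Finset.sum_neg_distrib, ← sub_eq_add_neg]
      congr 1
      simp only [dite_smul, zero_smul]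
      rw [← Finset.sum_filter_add_sum_filter_not Finset.univ (fun s => 0 < ω s)]
      rw [Finset.sum_congr rfl (g := fun _ => 0) (s₁ := Finset.univ.filter (fun s => ¬ 0 < ω s))
        (by intro x hx; simp at hx; simp [hx])]
      simp only [Finset.sum_const_zero, add_zero]
      rw [Finset.sum_subtype (p := fun s => 0 < ω s) _ (by simp)]
      apply Finset.sum_congr rfl
      rintro ⟨s, hs⟩ _
      simp [hs]
    have hd1 : ∀ j, ∑ s, d s * v s j = 0 := by
      intro j
      have := congrFun (congrArg Prod.fst hd) j
      simpa [Prod.fst_sum] using this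
    have hd2 : ∑ s, d s * val s = 1 := by
      have := congrArg Prod.snd hd
      simpa [Prod.snd_sum] using this
    -- a small positive step
    obtain ⟨t, ht0, ht⟩ : ∃ t : ℝ, 0 < t ∧ ∀ s, 0 ≤ ω s + t * d s := by
      have : ∀ s, ∃ t : ℝ, 0 < t ∧ ∀ t', 0 ≤ t' → t' ≤ t → 0 ≤ ω s + t' * d s := by
        intro s
        by_cases h : 0 < ω s
        · refine ⟨ω s / (|d s| + 1), by positivity, fun t' h0 h1 => ?_⟩
          rw [le_div_iff₀ (by positivity)] at h1
          have := neg_abs_le (d s)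
          nlinarith
        · refine ⟨1, one_pos, fun t' h0 _ => ?_⟩
          have : 0 ≤ d s := by simp [d, h, hc]
          have := hωK.1 s
          positivity
      choose t ht htt using this
      by_cases hne : Nonempty σ
      · refine ⟨Finset.univ.inf' Finset.univ_nonempty t, ?_, fun s => ?_⟩
        · simp [Finset.lt_inf'_iff, ht]
        · apply htt
          · rw [Finset.le_inf'_iff]
            exact fun i _ => (ht i).le
          · exact Finset.inf'_le _ (Finset.mem_univ s)
      · exact ⟨1, one_pos, fun s => (hne ⟨s⟩).elim⟩
    have hmem : (fun s => ω s + t * d s) ∈ K := by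
      refine ⟨ht, fun j => ?_⟩
      simp only [add_mul, Finset.sum_add_distrib, mul_assoc, ← Finset.mul_sum, hd1, hωK.2]
      simp
    have := hmax hmem
    simp only [Set.mem_ofPred_eq, add_mul, Finset.sum_add_distrib, mul_assoc, ← Finset.mul_sum,
      hd2] at this
    linarith
  · set lam := -y (0, 1) with hlam
    have hlam0 : 0 < lam := by linarith
    have hyv : ∀ s, y (v s, val s) = ∑ j, v s j * y (Pi.single j 1, 0) - lam * val s := by
      intro s
      have : ((v s, val s) : (ι → ℝ) × ℝ) =
          ∑ j, v s j • ((Pi.single j 1, 0) : (ι → ℝ) × ℝ) + val s • ((0, 1) : (ι → ℝ) × ℝ) := by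
        ext j
        · simp [Prod.fst_sum, Finset.sum_apply, Pi.single_apply]
        · simp [Prod.snd_sum]
      rw [this, map_add, map_sum]
      simp only [map_smul, smul_eq_mul, hlam]
      ring
    refine ⟨ω, fun j => - y (Pi.single j 1, 0) / lam, hωK.1, hωK.2, ?_, ?_⟩
    · intro s
      have h := hy (Sum.inl s)
      simp only [a, Sum.elim_inl, hyv] at h
      simp only [neg_div, mul_neg, Finset.sum_neg_distrib, mul_div_assoc', ← Finset.sum_div]
      rw [neg_le_neg_iff, le_div_iff₀ hlam0]
      linarith
    · intro s hs
      have h := hy (Sum.inl s)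
      have h' := hy (Sum.inr ⟨s, hs⟩)
      simp only [a, Sum.elim_inl, Sum.elim_inr, map_neg, hyv] at h h'
      simp only [neg_div, mul_neg, Finset.sum_neg_distrib, mul_div_assoc', ← Finset.sum_div]
      rw [neg_inj, div_eq_iff hlam0.ne']
      linarith

/-- The vertices `π 0, …` are pairwise adjacent. -/
def Clq {ι : Type} (R : SimpleGraph ι) {m : ℕ} (π : Fin m → ι) : Prop :=
  ∀ a b, a ≠ b → R.Adj (π a) (π b)

/-- Weights of the colour classes: `1 - m/χ` for colour `0` and `1/χ` for the others. -/
noncomputable def colWt (m : ℕ) (χ : ℝ) (l : Fin (m + 1)) : ℝ :=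
  if l = 0 then 1 - m / χ else 1 / χ

/-- The weighted degree condition. -/
def DegCondW {ι : Type} [Fintype ι] (R : SimpleGraph ι) (T : ι → ℝ) (m : ℕ) (χ : ℝ) : Prop :=
  ∀ S : Finset ι, S.Nonempty → ∃ x ∈ S,
    min ((m - 1) / χ * ∑ j, T j + (χ - m) * ∑ j ∈ S, T j) ((1 - 1 / χ) * ∑ j, T j) <
      ∑ j, if R.Adj x j then T j else 0

theorem Clq.injective {ι : Type} {R : SimpleGraph ι} {m : ℕ} {π : Fin m → ι} (h : Clq R π) :
    Function.Injective π := by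
  intro a b hab
  by_contra hne
  exact R.loopless.irrefl _ (hab ▸ h a b hne)

theorem Clq.update {ι : Type} {R : SimpleGraph ι} {m : ℕ} {π : Fin m → ι} (h : Clq R π)
    {x : ι} {l : Fin m} (hx : ∀ a, a ≠ l → R.Adj x (π a)) : Clq R (Function.update π l x) := by
  intro a b hab
  by_cases ha : a = l
  · subst ha
    rw [Function.update_self, Function.update_of_ne hab.symm]
    exact hx b hab.symm
  · by_cases hb : b = l
    · subst hb
      rw [Function.update_self, Function.update_of_ne hab]
      exact (hx a hab).symm
    · rw [Function.update_of_ne ha, Function.update_of_ne hb]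
      exact h a b hab

theorem Clq.cons {ι : Type} {R : SimpleGraph ι} {m : ℕ} {π : Fin m → ι} (h : Clq R π)
    {x : ι} (hx : ∀ a, R.Adj x (π a)) : Clq R (Fin.cons x π : Fin (m + 1) → ι) := by
  intro a b hab
  refine Fin.cases ?_ (fun a => ?_) a hab
  · refine Fin.cases ?_ (fun b => ?_) b
    · intro h; exact (h rfl).elim
    · intro _; simpa using hx b
  · refine Fin.cases ?_ (fun b => ?_) b
    · intro _; simpa using (hx a).symm
    · intro hab; simpa using h a b (by simpa using hab)

theorem Clq.comp {ι : Type} {R : SimpleGraph ι} {m : ℕ} {π : Fin m → ι} (h : Clq R π)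
    (σ : Equiv.Perm (Fin m)) : Clq R (π ∘ σ) :=
  fun _ _ hab => h _ _ fun h' => hab (σ.injective h')

theorem sum_update_weights {ι : Type} {m : ℕ} (π : Fin m → ι) (c : Fin m → ℝ) (y : ι → ℝ)
    (l : Fin m) (x : ι) : ∑ a, c a * y (Function.update π l x a) =
      ∑ a, c a * y (π a) + c l * (y x - y (π l)) := by
  rw [← sub_eq_iff_eq_add', ← Finset.sum_sub_distrib, Finset.sum_eq_single l]
  · rw [Function.update_self]; ring
  · intro a _ ha
    rw [Function.update_of_ne ha, sub_self]
  · simp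

/-- The part of a sum over the colours adjacent to `x` when at least two colours are missed. -/
theorem sum_adj_le_of_two_missed {m : ℕ} (c : Fin m → ℝ) (hc : ∀ l, 0 ≤ c l) (p : Fin m → Prop)
    {a b : Fin m} (hab : a ≠ b) (ha : ¬ p a) (hb : ¬ p b) :
    ∑ l, c l * (if p l then 1 else 0) ≤ ∑ l, c l - c a - c b := by
  have h1 : ∑ l, c l * (if p l then (1 : ℝ) else 0) ≤
      ∑ l, (c l - (if l = a then c a else 0) - if l = b then c b else 0) := by
    apply Finset.sum_le_sum
    intro l _
    have := hc l
    by_cases h1 : l = a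
    · subst h1; simp [ha, hab]
    · by_cases h2 : l = b
      · subst h2; simp [hb, h1]
      · simp only [h1, h2, if_false]; split_ifs <;> linarith
  simpa [Finset.sum_sub_distrib] using h1

theorem sum_adj_le_of_one_missed {m : ℕ} (c : Fin m → ℝ) (hc : ∀ l, 0 ≤ c l) (p : Fin m → Prop)
    {a : Fin m} (ha : ¬ p a) :
    ∑ l, c l * (if p l then 1 else 0) ≤ ∑ l, c l - c a := by
  have h1 : ∑ l, c l * (if p l then (1 : ℝ) else 0) ≤
      ∑ l, (c l - (if l = a then c a else 0)) := by
    apply Finset.sum_le_sum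
    intro l _
    have := hc l
    by_cases h1 : l = a
    · subst h1; simp [ha]
    · simp only [h1, if_false]; split_ifs <;> linarith
  simpa [Finset.sum_sub_distrib] using h1

theorem colWt_nonneg {m : ℕ} {χ : ℝ} (h0 : 0 < χ) (hχ : (m : ℝ) ≤ χ) (l : Fin (m + 1)) :
    0 ≤ colWt m χ l := by
  unfold colWt
  split_ifs
  · rw [sub_nonneg, div_le_one h0]; exact hχ
  · positivity

theorem sum_colWt {m : ℕ} {χ : ℝ} : ∑ l, colWt m χ l = 1 := by
  simp [colWt, Fin.sum_univ_succ, Fin.succ_ne_zero]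
  ring

/-- In an optimal configuration, a `k`-tile sees at most the claimed weight. -/
theorem ktile_adj_le {ι : Type} (R : SimpleGraph ι) {m : ℕ} (hm : 1 ≤ m) {χ : ℝ}
    (hχ : (m : ℝ) < χ) (hχ' : χ ≤ m + 1) (y : ι → ℝ)
    (hk : ∀ π : Fin (m + 1) → ι, Clq R π → ∑ l, colWt m χ l * y (π l) ≤ -1)
    {x : ι} (hx : ∀ z, y z ≤ y x) (hY : 0 ≤ y x) {π : Fin (m + 1) → ι} (hπ : Clq R π)
    (hπy : ∑ l, colWt m χ l * y (π l) = -1) :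
    ∑ l, colWt m χ l * (if R.Adj x (π l) then 1 else 0) ≤ min ((m - 1) / χ + (χ - m) *
      ∑ l, colWt m χ l * (if y (π l) = y x then 1 else 0)) (1 - 1 / χ) := by
  have hm1 : (1 : ℝ) ≤ m := by exact_mod_cast hm
  have h0 : 0 < χ := by linarith
  have hc := fun l => colWt_nonneg h0 hχ.le (m := m) l
  have hcpos : ∀ l, 0 < colWt m χ l := by
    intro l; unfold colWt; split_ifs
    · rw [sub_pos, div_lt_one h0]; exact hχ
    · positivity
  have hsp : 1 - m / χ ≤ 1 / χ := by
    rw [sub_le_iff_le_add, ← add_div, le_div_iff₀ h0]; linarith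
  have htop0 : 0 ≤ ∑ l, colWt m χ l * (if y (π l) = y x then (1 : ℝ) else 0) :=
    Finset.sum_nonneg fun l _ => mul_nonneg (hc l) (by split_ifs <;> norm_num)
  -- swapping in `x`
  have hswap : ∀ l, (∀ a, a ≠ l → R.Adj x (π a)) → y (π l) = y x := by
    intro l hl
    have := hk _ (hπ.update hl)
    rw [sum_update_weights, hπy] at this
    have h1 := hcpos l
    have h2 := hx (π l)
    nlinarith
  have hnotall : ¬ ∀ l, y (π l) = y x := by
    intro h
    simp only [h, ← Finset.sum_mul, sum_colWt] at hπy
    linarith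
  have hmiss : ∃ l, ¬ R.Adj x (π l) := by
    by_contra h
    push Not at h
    exact hnotall fun l => hswap l fun a _ => h a
  obtain ⟨l, hl⟩ := hmiss
  by_cases h2 : ∃ l', l' ≠ l ∧ ¬ R.Adj x (π l')
  · obtain ⟨l', hl', hl2⟩ := h2
    have h3 := sum_adj_le_of_two_missed (colWt m χ) hc (fun l => R.Adj x (π l)) hl' hl2 hl
    rw [sum_colWt] at h3
    have h4 : 1 - m / χ + 1 / χ ≤ colWt m χ l' + colWt m χ l := by
      unfold colWt
      by_cases e1 : l' = 0
      · have : l ≠ 0 := fun h => hl' (e1.trans h.symm)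
        simp [e1, this]
      · simp only [e1, if_false]
        split_ifs <;> linarith
    have h5 : (m - 1 : ℝ) / χ = m / χ - 1 / χ := sub_div _ _ _
    have h6 : (0 : ℝ) ≤ (χ - m) * ∑ l, colWt m χ l * (if y (π l) = y x then (1 : ℝ) else 0) :=
      mul_nonneg (by linarith) htop0
    have h7 : (m : ℝ) / χ ≤ 1 := by rw [div_le_one h0]; exact hχ.le
    apply le_min <;> linarith
  push Not at h2
  have hyl := hswap l h2
  have hl0 : colWt m χ l = 1 / χ := by
    by_contra hne
    have hlz : l = 0 := by
      by_contra h; exact hne (by simp [colWt, h])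
    subst hlz
    have hlt : colWt m χ 0 < 1 / χ := lt_of_le_of_ne (by simpa [colWt] using hsp) hne
    apply hnotall
    intro j
    by_cases hj : j = 0
    · rw [hj]; exact hyl
    have h8 := hk _ ((hπ.update h2).comp (Equiv.swap 0 j))
    have h9 : ∑ l, colWt m χ l * y ((Function.update π 0 x ∘ Equiv.swap 0 j) l) =
        ∑ l, colWt m χ (Equiv.swap 0 j l) * y (Function.update π 0 x l) := by
      rw [← Equiv.sum_comp (Equiv.swap 0 j)]; simp
    have h10 : ∀ l, colWt m χ (Equiv.swap 0 j l) = colWt m χ l +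
        ((if l = 0 then (1 / χ - colWt m χ 0) else 0) -
          (if l = j then (1 / χ - colWt m χ 0) else 0)) := by
      intro l
      have hj1 : colWt m χ j = 1 / χ := by simp [colWt, hj]
      by_cases e1 : l = 0
      · subst e1; simp [Ne.symm hj, hj1]
      · by_cases e2 : l = j
        · subst e2; simp [hj, hj1]
        · rw [Equiv.swap_apply_of_ne_of_ne e1 e2]; simp [e1, e2]
    rw [h9] at h8
    simp only [h10, add_mul, sub_mul, Finset.sum_add_distrib, Finset.sum_sub_distrib, ite_mul,
      zero_mul, Finset.sum_ite_eq', Finset.mem_univ, if_true] at h8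
    rw [sum_update_weights, hπy, Function.update_self, Function.update_of_ne hj, hyl] at h8
    have := hx (π j)
    nlinarith
  have h3 := sum_adj_le_of_one_missed (colWt m χ) hc (fun l => R.Adj x (π l)) hl
  rw [sum_colWt, hl0] at h3
  have h4 : 1 / χ ≤ ∑ l, colWt m χ l * (if y (π l) = y x then (1 : ℝ) else 0) := by
    rw [← hl0]
    calc colWt m χ l = colWt m χ l * (if y (π l) = y x then (1 : ℝ) else 0) := by simp [hyl]
      _ ≤ _ := Finset.single_le_sum (f := fun l => colWt m χ l *
          (if y (π l) = y x then (1 : ℝ) else 0))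
          (fun l _ => mul_nonneg (hc l) (by split_ifs <;> norm_num)) (Finset.mem_univ l)
  refine le_min (h3.trans ?_) h3
  have h5 : (m - 1 : ℝ) / χ + (χ - m) * (1 / χ) = 1 - 1 / χ := by field_simp; ring
  have h6 := mul_le_mul_of_nonneg_left h4 (show 0 ≤ χ - m by linarith)
  linarith

/-- In an optimal configuration, a uniform tile on `m` vertices sees at most the claimed
weight. -/
theorem ftile_adj_le {ι : Type} (R : SimpleGraph ι) {m : ℕ} (hm : 1 ≤ m) {χ : ℝ}
    (hχ : (m : ℝ) < χ) (hχ' : χ ≤ m + 1) (y : ι → ℝ)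
    (hk : ∀ π : Fin (m + 1) → ι, Clq R π → ∑ l, colWt m χ l * y (π l) ≤ -1)
    (hf : ∀ π : Fin m → ι, Clq R π → ∑ l, (1 / m : ℝ) * y (π l) ≤ 0)
    {x : ι} (hx : ∀ z, y z ≤ y x) (hY : 0 ≤ y x) {π : Fin m → ι} (hπ : Clq R π)
    (hπy : ∑ l, (1 / m : ℝ) * y (π l) = 0) :
    ∑ l, (1 / m : ℝ) * (if R.Adj x (π l) then 1 else 0) ≤ min ((m - 1) / χ + (χ - m) *
      ∑ l, (1 / m : ℝ) * (if y (π l) = y x then 1 else 0)) (1 - 1 / χ) := by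
  have hm1 : (1 : ℝ) ≤ m := by exact_mod_cast hm
  have h0 : 0 < χ := by linarith
  have hmpos : (0 : ℝ) < 1 / m := by positivity
  have htop0 : 0 ≤ ∑ l, (1 / m : ℝ) * (if y (π l) = y x then (1 : ℝ) else 0) :=
    Finset.sum_nonneg fun l _ => mul_nonneg hmpos.le (by split_ifs <;> norm_num)
  have hsum : ∑ _l : Fin m, (1 / m : ℝ) = 1 := by
    simp; field_simp
  obtain ⟨l, hl⟩ : ∃ l, ¬ R.Adj x (π l) := by
    by_contra h
    push Not at h
    have h1 := hk _ (hπ.cons h)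
    rw [Fin.sum_univ_succ] at h1
    simp only [Fin.cons_zero, Fin.cons_succ, colWt, Fin.succ_ne_zero, if_true, if_false] at h1
    rw [← Finset.mul_sum] at h1 hπy
    rw [mul_eq_zero] at hπy
    rcases hπy with h2 | h2
    · linarith
    rw [h2] at h1
    have : 0 ≤ (1 - m / χ) * y x :=
      mul_nonneg (by rw [sub_nonneg, div_le_one h0]; exact hχ.le) hY
    linarith
  have h1m : 1 - 1 / (m : ℝ) ≤ 1 - 1 / χ := by
    have := one_div_le_one_div_of_le (by linarith : (0 : ℝ) < m) hχ.le
    linarith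
  by_cases h2 : ∃ l', l' ≠ l ∧ ¬ R.Adj x (π l')
  · obtain ⟨l', hl', hl2⟩ := h2
    have h3 := sum_adj_le_of_two_missed (fun _ => (1 / m : ℝ)) (fun _ => hmpos.le)
      (fun l => R.Adj x (π l)) hl' hl2 hl
    rw [hsum] at h3
    have h6 : (0 : ℝ) ≤ (χ - m) * ∑ l, (1 / m : ℝ) * (if y (π l) = y x then (1 : ℝ) else 0) :=
      mul_nonneg (by linarith) htop0
    have hm2 : 2 ≤ m := by
      have := l.2; have := l'.2
      by_contra h
      apply hl'; ext; omega
    have hm2' : (2 : ℝ) ≤ m := by exact_mod_cast hm2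
    have h7 : 1 - 1 / (m : ℝ) - 1 / m ≤ (m - 1) / χ := by
      rw [le_div_iff₀ h0]
      have : 1 - 1 / (m : ℝ) - 1 / m = (m - 2) / m := by field_simp; ring
      rw [this, div_mul_eq_mul_div, div_le_iff₀ (by linarith)]
      nlinarith
    apply le_min <;> linarith
  push Not at h2
  have hyl : y (π l) = y x := by
    have := hf _ (hπ.update h2)
    have hs := sum_update_weights π (fun _ => (1 / m : ℝ)) y l x
    rw [hs, hπy] at this
    have h2 := hx (π l)
    nlinarith
  have h3 := sum_adj_le_of_one_missed (fun _ => (1 / m : ℝ)) (fun _ => hmpos.le)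
    (fun l => R.Adj x (π l)) hl
  rw [hsum] at h3
  have h4 : (1 / m : ℝ) ≤ ∑ l, (1 / m : ℝ) * (if y (π l) = y x then (1 : ℝ) else 0) := by
    calc (1 / m : ℝ) = (1 / m : ℝ) * (if y (π l) = y x then (1 : ℝ) else 0) := by simp [hyl]
      _ ≤ _ := Finset.single_le_sum (f := fun l => (1 / m : ℝ) *
          (if y (π l) = y x then (1 : ℝ) else 0))
          (fun l _ => mul_nonneg hmpos.le (by split_ifs <;> norm_num)) (Finset.mem_univ l)
  refine le_min (h3.trans ?_) (h3.trans h1m)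
  have h5 : 1 - 1 / (m : ℝ) ≤ (m - 1 : ℝ) / χ + (χ - m) * (1 / m) := by
    rw [← sub_nonneg]
    have : (m - 1 : ℝ) / χ + (χ - m) * (1 / m) - (1 - 1 / m) =
        (χ - m) * (χ - (m - 1)) / (χ * m) := by field_simp; ring
    rw [this]
    apply div_nonneg
    · apply mul_nonneg <;> linarith
    · positivity
  have h6 := mul_le_mul_of_nonneg_left h4 (show 0 ≤ χ - m by linarith)
  linarith

theorem DegCondW.pred {ι : Type} [Fintype ι] {R : SimpleGraph ι} {T : ι → ℝ} {m : ℕ} {χ : ℝ}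
    (hT : ∀ j, 0 ≤ T j) (hχ : ((m + 1 : ℕ) : ℝ) < χ) (hχ' : χ ≤ m + 2) (h : DegCondW R T (m + 1) χ) :
    DegCondW R T m ((m + 1 : ℕ) : ℝ) := by
  intro S hS
  obtain ⟨x, hx, hlt⟩ := h S hS
  refine ⟨x, hx, lt_of_le_of_lt ?_ hlt⟩
  have hST : ∑ j ∈ S, T j ≤ ∑ j, T j :=
    Finset.sum_le_sum_of_subset_of_nonneg (Finset.subset_univ S) fun j _ _ => hT j
  have hS0 : 0 ≤ ∑ j ∈ S, T j := Finset.sum_nonneg fun j _ => hT j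
  set t := ∑ j, T j
  set s := ∑ j ∈ S, T j
  push_cast at hχ ⊢
  have hm0 : (0 : ℝ) ≤ m := Nat.cast_nonneg m
  have h0 : 0 < χ := by linarith
  have hm1 : (0 : ℝ) < m + 1 := by linarith
  have ht : 0 ≤ t := hS0.trans hST
  refine le_min ?_ ((min_le_right _ _).trans ?_)
  · by_cases hc : (m + 1) * s ≤ t
    · refine (min_le_left _ _).trans ?_
      rw [← sub_nonneg]
      have e : (m + 1 - 1 : ℝ) / χ * t + (χ - (m + 1)) * s -
          ((m - 1) / (m + 1) * t + ((m : ℝ) + 1 - m) * s) =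
          (m * (m + 1) - (m - 1) * χ) / (χ * (m + 1)) * (t - (m + 1) * s) +
          (χ - m) * (χ - (m + 1)) / χ * s := by
        field_simp; ring
      rw [e]
      have h1 : 0 ≤ m * (m + 1) - (m - 1) * χ := by nlinarith
      have h2 : 0 ≤ (χ - m) * (χ - (m + 1)) := mul_nonneg (by linarith) (by linarith)
      have h3 : 0 ≤ t - (m + 1) * s := by linarith
      positivity
    · refine (min_le_right _ _).trans ?_
      push Not at hc
      rw [← sub_nonneg]
      have e : (m + 1 - 1 : ℝ) / χ * t + (χ - (m + 1)) * s - (1 - 1 / ((m : ℝ) + 1)) * t =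
          (χ - m) * (χ - (m + 1)) / (χ * (m + 1)) * t +
          (χ - (m + 1)) / (m + 1) * ((m + 1) * s - t) := by
        field_simp; ring
      rw [e]
      have h2 : 0 ≤ (χ - m) * (χ - (m + 1)) := mul_nonneg (by linarith) (by linarith)
      have h3 : 0 ≤ (m + 1) * s - t := by linarith
      have h4 : 0 ≤ χ - (m + 1) := by linarith
      positivity
  · apply mul_le_mul_of_nonneg_right _ ht
    have := one_div_le_one_div_of_le hm1 hχ.le
    linarith

theorem tile_sum_comm {ι : Type} [Fintype ι] {m : ℕ} (π : Fin m → ι) (c : Fin m → ℝ)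
    (z : ι → ℝ) : ∑ j, (∑ l, c l * if π l = j then 1 else 0) * z j = ∑ l, c l * z (π l) := by
  simp only [Finset.sum_mul]
  rw [Finset.sum_comm]
  simp

/-- Fractional tilings from the weighted degree condition. -/
theorem exists_fractional_tiling {ι : Type} [Fintype ι] (R : SimpleGraph ι) (T : ι → ℝ)
    (hT : ∀ j, 0 ≤ T j) (m : ℕ) : ∀ χ : ℝ, (m : ℝ) < χ → χ ≤ m + 1 → DegCondW R T m χ →
    ∃ ω : (Fin (m + 1) → ι) → ℝ, (∀ π, 0 ≤ ω π) ∧ (∀ π, ω π ≠ 0 → Clq R π) ∧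
      ∀ j, ∑ π, ω π * ∑ l, colWt m χ l * (if π l = j then 1 else 0) = T j := by
  induction m with
  | zero =>
    intro χ h0 h1 _
    refine ⟨fun π => T (π 0), fun π => hT _, fun π _ a b hab => (hab (Fin.ext (by omega))).elim,
      fun j => ?_⟩
    rw [← (Equiv.funUnique (Fin 1) ι).symm.sum_comp]
    simp [colWt]
  | succ m ih =>
    intro χ hχ hχ' hdeg
    obtain ⟨ω₀, hω₀, hω₀c, hω₀T⟩ := ih ((m + 1 : ℕ) : ℝ) (by push_cast; linarith)
      (by push_cast; linarith) (hdeg.pred hT hχ (by push_cast at hχ'; linarith))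
    let M := m + 1
    have hM : M = m + 1 := rfl
    change χ ≤ (M : ℝ) + 1 at hχ'
    change DegCondW R T M χ at hdeg
    have hMχ : (M : ℝ) < χ := hχ
    have hM0 : (0 : ℝ) < M := by positivity
    have hχ0 : 0 < χ := hM0.trans hMχ
    have hcol : ∀ l, colWt m (M : ℝ) l = 1 / M := by
      intro l; unfold colWt; split_ifs
      · rw [hM]; push_cast; field_simp; ring
      · rfl
    let σ := {π : Fin (M + 1) → ι // Clq R π} ⊕ {π : Fin M → ι // Clq R π}
    let v : σ → ι → ℝ := Sum.elim
      (fun π j => ∑ l, colWt M χ l * (if π.1 l = j then 1 else 0))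
      (fun π j => ∑ l, (1 / M : ℝ) * (if π.1 l = j then 1 else 0))
    let val : σ → ℝ := Sum.elim (fun _ => 1) (fun _ => 0)
    have hv1 : ∀ s, ∑ j, v s j = 1 := by
      rintro (π | π)
      · simp only [v, Sum.elim_inl]
        have := tile_sum_comm π.1 (colWt M χ) (fun _ => 1)
        simp only [mul_one] at this
        rw [this, sum_colWt]
      · simp only [v, Sum.elim_inr]
        have := tile_sum_comm π.1 (fun _ => (1 / M : ℝ)) (fun _ => 1)
        simp only [mul_one] at this
        rw [this]
        simp [hM0.ne']
    obtain ⟨ω, y, hω, hωT, hle, heq⟩ := exists_optimal_representation v val hv1 T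
      (Sum.elim (fun _ => 0) (fun π => ω₀ π.1)) (by rintro (π | π) <;> simp [hω₀]) (by
        intro j
        rw [Fintype.sum_sum_type]
        simp only [Sum.elim_inl, zero_mul, Finset.sum_const_zero, Sum.elim_inr, zero_add, v]
        rw [← hω₀T j]
        change _ = ∑ π, ω₀ π * ∑ l, colWt m (M : ℝ) l * _
        simp only [hcol]
        rw [← Finset.sum_filter_add_sum_filter_not Finset.univ (fun π : Fin M → ι => Clq R π)]
        rw [Finset.sum_eq_zero (s := Finset.univ.filter fun π : Fin M → ι => ¬ Clq R π)]
        · rw [add_zero, Finset.sum_subtype (p := fun π => Clq R π) _ (by simp)]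
        · intro π hπ
          have : ω₀ π = 0 := by
            by_contra h
            simp only [Finset.mem_filter, Finset.mem_univ, true_and] at hπ
            exact hπ (hω₀c π h)
          simp [this])
    have htsc : ∀ s, ∀ z : ι → ℝ, ∑ j, v s j * z j = match s with
        | .inl π => ∑ l, colWt M χ l * z (π.1 l)
        | .inr π => ∑ l, (1 / M : ℝ) * z (π.1 l) := by
      rintro (π | π) z
      · exact tile_sum_comm π.1 (colWt M χ) z
      · exact tile_sum_comm π.1 (fun _ => (1 / M : ℝ)) z
    have hk : ∀ π : Fin (M + 1) → ι, Clq R π → ∑ l, colWt M χ l * y (π l) ≤ -1 := by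
      intro π hπ
      have := hle (.inl ⟨π, hπ⟩)
      rwa [htsc] at this
    have hf : ∀ π : Fin M → ι, Clq R π → ∑ l, (1 / M : ℝ) * y (π l) ≤ 0 := by
      intro π hπ
      have := hle (.inr ⟨π, hπ⟩)
      rw [htsc] at this
      simpa [val] using this
    by_cases hall : ∀ π, ω (.inr π) = 0
    · refine ⟨fun π => if h : Clq R π then ω (.inl ⟨π, h⟩) else 0, fun π => ?_, fun π h => ?_,
        fun j => ?_⟩
      · dsimp only; split_ifs
        · exact hω _
        · exact le_rfl
      · by_contra hc; simp [hc] at h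
      · rw [← hωT j, Fintype.sum_sum_type]
        simp only [hall, zero_mul, Finset.sum_const_zero, add_zero]
        rw [← Finset.sum_filter_add_sum_filter_not Finset.univ
          (fun π : Fin (M + 1) → ι => Clq R π)]
        rw [Finset.sum_eq_zero (s := Finset.univ.filter fun π : Fin (M + 1) → ι => ¬ Clq R π)]
        · rw [add_zero, Finset.sum_subtype (p := fun π => Clq R π) _ (by simp)]
          apply Finset.sum_congr rfl
          rintro ⟨π, hπ⟩ _
          simp only [hπ, dif_pos, v, Sum.elim_inl]
          rfl
        · intro π hπ
          simp only [Finset.mem_filter, Finset.mem_univ, true_and] at hπ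
          simp [hπ]
    exfalso
    push Not at hall
    obtain ⟨π₀, hπ₀⟩ := hall
    have hπ₀' : 0 < ω (.inr π₀) := lt_of_le_of_ne (hω _) (Ne.symm hπ₀)
    have : Nonempty ι := ⟨π₀.1 ⟨0, by omega⟩⟩
    obtain ⟨xm, hxm⟩ := Finite.exists_max y
    obtain ⟨x, hxS, hxlt⟩ := hdeg (Finset.univ.filter fun z => y z = y xm)
      ⟨xm, by simp⟩
    have hyx : y x = y xm := by simpa using hxS
    have hx : ∀ z, y z ≤ y x := fun z => hyx ▸ hxm z
    have hY : 0 ≤ y x := by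
      have h1 := heq _ hπ₀'
      rw [htsc] at h1
      simp only [val, Sum.elim_inr, neg_zero] at h1
      have h2 : ∑ l, (1 / M : ℝ) * y (π₀.1 l) ≤ ∑ _l : Fin M, (1 / M : ℝ) * y x :=
        Finset.sum_le_sum fun l _ => mul_le_mul_of_nonneg_left (hx _) (by positivity)
      rw [h1] at h2
      simp only [Finset.sum_const, Finset.card_univ, Fintype.card_fin, nsmul_eq_mul] at h2
      field_simp at h2
      exact h2
    have key : ∀ s, ω s * ∑ j, v s j * (if R.Adj x j then 1 else 0) ≤
        ω s * min ((M - 1) / χ + (χ - M) *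
          ∑ j, v s j * (if y j = y x then 1 else 0)) (1 - 1 / χ) := by
      intro s
      rcases (hω s).eq_or_lt with h | h
      · rw [← h]; simp
      apply mul_le_mul_of_nonneg_left _ h.le
      have h1 := heq s h
      rw [htsc] at h1 ⊢
      rw [htsc]
      rcases s with π | π
      · exact ktile_adj_le R (by omega) hMχ hχ' y hk hx hY π.2 h1
      · exact ftile_adj_le R (by omega) hMχ hχ' y hk hf hx hY π.2 (by simpa [val] using h1)
    have hsumz : ∀ z : ι → ℝ, ∑ j, T j * z j = ∑ s, ω s * ∑ j, v s j * z j := by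
      intro z
      simp only [← hωT, Finset.sum_mul, Finset.mul_sum]
      rw [Finset.sum_comm]
      simp only [mul_assoc]
    have htot : ∑ j, T j = ∑ s, ω s := by
      have := hsumz (fun _ => 1)
      simpa [hv1] using this
    have hA : ∑ j, (if R.Adj x j then T j else 0) =
        ∑ s, ω s * ∑ j, v s j * (if R.Adj x j then 1 else 0) := by
      rw [← hsumz]; simp
    have hS : ∑ j ∈ Finset.univ.filter (fun z => y z = y xm), T j =
        ∑ s, ω s * ∑ j, v s j * (if y j = y x then 1 else 0) := by
      rw [← hsumz, Finset.sum_filter, hyx]; simp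
    apply absurd hxlt
    rw [not_lt, hA, hS, htot]
    refine (Finset.sum_le_sum fun s _ => key s).trans (le_min ?_ ?_)
    · calc _ ≤ ∑ s, ω s * ((M - 1) / χ + (χ - M) *
            ∑ j, v s j * (if y j = y x then 1 else 0)) :=
          Finset.sum_le_sum fun s _ => mul_le_mul_of_nonneg_left (min_le_left _ _) (hω s)
        _ = _ := by
          simp only [mul_add, Finset.sum_add_distrib, ← Finset.sum_mul]
          rw [Finset.mul_sum (a := χ - M), mul_comm]
          congr 1
          apply Finset.sum_congr rfl; intro s _; ring
    · rw [mul_comm, Finset.sum_mul]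
      exact Finset.sum_le_sum fun s _ => mul_le_mul_of_nonneg_left (min_le_right _ _) (hω s)

/-- The set of subset sums of `δ` over subsets of `s`. -/
def SubSum {σ : Type} (δ : σ → ℤ) (s : Finset σ) (t : ℤ) : Prop := ∃ u ⊆ s, ∑ i ∈ u, δ i = t

theorem SubSum.zero {σ : Type} (δ : σ → ℤ) (s : Finset σ) : SubSum δ s 0 :=
  ⟨∅, Finset.empty_subset _, rfl⟩

theorem SubSum.insert_left {σ : Type} {δ : σ → ℤ} {s : Finset σ} {t : ℤ} {a : σ} (ha : a ∉ s)
    (h : SubSum δ s t) (d : ℤ) : SubSum (Function.update δ a d) (insert a s) t := by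
  obtain ⟨u, hu, hs⟩ := h
  refine ⟨u, hu.trans (Finset.subset_insert _ _), ?_⟩
  rw [← hs]
  apply Finset.sum_congr rfl
  intro i hi
  rw [Function.update_of_ne]
  rintro rfl
  exact ha (hu hi)

theorem SubSum.insert_right {σ : Type} {δ : σ → ℤ} {s : Finset σ} {t : ℤ} {a : σ} (ha : a ∉ s)
    (h : SubSum δ s t) (d : ℤ) : SubSum (Function.update δ a d) (insert a s) (t + d) := by
  obtain ⟨u, hu, hs⟩ := h
  refine ⟨insert a u, Finset.insert_subset_insert _ hu, ?_⟩
  rw [Finset.sum_insert fun h => ha (hu h), Function.update_self, ← hs, add_comm]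
  congr 1
  apply Finset.sum_congr rfl
  intro i hi
  rw [Function.update_of_ne]
  rintro rfl
  exact ha (hu hi)

/-- A set of integers closed under shifts by `±d` within the window `[0, 2w]`. -/
def ClosedShift (S : Set ℤ) (w : ℕ) (d : ℕ) : Prop :=
  (∀ s ∈ S, 0 ≤ s → s + d ≤ 2 * w → s + d ∈ S) ∧ (∀ s ∈ S, s ≤ 2 * w → 0 ≤ s - d → s - d ∈ S)

theorem ClosedShift.sub {S : Set ℤ} {w d e : ℕ} (hd : ClosedShift S w d) (he : ClosedShift S w e)
    (hed : e ≤ d) (hdw : d ≤ w) : ClosedShift S w (d - e) := by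
  have hcast : ((d - e : ℕ) : ℤ) = d - e := by omega
  constructor
  · intro s hs h0 h1
    rw [hcast] at h1 ⊢
    by_cases h : (e : ℤ) ≤ s
    · have h2 := he.2 s hs (by omega) (by omega)
      have h3 := hd.1 _ h2 (by omega) (by omega)
      rwa [show s + (d - e : ℤ) = s - e + d by ring]
    · have h2 := hd.1 s hs h0 (by omega)
      have h3 := he.2 _ h2 (by omega) (by omega)
      rwa [show s + (d - e : ℤ) = s + d - e by ring]
  · intro s hs h0 h1
    rw [hcast] at h1 ⊢
    by_cases h : (d : ℤ) ≤ s
    · have h2 := hd.2 s hs (by omega) (by omega)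
      have h3 := he.1 _ h2 (by omega) (by omega)
      rwa [show s - (d - e : ℤ) = s - d + e by ring]
    · have h2 := he.1 s hs (by omega) (by omega)
      have h3 := hd.2 _ h2 (by omega) (by omega)
      rwa [show s - (d - e : ℤ) = s + e - d by ring]

theorem ClosedShift.gcd {S : Set ℤ} {w : ℕ} : ∀ N d e : ℕ, d + e ≤ N → d ≤ w → e ≤ w →
    ClosedShift S w d → ClosedShift S w e → ClosedShift S w (Nat.gcd d e) := by
  intro N
  induction N with
  | zero =>
    intro d e h _ _ hd _
    have : d = 0 := by omega
    have : e = 0 := by omega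
    subst_vars
    simpa using hd
  | succ N ih =>
    intro d e h hdw hew hd he
    by_cases hd0 : d = 0
    · subst hd0; simpa using he
    by_cases he0 : e = 0
    · subst he0; simpa using hd
    by_cases hle : e ≤ d
    · have := ih (d - e) e (by omega) (by omega) hew (hd.sub he hle hdw) he
      rwa [Nat.gcd_sub_self_left hle] at this
    · have := ih d (e - d) (by omega) hdw (by omega) hd (he.sub hd (by omega) hew)
      rwa [Nat.gcd_sub_self_right (by omega)] at this

theorem ClosedShift.mem_of_gcdOne {S : Set ℤ} {w : ℕ} {D : Set ℕ} (hD : GcdOne D)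
    (hDw : ∀ d ∈ D, d ≤ w) (hcl : ∀ d ∈ D, ClosedShift S w d) (h0 : (0 : ℤ) ∈ S)
    {t : ℤ} (ht : 0 ≤ t) (htw : t ≤ 2 * w) : t ∈ S := by
  obtain ⟨T, hTD, hT1⟩ := hD
  have hmain : ∀ T' : Finset ℕ, T' ⊆ T → ClosedShift S w (T'.gcd id) ∧ T'.gcd id ≤ w := by
    intro T'
    induction T' using Finset.induction_on with
    | empty => intro _; simp [ClosedShift]; tauto
    | insert a T' _ ih =>
      intro hsub
      have h1 := ih ((Finset.subset_insert _ _).trans hsub)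
      have ha : a ∈ D := hTD (hsub (Finset.mem_insert_self _ _))
      rw [Finset.gcd_insert]
      refine ⟨ClosedShift.gcd _ _ _ le_rfl (hDw a ha) h1.2 (hcl a ha) h1.1, ?_⟩
      by_cases ha0 : a = 0
      · subst ha0; simpa using h1.2
      · exact (Nat.gcd_le_left _ (Nat.pos_of_ne_zero ha0)).trans (hDw a ha)
  have h1 := (hmain T subset_rfl).1
  rw [hT1] at h1
  obtain ⟨m, rfl⟩ := Int.eq_ofNat_of_zero_le ht
  induction m with
  | zero => simpa using h0
  | succ m ih =>
    push_cast at htw ⊢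
    exact h1.1 _ (ih (by omega) (by omega)) (by omega) (by push_cast; omega)

theorem exists_signs_window_small {σ : Type} (D : σ → Set ℕ) (w : ℕ) (hD : ∀ i, GcdOne (D i))
    (hDw : ∀ i, ∀ d ∈ D i, d ≤ w) (s : Finset σ) : ∃ δ : σ → ℤ, (∀ i ∈ s, (δ i).natAbs ∈ D i) ∧
      min (s.card + 1) (2 * w + 1) ≤
        ((Finset.Icc (0 : ℤ) (2 * w)).filter fun t => SubSum δ s t).card := by
  induction s using Finset.induction_on with
  | empty =>
    refine ⟨fun _ => 0, by simp, ?_⟩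
    refine (min_le_left _ _).trans ?_
    rw [Finset.card_empty, zero_add, Nat.one_le_iff_ne_zero, Finset.card_ne_zero]
    exact ⟨0, by simp [SubSum.zero]⟩
  | insert a s ha ih =>
    obtain ⟨δ, hδ, hcard⟩ := ih
    have hkeep : ∀ d : ℤ, d.natAbs ∈ D a → ∀ i ∈ insert a s,
        (Function.update δ a d i).natAbs ∈ D i := by
      intro d hd i hi
      by_cases h : i = a
      · subst h; simpa using hd
      · rw [Function.update_of_ne h]
        exact hδ i ((Finset.mem_insert.1 hi).resolve_left h)
    have hgrow : ∀ d : ℤ, ∀ t : ℤ, t ∈ Finset.Icc (0 : ℤ) (2 * w) → ¬ SubSum δ s t →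
        SubSum δ s (t - d) → (s.card + 1) + 1 ≤ (((Finset.Icc (0 : ℤ) (2 * w)).filter
          fun t => SubSum δ s t).card) + 1 → min ((insert a s).card + 1) (2 * w + 1) ≤
        ((Finset.Icc (0 : ℤ) (2 * w)).filter
          fun t => SubSum (Function.update δ a d) (insert a s) t).card := by
      intro d t ht hnt htd hc
      have hsub : insert t ((Finset.Icc (0 : ℤ) (2 * w)).filter fun t => SubSum δ s t) ⊆
          (Finset.Icc (0 : ℤ) (2 * w)).filter
          fun t => SubSum (Function.update δ a d) (insert a s) t := by
        intro x hx
        rw [Finset.mem_insert] at hx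
        rw [Finset.mem_filter]
        rcases hx with rfl | hx
        · exact ⟨ht, by simpa using htd.insert_right ha d⟩
        · rw [Finset.mem_filter] at hx
          exact ⟨hx.1, hx.2.insert_left ha d⟩
      have := Finset.card_le_card hsub
      rw [Finset.card_insert_of_notMem (by simp [hnt])] at this
      rw [Finset.card_insert_of_notMem ha]
      omega
    have hkeepc : ∀ d : ℤ, ((Finset.Icc (0 : ℤ) (2 * w)).filter fun t => SubSum δ s t).card ≤
        ((Finset.Icc (0 : ℤ) (2 * w)).filter
          fun t => SubSum (Function.update δ a d) (insert a s) t).card := by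
      intro d
      apply Finset.card_le_card
      intro x hx
      rw [Finset.mem_filter] at hx ⊢
      exact ⟨hx.1, hx.2.insert_left ha d⟩
    obtain ⟨d₀, hd₀⟩ : (D a).Nonempty := by
      obtain ⟨T, hT, h1⟩ := hD a
      by_contra h
      rw [Set.not_nonempty_iff_eq_empty] at h
      rw [h] at hT
      have : T = ∅ := by simpa using hT
      simp [this] at h1
    by_cases hfull : 2 * w + 1 ≤
        ((Finset.Icc (0 : ℤ) (2 * w)).filter fun t => SubSum δ s t).card
    · exact ⟨Function.update δ a d₀, hkeep _ (by simpa using hd₀),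
        (min_le_right _ _).trans (hfull.trans (hkeepc _))⟩
    have hc : s.card + 1 ≤ ((Finset.Icc (0 : ℤ) (2 * w)).filter fun t => SubSum δ s t).card := by
      omega
    by_cases hcl : ∀ d ∈ D a, ClosedShift {t | SubSum δ s t} w d
    · exfalso
      apply hfull
      have : (Finset.Icc (0 : ℤ) (2 * w)).filter (fun t => SubSum δ s t) =
          Finset.Icc (0 : ℤ) (2 * w) := by
        rw [Finset.filter_eq_self]
        intro t ht
        rw [Finset.mem_Icc] at ht
        exact ClosedShift.mem_of_gcdOne (hD a) (hDw a) hcl (SubSum.zero _ _) ht.1 ht.2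
      rw [this]
      simp
    · unfold ClosedShift at hcl
      push Not at hcl
      obtain ⟨d, hd, h⟩ := hcl
      by_cases h1 : ∀ s' ∈ {t | SubSum δ s t}, 0 ≤ s' → s' + d ≤ 2 * w →
          s' + d ∈ {t | SubSum δ s t}
      · obtain ⟨t, ht, h2, h3, h4⟩ := h h1
        refine ⟨Function.update δ a (-d), hkeep _ (by simpa using hd), ?_⟩
        refine hgrow (-d) (t - d) ?_ h4 (by simpa using ht) (by omega)
        rw [Finset.mem_Icc]; omega
      · push Not at h1
        obtain ⟨t, ht, h2, h3, h4⟩ := h1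
        refine ⟨Function.update δ a d, hkeep _ (by simpa using hd), ?_⟩
        refine hgrow d (t + d) ?_ h4 (by simpa using ht) (by omega)
        rw [Finset.mem_Icc]; omega

/-- Enough items, each with a set of possible shifts of greatest common divisor one, can be
given signed shifts whose subset sums cover an interval. -/
theorem exists_signs_window {σ : Type} (D : σ → Set ℕ) (w : ℕ) (hD : ∀ i, GcdOne (D i))
    (hDw : ∀ i, ∀ d ∈ D i, d ≤ w) (L : ℕ) : ∀ s : Finset σ, 2 * w + L ≤ s.card →
    ∃ δ : σ → ℤ, (∀ i ∈ s, (δ i).natAbs ∈ D i) ∧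
      ∀ t : ℤ, 0 ≤ t → t ≤ 2 * w + L → SubSum δ s t := by
  induction L with
  | zero =>
    intro s hs
    obtain ⟨δ, hδ, hc⟩ := exists_signs_window_small D w hD hDw s
    refine ⟨δ, hδ, fun t h0 h1 => ?_⟩
    have : (Finset.Icc (0 : ℤ) (2 * w)).filter (fun t => SubSum δ s t) =
        Finset.Icc (0 : ℤ) (2 * w) := by
      apply Finset.eq_of_subset_of_card_le (Finset.filter_subset _ _)
      rw [Int.card_Icc]
      omega
    have ht : t ∈ Finset.Icc (0 : ℤ) (2 * w) := by rw [Finset.mem_Icc]; omega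
    rw [← this] at ht
    exact (Finset.mem_filter.1 ht).2
  | succ L ih =>
    intro s hs
    obtain ⟨a, ha⟩ : s.Nonempty := by rw [← Finset.card_pos]; omega
    obtain ⟨δ, hδ, hcov⟩ := ih (s.erase a) (by rw [Finset.card_erase_of_mem ha]; omega)
    obtain ⟨d, hd, hd0⟩ : ∃ d ∈ D a, d ≠ 0 := by
      obtain ⟨T, hT, h1⟩ := hD a
      by_contra h
      push Not at h
      have : T.gcd id = 0 := by
        rw [Finset.gcd_eq_zero_iff]
        exact fun x hx => h x (hT hx)
      omega
    have hdw := hDw a d hd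
    refine ⟨Function.update δ a d, ?_, ?_⟩
    · intro i hi
      by_cases h : i = a
      · subst h; simpa using hd
      · rw [Function.update_of_ne h]
        exact hδ i (Finset.mem_erase.2 ⟨h, hi⟩)
    · intro t h0 h1
      rw [← Finset.insert_erase ha]
      push_cast at h1
      by_cases h : t ≤ 2 * w + L
      · exact (hcov t h0 h).insert_left (Finset.notMem_erase _ _) _
      · have := (hcov (t - d) (by omega) (by omega)).insert_right (Finset.notMem_erase _ _) d
        simpa using this

/-- Items with bounded vectors can be distributed among finitely many classes in prescribed
proportions, up to an error that does not depend on the number of items. -/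
theorem exists_proportional_split {J C κ : Type} [Fintype J] [Fintype C] [Fintype κ]
    (u : J → κ → ℝ) (w : ℝ) (hu0 : ∀ T l, 0 ≤ u T l) (huw : ∀ T l, u T l ≤ w) (hw : 0 ≤ w)
    (p : C → ℝ) (hp : ∀ c, 0 ≤ p c) (hp1 : ∑ c, p c = 1) :
    ∃ a : J → C, ∀ c l, |∑ T, (if a T = c then u T l else 0) - p c * ∑ T, u T l| ≤
      (Fintype.card κ * Fintype.card C + 1) * w := by
  rcases isEmpty_or_nonempty J with hJ | hJ
  · refine ⟨fun T => (hJ.false T).elim, fun c l => ?_⟩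
    simp only [Finset.univ_eq_empty, Finset.sum_empty, mul_zero, sub_zero, abs_zero]
    positivity
  have hJ0 : (0 : ℝ) < Fintype.card J := by exact_mod_cast Fintype.card_pos
  let v : J × C → (J ⊕ C × κ → ℝ) := fun x => Sum.elim (fun T => if x.1 = T then 1 else 0)
    (fun q => if x.2 = q.1 then u x.1 q.2 else 0)
  let b : J ⊕ C × κ → ℝ := ∑ x : J × C, (p x.2 / Fintype.card J) • v x
  have hb : b ∈ convexHull ℝ (Set.range v) := by
    apply (convex_convexHull ℝ _).sum_mem
    · intro x _; have := hp x.2; positivity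
    · rw [Fintype.sum_prod_type]
      simp only [← Finset.sum_div, hp1]
      simp
    · intro x _; exact subset_convexHull _ _ ⟨x, rfl⟩
  obtain ⟨I, _, z, wt, hz, hind, hwt, hwt1, hbz⟩ := eq_pos_convex_span_of_mem_convexHull hb
  have hz' : ∀ i, ∃ x, v x = z i := fun i => hz ⟨i, rfl⟩
  choose x hx using hz'
  have hcardI : Fintype.card I ≤ Fintype.card J + Fintype.card κ * Fintype.card C + 1 := by
    have := hind.card_le_finrank_succ
    have h2 := Submodule.finrank_le (vectorSpan ℝ (Set.range z))
    rw [Module.finrank_fintype_fun_eq_card] at h2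
    simp only [Fintype.card_sum, Fintype.card_prod] at h2
    rw [mul_comm (Fintype.card C)] at h2
    omega
  have hrow : ∀ T, ∑ i, wt i * (if (x i).1 = T then 1 else 0) = 1 / Fintype.card J := by
    intro T
    have := congrFun hbz (Sum.inl T)
    simp only [← hx, Finset.sum_apply, Pi.smul_apply, smul_eq_mul, v, Sum.elim_inl, b,
      Fintype.sum_prod_type] at this
    rw [this]
    simp [← Finset.sum_div, hp1]
  have hcol : ∀ c l, ∑ i, wt i * (if (x i).2 = c then u (x i).1 l else 0) =
      p c / Fintype.card J * ∑ T, u T l := by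
    intro c l
    have := congrFun hbz (Sum.inr (c, l))
    simp only [← hx, Finset.sum_apply, Pi.smul_apply, smul_eq_mul, v, Sum.elim_inr, b,
      Fintype.sum_prod_type] at this
    rw [this]
    simp [Finset.mul_sum]
  have hex : ∀ T, ∃ i, (x i).1 = T := by
    intro T
    by_contra h
    push Not at h
    have := hrow T
    simp only [h, if_false, mul_zero, Finset.sum_const_zero] at this
    have : (0 : ℝ) < 1 / Fintype.card J := by positivity
    linarith
  choose g hg using hex
  have hginj : Function.Injective g := fun T T' h => by rw [← hg T, h, hg T']
  refine ⟨fun T => (x (g T)).2, fun c l => ?_⟩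
  -- the share of class `c` in item `T`
  let Y : J → C → ℝ := fun T c => Fintype.card J *
    ∑ i, wt i * (if (x i).1 = T ∧ (x i).2 = c then 1 else 0)
  have hY : ∑ T, Y T c * u T l = p c * ∑ T, u T l := by
    have h1 : ∑ T, Y T c * u T l = Fintype.card J *
        ∑ i, wt i * (if (x i).2 = c then u (x i).1 l else 0) := by
      simp only [Y, Finset.mul_sum, Finset.sum_mul]
      rw [Finset.sum_comm]
      apply Finset.sum_congr rfl
      intro i _
      rw [Finset.sum_eq_single (x i).1]
      · by_cases h : (x i).2 = c <;> simp [h]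
        ring
      · intro T _ hT
        simp [Ne.symm hT]
      · simp
    rw [h1, hcol]
    field_simp
  have hY0 : ∀ T, 0 ≤ Y T c := fun T => mul_nonneg hJ0.le (Finset.sum_nonneg fun i _ =>
    mul_nonneg (hwt i).le (by split_ifs <;> norm_num))
  have hY1 : ∀ T, Y T c ≤ 1 := by
    intro T
    have h1 : ∑ i, wt i * (if (x i).1 = T ∧ (x i).2 = c then (1 : ℝ) else 0) ≤
        ∑ i, wt i * (if (x i).1 = T then 1 else 0) := by
      apply Finset.sum_le_sum
      intro i _
      apply mul_le_mul_of_nonneg_left _ (hwt i).le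
      by_cases h : (x i).1 = T <;> by_cases h' : (x i).2 = c <;> simp [h, h']
    rw [hrow] at h1
    calc Y T c ≤ Fintype.card J * (1 / Fintype.card J) := mul_le_mul_of_nonneg_left h1 hJ0.le
      _ = 1 := by field_simp
  let bad : Finset J := (Finset.univ \ Finset.univ.image g).image fun i => (x i).1
  have hbad : bad.card ≤ Fintype.card κ * Fintype.card C + 1 := by
    refine Finset.card_image_le.trans ?_
    rw [Finset.card_sdiff_of_subset (Finset.subset_univ _), Finset.card_image_of_injective _ hginj,
      Finset.card_univ, Finset.card_univ]
    omega
  have hgood : ∀ T, T ∉ bad → Y T c = if (x (g T)).2 = c then 1 else 0 := by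
    intro T hT
    have huniq : ∀ i, (x i).1 = T → i = g T := by
      intro i hi
      by_contra hne
      apply hT
      refine Finset.mem_image.2 ⟨i, ?_, hi⟩
      simp only [Finset.mem_sdiff, Finset.mem_univ, Finset.mem_image, true_and, not_exists]
      intro T' hT'
      have : T' = T := by rw [← hi, ← hT', hg]
      exact hne (by rw [← hT', this])
    have hw1 : wt (g T) = 1 / Fintype.card J := by
      rw [← hrow T, Finset.sum_eq_single (g T)]
      · simp [hg]
      · intro i _ hi
        have : (x i).1 ≠ T := fun h => hi (huniq i h)
        simp [this]
      · simp
    simp only [Y]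
    rw [Finset.sum_eq_single (g T)]
    · rw [hw1]
      by_cases h : (x (g T)).2 = c
      · simp [h, hg]
      · simp [h]
    · intro i _ hi
      have : (x i).1 ≠ T := fun h => hi (huniq i h)
      simp [this]
    · simp
  rw [← hY, ← Finset.sum_sub_distrib]
  refine (Finset.abs_sum_le_sum_abs _ _).trans ?_
  calc _ ≤ ∑ T, (if T ∈ bad then w else 0) := by
        apply Finset.sum_le_sum
        intro T _
        have h0 := hu0 T l
        have h1 := huw T l
        have h2 := hY0 T
        have h3 := hY1 T
        by_cases h : T ∈ bad
        · simp only [h, if_true]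
          rw [abs_le]
          split_ifs <;> constructor <;> nlinarith
        · simp only [h, if_false, hgood T h]
          split_ifs <;> simp
    _ = bad.card * w := by simp
    _ ≤ _ := by
      apply mul_le_mul_of_nonneg_right _ hw
      exact_mod_cast hbad

section Embedding
variable {V W ι : Type} [Fintype V] [Fintype W]

/-- The neighbours of `w` as a finset. -/
noncomputable def nb (H : SimpleGraph W) (w : W) : Finset W := Finset.univ.filter fun u => H.Adj w u

theorem mem_nb {H : SimpleGraph W} {w u : W} : u ∈ nb H w ↔ H.Adj w u := by simp [nb]

/-- The candidates for `c` in its target set, given the partial embedding `f` on `S`. -/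
noncomputable def cand (G : SimpleGraph V) (H : SimpleGraph W) (T : W → Finset V) (S : Finset W)
    (f : W → V) (c : W) : Finset V :=
  (T c).filter fun z => ∀ u ∈ S, H.Adj u c → G.Adj (f u) z

/-- The partial embedding `f` on `S` leaves many candidates for all vertices of `A`. -/
def GoodState (G : SimpleGraph V) (H : SimpleGraph W) (d : ℝ) (A : Finset W) (T : W → Finset V)
    (S : Finset W) (f : W → V) : Prop :=
  ∀ c ∈ A, c ∉ S → d ^ (nb H c ∩ S).card * (T c).card ≤ (cand G H T S f c).card

/-- `f` embeds `H[S]` into `G`, respecting the clusters. -/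
structure PartEmb (G : SimpleGraph V) (H : SimpleGraph W) (P : ι → Finset V) (a : W → ι)
    (S : Finset W) (f : W → V) : Prop where
  inj : Set.InjOn f S
  adj : ∀ u ∈ S, ∀ v ∈ S, H.Adj u v → G.Adj (f u) (f v)
  mem : ∀ u ∈ S, f u ∈ P (a u)

/-- Lower regularity of the pairs of clusters along the edges of `R`. -/
def LowerReg (G : SimpleGraph V) (R : SimpleGraph ι) (P : ι → Finset V) (d ε : ℝ) : Prop :=
  ∀ i j, R.Adj i j → ∀ B ⊆ P j, ε * (P j).card ≤ B.card →
    (((P i).filter fun u => ((B.filter fun z => G.Adj u z).card : ℝ) < d * B.card).card : ℝ) ≤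
      ε * (P i).card

theorem cand_insert_of_adj {G : SimpleGraph V} {H : SimpleGraph W} {T : W → Finset V}
    {S : Finset W} {f : W → V} {u c : W} (hu : u ∉ S) (z : V) (huc : H.Adj u c) :
    cand G H T (insert u S) (Function.update f u z) c =
      (cand G H T S f c).filter fun z' => G.Adj z z' := by
  ext z'
  simp only [cand, Finset.mem_filter, Finset.mem_insert, forall_eq_or_imp, Function.update_self]
  constructor
  · rintro ⟨h1, h2, h3⟩
    refine ⟨⟨h1, fun v hv hvc => ?_⟩, h2 huc⟩
    have := h3 v hv hvc
    rwa [Function.update_of_ne (by rintro rfl; exact hu hv)] at this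
  · rintro ⟨⟨h1, h2⟩, h3⟩
    refine ⟨h1, fun _ => h3, fun v hv hvc => ?_⟩
    rw [Function.update_of_ne (by rintro rfl; exact hu hv)]
    exact h2 v hv hvc

theorem cand_insert_of_not_adj {G : SimpleGraph V} {H : SimpleGraph W} {T : W → Finset V}
    {S : Finset W} {f : W → V} {u c : W} (hu : u ∉ S) (z : V) (huc : ¬ H.Adj u c) :
    cand G H T (insert u S) (Function.update f u z) c = cand G H T S f c := by
  ext z'
  simp only [cand, Finset.mem_filter, Finset.mem_insert, forall_eq_or_imp, Function.update_self]
  constructor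
  · rintro ⟨h1, -, h3⟩
    refine ⟨h1, fun v hv hvc => ?_⟩
    have := h3 v hv hvc
    rwa [Function.update_of_ne (by rintro rfl; exact hu hv)] at this
  · rintro ⟨h1, h2⟩
    refine ⟨h1, fun h => (huc h).elim, fun v hv hvc => ?_⟩
    rw [Function.update_of_ne (by rintro rfl; exact hu hv)]
    exact h2 v hv hvc

/-- The images of `u` that would leave too few candidates for some neighbour of `u`. -/
noncomputable def badImages (G : SimpleGraph V) (H : SimpleGraph W) (d : ℝ) (A : Finset W)
    (T : W → Finset V) (S : Finset W) (f : W → V) (Q : Finset V) (u : W) : Finset V :=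
  Q.filter fun z => ∃ c ∈ A, c ∉ S ∧ H.Adj u c ∧
    (((cand G H T S f c).filter fun z' => G.Adj z z').card : ℝ) < d * (cand G H T S f c).card

theorem card_badImages_le {G : SimpleGraph V} {H : SimpleGraph W} {R : SimpleGraph ι}
    {P : ι → Finset V} {a : W → ι} {d ε : ℝ} {D : ℕ} {A : Finset W} {T : W → Finset V}
    {S : Finset W} {f : W → V} {u : W} (hreg : LowerReg G R P d ε) (hε : 0 ≤ ε)
    (hD : (nb H u).card ≤ D) (ha : ∀ ⦃x y⦄, H.Adj x y → R.Adj (a x) (a y))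
    (hT : ∀ c, T c ⊆ P (a c))
    (hc : ∀ c ∈ A, c ∉ S → ε * (P (a c)).card ≤ (cand G H T S f c).card) :
    ((badImages G H d A T S f (P (a u)) u).card : ℝ) ≤ D * ε * (P (a u)).card := by
  have hsub : badImages G H d A T S f (P (a u)) u ⊆
      ((nb H u).filter fun c => c ∈ A ∧ c ∉ S).biUnion fun c => (P (a u)).filter fun z =>
        (((cand G H T S f c).filter fun z' => G.Adj z z').card : ℝ) <
          d * (cand G H T S f c).card := by
    intro z hz
    rw [badImages, Finset.mem_filter] at hz
    obtain ⟨hz, c, hcA, hcS, huc, hlt⟩ := hz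
    rw [Finset.mem_biUnion]
    exact ⟨c, by simp [mem_nb, huc, hcA, hcS], by simp [hz, hlt]⟩
  have h1 : ((badImages G H d A T S f (P (a u)) u).card : ℝ) ≤
      ∑ c ∈ (nb H u).filter (fun c => c ∈ A ∧ c ∉ S), (((P (a u)).filter fun z =>
        (((cand G H T S f c).filter fun z' => G.Adj z z').card : ℝ) <
          d * (cand G H T S f c).card).card : ℝ) := by
    exact_mod_cast (Finset.card_le_card hsub).trans Finset.card_biUnion_le
  refine h1.trans ?_
  calc _ ≤ ∑ c ∈ (nb H u).filter (fun c => c ∈ A ∧ c ∉ S), ε * (P (a u)).card := by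
        apply Finset.sum_le_sum
        intro c hcm
        simp only [Finset.mem_filter, mem_nb] at hcm
        exact hreg _ _ (ha hcm.1) _ ((Finset.filter_subset _ _).trans (hT c))
          (hc c hcm.2.1 hcm.2.2)
    _ = ((nb H u).filter (fun c => c ∈ A ∧ c ∉ S)).card * (ε * (P (a u)).card) := by simp
    _ ≤ D * (ε * (P (a u)).card) := by
        apply mul_le_mul_of_nonneg_right _ (by positivity)
        exact_mod_cast (Finset.card_filter_le _ _).trans hD
    _ = _ := by ring

theorem GoodState.pow_le {G : SimpleGraph V} {H : SimpleGraph W} {d : ℝ} {A : Finset W}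
    {T : W → Finset V} {S : Finset W} {f : W → V} (h : GoodState G H d A T S f) (hd0 : 0 ≤ d)
    (hd1 : d ≤ 1) {D : ℕ} {c : W} (hD : (nb H c).card ≤ D) (hcA : c ∈ A) (hcS : c ∉ S) :
    d ^ D * (T c).card ≤ (cand G H T S f c).card := by
  refine le_trans ?_ (h c hcA hcS)
  apply mul_le_mul_of_nonneg_right _ (Nat.cast_nonneg _)
  exact pow_le_pow_of_le_one hd0 hd1 ((Finset.card_le_card Finset.inter_subset_left).trans hD)

theorem GoodState.insert_vertex {G : SimpleGraph V} {H : SimpleGraph W} {d : ℝ} {A : Finset W}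
    {T : W → Finset V} {S : Finset W} {f : W → V} (h : GoodState G H d A T S f) (hd0 : 0 ≤ d)
    {u : W} (hu : u ∉ S) {Q : Finset V} {z : V} (hzQ : z ∈ Q)
    (hz : z ∉ badImages G H d A T S f Q u) :
    GoodState G H d A T (insert u S) (Function.update f u z) := by
  intro c hcA hcS
  rw [Finset.mem_insert, not_or] at hcS
  have h1 := h c hcA hcS.2
  by_cases huc : H.Adj u c
  · rw [cand_insert_of_adj hu z huc]
    have h2 : d * (cand G H T S f c).card ≤
        ((cand G H T S f c).filter fun z' => G.Adj z z').card := by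
      by_contra h3
      push Not at h3
      exact hz (Finset.mem_filter.2 ⟨hzQ, c, hcA, hcS.2, huc, h3⟩)
    have h4 : (nb H c ∩ insert u S).card = (nb H c ∩ S).card + 1 := by
      rw [Finset.inter_insert_of_mem (mem_nb.2 huc.symm), Finset.card_insert_of_notMem]
      simp [hu]
    rw [h4, pow_succ]
    calc d ^ (nb H c ∩ S).card * d * (T c).card = d * (d ^ (nb H c ∩ S).card * (T c).card) := by
          ring
      _ ≤ d * (cand G H T S f c).card := mul_le_mul_of_nonneg_left h1 hd0
      _ ≤ _ := h2
  · rw [cand_insert_of_not_adj hu z huc, Finset.inter_insert_of_notMem]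
    · exact h1
    · rw [mem_nb]; exact fun h => huc h.symm

/-- Vertices of `U` are embedded one after the other; for a weighted family of systems of target
sets, a constant proportion of the weight is respected. -/
theorem exists_extension_family {Ω : Type} [Fintype Ω] {G : SimpleGraph V} {H : SimpleGraph W}
    {R : SimpleGraph ι} {P : ι → Finset V} {a : W → ι} {d ε c : ℝ} {D : ℕ}
    (hreg : LowerReg G R P d ε) (hε : 0 ≤ ε) (hd0 : 0 ≤ d) (hd1 : d ≤ 1) (hc : 0 < c)
    (hD : ∀ u, (nb H u).card ≤ D) (ha : ∀ ⦃x y⦄, H.Adj x y → R.Adj (a x) (a y))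
    (hPd : ∀ i j, i ≠ j → Disjoint (P i) (P j)) (Oset : Finset Ω) (hO : Oset.Nonempty)
    (T : Ω → W → Finset V) (q : Ω → ℝ) (hq : ∀ p, 0 < q p) (hT : ∀ p c, T p c ⊆ P (a c))
    (A S U : Finset W) (hUA : U ⊆ A) (hUS : Disjoint U S) (f : W → V)
    (hf : PartEmb G H P a S f) (hgood : ∀ p ∈ Oset, GoodState G H d A (T p) S f)
    (hε' : ∀ p ∈ Oset, ∀ x ∈ A, ε * (P (a x)).card ≤ d ^ D * (T p x).card)
    (hroom : ∀ p ∈ Oset, ∀ u ∈ U, c * (P (a u)).card + D * ε * (P (a u)).card +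
      (T p u ∩ S.image f).card + (U.filter fun v => a v = a u).card ≤ d ^ D * (T p u).card)
    (hPne : ∀ u ∈ U, (P (a u)).Nonempty) :
    ∃ f' : W → V, (∀ x, x ∉ U → f' x = f x) ∧ PartEmb G H P a (U ∪ S) f' ∧
      c ^ U.card * ∑ p ∈ Oset, q p ≤ ∑ p ∈ Oset.filter (fun p =>
        GoodState G H d A (T p) (U ∪ S) f' ∧ ∀ u ∈ U, f' u ∈ T p u), q p := by
  suffices hmain : ∀ U' ⊆ U, ∃ f' : W → V, (∀ x, x ∉ U' → f' x = f x) ∧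
      PartEmb G H P a (U' ∪ S) f' ∧ c ^ U'.card * ∑ p ∈ Oset, q p ≤
        ∑ p ∈ Oset.filter (fun p =>
        GoodState G H d A (T p) (U' ∪ S) f' ∧ ∀ u ∈ U', f' u ∈ T p u), q p from
    hmain U subset_rfl
  intro U'
  induction U' using Finset.induction_on with
  | empty =>
    intro _
    refine ⟨f, fun _ _ => rfl, by simpa using hf, ?_⟩
    rw [Finset.filter_true_of_mem]
    · simp
    · intro p hp
      simpa using hgood p hp
  | insert u U' hu ih =>
    intro hsub
    obtain ⟨f', hf'o, hf'e, hf'w⟩ := ih ((Finset.subset_insert _ _).trans hsub)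
    have huU : u ∈ U := hsub (Finset.mem_insert_self _ _)
    have hU'U : U' ⊆ U := (Finset.subset_insert _ _).trans hsub
    have huS : u ∉ S := Finset.disjoint_left.1 hUS huU
    have huUS : u ∉ U' ∪ S := by simp [hu, huS]
    set Al := Oset.filter (fun p =>
        GoodState G H d A (T p) (U' ∪ S) f' ∧ ∀ u ∈ U', f' u ∈ T p u) with hAl
    let Zp : Ω → Finset V := fun p => ((cand G H (T p) (U' ∪ S) f' u \
      badImages G H d A (T p) (U' ∪ S) f' (P (a u)) u) \ (S.image f)) \
      ((U'.filter fun v => a v = a u).image f')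
    have hZsub : ∀ p, Zp p ⊆ P (a u) := by
      intro p z hz
      simp only [Zp, Finset.mem_sdiff, cand, Finset.mem_filter] at hz
      exact hT p u hz.1.1.1.1
    have hZcard : ∀ p ∈ Al, c * (P (a u)).card ≤ (Zp p).card := by
      intro p hp
      simp only [hAl, Finset.mem_filter] at hp
      obtain ⟨hpO, hpg, hpT⟩ := hp
      have h1 := hpg.pow_le hd0 hd1 (hD u) (hUA huU) huUS
      have h2 := card_badImages_le (S := U' ∪ S) (f := f') (T := T p) (A := A) (u := u) hreg hε
        (hD u) ha (hT p) (fun x hx hxS => (hε' p hpO x hx).trans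
          (hpg.pow_le hd0 hd1 (hD x) hx hxS))
      have h3 := hroom p hpO u huU
      have h4 : ((cand G H (T p) (U' ∪ S) f' u ∩ S.image f).card : ℝ) ≤
          (T p u ∩ S.image f).card := by
        exact_mod_cast Finset.card_le_card
          (Finset.inter_subset_inter_right (Finset.filter_subset _ _))
      have h5 : (((U'.filter fun v => a v = a u).image f').card : ℝ) ≤
          (U.filter fun v => a v = a u).card := by
        exact_mod_cast Finset.card_image_le.trans
          (Finset.card_le_card (Finset.filter_subset_filter _ hU'U))
      have h6 : (cand G H (T p) (U' ∪ S) f' u).card ≤ (Zp p).card +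
          (badImages G H d A (T p) (U' ∪ S) f' (P (a u)) u).card +
          (cand G H (T p) (U' ∪ S) f' u ∩ S.image f).card +
          ((U'.filter fun v => a v = a u).image f').card := by
        have : cand G H (T p) (U' ∪ S) f' u ⊆ ((Zp p ∪
          badImages G H d A (T p) (U' ∪ S) f' (P (a u)) u) ∪
          (cand G H (T p) (U' ∪ S) f' u ∩ S.image f)) ∪
          ((U'.filter fun v => a v = a u).image f') := by
          intro z hz
          simp only [Zp, Finset.mem_union, Finset.mem_sdiff, Finset.mem_inter]
          tauto
        refine (Finset.card_le_card this).trans ?_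
        refine (Finset.card_union_le _ _).trans (Nat.add_le_add_right ?_ _)
        refine (Finset.card_union_le _ _).trans (Nat.add_le_add_right ?_ _)
        exact Finset.card_union_le _ _
      have h6' : ((cand G H (T p) (U' ∪ S) f' u).card : ℝ) ≤ (Zp p).card +
          (badImages G H d A (T p) (U' ∪ S) f' (P (a u)) u).card +
          (cand G H (T p) (U' ∪ S) f' u ∩ S.image f).card +
          ((U'.filter fun v => a v = a u).image f').card := by exact_mod_cast h6
      linarith
    have hAlpos : 0 < ∑ p ∈ Al, q p :=
      lt_of_lt_of_le (mul_pos (pow_pos hc _) (Finset.sum_pos (fun p _ => hq p) hO)) hf'w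
    -- averaging over the images of `u`
    obtain ⟨z, hzP, hz⟩ : ∃ z ∈ P (a u), c * ∑ p ∈ Al, q p ≤
        ∑ p ∈ Al.filter (fun p => z ∈ Zp p), q p := by
      apply Finset.exists_le_of_sum_le (hPne u huU)
      calc ∑ z ∈ P (a u), c * ∑ p ∈ Al, q p = ∑ p ∈ Al, q p * (c * (P (a u)).card) := by
            rw [Finset.sum_const, nsmul_eq_mul, ← Finset.sum_mul]; ring
        _ ≤ ∑ p ∈ Al, q p * (Zp p).card :=
            Finset.sum_le_sum fun p hp => mul_le_mul_of_nonneg_left (hZcard p hp) (hq p).le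
        _ = ∑ p ∈ Al, ∑ z ∈ P (a u), if z ∈ Zp p then q p else 0 := by
            apply Finset.sum_congr rfl
            intro p _
            rw [← Finset.sum_filter, Finset.sum_const, nsmul_eq_mul, mul_comm,
              Finset.filter_mem_eq_inter, Finset.inter_eq_right.2 (hZsub p)]
        _ = _ := by
            rw [Finset.sum_comm]
            simp only [Finset.sum_filter]
    obtain ⟨p₀, hp₀⟩ : (Al.filter fun p => z ∈ Zp p).Nonempty := by
      by_contra h
      rw [Finset.not_nonempty_iff_eq_empty] at h
      rw [h, Finset.sum_empty] at hz
      have := mul_pos hc hAlpos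
      linarith
    rw [Finset.mem_filter] at hp₀
    have hzZ := hp₀.2
    simp only [Zp, Finset.mem_sdiff] at hzZ
    obtain ⟨⟨⟨hzc, -⟩, hzS⟩, hzU'⟩ := hzZ
    have hzadj : ∀ v ∈ U' ∪ S, H.Adj v u → G.Adj (f' v) z := (Finset.mem_filter.1 hzc).2
    have hzT : z ∈ P (a u) := hzP
    have hznot : ∀ v ∈ U' ∪ S, f' v ≠ z := by
      intro v hv hvz
      rcases Finset.mem_union.1 hv with hv' | hv'
      · have h1 : a v = a u := by
          by_contra hne
          exact Finset.disjoint_left.1 (hPd _ _ hne) (hf'e.mem v hv) (hvz ▸ hzT)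
        exact hzU' (Finset.mem_image.2 ⟨v, by simp [hv', h1], hvz⟩)
      · apply hzS
        refine Finset.mem_image.2 ⟨v, hv', ?_⟩
        rw [← hvz]
        exact (hf'o v fun h => Finset.disjoint_left.1 hUS (hU'U h) hv').symm
    have hupd : ∀ v ∈ U' ∪ S, Function.update f' u z v = f' v := by
      intro v hv
      rw [Function.update_of_ne]
      rintro rfl
      exact huUS hv
    refine ⟨Function.update f' u z, ?_, ?_, ?_⟩
    · intro x hx
      rw [Finset.mem_insert, not_or] at hx
      rw [Function.update_of_ne hx.1, hf'o x hx.2]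
    · rw [Finset.insert_union]
      refine ⟨?_, ?_, ?_⟩
      · intro v hv w hw hvw
        rw [Finset.mem_coe, Finset.mem_insert] at hv hw
        rcases hv with rfl | hv
        · rcases hw with rfl | hw
          · rfl
          · rw [Function.update_self, hupd w hw] at hvw
            exact (hznot w hw hvw.symm).elim
        · rcases hw with rfl | hw
          · rw [Function.update_self, hupd v hv] at hvw
            exact (hznot v hv hvw).elim
          · rw [hupd v hv, hupd w hw] at hvw
            exact hf'e.inj hv hw hvw
      · intro v hv w hw hvw
        rw [Finset.mem_insert] at hv hw
        rcases hv with rfl | hv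
        · rcases hw with rfl | hw
          · exact (H.loopless.irrefl _ hvw).elim
          · rw [Function.update_self, hupd w hw]
            exact (hzadj w hw hvw.symm).symm
        · rcases hw with rfl | hw
          · rw [Function.update_self, hupd v hv]
            exact hzadj v hv hvw
          · rw [hupd v hv, hupd w hw]
            exact hf'e.adj v hv w hw hvw
      · intro v hv
        rw [Finset.mem_insert] at hv
        rcases hv with rfl | hv
        · rw [Function.update_self]; exact hzT
        · rw [hupd v hv]; exact hf'e.mem v hv
    · rw [Finset.card_insert_of_notMem hu, pow_succ]
      calc c ^ U'.card * c * ∑ p ∈ Oset, q p = c * (c ^ U'.card * ∑ p ∈ Oset, q p) := by ring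
        _ ≤ c * ∑ p ∈ Al, q p := mul_le_mul_of_nonneg_left hf'w hc.le
        _ ≤ _ := hz
        _ ≤ _ := by
          apply Finset.sum_le_sum_of_subset_of_nonneg _ fun p _ _ => (hq p).le
          intro p hp
          simp only [hAl, Finset.mem_filter, Zp, Finset.mem_sdiff] at hp
          obtain ⟨⟨hpO, hpg, hpT⟩, ⟨⟨hpc, hpb⟩, -⟩, -⟩ := hp
          rw [Finset.mem_filter, Finset.insert_union]
          refine ⟨hpO, hpg.insert_vertex hd0 huUS hzP hpb, ?_⟩
          intro v hv
          rw [Finset.mem_insert] at hv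
          rcases hv with rfl | hv
          · rw [Function.update_self]
            exact (Finset.mem_filter.1 hpc).1
          · rw [hupd v (Finset.mem_union_left _ hv)]
            exact hpT v hv
end Embedding

section Blocks
variable {V W ι : Type} [Fintype V] [Fintype W]

theorem GoodState.of_no_edges {G : SimpleGraph V} {H : SimpleGraph W} {d : ℝ}
    {A : Finset W} {T : W → Finset V} {S : Finset W} {f : W → V} {c : W}
    (hc : ∀ u ∈ S, ¬ H.Adj u c) :
    d ^ (nb H c ∩ S).card * (T c).card ≤ (cand G H T S f c).card := by
  have h1 : nb H c ∩ S = ∅ := by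
    rw [Finset.eq_empty_iff_forall_notMem]
    intro u hu
    rw [Finset.mem_inter, mem_nb] at hu
    exact hc u hu.2 hu.1.symm
  have h2 : cand G H T S f c = T c := by
    rw [cand, Finset.filter_true_of_mem]
    intro z _ u hu huc
    exact (hc u hu huc).elim
  simp [h1, h2]

theorem cand_congr {G : SimpleGraph V} {H : SimpleGraph W} {T T' : W → Finset V} {S : Finset W}
    {f : W → V} {c : W} (h : T c = T' c) : cand G H T S f c = cand G H T' S f c := by
  rw [cand, cand, h]

theorem PartEmb.card_inter_image_le {G : SimpleGraph V} {H : SimpleGraph W} {P : ι → Finset V}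
    {a : W → ι} {S : Finset W} {f : W → V} (hf : PartEmb G H P a S f)
    (hPd : ∀ i j, i ≠ j → Disjoint (P i) (P j)) {Q : Finset V} {i : ι} (hQ : Q ⊆ P i) :
    (Q ∩ S.image f).card ≤ (S.filter fun v => a v = i).card := by
  refine (Finset.card_le_card ?_).trans (Finset.card_image_le (f := f))
  intro z hz
  rw [Finset.mem_inter, Finset.mem_image] at hz
  obtain ⟨hzQ, v, hv, rfl⟩ := hz
  refine Finset.mem_image.2 ⟨v, Finset.mem_filter.2 ⟨hv, ?_⟩, rfl⟩
  by_contra hne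
  exact Finset.disjoint_left.1 (hPd _ _ hne) (hf.mem v hv) (hQ hzQ)

/-- The closed neighbourhood of `y`. -/
noncomputable def blk (H : SimpleGraph W) (y : W) : Finset W := insert y (nb H y)

theorem card_blk_le {H : SimpleGraph W} {D : ℕ} (hD : ∀ u, (nb H u).card ≤ D) (y : W) :
    (blk H y).card ≤ D + 1 :=
  (Finset.card_insert_le _ _).trans (Nat.add_le_add_right (hD y) 1)

theorem self_mem_blk {H : SimpleGraph W} (y : W) : y ∈ blk H y := Finset.mem_insert_self _ _

/-- Closed neighbourhoods of far apart vertices are embedded one after the other, so that each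
admissible system of target sets is respected by a constant proportion of those of its type. -/
theorem exists_block_embedding {Ω θ : Type} [Fintype Ω] {G : SimpleGraph V}
    {H : SimpleGraph W} {R : SimpleGraph ι} {P : ι → Finset V} {a : W → ι} {d ε c γ : ℝ} {D : ℕ}
    (hreg : LowerReg G R P d ε) (hε : 0 ≤ ε) (hd0 : 0 < d) (hd1 : d ≤ 1) (hc : 0 < c)
    (hc1 : c ≤ 1)
    (hD : ∀ u, (nb H u).card ≤ D) (ha : ∀ ⦃x y⦄, H.Adj x y → R.Adj (a x) (a y))
    (hPd : ∀ i j, i ≠ j → Disjoint (P i) (P j)) (hPne : ∀ i, (P i).Nonempty)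
    (Z : Finset W) (hZ : ∀ i, ((Z.filter fun v => a v = i).card : ℝ) ≤ γ * (P i).card)
    (hnum : c + D * ε + γ ≤ d ^ D * d ^ D) (hnum' : ε ≤ d ^ D * d ^ D)
    (O : θ → Finset Ω) (τ : W → θ) (T : W → Ω → W → Finset V)
    (hT : ∀ y p x, T y p x ⊆ P (a x))
    (Y : Finset W) (hYZ : ∀ y ∈ Y, blk H y ⊆ Z)
    (hO : ∀ y ∈ Y, (O (τ y)).Nonempty)
    (hTout : ∀ y ∈ Y, ∀ p ∈ O (τ y), ∀ x, x ∉ blk H y → T y p x = P (a x))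
    (hTbig : ∀ y ∈ Y, ∀ p ∈ O (τ y), ∀ x, d ^ D * (P (a x)).card ≤ (T y p x).card)
    (hYd : ∀ y ∈ Y, ∀ y' ∈ Y, y ≠ y' → ∀ u ∈ blk H y, ∀ v ∈ blk H y', u ≠ v ∧ ¬ H.Adj u v) :
    ∃ f : W → V, PartEmb G H P a (Y.biUnion (blk H)) f ∧
      GoodState G H d Z (P ∘ a) (Y.biUnion (blk H)) f ∧
      ∀ t, ∀ p ∈ O t, Real.log (Fintype.card Ω) ≤
          c ^ (D + 1) / 4 * (Y.filter fun y => τ y = t).card →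
        c ^ (D + 1) / 4 * (Y.filter fun y => τ y = t).card ≤
        (Y.filter fun y => τ y = t ∧ ∀ x ∈ blk H y, f x ∈ T y p x).card := by
  set c0 := c ^ (D + 1) with hc0
  have hc0pos : 0 < c0 := pow_pos hc _
  have hc01 : c0 ≤ 1 := pow_le_one₀ hc.le hc1
  set cnt : (W → V) → Finset W → θ → Ω → ℕ := fun f Y' t p =>
    (Y'.filter fun y => τ y = t ∧ ∀ x ∈ blk H y, f x ∈ T y p x).card with hcnt
  suffices hmain : ∀ Y' ⊆ Y, ∃ f : W → V, PartEmb G H P a (Y'.biUnion (blk H)) f ∧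
      GoodState G H d Z (P ∘ a) (Y'.biUnion (blk H)) f ∧
      ∀ t, ∑ p ∈ O t, ((1 : ℝ) / 2) ^ cnt f Y' t p ≤
        Fintype.card Ω * (1 - c0 / 2) ^ (Y'.filter fun y => τ y = t).card by
    obtain ⟨f, hf1, hf2, hf3⟩ := hmain Y subset_rfl
    refine ⟨f, hf1, hf2, fun t p hp hlog => ?_⟩
    have h1 : ((1 : ℝ) / 2) ^ cnt f Y t p ≤
        Fintype.card Ω * (1 - c0 / 2) ^ (Y.filter fun y => τ y = t).card :=
      (Finset.single_le_sum (f := fun p => ((1 : ℝ) / 2) ^ cnt f Y t p)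
        (fun p _ => by positivity) hp).trans (hf3 t)
    set m := (Y.filter fun y => τ y = t).card
    have hΩ : (0 : ℝ) < Fintype.card Ω := by
      have : 0 < Fintype.card Ω := Fintype.card_pos_iff.2 ⟨p⟩
      exact_mod_cast this
    have hlt : 0 < 1 - c0 / 2 := by linarith
    have h2 := Real.log_le_log (by positivity) h1
    rw [Real.log_mul hΩ.ne' (pow_pos hlt _).ne', Real.log_pow, Real.log_pow,
      one_div, Real.log_inv] at h2
    have h3 : Real.log (1 - c0 / 2) ≤ - (c0 / 2) := by
      have := Real.log_le_sub_one_of_pos hlt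
      linarith
    have h4 : Real.log 2 ≤ 1 := by
      have := Real.log_le_sub_one_of_pos (show (0 : ℝ) < 2 by norm_num)
      linarith
    have h5 : (m : ℝ) * Real.log (1 - c0 / 2) ≤ m * (-(c0 / 2)) :=
      mul_le_mul_of_nonneg_left h3 (Nat.cast_nonneg _)
    have h6 : (cnt f Y t p : ℝ) * Real.log 2 ≤ cnt f Y t p * 1 :=
      mul_le_mul_of_nonneg_left h4 (Nat.cast_nonneg _)
    have h7 : c0 / 4 * m ≤ (cnt f Y t p : ℝ) := by nlinarith
    exact h7
  intro Y'
  induction Y' using Finset.induction_on with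
  | empty =>
    intro _
    obtain ⟨f⟩ : Nonempty (W → V) := ⟨fun w => (hPne (a w)).choose⟩
    refine ⟨f, ⟨by simp, by simp, by simp⟩, ?_, fun t => ?_⟩
    · intro x _ _
      exact GoodState.of_no_edges (A := Z) (by simp)
    · simp only [hcnt, Finset.filter_empty, Finset.card_empty, pow_zero, Finset.sum_const,
        nsmul_eq_mul, mul_one]
      exact_mod_cast Finset.card_le_univ _
  | insert y Y' hy ih =>
    intro hsub
    obtain ⟨f, hf, hgood, hΦ⟩ := ih ((Finset.subset_insert _ _).trans hsub)
    have hyY : y ∈ Y := hsub (Finset.mem_insert_self _ _)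
    have hY'Y : Y' ⊆ Y := (Finset.subset_insert _ _).trans hsub
    set S := Y'.biUnion (blk H) with hS
    have hsep : ∀ u ∈ S, ∀ v ∈ blk H y, u ≠ v ∧ ¬ H.Adj u v := by
      intro u hu v hv
      obtain ⟨y', hy', huy'⟩ := Finset.mem_biUnion.1 hu
      exact hYd y' (hY'Y hy') y hyY (by rintro rfl; exact hy hy') u huy' v hv
    have hdisj : Disjoint (blk H y) S :=
      Finset.disjoint_left.2 fun v hv hvS => (hsep v hvS v hv).1 rfl
    have hSZ : S ⊆ Z := Finset.biUnion_subset.2 fun y' hy' => hYZ y' (hY'Y hy')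
    have hBZ := hYZ y hyY
    obtain ⟨f', hf'o, hf'e, hf'w⟩ := exists_extension_family (Ω := Ω) hreg hε hd0.le hd1 hc hD ha hPd
      (O (τ y)) (hO y hyY) (T y) (fun p => (1 / 2) ^ cnt f Y' (τ y) p) (fun p => by positivity)
      (hT y) Z S (blk H y) hBZ hdisj f hf
      (by
        intro p hp x hxZ hxS
        by_cases hxB : x ∈ blk H y
        · exact GoodState.of_no_edges (A := Z) fun u hu => (hsep u hu x hxB).2
        · have h1 := hgood x hxZ hxS
          have h2 := hTout y hyY p hp x hxB
          rw [cand_congr (T' := P ∘ a) h2, h2]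
          exact h1)
      (by
        intro p hp x _
        have h1 := hTbig y hyY p hp x
        calc ε * (P (a x)).card ≤ d ^ D * d ^ D * (P (a x)).card :=
              mul_le_mul_of_nonneg_right hnum' (Nat.cast_nonneg _)
          _ = d ^ D * (d ^ D * (P (a x)).card) := by ring
          _ ≤ _ := mul_le_mul_of_nonneg_left h1 (by positivity))
      (by
        intro p hp u hu
        have h1 := hTbig y hyY p hp u
        have h2 := hf.card_inter_image_le hPd (hT y p u)
        have h3 : (S.filter fun v => a v = a u).card + ((blk H y).filter fun v => a v = a u).card ≤
            (Z.filter fun v => a v = a u).card := by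
          rw [← Finset.card_union_of_disjoint
            (Finset.disjoint_filter_filter hdisj.symm), ← Finset.filter_union]
          exact Finset.card_le_card (Finset.filter_subset_filter _ (Finset.union_subset hSZ hBZ))
        have h4 := hZ (a u)
        have h5 : ((T y p u ∩ S.image f).card : ℝ) + ((blk H y).filter fun v => a v = a u).card ≤
            (Z.filter fun v => a v = a u).card := by
          have := (Nat.add_le_add_right h2 _).trans h3
          exact_mod_cast this
        have h6 : (c + D * ε + γ) * (P (a u)).card ≤ d ^ D * d ^ D * (P (a u)).card :=
          mul_le_mul_of_nonneg_right hnum (Nat.cast_nonneg _)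
        have h7 : d ^ D * (d ^ D * (P (a u)).card) ≤ d ^ D * (T y p u).card :=
          mul_le_mul_of_nonneg_left h1 (by positivity)
        nlinarith)
      (fun u _ => hPne _)
    have hbi : (insert y Y').biUnion (blk H) = blk H y ∪ S := by
      rw [Finset.biUnion_insert]
    have hserv_old : ∀ t p, ∀ y' ∈ Y', (τ y' = t ∧ ∀ x ∈ blk H y', f' x ∈ T y' p x) ↔
        (τ y' = t ∧ ∀ x ∈ blk H y', f x ∈ T y' p x) := by
      intro t p y' hy'
      refine and_congr_right fun _ => forall₂_congr fun x hx => ?_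
      rw [hf'o x]
      intro hxB
      exact (hsep x (Finset.mem_biUnion.2 ⟨y', hy', hx⟩) x hxB).1 rfl
    have hcnt_old : ∀ t p, cnt f' Y' t p = cnt f Y' t p := by
      intro t p
      simp only [hcnt]
      rw [Finset.filter_congr (hserv_old t p)]
    have hcnt_new : ∀ t p, cnt f' (insert y Y') t p = cnt f Y' t p +
        if (τ y = t ∧ ∀ x ∈ blk H y, f' x ∈ T y p x) then 1 else 0 := by
      intro t p
      rw [← hcnt_old]
      simp only [hcnt]
      rw [Finset.filter_insert]
      split_ifs with h
      · rw [Finset.card_insert_of_notMem (by simp [hy])]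
      · simp
    have hq : ∀ p, (0 : ℝ) < (1 / 2) ^ cnt f Y' (τ y) p := fun p => by positivity
    have hΦpos : 0 < ∑ p ∈ O (τ y), ((1 : ℝ) / 2) ^ cnt f Y' (τ y) p :=
      Finset.sum_pos (fun p _ => hq p) (hO y hyY)
    have hle : c0 * ∑ p ∈ O (τ y), ((1 : ℝ) / 2) ^ cnt f Y' (τ y) p ≤
        ∑ p ∈ (O (τ y)).filter (fun p => GoodState G H d Z (T y p) (blk H y ∪ S) f' ∧
          ∀ u ∈ blk H y, f' u ∈ T y p u), ((1 : ℝ) / 2) ^ cnt f Y' (τ y) p := by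
      refine le_trans (mul_le_mul_of_nonneg_right ?_ hΦpos.le) hf'w
      exact pow_le_pow_of_le_one hc.le hc1 (card_blk_le hD y)
    refine ⟨f', ?_, ?_, ?_⟩
    · rw [hbi]; exact hf'e
    · rw [hbi]
      obtain ⟨p, hp⟩ : ((O (τ y)).filter (fun p => GoodState G H d Z (T y p) (blk H y ∪ S) f' ∧
          ∀ u ∈ blk H y, f' u ∈ T y p u)).Nonempty := by
        by_contra h
        rw [Finset.not_nonempty_iff_eq_empty] at h
        rw [h, Finset.sum_empty] at hle
        have := mul_pos hc0pos hΦpos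
        linarith
      rw [Finset.mem_filter] at hp
      intro x hxZ hxS
      have h1 := hp.2.1 x hxZ hxS
      have hxB : x ∉ blk H y := fun h => hxS (Finset.mem_union_left _ h)
      have h2 := hTout y hyY p hp.1 x hxB
      rw [cand_congr (T' := P ∘ a) h2, h2] at h1
      exact h1
    · intro t
      by_cases ht : τ y = t
      · subst ht
        rw [Finset.filter_insert, if_pos rfl, Finset.card_insert_of_notMem (by simp [hy]), pow_succ]
        have hsum : ∑ p ∈ O (τ y), ((1 : ℝ) / 2) ^ cnt f' (insert y Y') (τ y) p =
            ∑ p ∈ O (τ y), ((1 : ℝ) / 2) ^ cnt f Y' (τ y) p -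
            (∑ p ∈ (O (τ y)).filter (fun p => ∀ u ∈ blk H y, f' u ∈ T y p u),
              ((1 : ℝ) / 2) ^ cnt f Y' (τ y) p) / 2 := by
          rw [Finset.sum_filter, Finset.sum_div, ← Finset.sum_sub_distrib]
          apply Finset.sum_congr rfl
          intro p _
          rw [hcnt_new]
          by_cases h : ∀ u ∈ blk H y, f' u ∈ T y p u
          · rw [if_pos ⟨rfl, h⟩, if_pos h, pow_succ]; ring
          · rw [if_neg (fun h' => h h'.2), if_neg h]; simp
        have hle2 : ∑ p ∈ (O (τ y)).filter (fun p =>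
            GoodState G H d Z (T y p) (blk H y ∪ S) f' ∧
            ∀ u ∈ blk H y, f' u ∈ T y p u), ((1 : ℝ) / 2) ^ cnt f Y' (τ y) p ≤
            ∑ p ∈ (O (τ y)).filter (fun p => ∀ u ∈ blk H y, f' u ∈ T y p u),
              ((1 : ℝ) / 2) ^ cnt f Y' (τ y) p := by
          apply Finset.sum_le_sum_of_subset_of_nonneg _ fun p _ _ => (hq p).le
          intro p hp
          rw [Finset.mem_filter] at hp ⊢
          exact ⟨hp.1, hp.2.2⟩
        rw [hsum]
        have h3 := hΦ (τ y)
        have hpos : 0 ≤ 1 - c0 / 2 := by linarith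
        calc _ ≤ (1 - c0 / 2) * ∑ p ∈ O (τ y), ((1 : ℝ) / 2) ^ cnt f Y' (τ y) p := by linarith
          _ ≤ (1 - c0 / 2) * (Fintype.card Ω *
              (1 - c0 / 2) ^ (Y'.filter fun y' => τ y' = τ y).card) :=
            mul_le_mul_of_nonneg_left h3 hpos
          _ = _ := by ring
      · rw [Finset.filter_insert, if_neg ht]
        refine le_trans (le_of_eq ?_) (hΦ t)
        apply Finset.sum_congr rfl
        intro p _
        rw [hcnt_new, if_neg (fun h => ht h.1), add_zero]

end Blocks

section Tiles
variable {V W ι J : Type} [Fintype V] [Fintype W] [Fintype J]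

/-- A partial embedding in the good state extends to a closed set `Z`. -/
theorem exists_closed_extension {G : SimpleGraph V}
    {H : SimpleGraph W} {R : SimpleGraph ι} {P : ι → Finset V} {a : W → ι} {d ε c γ : ℝ} {D : ℕ}
    (hreg : LowerReg G R P d ε) (hε : 0 ≤ ε) (hd0 : 0 < d) (hd1 : d ≤ 1) (hc : 0 < c)
    (hD : ∀ u, (nb H u).card ≤ D) (ha : ∀ ⦃x y⦄, H.Adj x y → R.Adj (a x) (a y))
    (hPd : ∀ i j, i ≠ j → Disjoint (P i) (P j)) (hPne : ∀ i, (P i).Nonempty)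
    (Z : Finset W) (hZ : ∀ i, ((Z.filter fun v => a v = i).card : ℝ) ≤ γ * (P i).card)
    (hnum : c + D * ε + γ ≤ d ^ D * d ^ D) (hnum' : ε ≤ d ^ D * d ^ D)
    {S : Finset W} (hSZ : S ⊆ Z) {f : W → V} (hf : PartEmb G H P a S f)
    (hgood : GoodState G H d Z (P ∘ a) S f) :
    ∃ f' : W → V, (∀ x ∈ S, f' x = f x) ∧ PartEmb G H P a Z f' := by
  have hdD : d ^ D ≤ 1 := pow_le_one₀ hd0.le hd1
  have hdD0 : 0 < d ^ D := by positivity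
  have hdD2 : d ^ D * d ^ D ≤ d ^ D := by nlinarith
  obtain ⟨f', h1, h2, -⟩ := exists_extension_family (Ω := Unit) hreg hε hd0.le hd1 hc hD ha hPd
    Finset.univ Finset.univ_nonempty (fun _ => P ∘ a) (fun _ => 1) (fun _ => one_pos)
    (fun _ _ => subset_rfl) Z S (Z \ S) Finset.sdiff_subset Finset.sdiff_disjoint f hf
    (fun _ _ => hgood)
    (fun _ _ x _ => mul_le_mul_of_nonneg_right (hnum'.trans hdD2) (Nat.cast_nonneg _))
    (by
      intro _ _ u hu
      have h2 := hf.card_inter_image_le hPd (subset_rfl : P (a u) ⊆ P (a u))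
      have h3 : (S.filter fun v => a v = a u).card + ((Z \ S).filter fun v => a v = a u).card ≤
          (Z.filter fun v => a v = a u).card := by
        rw [← Finset.card_union_of_disjoint
          (Finset.disjoint_filter_filter Finset.sdiff_disjoint.symm), ← Finset.filter_union]
        exact Finset.card_le_card (Finset.filter_subset_filter _
          (Finset.union_subset hSZ Finset.sdiff_subset))
      have h4 := hZ (a u)
      have h5 : ((P (a u) ∩ S.image f).card : ℝ) + ((Z \ S).filter fun v => a v = a u).card ≤
          (Z.filter fun v => a v = a u).card := by
        exact_mod_cast (Nat.add_le_add_right h2 _).trans h3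
      have h6 : (c + D * ε + γ) * (P (a u)).card ≤ d ^ D * (P (a u)).card :=
        mul_le_mul_of_nonneg_right (hnum.trans hdD2) (Nat.cast_nonneg _)
      simp only [Function.comp]
      nlinarith)
    (fun u _ => hPne _)
  refine ⟨f', fun x hx => h1 x (by simp [hx]), ?_⟩
  rwa [Finset.sdiff_union_of_subset hSZ] at h2

/-- The tiles outside `Z` are embedded one after the other, apart from an independent set `X`
whose vertices keep many candidates. -/
theorem exists_tiles_extension {G : SimpleGraph V}
    {H : SimpleGraph W} {R : SimpleGraph ι} {P : ι → Finset V} {a : W → ι} {d ε δ : ℝ} {D : ℕ}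
    (hreg : LowerReg G R P d ε) (hε : 0 < ε) (hd0 : 0 < d) (hd1 : d ≤ 1) (hδ : δ ≤ 1)
    (hD : ∀ u, (nb H u).card ≤ D) (ha : ∀ ⦃x y⦄, H.Adj x y → R.Adj (a x) (a y))
    (hPd : ∀ i j, i ≠ j → Disjoint (P i) (P j)) (hPne : ∀ i, (P i).Nonempty)
    (t : W → J) (ht : ∀ ⦃x y⦄, H.Adj x y → t x = t y) {w : ℝ}
    (htw : ∀ j, ((Finset.univ.filter fun v => t v = j).card : ℝ) ≤ w)
    (X Z : Finset W) (hXZ : Disjoint X Z) (hXind : ∀ x ∈ X, ∀ y ∈ X, ¬ H.Adj x y)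
    (hZ : ∀ x y, t x = t y → x ∈ Z → y ∈ Z)
    (hload : ∀ i, ((Finset.univ.filter fun v => v ∉ X ∧ a v = i).card : ℝ) + δ * (P i).card ≤
      (P i).card)
    (hnum : ∀ i, ε * (P i).card + D * ε * (P i).card + w ≤ d ^ D * (δ * (P i).card))
    (hnum' : ε ≤ d ^ D * δ) {f : W → V} (hf : PartEmb G H P a Z f) :
    ∃ f' : W → V, (∀ x ∈ Z, f' x = f x) ∧ PartEmb G H P a Xᶜ f' ∧
      ∀ x ∈ X, d ^ D * (P (a x)).card ≤ (cand G H (P ∘ a) Finset.univ f' x).card := by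
  set tl : J → Finset W := fun j => Finset.univ.filter fun v => t v = j with htl
  have hδ0 : 0 < δ := by
    have : 0 < d ^ D := by positivity
    by_contra h
    push Not at h
    nlinarith
  suffices hmain : ∀ J' : Finset J, (∀ j ∈ J', Disjoint (tl j) Z) → ∃ f' : W → V,
      (∀ x ∈ Z, f' x = f x) ∧ PartEmb G H P a (Z ∪ J'.biUnion fun j => tl j \ X) f' ∧
      ∀ x ∈ X, t x ∈ J' → d ^ D * (P (a x)).card ≤
        (cand G H (P ∘ a) Finset.univ f' x).card by
    obtain ⟨f', h1, h2, h3⟩ := hmain (Finset.univ.filter fun j => Disjoint (tl j) Z) (by simp)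
    have hdj : ∀ x, x ∉ Z → Disjoint (tl (t x)) Z := by
      intro x hx
      refine Finset.disjoint_left.2 fun y hy hyZ => hx ?_
      simp only [htl, Finset.mem_filter, Finset.mem_univ, true_and] at hy
      exact hZ y x hy hyZ
    refine ⟨f', h1, ?_, fun x hx => h3 x hx ?_⟩
    · convert h2 using 1
      ext x
      simp only [Finset.mem_compl, Finset.mem_union, Finset.mem_biUnion, Finset.mem_filter,
        Finset.mem_univ, true_and, Finset.mem_sdiff, htl]
      constructor
      · intro hx
        by_cases hxZ : x ∈ Z
        · exact Or.inl hxZ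
        · exact Or.inr ⟨t x, hdj x hxZ, rfl, hx⟩
      · rintro (hx | ⟨j, -, -, hx⟩)
        · exact fun h => Finset.disjoint_left.1 hXZ h hx
        · exact hx
    · simp only [Finset.mem_filter, Finset.mem_univ, true_and]
      exact hdj x (Finset.disjoint_left.1 hXZ hx)
  intro J'
  induction J' using Finset.induction_on with
  | empty => exact fun _ => ⟨f, fun _ _ => rfl, by simpa using hf, by simp⟩
  | insert j J' hj ih =>
    intro hJ
    obtain ⟨f₁, h1, h2, h3⟩ := ih fun i hi => hJ i (Finset.mem_insert_of_mem hi)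
    set S := Z ∪ J'.biUnion fun j => tl j \ X with hS
    have hjS : ∀ u ∈ S, t u ≠ j := by
      intro u hu huj
      rcases Finset.mem_union.1 hu with h | h
      · exact Finset.disjoint_left.1 (hJ j (Finset.mem_insert_self _ _))
          (by simp [htl, huj]) h
      · obtain ⟨j', hj', hu'⟩ := Finset.mem_biUnion.1 h
        simp only [htl, Finset.mem_sdiff, Finset.mem_filter, Finset.mem_univ, true_and] at hu'
        exact hj (by rw [← huj, hu'.1]; exact hj')
    have hSX : ∀ u ∈ S, u ∉ X := by
      intro u hu huX
      rcases Finset.mem_union.1 hu with h | h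
      · exact Finset.disjoint_left.1 hXZ huX h
      · obtain ⟨j', hj', hu'⟩ := Finset.mem_biUnion.1 h
        exact (Finset.mem_sdiff.1 hu').2 huX
    set T : W → Finset V := fun x => if x ∈ X then P (a x) else P (a x) \ S.image f₁ with hT
    have hTP : ∀ x, T x ⊆ P (a x) := by
      intro x
      simp only [hT]
      split_ifs
      · exact subset_rfl
      · exact Finset.sdiff_subset
    have hTc : ∀ x, δ * (P (a x)).card ≤ (T x).card := by
      intro x
      simp only [hT]
      split_ifs with hx
      · nlinarith [Nat.cast_nonneg (α := ℝ) (P (a x)).card]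
      · have h4 := h2.card_inter_image_le hPd (subset_rfl : P (a x) ⊆ P (a x))
        have h5 : (S.filter fun v => a v = a x).card ≤
            (Finset.univ.filter fun v => v ∉ X ∧ a v = a x).card := by
          apply Finset.card_le_card
          intro v hv
          rw [Finset.mem_filter] at hv
          simp [hSX v hv.1, hv.2]
        have h6 := Finset.card_sdiff_add_card_inter (P (a x)) (S.image f₁)
        have h7 := hload (a x)
        have h8 : ((P (a x)).card : ℝ) ≤ (P (a x) \ S.image f₁).card +
            (Finset.univ.filter fun v => v ∉ X ∧ a v = a x).card := by
          exact_mod_cast (by omega)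
        linarith
    have hdisj : Disjoint (tl j \ X) S := by
      refine Finset.disjoint_left.2 fun u hu huS => hjS u huS ?_
      simpa [htl] using (Finset.mem_sdiff.1 hu).1
    have hP0 : ∀ i, (0 : ℝ) ≤ (P i).card := fun i => Nat.cast_nonneg _
    obtain ⟨f₂, h4, h5, h6⟩ := exists_extension_family (Ω := Unit) hreg hε.le hd0.le hd1 hε hD ha
      hPd Finset.univ Finset.univ_nonempty (fun _ => T) (fun _ => 1) (fun _ => one_pos)
      (fun _ => hTP) (tl j) S (tl j \ X) Finset.sdiff_subset hdisj f₁ h2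
      (fun _ _ x hx hxS => GoodState.of_no_edges (A := tl j) fun u hu hux =>
        hjS u hu ((ht hux).trans (by simpa [htl] using hx)))
      (by
        intro _ _ x _
        have := hTc x
        calc ε * (P (a x)).card ≤ d ^ D * δ * (P (a x)).card :=
              mul_le_mul_of_nonneg_right hnum' (hP0 _)
          _ = d ^ D * (δ * (P (a x)).card) := by ring
          _ ≤ _ := mul_le_mul_of_nonneg_left this (by positivity))
      (by
        intro _ _ u hu
        have huX : u ∉ X := (Finset.mem_sdiff.1 hu).2
        have h7 : T u ∩ S.image f₁ = ∅ := by
          simp only [hT, if_neg huX]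
          exact Finset.disjoint_iff_inter_eq_empty.1 Finset.sdiff_disjoint
        rw [h7, Finset.card_empty, Nat.cast_zero, add_zero]
        have h8 : (((tl j \ X).filter fun v => a v = a u).card : ℝ) ≤ w := by
          refine le_trans ?_ (htw j)
          exact_mod_cast Finset.card_le_card
            ((Finset.filter_subset _ _).trans Finset.sdiff_subset)
        have h9 := hnum (a u)
        have h10 : d ^ D * (δ * (P (a u)).card) ≤ d ^ D * (T u).card :=
          mul_le_mul_of_nonneg_left (hTc u) (by positivity)
        linarith)
      (fun u _ => hPne _)
    have hS' : (tl j \ X) ∪ S = Z ∪ (insert j J').biUnion fun j => tl j \ X := by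
      rw [Finset.biUnion_insert, hS, Finset.union_left_comm]
    have hserved : GoodState G H d (tl j) T ((tl j \ X) ∪ S) f₂ := by
      have h7 : (0 : ℝ) < ε ^ (tl j \ X).card * ∑ p ∈ (Finset.univ : Finset Unit), (1 : ℝ) := by
        simp only [Finset.univ_unique, Finset.sum_const, Finset.card_singleton, one_smul, mul_one]
        positivity
      have h8 := lt_of_lt_of_le h7 h6
      by_contra hcon
      rw [Finset.filter_false_of_mem] at h8
      · simp at h8
      · rintro _ _ ⟨h, -⟩
        exact hcon h
    refine ⟨f₂, ?_, ?_, ?_⟩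
    · intro x hx
      rw [h4 x, h1 x hx]
      intro hxU
      exact Finset.disjoint_left.1 hdisj hxU (Finset.mem_union_left _ hx)
    · rw [← hS']; exact h5
    · intro x hxX hxJ
      rw [Finset.mem_insert] at hxJ
      rcases hxJ with hxj | hxJ
      · have hx1 : x ∈ tl j := by simp [htl, hxj]
        have hx2 : x ∉ (tl j \ X) ∪ S := by
          rw [Finset.mem_union, not_or]
          exact ⟨by simp [hxX], fun h => hSX x h hxX⟩
        have h7 := hserved.pow_le hd0.le hd1 (hD x) hx1 hx2
        have h8 : T x = P (a x) := by simp [hT, hxX]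
        rw [h8] at h7
        refine h7.trans ?_
        norm_cast
        apply Finset.card_le_card
        intro z hz
        simp only [cand, Finset.mem_filter, h8] at hz ⊢
        refine ⟨hz.1, fun u _ hux => hz.2 u ?_ hux⟩
        refine Finset.mem_union_left _ (Finset.mem_sdiff.2 ⟨?_, fun huX => hXind u huX x hxX hux⟩)
        simp [htl, ht hux, hxj]
      · refine (h3 x hxX hxJ).trans (le_of_eq ?_)
        congr 2
        simp only [cand]
        apply Finset.filter_congr
        intro z _
        refine forall₂_congr fun u _ => ?_
        refine imp_congr_right fun hux => ?_
        rw [h4 u]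
        intro hu
        have : t u = j := by simpa [htl] using (Finset.mem_sdiff.1 hu).1
        rw [ht hux] at this
        exact hj (this ▸ hxJ)
end Tiles

theorem exists_injOn_selection {α β θ : Type} [Nonempty β] (τ : α → θ) (σ : β → θ)
    (Av : α → Finset β) (A : Finset α) (hAv : ∀ x ∈ A, ∀ y ∈ Av x, σ y = τ x)
    (hcard : ∀ x ∈ A, (A.filter fun x' => τ x' = τ x).card ≤ (Av x).card) :
    ∃ g : α → β, Set.InjOn g A ∧ ∀ x ∈ A, g x ∈ Av x := by
  induction A using Finset.induction_on with
  | empty => exact ⟨fun _ => Classical.arbitrary β, by simp, by simp⟩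
  | insert x A hx ih =>
    obtain ⟨g, hg, hgA⟩ := ih (fun y hy => hAv y (Finset.mem_insert_of_mem hy)) (fun y hy =>
      (Finset.card_le_card (Finset.filter_subset_filter _ (Finset.subset_insert _ _))).trans
        (hcard y (Finset.mem_insert_of_mem hy)))
    have h1 := hcard x (Finset.mem_insert_self _ _)
    rw [Finset.filter_insert, if_pos rfl, Finset.card_insert_of_notMem (by simp [hx])] at h1
    obtain ⟨y, hy, hyn⟩ : ∃ y ∈ Av x, y ∉ (A.filter fun x' => τ x' = τ x).image g := by
      by_contra hcon
      push Not at hcon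
      have := (Finset.card_le_card hcon).trans Finset.card_image_le
      omega
    have hynot : ∀ x' ∈ A, g x' ≠ y := by
      intro x' hx' he
      refine hyn (Finset.mem_image.2 ⟨x', Finset.mem_filter.2 ⟨hx', ?_⟩, he⟩)
      rw [← hAv x (Finset.mem_insert_self _ _) y hy, ← he]
      exact (hAv x' (Finset.mem_insert_of_mem hx') _ (hgA x' hx')).symm
    have hupd : ∀ x' ∈ A, Function.update g x y x' = g x' := fun x' hx' =>
      Function.update_of_ne (by rintro rfl; exact hx hx') _ _
    refine ⟨Function.update g x y, ?_, ?_⟩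
    · rw [Finset.coe_insert]
      intro u hu v hv huv
      rcases hu with rfl | hu <;> rcases hv with rfl | hv
      · rfl
      · rw [Function.update_self, hupd v hv] at huv
        exact (hynot v hv huv.symm).elim
      · rw [Function.update_self, hupd u hu] at huv
        exact (hynot u hu huv).elim
      · rw [hupd u hu, hupd v hv] at huv
        exact hg hu hv huv
    · intro u hu
      rcases Finset.mem_insert.1 hu with rfl | hu
      · rwa [Function.update_self]
      · rw [hupd u hu]; exact hgA u hu

/-- The swapping step: the vertices of `X` take the images of their partners `y x`, whose new
images are the unused vertices `β x`. -/
theorem exists_embedding_of_swap {V W : Type} {G : SimpleGraph V} {H : SimpleGraph W}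
    (X : Finset W) (f : W → V) (hfinj : Set.InjOn f (↑X)ᶜ)
    (hfadj : ∀ u v, u ∉ X → v ∉ X → H.Adj u v → G.Adj (f u) (f v))
    (hX : ∀ x ∈ X, ∀ y ∈ X, ¬ H.Adj x y) (β : W → V) (hβ : Set.InjOn β X)
    (hβf : ∀ x ∈ X, ∀ u, u ∉ X → f u ≠ β x) (y : W → W) (hy : Set.InjOn y X)
    (hyX : ∀ x ∈ X, y x ∉ X) (hxy : ∀ x ∈ X, ∀ x' ∈ X, ¬ H.Adj x (y x'))
    (hyy : ∀ x ∈ X, ∀ x' ∈ X, ¬ H.Adj (y x) (y x'))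
    (hfx : ∀ x ∈ X, ∀ u, H.Adj u x → G.Adj (f u) (f (y x)))
    (hfy : ∀ x ∈ X, ∀ u, H.Adj u (y x) → G.Adj (f u) (β x)) :
    ∃ F : W → V, Function.Injective F ∧ ∀ ⦃u v⦄, H.Adj u v → G.Adj (F u) (F v) := by
  set g : W → V := fun w => if w ∈ X then β w else f w with hg
  set s : W → W := fun w => if w ∈ X then y w else
    if h : ∃ x, x ∈ X ∧ y x = w then h.choose else w with hs
  have hs1 : ∀ x ∈ X, s x = y x := fun x hx => by simp only [hs, if_pos hx]
  have hs2 : ∀ x ∈ X, s (y x) = x := by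
    intro x hx
    have h : ∃ x', x' ∈ X ∧ y x' = y x := ⟨x, hx, rfl⟩
    simp only [hs, if_neg (hyX x hx), dif_pos h]
    exact hy h.choose_spec.1 hx h.choose_spec.2
  have hs3 : ∀ w, w ∉ X → (∀ x ∈ X, y x ≠ w) → s w = w := by
    intro w hw hn
    simp only [hs, if_neg hw]
    rw [dif_neg]
    rintro ⟨x, hx, h⟩
    exact hn x hx h
  have hcases : ∀ w, w ∈ X ∨ (∃ x ∈ X, y x = w) ∨ (w ∉ X ∧ ∀ x ∈ X, y x ≠ w) := by
    intro w
    by_cases h1 : w ∈ X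
    · exact Or.inl h1
    · by_cases h2 : ∃ x ∈ X, y x = w
      · exact Or.inr (Or.inl h2)
      · push Not at h2
        exact Or.inr (Or.inr ⟨h1, h2⟩)
  have hss : ∀ w, s (s w) = w := by
    intro w
    rcases hcases w with h | ⟨x, hx, rfl⟩ | ⟨h, h'⟩
    · rw [hs1 w h, hs2 w h]
    · rw [hs2 x hx, hs1 x hx]
    · rw [hs3 w h h', hs3 w h h']
  have hginj : Function.Injective g := by
    intro u v huv
    simp only [hg] at huv
    split_ifs at huv with h1 h2 h2
    · exact hβ h1 h2 huv
    · exact (hβf u h1 v h2 huv.symm).elim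
    · exact (hβf v h2 u h1 huv).elim
    · exact hfinj (by simpa using h1) (by simpa using h2) huv
  have hF1 : ∀ x ∈ X, g (s x) = f (y x) := fun x hx => by
    rw [hs1 x hx]; simp only [hg, if_neg (hyX x hx)]
  have hF2 : ∀ x ∈ X, g (s (y x)) = β x := fun x hx => by
    rw [hs2 x hx]; simp only [hg, if_pos hx]
  have hF3 : ∀ w, w ∉ X → (∀ x ∈ X, y x ≠ w) → g (s w) = f w := fun w h h' => by
    rw [hs3 w h h']; simp only [hg, if_neg h]
  refine ⟨fun w => g (s w), fun u v huv => ?_, ?_⟩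
  · have := hginj huv
    rw [← hss u, this, hss]
  · have key : ∀ u v, H.Adj u v → (u ∈ X ∨ ∃ x ∈ X, y x = u) → G.Adj (g (s v)) (g (s u)) := by
      rintro u v huv (hu | ⟨x, hx, rfl⟩)
      · rw [hF1 u hu, hF3 v (fun hv => hX u hu v hv huv) (fun x hx he => hxy u hu x hx (he ▸ huv))]
        exact hfx u hu v huv.symm
      · rw [hF2 x hx, hF3 v (fun hv => hxy v hv x hx huv.symm)
          (fun x' hx' he => hyy x hx x' hx' (he ▸ huv))]
        exact hfy x hx v huv.symm
    intro u v huv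
    rcases hcases u with h | h | ⟨h, h'⟩
    · exact (key u v huv (Or.inl h)).symm
    · exact (key u v huv (Or.inr h)).symm
    · rcases hcases v with h1 | h1 | ⟨h1, h1'⟩
      · exact key v u huv.symm (Or.inl h1)
      · exact key v u huv.symm (Or.inr h1)
      · simp only [hF3 u h h', hF3 v h1 h1']
        exact hfadj u v h h1 huv

section Main
variable {V W ι J : Type} [Fintype V] [Fintype W] [Fintype J]

/-- The systems of target sets for the closed neighbourhood of `y`: the neighbours go to the
neighbourhood of a vertex `v`, and `y` goes to a common neighbourhood of few vertices. -/
noncomputable def targets (G : SimpleGraph V) (H : SimpleGraph W) (P : ι → Finset V) (a : W → ι)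
    {D : ℕ} (y : W) (p : Option (V × (Fin D → Option V))) (x : W) : Finset V :=
  match p with
  | none => P (a x)
  | some (v, g) =>
    if x = y then (P (a x)).filter fun z => ∀ i u, g i = some u → G.Adj u z
    else if H.Adj y x then (P (a x)).filter fun z => G.Adj v z else P (a x)

/-- The embedding theorem: a homomorphism to the reduced graph with the correct class sizes and
with many absorbing vertices of all relevant types yields an embedding. -/
theorem exists_embedding {G : SimpleGraph V}
    {H : SimpleGraph W} {R : SimpleGraph ι} {P : ι → Finset V} {a : W → ι} {d ε c γ δ : ℝ} {D : ℕ}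
    (hreg : LowerReg G R P d ε) (hε : 0 < ε) (hd0 : 0 < d) (hd1 : d ≤ 1) (hc : 0 < c)
    (hc1 : c ≤ 1) (hδ : δ ≤ 1) (hD1 : 1 ≤ D)
    (hD : ∀ u, (nb H u).card ≤ D) (ha : ∀ ⦃x y⦄, H.Adj x y → R.Adj (a x) (a y))
    (h : V → ι) (K : V → Finset ι) (κ : ι → Finset ι)
    (hPh : ∀ i, ∀ v ∈ P i, h v = i) (hPK : ∀ i, ∀ v ∈ P i, K v = κ i)
    (hPne : ∀ i, (P i).Nonempty)
    (hKdeg : ∀ v, ∀ j ∈ K v, j ≠ h v →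
      d * (P j).card ≤ ((P j).filter fun z => G.Adj v z).card)
    (hcount : ∀ i, (Finset.univ.filter fun x => a x = i).card =
      (Finset.univ.filter fun v => h v = i).card)
    (t : W → J) (ht : ∀ ⦃x y⦄, H.Adj x y → t x = t y) {w : ℝ}
    (htw : ∀ j, ((Finset.univ.filter fun v => t v = j).card : ℝ) ≤ w)
    (X Y Z : Finset W) (hXZ : Disjoint X Z) (hXind : ∀ x ∈ X, ∀ y ∈ X, ¬ H.Adj x y)
    (hZt : ∀ x y, t x = t y → x ∈ Z → y ∈ Z)
    (hZ : ∀ i, ((Z.filter fun v => a v = i).card : ℝ) ≤ γ * (P i).card)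
    (hYZ : Y ⊆ Z) (ty : W → Finset ι) (hYty : ∀ y ∈ Y, ∀ x, H.Adj y x → a x ∈ ty y)
    (hYd : ∀ y ∈ Y, ∀ y' ∈ Y, y ≠ y' → ∀ u ∈ blk H y, ∀ v ∈ blk H y', u ≠ v ∧ ¬ H.Adj u v)
    (hload : ∀ i, ((Finset.univ.filter fun v => v ∉ X ∧ a v = i).card : ℝ) + δ * (P i).card ≤
      (P i).card)
    (hnum : c + D * ε + γ ≤ d ^ D * d ^ D) (hnum' : ε ≤ d ^ D * d ^ D)
    (hnum2 : ∀ i, ε * (P i).card + D * ε * (P i).card + w ≤ d ^ D * (δ * (P i).card))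
    (hnum2' : ε ≤ d ^ D * δ)
    (habs : ∀ v, ((Finset.univ.filter fun v' => v' ∉ P (h v) ∧ h v' = h v ∧
        K v' = K v).card : ℝ) + (if K v = κ (h v) then
          ((X.filter fun x => a x = h v).card : ℝ) else 0) ≤
      c ^ (D + 1) / 4 * (Y.filter fun y => a y = h v ∧ ty y = K v).card)
    (hlog : ∀ v, Real.log (Fintype.card (Option (V × (Fin D → Option V)))) ≤
      c ^ (D + 1) / 4 * (Y.filter fun y => a y = h v ∧ ty y = K v).card) :
    ∃ F : W → V, Function.Injective F ∧ ∀ ⦃u v⦄, H.Adj u v → G.Adj (F u) (F v) := by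
  rcases isEmpty_or_nonempty W with hW | ⟨⟨w₀⟩⟩
  · exact ⟨fun w => (hW.false w).elim, fun w => (hW.false w).elim, fun w => (hW.false w).elim⟩
  haveI : Nonempty V := ⟨(hPne (a w₀)).choose⟩
  haveI : Nonempty W := ⟨w₀⟩
  have hPd : ∀ i j, i ≠ j → Disjoint (P i) (P j) := fun i j hij =>
    Finset.disjoint_left.2 fun v hv hv' => hij ((hPh i v hv).symm.trans (hPh j v hv'))
  have hdD : d ^ D ≤ 1 := pow_le_one₀ hd0.le hd1
  have hdDd : d ^ D ≤ d := by
    calc d ^ D ≤ d ^ 1 := pow_le_pow_of_le_one hd0.le hd1 hD1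
      _ = d := pow_one d
  have hP0 : ∀ i, (0 : ℝ) ≤ (P i).card := fun i => Nat.cast_nonneg _
  have hblkZ : ∀ y ∈ Y, blk H y ⊆ Z := by
    intro y hy x hx
    rcases Finset.mem_insert.1 hx with rfl | hx
    · exact hYZ hy
    · exact hZt y x (ht (mem_nb.1 hx)) (hYZ hy)
  set τ : W → ι × Finset ι := fun y => (a y, ty y) with hτ
  set O : ι × Finset ι → Finset (Option (V × (Fin D → Option V))) := fun θ =>
    Finset.univ.filter fun p => ∀ q, p = some q → (h q.1, K q.1) = θ ∧
      d ^ D * (P (h q.1)).card ≤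
        ((P (h q.1)).filter fun z => ∀ i u, q.2 i = some u → G.Adj u z).card with hO
  have hbig : ∀ x, d ^ D * (P (a x)).card ≤ (P (a x)).card := fun x => by
    nlinarith [hP0 (a x)]
  obtain ⟨f₁, hf1, hg1, hserv⟩ := exists_block_embedding (Ω := Option (V × (Fin D → Option V)))
    hreg hε.le hd0 hd1 hc hc1 hD ha hPd hPne Z hZ hnum hnum' O τ (targets G H P a)
    (by
      intro y p x
      rcases p with _ | ⟨v, g⟩
      · exact subset_rfl
      · simp only [targets]
        split_ifs
        · exact Finset.filter_subset _ _
        · exact Finset.filter_subset _ _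
        · exact subset_rfl)
    Y hblkZ (fun y _ => ⟨none, by simp [hO]⟩)
    (by
      intro y hy p hp x hx
      rcases p with _ | ⟨v, g⟩
      · rfl
      · simp only [blk, Finset.mem_insert, mem_nb, not_or] at hx
        simp only [targets, if_neg hx.1, if_neg hx.2])
    (by
      intro y hy p hp x
      rcases p with _ | ⟨v, g⟩
      · exact hbig x
      · simp only [hO, Finset.mem_filter, Finset.mem_univ, true_and] at hp
        obtain ⟨hp1, hp2⟩ := hp (v, g) rfl
        simp only [hτ, Prod.mk.injEq] at hp1
        simp only [targets]
        split_ifs with h1 h2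
        · subst h1
          simp only [hp1.1] at hp2
          exact hp2
        · have h3 : a x ∈ K v := by rw [hp1.2]; exact hYty y hy x h2
          have h4 := hKdeg v (a x) h3 (by rw [hp1.1]; exact (ha h2).ne')
          exact (mul_le_mul_of_nonneg_right hdDd (hP0 _)).trans h4
        · exact hbig x)
    hYd
  obtain ⟨f₂, hf2, hf2e⟩ := exists_closed_extension hreg hε.le hd0 hd1 hc hD ha hPd hPne Z hZ hnum
    hnum' (Finset.biUnion_subset.2 hblkZ) hf1 hg1
  obtain ⟨f, hf3, hfe, hfX⟩ := exists_tiles_extension hreg hε hd0 hd1 hδ hD ha hPd hPne t ht htw X Z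
    hXZ hXind hZt hload hnum2 hnum2' hf2e
  have hfblk : ∀ y ∈ Y, ∀ x ∈ blk H y, f x = f₁ x := fun y hy x hx => by
    rw [hf3 x (hblkZ y hy hx), hf2 x (Finset.mem_biUnion.2 ⟨y, hy, hx⟩)]
  -- the unused vertices
  set L : Finset V := (Xᶜ.image f)ᶜ with hL
  have hLcount : ∀ i, (X.filter fun x => a x = i).card = (L.filter fun v => h v = i).card := by
    intro i
    have h1 : (Finset.univ.filter fun x => a x = i).card =
        (X.filter fun x => a x = i).card + (Xᶜ.filter fun x => a x = i).card := by
      rw [← Finset.card_union_of_disjoint (Finset.disjoint_filter_filter disjoint_compl_right),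
        ← Finset.filter_union, Finset.union_compl]
    have h2 : (Finset.univ.filter fun v => h v = i).card =
        (L.filter fun v => h v = i).card + ((Xᶜ.image f).filter fun v => h v = i).card := by
      rw [← Finset.card_union_of_disjoint (Finset.disjoint_filter_filter
        (disjoint_compl_left)), ← Finset.filter_union, hL,
        Finset.union_comm, Finset.union_compl]
    have h3 : ((Xᶜ.image f).filter fun v => h v = i).card = (Xᶜ.filter fun x => a x = i).card := by
      rw [Finset.filter_image, Finset.card_image_of_injOn]
      · congr 1
        apply Finset.filter_congr
        intro x hx
        rw [hPh _ _ (hfe.mem x hx)]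
      · exact hfe.inj.mono fun x hx => Finset.mem_coe.2 (Finset.mem_filter.1 hx).1
    have := hcount i
    omega
  obtain ⟨β, hβinj, hβ⟩ := exists_injOn_selection a h (fun x => L.filter fun v => h v = a x) X
    (fun x _ v hv => (Finset.mem_filter.1 hv).2) (fun x _ => (hLcount (a x)).le)
  simp only [Finset.mem_filter] at hβ
  -- the partners
  have hexg : ∀ x, ∃ g : Fin D → Option V, ∀ z, (∀ i u, g i = some u → G.Adj u z) ↔
      ∀ u, H.Adj u x → G.Adj (f u) z := by
    intro x
    obtain ⟨e⟩ : Nonempty ({u // u ∈ nb H x} ↪ Fin D) :=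
      Function.Embedding.nonempty_of_card_le (by simpa using hD x)
    refine ⟨Function.extend e (fun u => some (f u.1)) fun _ => none, fun z => ⟨fun hz u hu => ?_,
      fun hz i u hi => ?_⟩⟩
    · refine hz (e ⟨u, mem_nb.2 hu.symm⟩) (f u) ?_
      rw [e.injective.extend_apply]
    · by_cases hi' : ∃ u', e u' = i
      · obtain ⟨u', rfl⟩ := hi'
        rw [e.injective.extend_apply] at hi
        cases hi
        exact hz u'.1 (mem_nb.1 u'.2).symm
      · rw [Function.extend_apply' _ _ _ hi'] at hi
        exact (Option.some_ne_none _ hi.symm).elim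
  choose g hg using hexg
  set Av : W → Finset W := fun x => Y.filter fun y => τ y = (h (β x), K (β x)) ∧
    ∀ u ∈ blk H y, f₁ u ∈ targets G H P a y (some (β x, g x)) u with hAv
  have hAvcard : ∀ x ∈ X, c ^ (D + 1) / 4 *
      (Y.filter fun y => a y = h (β x) ∧ ty y = K (β x)).card ≤ (Av x).card := by
    intro x hx
    have h1 := hserv (h (β x), K (β x)) (some (β x, g x)) (by
      simp only [hO, Finset.mem_filter, Finset.mem_univ, true_and]
      rintro q hq
      cases hq
      refine ⟨rfl, ?_⟩
      rw [(hβ x hx).2]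
      refine (hfX x hx).trans (le_of_eq ?_)
      congr 2
      simp only [cand, Function.comp]
      apply Finset.filter_congr
      intro z _
      rw [hg]
      simp)
    simp only [hτ, Prod.mk.injEq] at h1
    have h2 := h1 (hlog (β x))
    simpa only [hAv, hτ, Prod.mk.injEq] using h2
  obtain ⟨y, hyinj, hy⟩ := exists_injOn_selection (fun x => (h (β x), K (β x))) τ Av X
    (fun x _ y hy => by
      simp only [hAv, Finset.mem_filter] at hy
      exact hy.2.1)
    (by
      intro x hx
      have h1 := hAvcard x hx
      have h2 := habs (β x)
      rw [← Nat.cast_le (α := ℝ)]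
      refine le_trans ?_ (h2.trans h1)
      set v := β x with hv
      have h3 : (X.filter fun x' => (h (β x'), K (β x')) = (h v, K v)) ⊆
          (X.filter fun x' => β x' ∉ P (h v) ∧ h (β x') = h v ∧ K (β x') = K v) ∪
          (if K v = κ (h v) then X.filter fun x' => a x' = h v else ∅) := by
        intro x' hx'
        rw [Finset.mem_filter, Prod.mk.injEq] at hx'
        by_cases hP : β x' ∈ P (h v)
        · rw [Finset.mem_union]
          right
          rw [if_pos, Finset.mem_filter]
          · exact ⟨hx'.1, by rw [← (hβ x' hx'.1).2, hx'.2.1]⟩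
          · rw [← hx'.2.2, hPK _ _ hP]
        · rw [Finset.mem_union]
          left
          rw [Finset.mem_filter]
          exact ⟨hx'.1, hP, hx'.2⟩
      have h4 : (X.filter fun x' => β x' ∉ P (h v) ∧ h (β x') = h v ∧ K (β x') = K v).card ≤
          (Finset.univ.filter fun v' => v' ∉ P (h v) ∧ h v' = h v ∧ K v' = K v).card := by
        apply Finset.card_le_card_of_injOn β
        · intro x' hx'
          simp only [Finset.coe_filter, Set.mem_ofPred_eq] at hx'
          simpa using hx'.2
        · exact hβinj.mono fun x hx => Finset.mem_coe.2 (Finset.mem_filter.1 hx).1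
      have h5 := (Finset.card_le_card h3).trans (Finset.card_union_le _ _)
      split_ifs at h5 ⊢ with hK
      · have h6 := (Nat.cast_le (α := ℝ)).2 (h5.trans (Nat.add_le_add_right h4 _))
        rw [Nat.cast_add] at h6
        refine le_trans (le_of_eq ?_) h6
        congr!
      · rw [Finset.card_empty, add_zero] at h5
        rw [add_zero]
        refine le_trans (le_of_eq ?_) ((Nat.cast_le (α := ℝ)).2 (h5.trans h4))
        congr!)
  have hyY : ∀ x ∈ X, y x ∈ Y := fun x hx => (Finset.mem_filter.1 (hy x hx)).1
  have hyt : ∀ x ∈ X, τ (y x) = (h (β x), K (β x)) := fun x hx =>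
    (Finset.mem_filter.1 (hy x hx)).2.1
  have hyT : ∀ x ∈ X, ∀ u ∈ blk H (y x), f u ∈ targets G H P a (y x) (some (β x, g x)) u := by
    intro x hx u hu
    rw [hfblk _ (hyY x hx) u hu]
    exact (Finset.mem_filter.1 (hy x hx)).2.2 u hu
  refine exists_embedding_of_swap X f (hfe.inj.mono (by simp)) (fun u v hu hv huv =>
    hfe.adj u (by simpa using hu) v (by simpa using hv) huv) hXind β hβinj ?_ y hyinj ?_ ?_ ?_ ?_ ?_
  · intro x hx u hu he
    have h1 := (hβ x hx).1
    rw [hL, Finset.mem_compl] at h1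
    exact h1 (Finset.mem_image.2 ⟨u, by simpa using hu, he⟩)
  · intro x hx hyx
    exact Finset.disjoint_left.1 hXZ hyx (hYZ (hyY x hx))
  · intro x hx x' hx' hadj
    exact Finset.disjoint_left.1 hXZ hx (hZt (y x') x (ht hadj).symm (hYZ (hyY x' hx')))
  · intro x hx x' hx' hadj
    by_cases he : y x = y x'
    · exact (he ▸ hadj).ne rfl
    · exact (hYd _ (hyY x hx) _ (hyY x' hx') he _ (self_mem_blk _) _ (self_mem_blk _)).2 hadj
  · intro x hx u hu
    have h1 := hyT x hx (y x) (self_mem_blk _)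
    simp only [targets, if_true, Finset.mem_filter] at h1
    exact (hg x _).1 h1.2 u hu
  · intro x hx u hu
    have h1 := hyT x hx u (Finset.mem_insert_of_mem (mem_nb.2 hu.symm))
    simp only [targets, if_neg hu.ne, if_pos hu.symm, Finset.mem_filter] at h1
    exact h1.2.symm
end Main

section WeightedGraph
variable {ι : Type} [Fintype ι]

/-- The total weight of the neighbours of `x` in the set `M`. -/
noncomputable def wdeg (R : SimpleGraph ι) (s : ι → ℝ) (M : Finset ι) (x : ι) : ℝ :=
  ∑ j ∈ M.filter fun j => R.Adj x j, s j

/-- The weighted version of the strong degree sequence condition. -/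
structure StrongW (R : SimpleGraph ι) (s : ι → ℝ) (n : ℝ) (m : ℕ) (χ κ : ℝ) : Prop where
  nonneg : ∀ j, 0 ≤ s j
  tot : ∑ j, s j ≤ n
  npos : 0 < n
  kpos : 0 < κ
  mpos : 1 ≤ m
  lt : (m : ℝ) < χ
  le : χ ≤ m + 1
  deg : ∀ S : Finset ι, S.Nonempty → ∃ x ∈ S,
    min (((m : ℝ) - 1) / χ * n + (χ - m) * ∑ j ∈ S, s j) ((1 - 1 / χ) * n) + κ * n ≤
      wdeg R s Finset.univ x

variable {R : SimpleGraph ι} {s : ι → ℝ} {n : ℝ} {m : ℕ} {χ κ : ℝ}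

namespace StrongW

theorem wdeg_ge (h : StrongW R s n m χ κ) (x : ι) :
    (((m : ℝ) - 1) / χ + κ) * n ≤ wdeg R s Finset.univ x := by
  obtain ⟨y, hy, h1⟩ := h.deg {x} (Finset.singleton_nonempty x)
  rw [Finset.mem_singleton] at hy
  subst hy
  have hm : (1 : ℝ) ≤ m := by exact_mod_cast h.mpos
  have hχ : 0 < χ := by linarith [h.lt]
  have h2 : ((m : ℝ) - 1) / χ * n ≤ (1 - 1 / χ) * n := by
    apply mul_le_mul_of_nonneg_right _ h.npos.le
    rw [div_le_iff₀ hχ, sub_mul, one_div, inv_mul_cancel₀ hχ.ne']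
    linarith [h.lt]
  have h3 : ((m : ℝ) - 1) / χ * n ≤ ((m : ℝ) - 1) / χ * n +
      (χ - m) * ∑ j ∈ ({y} : Finset ι), s j := by
    have := mul_nonneg (sub_nonneg.2 h.lt.le) (Finset.sum_nonneg fun j (_ : j ∈ ({y} : Finset ι)) =>
      h.nonneg j)
    linarith
  have h4 := le_min h3 h2
  linarith

/-- The vertices with large weighted degree. -/
noncomputable def big (R : SimpleGraph ι) (s : ι → ℝ) (n χ κ : ℝ) : Finset ι :=
  Finset.univ.filter fun x => (1 - 1 / χ + κ) * n ≤ wdeg R s Finset.univ x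

theorem sum_not_big_lt (h : StrongW R s n m χ κ) :
    ∑ j ∈ Finset.univ.filter (fun j => j ∉ big R s n χ κ), s j < n / χ := by
  have hm : (1 : ℝ) ≤ m := by exact_mod_cast h.mpos
  have hχ : 0 < χ := by linarith [h.lt]
  by_contra hcon
  push Not at hcon
  have hne : (Finset.univ.filter (fun j => j ∉ big R s n χ κ)).Nonempty := by
    by_contra hemp
    rw [Finset.not_nonempty_iff_eq_empty] at hemp
    rw [hemp, Finset.sum_empty] at hcon
    have := div_pos h.npos hχ
    linarith
  obtain ⟨x, hx, h1⟩ := h.deg _ hne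
  simp only [Finset.mem_filter, Finset.mem_univ, true_and, big] at hx
  apply hx
  have h2 : (1 - 1 / χ) * n ≤ ((m : ℝ) - 1) / χ * n + (χ - m) *
      ∑ j ∈ Finset.univ.filter (fun j => j ∉ big R s n χ κ), s j := by
    have h3 := mul_le_mul_of_nonneg_left hcon (sub_nonneg.2 h.lt.le)
    have h4 : (1 - 1 / χ) * n = ((m : ℝ) - 1) / χ * n + (χ - m) * (n / χ) := by
      field_simp
      ring
    linarith
  rw [min_eq_right h2] at h1
  linarith

theorem wdeg_inter_ge (h : StrongW R s n m χ κ) {b : ι} (hb : b ∈ big R s n χ κ) (M : Finset ι) :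
    ∑ j ∈ M, s j - n / χ + κ * n ≤ ∑ j ∈ M.filter (fun j => R.Adj b j), s j := by
  simp only [big, Finset.mem_filter, Finset.mem_univ, true_and] at hb
  have h1 := Finset.sum_filter_add_sum_filter_not M (fun j => R.Adj b j) s
  have h2 := Finset.sum_filter_add_sum_filter_not Finset.univ (fun j => R.Adj b j) s
  have h3 : ∑ j ∈ M.filter (fun j => ¬ R.Adj b j), s j ≤
      ∑ j ∈ Finset.univ.filter (fun j => ¬ R.Adj b j), s j :=
    Finset.sum_le_sum_of_subset_of_nonneg
      (Finset.filter_subset_filter _ (Finset.subset_univ _)) fun j _ _ => h.nonneg j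
  have h4 := h.tot
  rw [wdeg] at hb
  have h5 : (1 - 1 / χ + κ) * n = n - n / χ + κ * n := by ring
  linarith

theorem exists_mem_of_sum_lt {N0 Φ : Finset ι} (hs : ∀ j, 0 ≤ s j)
    (h : ∑ j ∈ Φ, s j < ∑ j ∈ N0, s j) : ∃ j ∈ N0, j ∉ Φ := by
  by_contra hcon
  push Not at hcon
  have := Finset.sum_le_sum_of_subset_of_nonneg (f := s) hcon fun j _ _ => hs j
  linarith

/-- Cliques avoiding a light set, inside a heavy set, with a common neighbour. -/
theorem exists_clique_aux (h : StrongW R s n m χ κ) {Φ : Finset ι}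
    (hΦ : ∑ j ∈ Φ, s j ≤ κ * n / 2) (l : ℕ) : ∀ N0 M0 : Finset ι,
    ((l : ℝ) / χ + κ) * n ≤ ∑ j ∈ N0, s j →
    (∀ x, ((l : ℝ) / χ + κ) * n ≤ wdeg R s M0 x) →
    ∃ e : Finset ι, ∃ z, e ⊆ N0 ∧ e.card = l + 1 ∧ R.IsClique (e : Set ι) ∧ Disjoint e Φ ∧
      z ∈ M0 ∧ z ∉ Φ ∧ ∀ x ∈ e, R.Adj x z := by
  have hm : (1 : ℝ) ≤ m := by exact_mod_cast h.mpos
  have hχ : 0 < χ := by linarith [h.lt]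
  have hκn := mul_pos h.kpos h.npos
  induction l with
  | zero =>
    intro N0 M0 hN hM
    have hΦ' : ∀ N : Finset ι, (((0 : ℕ) : ℝ) / χ + κ) * n ≤ ∑ j ∈ N, s j → ∃ j ∈ N, j ∉ Φ := by
      intro N hN
      apply exists_mem_of_sum_lt h.nonneg
      simp only [Nat.cast_zero, zero_div, zero_add] at hN
      linarith
    obtain ⟨x, hx, hxΦ⟩ := hΦ' N0 hN
    obtain ⟨z, hz, hzΦ⟩ := hΦ' _ (hM x)
    rw [Finset.mem_filter] at hz
    exact ⟨{x}, z, by simpa using hx, by simp, by simp, by simpa using hxΦ, hz.1, hzΦ,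
      by simpa using hz.2⟩
  | succ l ih =>
    intro N0 M0 hN hM
    have hsplit : (((l + 1 : ℕ) : ℝ) / χ + κ) * n = ((l : ℝ) / χ + κ) * n + n / χ := by
      push_cast
      ring
    rw [hsplit] at hN
    have hnn : 0 ≤ (l : ℝ) / χ * n := by have := h.npos; positivity
    obtain ⟨b, hb, hbΦ⟩ : ∃ b ∈ N0, b ∉ Φ ∪
        Finset.univ.filter (fun j => j ∉ big R s n χ κ) := by
      apply exists_mem_of_sum_lt h.nonneg
      have h1 : ∑ j ∈ Φ ∪ Finset.univ.filter (fun j => j ∉ big R s n χ κ), s j ≤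
          ∑ j ∈ Φ, s j + ∑ j ∈ Finset.univ.filter (fun j => j ∉ big R s n χ κ), s j := by
        rw [← Finset.sum_union_inter]
        have := Finset.sum_nonneg fun j
          (_ : j ∈ Φ ∩ Finset.univ.filter (fun j => j ∉ big R s n χ κ)) => h.nonneg j
        linarith
      have h2 := h.sum_not_big_lt
      nlinarith
    rw [Finset.mem_union, not_or, Finset.mem_filter] at hbΦ
    obtain ⟨hbΦ, hbig⟩ := hbΦ
    simp only [Finset.mem_univ, true_and, not_not] at hbig
    obtain ⟨e, z, he, hcard, hcl, hdis, hz, hzΦ, hez⟩ := ih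
      (N0.filter fun j => R.Adj b j) (M0.filter fun j => R.Adj b j)
      (by have := h.wdeg_inter_ge hbig N0; linarith)
      (by
        intro x
        have h1 := h.wdeg_inter_ge hbig (M0.filter fun j => R.Adj x j)
        have h2 := hM x
        rw [hsplit, wdeg] at h2
        rw [wdeg, Finset.filter_comm]
        linarith)
    rw [Finset.mem_filter] at hz
    have hbe : ∀ x ∈ e, R.Adj b x := fun x hx => (Finset.mem_filter.1 (he hx)).2
    have hbne : b ∉ e := fun hbe' => (hbe b hbe').ne rfl
    refine ⟨insert b e, z, ?_, ?_, ?_, ?_, hz.1, hzΦ, ?_⟩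
    · exact Finset.insert_subset hb (he.trans (Finset.filter_subset _ _))
    · rw [Finset.card_insert_of_notMem hbne, hcard]
    · rw [Finset.coe_insert, SimpleGraph.isClique_insert]
      exact ⟨hcl, fun x hx _ => hbe x hx⟩
    · rw [Finset.disjoint_insert_left]
      exact ⟨hbΦ, hdis⟩
    · intro x hx
      rcases Finset.mem_insert.1 hx with rfl | hx
      · exact hz.2
      · exact hez x hx

/-- A heavy set contains a clique of size `m` which extends to a clique of size `m + 1`, avoiding a
given light set. -/
theorem exists_clique_extension (h : StrongW R s n m χ κ) {Φ N0 : Finset ι}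
    (hΦ : ∑ j ∈ Φ, s j ≤ κ * n / 2) (hN : (((m : ℝ) - 1) / χ + κ) * n ≤ ∑ j ∈ N0, s j) :
    ∃ e : Finset ι, ∃ z, e ⊆ N0 ∧ e.card = m ∧ R.IsClique (e : Set ι) ∧ Disjoint e Φ ∧ z ∉ Φ ∧
      ∀ x ∈ e, R.Adj x z := by
  obtain ⟨l, rfl⟩ : ∃ l, m = l + 1 := ⟨m - 1, by have := h.mpos; omega⟩
  have hc : (((l + 1 : ℕ) : ℝ) - 1) = l := by push_cast; ring
  have hd := h.wdeg_ge
  rw [hc] at hN hd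
  obtain ⟨e, z, h1, h2, h3, h4, -, h5, h6⟩ := h.exists_clique_aux hΦ l N0 Finset.univ hN hd
  exact ⟨e, z, h1, h2, h3, h4, h5, h6⟩

/-- Every vertex lies in a clique of size `m + 1` whose other vertices avoid a light set. -/
theorem exists_clique_through (h : StrongW R s n m χ κ) {Φ : Finset ι}
    (hΦ : ∑ j ∈ Φ, s j ≤ κ * n / 2) (x : ι) :
    ∃ e : Finset ι, x ∉ e ∧ e.card = m ∧ R.IsClique (insert x e : Set ι) ∧ Disjoint e Φ := by
  obtain ⟨e, z, h1, h2, h3, h4, -⟩ := h.exists_clique_extension hΦ (h.wdeg_ge x)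
  have hx : ∀ y ∈ e, R.Adj x y := fun y hy => (Finset.mem_filter.1 (h1 hy)).2
  refine ⟨e, fun hxe => (hx x hxe).ne rfl, h2, ?_, h4⟩
  rw [SimpleGraph.isClique_insert]
  exact ⟨h3, fun y hy _ => hx y hy⟩

/-- Two vertices in a common clique of size `k`. -/
def CoClq (R : SimpleGraph ι) (k : ℕ) (x y : ι) : Prop :=
  ∃ e : Finset ι, e.card = k ∧ R.IsClique (e : Set ι) ∧ x ∈ e ∧ y ∈ e

theorem CoClq.symm {k : ℕ} {x y : ι} (h : CoClq R k x y) : CoClq R k y x := by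
  obtain ⟨e, h1, h2, h3, h4⟩ := h
  exact ⟨e, h1, h2, h4, h3⟩

theorem coClq_of_big (h : StrongW R s n m χ κ) (hm2 : 2 ≤ m) {b x : ι}
    (hb : b ∈ big R s n χ κ) (hbx : R.Adj b x) : CoClq R (m + 1) b x := by
  obtain ⟨l, rfl⟩ : ∃ l, m = l + 2 := ⟨m - 2, by omega⟩
  have h1 := h.wdeg_inter_ge hb (Finset.univ.filter fun j => R.Adj x j)
  have h2 := h.wdeg_ge x
  rw [wdeg] at h2
  have hκn := mul_pos h.kpos h.npos
  have hl : ((((l + 2 : ℕ) : ℝ) - 1) / χ + κ) * n = ((l : ℝ) / χ + κ) * n + n / χ := by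
    push_cast
    ring
  rw [hl] at h2
  have hl' : (l : ℝ) / χ ≤ (((l + 2 : ℕ) : ℝ) - 1) / χ := by
    have h3 := h.lt
    have : 0 < χ := lt_of_le_of_lt (Nat.cast_nonneg _) h3
    apply div_le_div_of_nonneg_right _ this.le
    push_cast
    linarith
  obtain ⟨e, z, he, hc, hcl, -⟩ := h.exists_clique_aux (Φ := ∅) (by simp; positivity) l
    ((Finset.univ.filter fun j => R.Adj x j).filter fun j => R.Adj b j) Finset.univ
    (by linarith) (fun y => le_trans (mul_le_mul_of_nonneg_right (by linarith) h.npos.le)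
      (h.wdeg_ge y))
  have hx : ∀ y ∈ e, R.Adj x y ∧ R.Adj b y := fun y hy => by
    have := he hy
    simp only [Finset.mem_filter, Finset.mem_univ, true_and] at this
    exact this
  have hxe : x ∉ e := fun hxe => (hx x hxe).1.ne rfl
  have hbe : b ∉ insert x e := by
    rw [Finset.mem_insert, not_or]
    exact ⟨hbx.ne, fun hbe => (hx b hbe).2.ne rfl⟩
  refine ⟨insert b (insert x e), ?_, ?_, by simp, by simp⟩
  · rw [Finset.card_insert_of_notMem hbe, Finset.card_insert_of_notMem hxe, hc]
  · rw [Finset.coe_insert, Finset.coe_insert, SimpleGraph.isClique_insert,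
      SimpleGraph.isClique_insert]
    refine ⟨⟨hcl, fun y hy _ => (hx y hy).1⟩, fun y hy _ => ?_⟩
    rcases hy with rfl | hy
    · exact hbx
    · exact (hx y hy).2

/-- For `m ≥ 2`, any two vertices are joined by a short walk through cliques of size `m + 1`. -/
theorem coClq_connected (h : StrongW R s n m χ κ) (hm2 : 2 ≤ m) (x y : ι) :
    ∃ b z b', CoClq R (m + 1) x b ∧ CoClq R (m + 1) b z ∧ CoClq R (m + 1) z b' ∧
      CoClq R (m + 1) b' y := by
  have hm : (2 : ℝ) ≤ m := by exact_mod_cast hm2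
  have hχ : 0 < χ := by linarith [h.lt]
  have hκn := mul_pos h.kpos h.npos
  have hbn : ∀ x, ∃ b ∈ big R s n χ κ, R.Adj b x := by
    intro x
    have h1 := h.wdeg_ge x
    have h2 := h.sum_not_big_lt
    have h3 : n / χ ≤ ((m : ℝ) - 1) / χ * n := by
      rw [div_mul_eq_mul_div]
      apply div_le_div_of_nonneg_right _ hχ.le
      nlinarith [h.npos]
    rw [wdeg] at h1
    obtain ⟨b, hb, hb'⟩ := exists_mem_of_sum_lt h.nonneg
      (show ∑ j ∈ Finset.univ.filter (fun j => j ∉ big R s n χ κ), s j <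
        ∑ j ∈ Finset.univ.filter (fun j => R.Adj x j), s j by linarith)
    simp only [Finset.mem_filter, Finset.mem_univ, true_and, not_not] at hb hb'
    exact ⟨b, hb', hb.symm⟩
  obtain ⟨b, hb, hbx⟩ := hbn x
  obtain ⟨b', hb', hby⟩ := hbn y
  have h1 := h.wdeg_inter_ge hb (Finset.univ.filter fun j => R.Adj b' j)
  have h2 := (Finset.mem_filter.1 hb').2
  rw [wdeg] at h2
  have h3 : 2 * (n / χ) ≤ n := by
    rw [← mul_div_assoc, div_le_iff₀ hχ]
    nlinarith [h.lt, h.npos]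
  have h4 : (1 - 1 / χ + κ) * n = n - n / χ + κ * n := by ring
  obtain ⟨z, hz, -⟩ := exists_mem_of_sum_lt (Φ := ∅) h.nonneg
      (show ∑ j ∈ (∅ : Finset ι), s j <
        ∑ j ∈ (Finset.univ.filter fun j => R.Adj b' j).filter (fun j => R.Adj b j), s j by
          rw [Finset.sum_empty]; linarith)
  simp only [Finset.mem_filter, Finset.mem_univ, true_and] at hz
  exact ⟨b, z, b', (h.coClq_of_big hm2 hb hbx).symm, h.coClq_of_big hm2 hb hz.2,
    (h.coClq_of_big hm2 hb' hz.1).symm, h.coClq_of_big hm2 hb' hby⟩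

/-- The weighted condition is robust. -/
theorem degCondW (h : StrongW R s n m χ κ) {T : ι → ℝ} {χ' η ρ : ℝ} (hχ' : χ ≤ χ')
    (hη : χ' ≤ χ + η) (hρ : 0 ≤ ρ)
    (hT : ∀ j, |T j - s j| ≤ ρ * s j) (hκ : η + 4 * ρ < κ) (hχm : χ' ≤ m + 1) :
    DegCondW R T m χ' := by
  have hm : (1 : ℝ) ≤ m := by exact_mod_cast h.mpos
  have hχ : 0 < χ := by linarith [h.lt]
  have hlt := h.lt
  have hn := h.npos
  have hTs : ∀ M : Finset ι, |∑ j ∈ M, T j - ∑ j ∈ M, s j| ≤ ρ * n := by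
    intro M
    rw [← Finset.sum_sub_distrib]
    refine (Finset.abs_sum_le_sum_abs _ _).trans ?_
    refine (Finset.sum_le_sum fun j _ => hT j).trans ?_
    rw [← Finset.mul_sum]
    apply mul_le_mul_of_nonneg_left _ hρ
    exact (Finset.sum_le_sum_of_subset_of_nonneg (Finset.subset_univ _) fun j _ _ =>
      h.nonneg j).trans h.tot
  intro S hS
  obtain ⟨x, hx, h1⟩ := h.deg S hS
  refine ⟨x, hx, ?_⟩
  rw [← Finset.sum_filter]
  have h2 := hTs (Finset.univ.filter fun j => R.Adj x j)
  have h3 := hTs Finset.univ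
  have h4 := hTs S
  rw [abs_le] at h2 h3 h4
  have h5 : ∑ j, T j ≤ (1 + ρ) * n := by linarith [h.tot]
  have h6 : ∑ j ∈ S, s j ≤ n := (Finset.sum_le_sum_of_subset_of_nonneg (Finset.subset_univ _)
    fun j _ _ => h.nonneg j).trans h.tot
  have h6' : 0 ≤ ∑ j ∈ S, s j := Finset.sum_nonneg fun j _ => h.nonneg j
  rw [wdeg] at h1
  have hχ'0 : 0 < χ' := by linarith
  have hinv : 1 / χ - 1 / χ' ≤ η := by
    have h7 : 1 / χ - 1 / χ' = (χ' - χ) / (χ * χ') := by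
      field_simp
    rw [h7, div_le_iff₀ (by positivity)]
    have h8 : 1 ≤ χ * χ' := by nlinarith
    nlinarith
  have hρn : 0 ≤ ρ * n := by positivity
  have hA : ((m : ℝ) - 1) / χ' * ∑ j, T j + (χ' - m) * ∑ j ∈ S, T j ≤
      ((m : ℝ) - 1) / χ * n + (χ - m) * ∑ j ∈ S, s j + (η + 2 * ρ) * n := by
    have h7 : ((m : ℝ) - 1) / χ' * ∑ j, T j ≤ ((m : ℝ) - 1) / χ * n + ρ * n := by
      have h8 : ((m : ℝ) - 1) / χ' ≤ ((m : ℝ) - 1) / χ :=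
        div_le_div_of_nonneg_left (by linarith) hχ hχ'
      have h9 : 0 ≤ ((m : ℝ) - 1) / χ' := div_nonneg (by linarith) (by linarith)
      have h10 : ((m : ℝ) - 1) / χ ≤ 1 := by rw [div_le_one hχ]; linarith
      calc ((m : ℝ) - 1) / χ' * ∑ j, T j ≤ ((m : ℝ) - 1) / χ' * ((1 + ρ) * n) :=
            mul_le_mul_of_nonneg_left h5 h9
        _ ≤ ((m : ℝ) - 1) / χ * ((1 + ρ) * n) :=
            mul_le_mul_of_nonneg_right h8 (by positivity)
        _ ≤ _ := by nlinarith
    have h8 : (χ' - m) * ∑ j ∈ S, T j ≤ (χ - m) * ∑ j ∈ S, s j + η * n + ρ * n := by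
      have h9 : (χ' - m) * ∑ j ∈ S, T j ≤ (χ' - m) * (∑ j ∈ S, s j + ρ * n) :=
        mul_le_mul_of_nonneg_left (by linarith) (by linarith)
      have h10 : (χ' - m) * (∑ j ∈ S, s j) ≤ (χ - m) * ∑ j ∈ S, s j + η * n := by
        have h11 : (χ' - χ) * ∑ j ∈ S, s j ≤ η * n :=
          mul_le_mul (by linarith) h6 h6' (by linarith)
        linarith
      have h11 : (χ' - m) * (ρ * n) ≤ ρ * n := by nlinarith
      linarith
    linarith
  have hB : (1 - 1 / χ') * ∑ j, T j ≤ (1 - 1 / χ) * n + (η + 2 * ρ) * n := by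
    have h7 : 0 ≤ 1 - 1 / χ' := by
      rw [sub_nonneg, div_le_one (by linarith)]
      linarith
    have h8 : 1 - 1 / χ' ≤ 1 := by
      have : 0 < 1 / χ' := by positivity
      linarith
    calc (1 - 1 / χ') * ∑ j, T j ≤ (1 - 1 / χ') * ((1 + ρ) * n) :=
          mul_le_mul_of_nonneg_left h5 h7
      _ = (1 - 1 / χ') * n + (1 - 1 / χ') * (ρ * n) := by ring
      _ ≤ (1 - 1 / χ + η) * n + 1 * (ρ * n) :=
          add_le_add (mul_le_mul_of_nonneg_right (by linarith) hn.le)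
            (mul_le_mul_of_nonneg_right h8 hρn)
      _ ≤ _ := by linarith
  have hC : min (((m : ℝ) - 1) / χ' * ∑ j, T j + (χ' - m) * ∑ j ∈ S, T j)
      ((1 - 1 / χ') * ∑ j, T j) ≤ min (((m : ℝ) - 1) / χ * n + (χ - m) * ∑ j ∈ S, s j)
      ((1 - 1 / χ) * n) + (η + 2 * ρ) * n := by
    rw [← min_add_add_right]
    exact min_le_min hA hB
  nlinarith
end StrongW
end WeightedGraph

section Greedy
variable {ι α : Type} [Fintype ι]

/-- Greedy selection of sets with bounded loads. -/
theorem exists_selection_bounded_load (A : Finset α) (Q : α → Finset ι → Prop) (k : ℕ)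
    (cap : ι → ℕ)
    (hQ : ∀ x ∈ A, ∀ Φ : Finset ι, ∑ j ∈ Φ, cap j ≤ k * A.card →
      ∃ e, Q x e ∧ e.card ≤ k ∧ Disjoint e Φ) :
    ∃ E : α → Finset ι, (∀ x ∈ A, Q x (E x)) ∧ ∀ j, (A.filter fun x => j ∈ E x).card ≤ cap j := by
  suffices h : ∀ B ⊆ A, ∃ E : α → Finset ι, (∀ x ∈ B, Q x (E x) ∧ (E x).card ≤ k) ∧
      ∀ j, (B.filter fun x => j ∈ E x).card ≤ cap j by
    obtain ⟨E, h1, h2⟩ := h A subset_rfl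
    exact ⟨E, fun x hx => (h1 x hx).1, h2⟩
  intro B
  induction B using Finset.induction_on with
  | empty => exact fun _ => ⟨fun _ => ∅, by simp, by simp⟩
  | insert x B hx ih =>
    intro hB
    have hBA : B ⊆ A := (Finset.subset_insert x B).trans hB
    obtain ⟨E, h1, h2⟩ := ih hBA
    set Φ : Finset ι := Finset.univ.filter fun j => (B.filter fun x => j ∈ E x).card = cap j
    have hΦ : ∑ j ∈ Φ, cap j ≤ k * A.card := by
      calc ∑ j ∈ Φ, cap j = ∑ j ∈ Φ, (B.filter fun x => j ∈ E x).card :=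
            Finset.sum_congr rfl fun j hj => (Finset.mem_filter.1 hj).2.symm
        _ ≤ ∑ j, (B.filter fun x => j ∈ E x).card :=
            Finset.sum_le_sum_of_subset (Finset.subset_univ _)
        _ = ∑ x ∈ B, (E x).card := by
            simp only [Finset.card_filter]
            rw [Finset.sum_comm]
            refine Finset.sum_congr rfl fun y _ => ?_
            simp
        _ ≤ ∑ x ∈ B, k := Finset.sum_le_sum fun y hy => (h1 y hy).2
        _ ≤ k * A.card := by
            rw [Finset.sum_const, smul_eq_mul, mul_comm]
            exact Nat.mul_le_mul_left _ (Finset.card_le_card hBA)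
    obtain ⟨e, he, hek, hed⟩ := hQ x (hB (Finset.mem_insert_self _ _)) Φ hΦ
    have hne : ∀ y ∈ B, y ≠ x := fun y hy hyx => hx (hyx ▸ hy)
    refine ⟨Function.update E x e, ?_, ?_⟩
    · intro y hy
      rcases Finset.mem_insert.1 hy with rfl | hy
      · rw [Function.update_self]
        exact ⟨he, hek⟩
      · rw [Function.update_of_ne (hne y hy)]
        exact h1 y hy
    · intro j
      have h3 : (B.filter fun y => j ∈ Function.update E x e y) = B.filter fun y => j ∈ E y := by
        refine Finset.filter_congr fun y hy => ?_
        rw [Function.update_of_ne (hne y hy)]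
      rw [Finset.filter_insert, Function.update_self]
      split_ifs with hje
      · refine (Finset.card_insert_le _ _).trans ?_
        rw [h3]
        have h4 : j ∉ Φ := fun hj => Finset.disjoint_left.1 hed hje hj
        have h5 : (B.filter fun y => j ∈ E y).card ≠ cap j := fun h =>
          h4 (Finset.mem_filter.2 ⟨Finset.mem_univ _, h⟩)
        have := h2 j
        omega
      · rw [h3]
        exact h2 j
end Greedy

section DegreeSequence
variable {V : Type} [Fintype V]

theorem ndeg_eq_card (G : SimpleGraph V) (v : V) :
    ndeg G v = (Finset.univ.filter fun u => G.Adj v u).card := by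
  rw [ndeg, ← Set.ncard_coe_finset]
  congr 1
  ext u
  simp

/-- In a graph with strong degree sequence every nonempty set contains a vertex of large degree. -/
theorem DegSeqStrong.exists_degree {G : SimpleGraph V} {χ μ : ℝ} (h : DegSeqStrong G χ μ)
    (hχ : 1 < χ) (hμ : 0 < μ) (hn : 2 / μ ≤ Fintype.card V) (hnχ : χ ≤ Fintype.card V)
    {S : Finset V} (hS : S.Nonempty) :
    ∃ v ∈ S, min (((⌈χ⌉₊ : ℝ) - 2) / χ * Fintype.card V + (χ - (⌈χ⌉₊ - 1)) * S.card)
      ((1 - 1 / χ) * Fintype.card V) + μ / 2 * Fintype.card V ≤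
        (Finset.univ.filter fun u => G.Adj v u).card := by
  obtain ⟨e, hmono, hdeg⟩ := h
  set n : ℝ := (Fintype.card V : ℝ) with hn_def
  set k : ℝ := (⌈χ⌉₊ : ℝ)
  have hχ0 : 0 < χ := by linarith
  have hk1 : k - 1 < χ := by
    have := Nat.ceil_lt_add_one hχ0.le
    linarith
  have hk2 : χ ≤ k := Nat.le_ceil χ
  have hα : 1 - 1 / χ - alphaOf χ = (k - 2) / χ := by
    simp only [alphaOf]
    field_simp
    ring
  have hα' : χ * alphaOf χ = χ - (k - 1) := by
    simp only [alphaOf]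
    field_simp
    rfl
  rw [hα, hα'] at hdeg
  have hnpos : 0 < n := by linarith
  have hμn : 1 ≤ μ / 2 * n := by
    rw [div_le_iff₀ hμ] at hn
    linarith
  obtain ⟨i, hi, himax⟩ : ∃ i ∈ S.image e.symm, ∀ j ∈ S.image e.symm, j ≤ i :=
    Finset.exists_max_image _ id (hS.image _)
  obtain ⟨v, hv, rfl⟩ := Finset.mem_image.1 hi
  refine ⟨v, hv, ?_⟩
  rw [← ndeg_eq_card]
  have hcard : S.card ≤ (e.symm v : ℕ) + 1 := by
    rw [← Finset.card_image_of_injective S e.symm.injective]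
    calc _ ≤ (Finset.Iic (e.symm v)).card := Finset.card_le_card fun j hj =>
          Finset.mem_Iic.2 (himax j hj)
      _ = _ := by rw [Fin.card_Iic]
  have hcard' : (S.card : ℝ) ≤ (e.symm v : ℕ) + 1 := by exact_mod_cast hcard
  by_cases hlt : ((e.symm v : ℕ) + 1 : ℝ) ≤ n / χ
  · have h1 := hdeg _ hlt
    rw [Equiv.apply_symm_apply] at h1
    have h2 : (χ - (k - 1)) * S.card ≤ (χ - (k - 1)) * ((e.symm v : ℕ) + 1) :=
      mul_le_mul_of_nonneg_left hcard' (by linarith)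
    have h3 := min_le_left ((k - 2) / χ * n + (χ - (k - 1)) * S.card) ((1 - 1 / χ) * n)
    have h4 : 0 < μ * n := by positivity
    linarith
  · push Not at hlt
    have hfl : 1 ≤ ⌊n / χ⌋₊ := by
      rw [Nat.le_floor_iff (by positivity), le_div_iff₀ hχ0]
      simpa using hnχ
    have hfl2 : ((⌊n / χ⌋₊ : ℕ) : ℝ) ≤ n / χ := Nat.floor_le (by positivity)
    have hfl3 := Nat.lt_floor_add_one (n / χ)
    have hfl4 : ⌊n / χ⌋₊ - 1 < Fintype.card V := by
      have h1 : n / χ ≤ n := div_le_self hnpos.le hχ.le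
      have h2 : ⌊n / χ⌋₊ ≤ Fintype.card V := Nat.floor_le_of_le h1
      omega
    have hcast : (((⟨⌊n / χ⌋₊ - 1, hfl4⟩ : Fin (Fintype.card V)) : ℕ) : ℝ) + 1 = ⌊n / χ⌋₊ := by
      exact_mod_cast Nat.sub_add_cancel hfl
    have h1 := hdeg ⟨⌊n / χ⌋₊ - 1, hfl4⟩ (by rw [hcast]; exact hfl2)
    rw [hcast] at h1
    have hle : (⟨⌊n / χ⌋₊ - 1, hfl4⟩ : Fin (Fintype.card V)) ≤ e.symm v := by
      rw [Fin.le_def]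
      have : (⌊n / χ⌋₊ : ℝ) < (e.symm v : ℕ) + 1 := lt_of_le_of_lt hfl2 hlt
      have h2 : ⌊n / χ⌋₊ < (e.symm v : ℕ) + 1 := by exact_mod_cast this
      change ⌊n / χ⌋₊ - 1 ≤ (e.symm v : ℕ)
      omega
    have h2 := hmono _ _ hle
    rw [Equiv.apply_symm_apply] at h2
    have h2' : (ndeg G (e ⟨⌊n / χ⌋₊ - 1, hfl4⟩) : ℝ) ≤ ndeg G v := by exact_mod_cast h2
    have h3 := min_le_right ((k - 2) / χ * n + (χ - (k - 1)) * S.card) ((1 - 1 / χ) * n)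
    have h5 : (χ - (k - 1)) * (n / χ - 1) ≤ (χ - (k - 1)) * ⌊n / χ⌋₊ :=
      mul_le_mul_of_nonneg_left (by linarith) (by linarith)
    have h6 : (k - 2) / χ * n + (χ - (k - 1)) * (n / χ) = (1 - 1 / χ) * n := by
      field_simp
      ring
    linarith
end DegreeSequence

/-- A version of the regularity lemma in which every cluster is regular with most others. -/
theorem exists_clusters (β : ℝ) (hβ : 0 < β) (l : ℕ) (hl : 1 ≤ l) :
    ∃ r₀ : ℕ, ∀ (V : Type) [Fintype V] (G : SimpleGraph V), 2 * r₀ ≤ Fintype.card V →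
    ∃ (ι : Type) (_ : Fintype ι) (C : ι → Finset V) (r : ℕ), l ≤ r ∧ r ≤ r₀ ∧
      Fintype.card ι ≤ r ∧ (∀ i j, i ≠ j → Disjoint (C i) (C j)) ∧
      (∀ i, (Fintype.card V : ℝ) / r / 2 ≤ (C i).card) ∧
      (∀ i, ((C i).card : ℝ) ≤ 2 * (Fintype.card V / r)) ∧
      ((Finset.univ.filter fun v => ∀ i, v ∉ C i).card : ℝ) ≤ 2 * β * Fintype.card V ∧
      ∀ i, ∑ j ∈ Finset.univ.filter (fun j => j ≠ i ∧ ¬ G.IsUniform (β ^ 2) (C i) (C j)),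
        ((C j).card : ℝ) ≤ 2 * β * Fintype.card V := by
  refine ⟨SzemerediRegularity.bound (β ^ 2) l, fun V _ G hn => ?_⟩
  set n := Fintype.card V with hn_def
  have hlb : l ≤ SzemerediRegularity.bound (β ^ 2) l := SzemerediRegularity.le_bound _ _
  obtain ⟨P, hP, hlP, hPb, hPu⟩ := szemeredi_regularity G (pow_pos hβ 2)
    (show l ≤ Fintype.card V by omega)
  set r := P.parts.card with hr_def
  have hr1 : 1 ≤ r := hl.trans hlP
  have hr0 : (0 : ℝ) < r := by exact_mod_cast hr1
  have h2r : (2 : ℝ) * r ≤ n := by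
    have : 2 * r ≤ n := by omega
    exact_mod_cast this
  have hq2 : 2 ≤ (n : ℝ) / r := by rw [le_div_iff₀ hr0]; exact h2r
  have hup : ∀ A ∈ P.parts, (A.card : ℝ) ≤ 2 * (n / r) := by
    intro A hA
    have h1 := hP.card_part_le_average_add_one hA
    rw [Finset.card_univ] at h1
    have h2 : (A.card : ℝ) ≤ ((n / r : ℕ) : ℝ) + 1 := by exact_mod_cast h1
    have h3 : ((n / r : ℕ) : ℝ) ≤ (n : ℝ) / r := Nat.cast_div_le
    linarith
  have hlow : ∀ A ∈ P.parts, (n : ℝ) / r / 2 ≤ A.card := by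
    intro A hA
    have h1 := hP.average_le_card_part hA
    rw [Finset.card_univ] at h1
    have h2 : ((n / r : ℕ) : ℝ) ≤ A.card := by exact_mod_cast h1
    have h3 : (n : ℝ) / r < ((n / r : ℕ) : ℝ) + 1 := by
      rw [div_lt_iff₀ hr0]
      have := Nat.lt_div_mul_add (a := n) hr1
      have h4 : n < (n / r + 1) * r := by rw [add_mul, one_mul]; exact this
      exact_mod_cast h4
    linarith
  set irr : Finset V → Finset (Finset V) := fun A =>
    P.parts.filter fun B => B ≠ A ∧ ¬ G.IsUniform (β ^ 2) A B with hirr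
  set bad : Finset (Finset V) := P.parts.filter fun A => β * r < (irr A).card with hbad
  have hbadcard : (bad.card : ℝ) ≤ β * r := by
    have h1 : ∑ A ∈ bad, (irr A).card ≤ (P.nonUniforms G (β ^ 2)).card := by
      rw [← Finset.card_sigma]
      refine Finset.card_le_card_of_injOn (fun x => (x.1, x.2)) ?_ ?_
      · rintro ⟨A, B⟩ hx
        simp only [Finset.coe_sigma, Set.mem_sigma_iff, Finset.mem_coe, hbad, hirr,
          Finset.mem_filter] at hx
        rw [Finset.mem_coe, Finpartition.mk_mem_nonUniforms]
        exact ⟨hx.1.1, hx.2.1, fun h => hx.2.2.1 h.symm, hx.2.2.2⟩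
      · rintro ⟨A, B⟩ _ ⟨A', B'⟩ _ h
        simp only [Prod.mk.injEq] at h
        obtain ⟨rfl, rfl⟩ := h
        rfl
    have h2 : (bad.card : ℝ) * (β * r) ≤ ∑ A ∈ bad, ((irr A).card : ℝ) := by
      rw [← nsmul_eq_mul, ← Finset.sum_const]
      exact Finset.sum_le_sum fun A hA => (Finset.mem_filter.1 hA).2.le
    have h3 : ((P.nonUniforms G (β ^ 2)).card : ℝ) ≤ (r * (r - 1) : ℕ) * β ^ 2 := hPu
    have h4 : ((r * (r - 1) : ℕ) : ℝ) ≤ r * r := by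
      have : r * (r - 1) ≤ r * r := Nat.mul_le_mul_left _ (Nat.sub_le _ _)
      exact_mod_cast this
    have h5 : (∑ A ∈ bad, ((irr A).card : ℝ)) ≤ (P.nonUniforms G (β ^ 2)).card := by
      exact_mod_cast h1
    have h6 : (bad.card : ℝ) * (β * r) ≤ (β * r) * (β * r) := by
      have : ((r * (r - 1) : ℕ) : ℝ) * β ^ 2 ≤ r * r * β ^ 2 := by gcongr
      nlinarith
    exact le_of_mul_le_mul_right h6 (by positivity)
  have hgood : ∀ A ∈ P.parts, A ∉ bad → ((irr A).card : ℝ) ≤ β * r := fun A hA hA' => by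
    by_contra hcon
    exact hA' (Finset.mem_filter.2 ⟨hA, not_le.1 hcon⟩)
  have hsumle : ∀ F : Finset (Finset V), F ⊆ P.parts → (F.card : ℝ) ≤ β * r →
      ∑ B ∈ F, (B.card : ℝ) ≤ 2 * β * n := by
    intro F hF hFc
    calc ∑ B ∈ F, (B.card : ℝ) ≤ ∑ B ∈ F, 2 * ((n : ℝ) / r) :=
          Finset.sum_le_sum fun B hB => hup B (hF hB)
      _ = F.card * (2 * ((n : ℝ) / r)) := by rw [Finset.sum_const, nsmul_eq_mul]
      _ ≤ (β * r) * (2 * ((n : ℝ) / r)) := by gcongr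
      _ = 2 * β * n := by field_simp
  refine ⟨{A // A ∈ P.parts \ bad}, inferInstance, fun A => A.1, r, hlP, hPb, ?_, ?_, ?_, ?_, ?_,
    ?_⟩
  · rw [Fintype.card_coe]
    exact Finset.card_le_card Finset.sdiff_subset
  · rintro ⟨A, hA⟩ ⟨B, hB⟩ hAB
    exact P.disjoint (Finset.mem_sdiff.1 hA).1 (Finset.mem_sdiff.1 hB).1
      fun h => hAB (Subtype.ext h)
  · exact fun A => hlow _ (Finset.mem_sdiff.1 A.2).1
  · exact fun A => hup _ (Finset.mem_sdiff.1 A.2).1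
  · refine le_trans ?_ (hsumle bad (Finset.filter_subset _ _) hbadcard)
    have h1 : (Finset.univ.filter fun v => ∀ i : {A // A ∈ P.parts \ bad}, v ∉ i.1) ⊆
        bad.biUnion id := by
      intro v hv
      have hv' := (Finset.mem_filter.1 hv).2
      obtain ⟨A, hA, hvA⟩ := P.exists_mem (Finset.mem_univ v)
      refine Finset.mem_biUnion.2 ⟨A, ?_, hvA⟩
      by_contra hAb
      exact hv' ⟨A, Finset.mem_sdiff.2 ⟨hA, hAb⟩⟩ hvA
    exact_mod_cast (Finset.card_le_card h1).trans Finset.card_biUnion_le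
  · rintro ⟨A, hA⟩
    rw [Finset.mem_sdiff] at hA
    refine le_trans ?_ (hsumle (irr A) (Finset.filter_subset _ _) (hgood A hA.1 hA.2))
    refine le_trans (le_of_eq (Finset.sum_map _ (Function.Embedding.subtype _)
      (fun B : Finset V => (B.card : ℝ))).symm) ?_
    refine Finset.sum_le_sum_of_subset_of_nonneg ?_ fun _ _ _ => Nat.cast_nonneg _
    intro B hB
    obtain ⟨⟨B', hB'⟩, h1, rfl⟩ := Finset.mem_map.1 hB
    simp only [Finset.mem_filter] at h1
    exact Finset.mem_filter.2 ⟨(Finset.mem_sdiff.1 hB').1, fun h => h1.2.1 (Subtype.ext h), h1.2.2⟩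

section Uniform
variable {V : Type} {G : SimpleGraph V} {e D : ℝ} {A B : Finset V}

theorem sum_card_adj (G : SimpleGraph V) (A B : Finset V) :
    ((∑ v ∈ A, (B.filter fun u => G.Adj v u).card : ℕ) : ℝ) =
      G.edgeDensity A B * (A.card * B.card) := by
  have h1 : ∑ v ∈ A, (B.filter fun u => G.Adj v u).card = (G.interedges A B).card := by
    rw [SimpleGraph.interedges_def, Finset.card_filter, Finset.sum_product]
    simp only [Finset.card_filter]
  rw [h1, SimpleGraph.edgeDensity_def]
  push_cast
  rcases A.eq_empty_or_nonempty with rfl | hA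
  · simp
  rcases B.eq_empty_or_nonempty with rfl | hB
  · simp [SimpleGraph.interedges_def]
  have : (A.card : ℝ) ≠ 0 := by exact_mod_cast hA.card_pos.ne'
  have : (B.card : ℝ) ≠ 0 := by exact_mod_cast hB.card_pos.ne'
  field_simp

/-- Few vertices of a uniform dense pair have small degree into a large set. -/
theorem card_low_degree_le (h : G.IsUniform e A B) (he : 0 < e)
    (hD : D + e ≤ G.edgeDensity A B) {B' : Finset V} (hB' : B' ⊆ B)
    (hcard : e * B.card ≤ B'.card) :
    ((A.filter fun v => ((B'.filter fun u => G.Adj v u).card : ℝ) < D * B'.card).card : ℝ) ≤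
      e * A.card := by
  by_contra hcon
  push Not at hcon
  set A' := A.filter fun v => ((B'.filter fun u => G.Adj v u).card : ℝ) < D * B'.card with hA'
  have h1 := h (Finset.filter_subset _ _ : A' ⊆ A) hB' (by linarith) (by linarith)
  have hA'pos : (0 : ℝ) < A'.card := lt_of_le_of_lt (by positivity) hcon
  have hne : A'.Nonempty := by
    rw [← Finset.card_pos]
    exact_mod_cast hA'pos
  have h2 := sum_card_adj G A' B'
  have h3 : ((∑ v ∈ A', (B'.filter fun u => G.Adj v u).card : ℕ) : ℝ) <
      ∑ v ∈ A', D * B'.card := by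
    push_cast
    exact Finset.sum_lt_sum_of_nonempty hne fun v hv => (Finset.mem_filter.1 hv).2
  rw [h2, Finset.sum_const, nsmul_eq_mul] at h3
  rw [abs_lt] at h1
  have h4 : D * (A'.card * B'.card) ≤ G.edgeDensity A' B' * (A'.card * B'.card) :=
    mul_le_mul_of_nonneg_right (by linarith) (by positivity)
  linarith

/-- A large subset of a sparse uniform pair has few edges. -/
theorem sum_card_adj_le (h : G.IsUniform e A B) (he1 : e ≤ 1)
    (hD : (G.edgeDensity A B : ℝ) ≤ D) {A' : Finset V} (hA' : A' ⊆ A)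
    (hcard : e * A.card ≤ A'.card) :
    ((∑ v ∈ A', (B.filter fun u => G.Adj v u).card : ℕ) : ℝ) ≤
      (D + e) * (A'.card * B.card) := by
  have h1 := h hA' subset_rfl (by linarith) (by
    nlinarith [(Nat.cast_nonneg B.card : (0:ℝ) ≤ B.card)])
  rw [sum_card_adj]
  rw [abs_lt] at h1
  exact mul_le_mul_of_nonneg_right (by linarith) (by positivity)

end Uniform

section Clusters
variable {V ι : Type} [Fintype V] [Fintype ι]

/-- A family of clusters of comparable size, most pairs of which are uniform. -/
structure Clusters (G : SimpleGraph V) (C : ι → Finset V) (β r : ℝ) : Prop where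
  disj : ∀ i j, i ≠ j → Disjoint (C i) (C j)
  low : ∀ i, (Fintype.card V : ℝ) / r / 2 ≤ (C i).card
  up : ∀ i, ((C i).card : ℝ) ≤ 2 * (Fintype.card V / r)
  miss : ((Finset.univ.filter fun v => ∀ i, v ∉ C i).card : ℝ) ≤ 2 * β * Fintype.card V
  irr : ∀ i, ∑ j ∈ Finset.univ.filter (fun j => j ≠ i ∧ ¬ G.IsUniform (β ^ 2) (C i) (C j)),
    ((C j).card : ℝ) ≤ 2 * β * Fintype.card V

/-- The reduced graph of a family of clusters. -/
def reducedGraph (G : SimpleGraph V) (C : ι → Finset V) (e D : ℝ) : SimpleGraph ι where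
  Adj i j := i ≠ j ∧ G.IsUniform e (C i) (C j) ∧ D ≤ G.edgeDensity (C i) (C j)
  symm := ⟨fun i j h => ⟨h.1.symm, h.2.1.symm, by rw [SimpleGraph.edgeDensity_comm]; exact h.2.2⟩⟩
  loopless := ⟨fun _ h => h.1 rfl⟩

variable {G : SimpleGraph V} {C : ι → Finset V} {β r D : ℝ}

namespace Clusters

theorem sum_card_le (h : Clusters G C β r) : ∑ i, ((C i).card : ℝ) ≤ Fintype.card V := by
  have h1 : (Finset.univ.biUnion C).card = ∑ i, (C i).card :=
    Finset.card_biUnion fun i _ j _ hij => h.disj i j hij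
  exact_mod_cast h1 ▸ Finset.card_le_univ _

theorem degree_le (h : Clusters G C β r) (v : V) :
    ((Finset.univ.filter fun u => G.Adj v u).card : ℝ) ≤
      ∑ i, (((C i).filter fun u => G.Adj v u).card : ℝ) + 2 * β * Fintype.card V := by
  have h1 : (Finset.univ.filter fun u => G.Adj v u) ⊆
      (Finset.univ.biUnion fun i => (C i).filter fun u => G.Adj v u) ∪
        Finset.univ.filter fun v => ∀ i, v ∉ C i := by
    intro u hu
    by_cases hu' : ∀ i, u ∉ C i
    · exact Finset.mem_union_right _ (Finset.mem_filter.2 ⟨Finset.mem_univ _, hu'⟩)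
    · push Not at hu'
      obtain ⟨i, hi⟩ := hu'
      exact Finset.mem_union_left _ (Finset.mem_biUnion.2 ⟨i, Finset.mem_univ _,
        Finset.mem_filter.2 ⟨hi, (Finset.mem_filter.1 hu).2⟩⟩)
  have h2 := (Finset.card_le_card h1).trans ((Finset.card_union_le _ _).trans
    (Nat.add_le_add_right Finset.card_biUnion_le _))
  have h3 : ((Finset.univ.filter fun u => G.Adj v u).card : ℝ) ≤
      ∑ i, (((C i).filter fun u => G.Adj v u).card : ℝ) +
        (Finset.univ.filter fun v => ∀ i, v ∉ C i).card := by exact_mod_cast h2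
  linarith [h.miss]

/-- Most vertices of a cluster have degree bounded by the weighted degree of the cluster. -/
theorem card_large_degree_le (h : Clusters G C β r) (hβ : 0 < β) (hβ1 : β ≤ 1) (hD : 0 ≤ D)
    (i : ι) :
    (((C i).filter fun v => wdeg (reducedGraph G C (β ^ 2) D) (fun j => ((C j).card : ℝ))
      Finset.univ i + (D + β ^ 2 + 4 * β + 2 / r) * Fintype.card V <
        (Finset.univ.filter fun u => G.Adj v u).card).card : ℝ) ≤ β ^ 2 * (C i).card := by
  set n : ℝ := (Fintype.card V : ℝ) with hn
  set R := reducedGraph G C (β ^ 2) D with hR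
  set s : ι → ℝ := fun j => ((C j).card : ℝ) with hs
  set A' := (C i).filter fun v => wdeg R s Finset.univ i + (D + β ^ 2 + 4 * β + 2 / r) * n <
    (Finset.univ.filter fun u => G.Adj v u).card with hA'
  by_contra hcon
  push Not at hcon
  have hA'pos : (0 : ℝ) < A'.card := lt_of_le_of_lt (by positivity) hcon
  have hne : A'.Nonempty := by
    rw [← Finset.card_pos]
    exact_mod_cast hA'pos
  have hs0 : ∀ j, 0 ≤ s j := fun j => Nat.cast_nonneg _
  have hj : ∀ j, ∑ v ∈ A', (((C j).filter fun u => G.Adj v u).card : ℝ) ≤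
      A'.card * ((if R.Adj i j then s j else 0) + (if j = i then s j else 0) +
        (if j ≠ i ∧ ¬ G.IsUniform (β ^ 2) (C i) (C j) then s j else 0) + (D + β ^ 2) * s j) := by
    intro j
    have htriv : ∑ v ∈ A', (((C j).filter fun u => G.Adj v u).card : ℝ) ≤ A'.card * s j := by
      rw [← nsmul_eq_mul, ← Finset.sum_const]
      exact Finset.sum_le_sum fun v _ => by
        have := Finset.card_filter_le (C j) fun u => G.Adj v u
        exact Nat.cast_le.2 this
    have hp1 : 0 ≤ (D + β ^ 2) * s j := mul_nonneg (by positivity) (hs0 j)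
    have hp2 : 0 ≤ if R.Adj i j then s j else 0 := by split_ifs <;> simp [hs0 j]
    have hp3 : 0 ≤ if j = i then s j else 0 := by split_ifs <;> simp [hs0 j]
    have hp4 : 0 ≤ if j ≠ i ∧ ¬ G.IsUniform (β ^ 2) (C i) (C j) then s j else 0 := by
      split_ifs <;> simp [hs0 j]
    by_cases h1 : R.Adj i j
    · refine htriv.trans (mul_le_mul_of_nonneg_left ?_ hA'pos.le)
      rw [if_pos h1]
      linarith
    by_cases h2 : j = i
    · refine htriv.trans (mul_le_mul_of_nonneg_left ?_ hA'pos.le)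
      rw [if_pos h2]
      linarith
    by_cases h3 : G.IsUniform (β ^ 2) (C i) (C j)
    · have h4 : (G.edgeDensity (C i) (C j) : ℝ) ≤ D := by
        by_contra h5
        exact h1 ⟨fun h => h2 h.symm, h3, (not_le.1 h5).le⟩
      have h5 := sum_card_adj_le h3 (by nlinarith) h4 (Finset.filter_subset _ _ : A' ⊆ C i) hcon.le
      push_cast at h5
      refine h5.trans ?_
      calc (D + β ^ 2) * ((A'.card : ℝ) * (C j).card) = A'.card * ((D + β ^ 2) * s j) := by
            rw [hs]; ring
        _ ≤ _ := mul_le_mul_of_nonneg_left (by linarith) hA'pos.le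
    · refine htriv.trans (mul_le_mul_of_nonneg_left ?_ hA'pos.le)
      rw [if_pos (show j ≠ i ∧ ¬ G.IsUniform (β ^ 2) (C i) (C j) from ⟨h2, h3⟩)]
      linarith
  have hsum : ∑ v ∈ A', ((Finset.univ.filter fun u => G.Adj v u).card : ℝ) ≤
      A'.card * (wdeg R s Finset.univ i + (D + β ^ 2 + 4 * β + 2 / r) * n) := by
    calc ∑ v ∈ A', ((Finset.univ.filter fun u => G.Adj v u).card : ℝ) ≤
        ∑ v ∈ A', (∑ j, (((C j).filter fun u => G.Adj v u).card : ℝ) + 2 * β * n) :=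
          Finset.sum_le_sum fun v _ => h.degree_le v
      _ = ∑ j, ∑ v ∈ A', (((C j).filter fun u => G.Adj v u).card : ℝ) +
          A'.card * (2 * β * n) := by
          rw [Finset.sum_add_distrib, Finset.sum_comm, Finset.sum_const, nsmul_eq_mul]
      _ ≤ ∑ j, A'.card * ((if R.Adj i j then s j else 0) + (if j = i then s j else 0) +
          (if j ≠ i ∧ ¬ G.IsUniform (β ^ 2) (C i) (C j) then s j else 0) + (D + β ^ 2) * s j) +
          A'.card * (2 * β * n) := add_le_add_left (Finset.sum_le_sum fun j _ => hj j) _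
      _ = A'.card * (wdeg R s Finset.univ i + s i +
          ∑ j ∈ Finset.univ.filter (fun j => j ≠ i ∧ ¬ G.IsUniform (β ^ 2) (C i) (C j)), s j +
          (D + β ^ 2) * ∑ j, s j + 2 * β * n) := by
          rw [← Finset.mul_sum, ← mul_add]
          congr 1
          rw [Finset.sum_add_distrib, Finset.sum_add_distrib, Finset.sum_add_distrib,
            ← Finset.sum_filter, ← Finset.sum_filter, ← Finset.sum_filter, ← Finset.mul_sum, wdeg]
          congr 4
          · rw [Finset.filter_eq' Finset.univ i, if_pos (Finset.mem_univ i), Finset.sum_singleton]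
      _ ≤ _ := by
          apply mul_le_mul_of_nonneg_left _ hA'pos.le
          have h1 := h.irr i
          have h2 : (D + β ^ 2) * ∑ j, s j ≤ (D + β ^ 2) * n :=
            mul_le_mul_of_nonneg_left h.sum_card_le (by positivity)
          have h3 : s i ≤ 2 * (n / r) := h.up i
          have h4 : 2 / r * n = 2 * (n / r) := by ring
          linarith
  have hlt : (A'.card : ℝ) * (wdeg R s Finset.univ i + (D + β ^ 2 + 4 * β + 2 / r) * n) <
      ∑ v ∈ A', ((Finset.univ.filter fun u => G.Adj v u).card : ℝ) := by
    rw [← nsmul_eq_mul, ← Finset.sum_const]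
    exact Finset.sum_lt_sum_of_nonempty hne fun v hv => (Finset.mem_filter.1 hv).2
  linarith

/-- The reduced graph inherits the degree condition. -/
theorem strongW (h : Clusters G C β r) (hβ : 0 < β) (hβ1 : β ≤ 1 / 2) (hD : 0 ≤ D) (hr : 0 < r)
    {χ μ : ℝ} (hG : DegSeqStrong G χ μ) (hχ : 1 < χ) (hμ : 0 < μ)
    (hn : 2 / μ ≤ Fintype.card V) (hnχ : χ ≤ Fintype.card V) {m : ℕ} (hm : ⌈χ⌉₊ = m + 1)
    (hsl : D + 2 * β ^ 2 + 4 * β + 2 / r ≤ μ / 4) :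
    StrongW (reducedGraph G C (β ^ 2) D) (fun j => ((C j).card : ℝ)) (Fintype.card V) m χ
      (μ / 4) := by
  have hχ0 : 0 < χ := by linarith
  have hnpos : (0 : ℝ) < Fintype.card V := by linarith
  have hm1 : (m : ℝ) < χ := by
    have := Nat.ceil_lt_add_one hχ0.le
    rw [hm] at this
    push_cast at this
    linarith
  have hm2 : χ ≤ m + 1 := by
    have := Nat.le_ceil χ
    rw [hm] at this
    exact_mod_cast this
  have hmpos : 1 ≤ m := by
    by_contra hc
    have : m = 0 := by omega
    subst this
    norm_num at hm2
    linarith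
  refine ⟨fun j => Nat.cast_nonneg _, h.sum_card_le, hnpos, by positivity, hmpos, hm1, hm2, ?_⟩
  intro S hS
  set n : ℝ := (Fintype.card V : ℝ) with hn_def
  set R := reducedGraph G C (β ^ 2) D with hR
  set s : ι → ℝ := fun j => ((C j).card : ℝ) with hs
  set good : ι → Finset V := fun i => (C i).filter fun v =>
    ¬ (wdeg R s Finset.univ i + (D + β ^ 2 + 4 * β + 2 / r) * n <
      (Finset.univ.filter fun u => G.Adj v u).card) with hgood
  have hgc : ∀ i, (1 - β ^ 2) * s i ≤ (good i).card := by
    intro i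
    have h1 := h.card_large_degree_le hβ (by linarith) hD i
    have h2 := Finset.card_filter_add_card_filter_not (s := C i) fun v =>
      wdeg R s Finset.univ i + (D + β ^ 2 + 4 * β + 2 / r) * n <
      (Finset.univ.filter fun u => G.Adj v u).card
    have h3 : (((C i).filter fun v => wdeg R s Finset.univ i +
      (D + β ^ 2 + 4 * β + 2 / r) * n <
      (Finset.univ.filter fun u => G.Adj v u).card).card : ℝ) + (good i).card = s i := by
      rw [← Nat.cast_add]
      exact congrArg Nat.cast h2
    linarith
  have hspos : ∀ i, 0 < s i := fun i => lt_of_lt_of_le (by positivity) (h.low i)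
  have hβ2 : β ^ 2 < 1 := by nlinarith
  have hUcard : ((S.biUnion good).card : ℝ) = ∑ i ∈ S, ((good i).card : ℝ) := by
    rw [Finset.card_biUnion fun i _ j _ hij => (h.disj i j hij).mono (Finset.filter_subset _ _)
      (Finset.filter_subset _ _)]
    push_cast
    rfl
  have hU : (1 - β ^ 2) * ∑ i ∈ S, s i ≤ (S.biUnion good).card := by
    rw [hUcard, Finset.mul_sum]
    exact Finset.sum_le_sum fun i _ => hgc i
  have hUne : (S.biUnion good).Nonempty := by
    obtain ⟨i, hi⟩ := hS
    have h1 : (0 : ℝ) < (good i).card :=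
      lt_of_lt_of_le (mul_pos (by linarith) (hspos i)) (hgc i)
    have h2 : (good i).Nonempty := by
      rw [← Finset.card_pos]
      exact_mod_cast h1
    obtain ⟨v, hv⟩ := h2
    exact ⟨v, Finset.mem_biUnion.2 ⟨i, hi, hv⟩⟩
  obtain ⟨v, hv, hdeg⟩ := hG.exists_degree hχ hμ hn hnχ hUne
  obtain ⟨i, hi, hvi⟩ := Finset.mem_biUnion.1 hv
  refine ⟨i, hi, ?_⟩
  have h1 := not_lt.1 (Finset.mem_filter.1 hvi).2
  have hk : (⌈χ⌉₊ : ℝ) = m + 1 := by exact_mod_cast hm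
  rw [hk] at hdeg
  have h2 : ∑ i ∈ S, s i ≤ n := (Finset.sum_le_sum_of_subset_of_nonneg (Finset.subset_univ _)
    fun j _ _ => (hspos j).le).trans h.sum_card_le
  have h3 : ((m : ℝ) - 1) / χ * n + (χ - m) * ∑ i ∈ S, s i ≤
      ((m : ℝ) + 1 - 2) / χ * n + (χ - (m + 1 - 1)) * (S.biUnion good).card + β ^ 2 * n := by
    have h4 : (χ - m) * ((1 - β ^ 2) * ∑ i ∈ S, s i) ≤ (χ - m) * (S.biUnion good).card :=
      mul_le_mul_of_nonneg_left hU (by linarith)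
    have h5 : (χ - m) * (β ^ 2 * ∑ i ∈ S, s i) ≤ 1 * (β ^ 2 * n) :=
      mul_le_mul (by linarith) (mul_le_mul_of_nonneg_left h2 (by positivity))
        (mul_nonneg (by positivity) (Finset.sum_nonneg fun j _ => (hspos j).le)) (by norm_num)
    have h6 : ((m : ℝ) + 1 - 2) = m - 1 := by ring
    rw [h6, add_sub_cancel_right]
    linarith
  have h4 : min (((m : ℝ) - 1) / χ * n + (χ - m) * ∑ i ∈ S, s i) ((1 - 1 / χ) * n) ≤
      min (((m : ℝ) + 1 - 2) / χ * n + (χ - (m + 1 - 1)) * (S.biUnion good).card)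
        ((1 - 1 / χ) * n) + β ^ 2 * n := by
    rw [← min_add_add_right]
    exact min_le_min h3 (by nlinarith)
  have h5 : (D + 2 * β ^ 2 + 4 * β + 2 / r) * n ≤ μ / 4 * n :=
    mul_le_mul_of_nonneg_right hsl hnpos.le
  linarith

end Clusters
end Clusters

section Frame
variable {V ι : Type} [Fintype V] [Fintype ι]

/-- The structure extracted from the host graph: a reduced graph `R`, a family `P` of sets of
typical vertices, and for each vertex `v` a clique `K v` of `R` through `h v` such that `v` has many
neighbours in all sets indexed by the other members of `K v`. -/
structure Frame (G : SimpleGraph V) (R : SimpleGraph ι) (P : ι → Finset V) (h : V → ι)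
    (K : V → Finset ι) (κ : ι → Finset ι) (m : ℕ) (χ d δ' δ ε : ℝ) (C₀ r₀ : ℕ) : Prop where
  hP : ∀ i, ∀ v ∈ P i, h v = i
  KP : ∀ i, ∀ v ∈ P i, K v = κ i
  clq : ∀ v, R.IsClique (K v : Set ι)
  card_K : ∀ v, (K v).card = m + 1
  mem_K : ∀ v, h v ∈ K v
  deg : ∀ v, ∀ j ∈ K v, j ≠ h v → d * (P j).card ≤ ((P j).filter (G.Adj v ·)).card
  load : ∀ j, (Finset.univ.filter fun i => j ∈ κ i).card ≤ C₀
  atyp : ∀ j, ((Finset.univ.filter fun v => v ∉ P (h v) ∧ j ∈ K v).card : ℝ) ≤ δ * (P j).card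
  reg : LowerReg G R P d ε
  ratio : ∀ i j, ((P i).card : ℝ) ≤ 8 * (P j).card
  size : ∀ i, Fintype.card V ≤ r₀ * (P i).card
  deg_cond : ∀ T : ι → ℝ, (∀ j, |T j - (P j).card| ≤ δ' * (P j).card) → DegCondW R T m χ
  conn : 2 ≤ m → ∀ x y, ∃ b z b', StrongW.CoClq R (m + 1) x b ∧ StrongW.CoClq R (m + 1) b z ∧
    StrongW.CoClq R (m + 1) z b' ∧ StrongW.CoClq R (m + 1) b' y

variable {G : SimpleGraph V} {C : ι → Finset V} {β r d : ℝ} {m : ℕ} {χ μ : ℝ}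

/-- Every vertex has a clique of the reduced graph in which all but one clusters contain many
neighbours of the vertex. -/
theorem Clusters.exists_clique_of_vertex (hC : Clusters G C β r)
    (hS : StrongW (reducedGraph G C (β ^ 2) (2 * d)) (fun j => ((C j).card : ℝ)) (Fintype.card V)
      m χ (μ / 4)) (hd : 0 ≤ d) (hs : 2 * β + 2 * d ≤ μ / 4)
    {v : V} (hv : (((m : ℝ) - 1) / χ + μ / 2) * Fintype.card V ≤
      (Finset.univ.filter fun u => G.Adj v u).card) {Φ : Finset ι}
    (hΦ : ∑ j ∈ Φ, ((C j).card : ℝ) ≤ μ / 4 * Fintype.card V / 2) :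
    ∃ e : Finset ι, (e.card = m + 1 ∧
      (reducedGraph G C (β ^ 2) (2 * d)).IsClique (e : Set ι) ∧
      ∃ z ∈ e, ∀ j ∈ e, j ≠ z → 2 * d * (C j).card ≤ ((C j).filter (G.Adj v ·)).card) ∧
      e.card ≤ m + 1 ∧ Disjoint e Φ := by
  set n : ℝ := (Fintype.card V : ℝ) with hn
  set N0 : Finset ι := Finset.univ.filter fun j =>
    2 * d * (C j).card ≤ ((C j).filter (G.Adj v ·)).card with hN0
  have h1 : ∑ j, (((C j).filter fun u => G.Adj v u).card : ℝ) ≤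
      ∑ j ∈ N0, ((C j).card : ℝ) + 2 * d * n := by
    calc ∑ j, (((C j).filter fun u => G.Adj v u).card : ℝ) ≤
        ∑ j, ((if j ∈ N0 then ((C j).card : ℝ) else 0) + 2 * d * (C j).card) := by
          refine Finset.sum_le_sum fun j _ => ?_
          by_cases hj : j ∈ N0
          · rw [if_pos hj]
            have h2 : (((C j).filter fun u => G.Adj v u).card : ℝ) ≤ (C j).card :=
              Nat.cast_le.2 (Finset.card_filter_le _ _)
            have : 0 ≤ 2 * d * ((C j).card : ℝ) := by positivity
            linarith
          · rw [if_neg hj, zero_add]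
            by_contra hcon
            exact hj (Finset.mem_filter.2 ⟨Finset.mem_univ _, (not_le.1 hcon).le⟩)
      _ = ∑ j ∈ N0, ((C j).card : ℝ) + 2 * d * ∑ j, ((C j).card : ℝ) := by
          rw [Finset.sum_add_distrib, ← Finset.mul_sum, ← Finset.sum_filter]
          congr 2
          ext j
          simp
      _ ≤ _ := by
          have := mul_le_mul_of_nonneg_left hC.sum_card_le (by positivity : 0 ≤ 2 * d)
          linarith
  have h2 := hC.degree_le v
  have h3 : (2 * β + 2 * d) * n ≤ μ / 4 * n :=
    mul_le_mul_of_nonneg_right hs (Nat.cast_nonneg _)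
  obtain ⟨e, z, he, hec, hecl, hed, hz, hez⟩ := hS.exists_clique_extension hΦ
    (N0 := N0) (by linarith)
  have hze : z ∉ e := fun h => (hez z h).ne rfl
  refine ⟨insert z e, ⟨by rw [Finset.card_insert_of_notMem hze, hec], ?_, z,
    Finset.mem_insert_self _ _, ?_⟩, by rw [Finset.card_insert_of_notMem hze, hec], ?_⟩
  · rw [Finset.coe_insert, SimpleGraph.isClique_insert]
    exact ⟨hecl, fun y hy _ => (hez y hy).symm⟩
  · intro j hj hjz
    exact (Finset.mem_filter.1 (he (Finset.mem_of_mem_insert_of_ne hj hjz))).2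
  · rw [Finset.disjoint_insert_left]
    exact ⟨hz, hed⟩

end Frame

section Frame
set_option linter.unusedSectionVars false
variable {V ι : Type} [Fintype V] [Fintype ι]
variable {G : SimpleGraph V} {C : ι → Finset V} {β r d : ℝ} {m : ℕ} {χ μ : ℝ}

/-- The vertices of `C i` with many neighbours in all clusters indexed by `κ i`. -/
noncomputable def typical (G : SimpleGraph V) (C : ι → Finset V) (κ : ι → Finset ι) (d : ℝ) (i : ι) : Finset V :=
  (C i).filter fun v => ∀ j ∈ κ i, j ≠ i →
    3 / 2 * d * (C j).card ≤ ((C j).filter (G.Adj v ·)).card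

theorem Clusters.card_sdiff_typical_le (hβ : 0 < β) (hβd : β ^ 2 ≤ d / 2)
    {κ : ι → Finset ι} {i : ι} (hmem : i ∈ κ i) (hcard : (κ i).card = m + 1)
    (hcl : (reducedGraph G C (β ^ 2) (2 * d)).IsClique (κ i : Set ι)) :
    ((C i \ typical G C κ d i).card : ℝ) ≤ m * (β ^ 2 * (C i).card) := by
  have h1 : C i \ typical G C κ d i ⊆ ((κ i).erase i).biUnion fun j => (C i).filter fun v =>
      (((C j).filter fun u => G.Adj v u).card : ℝ) < 3 / 2 * d * (C j).card := by
    intro v hv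
    rw [Finset.mem_sdiff, typical, Finset.mem_filter, not_and] at hv
    have h2 := hv.2 hv.1
    push Not at h2
    obtain ⟨j, hj, hji, hlt⟩ := h2
    exact Finset.mem_biUnion.2 ⟨j, Finset.mem_erase.2 ⟨hji, hj⟩, Finset.mem_filter.2 ⟨hv.1, hlt⟩⟩
  have h2 : ∀ j ∈ (κ i).erase i, (((C i).filter fun v =>
      (((C j).filter fun u => G.Adj v u).card : ℝ) < 3 / 2 * d * (C j).card).card : ℝ) ≤
      β ^ 2 * (C i).card := by
    intro j hj
    rw [Finset.mem_erase] at hj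
    have hadj := hcl (Finset.mem_coe.2 hmem) (Finset.mem_coe.2 hj.2) hj.1.symm
    have hβ1 : β ^ 2 ≤ 1 := by
      have : (G.edgeDensity (C i) (C j) : ℝ) ≤ 1 := by exact_mod_cast G.edgeDensity_le_one _ _
      linarith [hadj.2.2]
    exact card_low_degree_le hadj.2.1 (by positivity) (by linarith [hadj.2.2]) subset_rfl
      (by nlinarith [(Nat.cast_nonneg (C j).card : (0 : ℝ) ≤ (C j).card)])
  have h3 := (Finset.card_le_card h1).trans Finset.card_biUnion_le
  have h4 : ((C i \ typical G C κ d i).card : ℝ) ≤ ∑ j ∈ (κ i).erase i, (((C i).filter fun v =>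
      (((C j).filter fun u => G.Adj v u).card : ℝ) < 3 / 2 * d * (C j).card).card : ℝ) := by
    exact_mod_cast h3
  refine h4.trans ((Finset.sum_le_sum h2).trans (le_of_eq ?_))
  rw [Finset.sum_const, nsmul_eq_mul, Finset.card_erase_of_mem hmem, hcard, Nat.add_sub_cancel]

set_option maxHeartbeats 2000000 in
/-- The frame obtained from a family of clusters. -/
theorem Clusters.exists_frame (hC : Clusters G C β r)
    (hS : StrongW (reducedGraph G C (β ^ 2) (2 * d)) (fun j => ((C j).card : ℝ)) (Fintype.card V)
      m χ (μ / 4)) (hβ : 0 < β) (hd : 0 < d) (hd1 : d ≤ 1) (hs : 2 * β + 2 * d ≤ μ / 4)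
    (hdeg : ∀ v, (((m : ℝ) - 1) / χ + μ / 2) * Fintype.card V ≤
      (Finset.univ.filter fun u => G.Adj v u).card)
    (hr : 1 ≤ r) (hιr : (Fintype.card ι : ℝ) ≤ r)
    {δ ε χ' : ℝ} {C₀ r₀ : ℕ} (hrr₀ : 4 * r ≤ r₀) (hε : 0 < ε) (hδ : 0 < δ)
    (hβ1 : β ≤ 1 / 2) (hβd : β ≤ d / (2 * (m + 1))) (hβε : β ≤ ε / 2)
    (hβμ : β ≤ μ / (64 * (m + 1))) (hβδ : β ≤ μ * δ / (32 * (m + 1) * (m + 2)))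
    (hC₀ : 64 * (m + 1) / μ + 1 ≤ C₀)
    (hn : 8 * r / δ ≤ Fintype.card V) (hχ : χ ≤ χ') (hχ' : χ' ≤ χ + μ / 16)
    (hχm : χ' ≤ m + 1) :
    ∃ R P h K κ, Frame (ι := ι) G R P h K κ m χ' d (μ / 64) δ ε C₀ r₀ := by
  set n : ℝ := (Fintype.card V : ℝ) with hn_def
  set R := reducedGraph G C (β ^ 2) (2 * d) with hR
  have hm1 : (1 : ℝ) ≤ m := by exact_mod_cast hS.mpos
  have hμ : 0 < μ := by linarith [hS.kpos]
  have hnpos : 0 < n := hS.npos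
  have hr0 : 0 < r := by linarith
  have hcpos : ∀ i, 0 < ((C i).card : ℝ) := fun i => lt_of_lt_of_le (by positivity) (hC.low i)
  -- cliques through clusters
  have hκ : ∃ E : ι → Finset ι, (∀ i ∈ (Finset.univ : Finset ι), i ∉ E i ∧ (E i).card = m ∧
      R.IsClique (insert i (E i) : Set ι)) ∧
      ∀ j, ((Finset.univ : Finset ι).filter fun i => j ∈ E i).card ≤ C₀ - 1 := by
    refine exists_selection_bounded_load Finset.univ (fun i e => i ∉ e ∧ e.card = m ∧
      R.IsClique (insert i e : Set ι)) (m + 1) (fun _ => C₀ - 1) fun i _ Φ hΦ => ?_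
    have hC1 : 64 * (m + 1) / μ ≤ ((C₀ - 1 : ℕ) : ℝ) := by
      have h1 : 1 ≤ C₀ := by
        have : (0 : ℝ) ≤ 64 * (m + 1) / μ := by positivity
        have : (1 : ℝ) ≤ C₀ := by linarith
        exact_mod_cast this
      rw [Nat.cast_sub h1]
      push_cast
      linarith
    have h2 : ∑ j ∈ Φ, ((C j).card : ℝ) ≤ μ / 4 * n / 2 := by
      have h3 : (Φ.card : ℝ) * ((C₀ - 1 : ℕ) : ℝ) ≤ (m + 1) * r := by
        rw [Finset.sum_const, smul_eq_mul, Finset.card_univ] at hΦ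
        have h4 : (Φ.card : ℝ) * ((C₀ - 1 : ℕ) : ℝ) ≤ (m + 1) * Fintype.card ι := by
          exact_mod_cast hΦ
        exact h4.trans (mul_le_mul_of_nonneg_left hιr (by positivity))
      have h4 : (Φ.card : ℝ) * (64 * (m + 1) / μ) ≤ (m + 1) * r :=
        (mul_le_mul_of_nonneg_left hC1 (Nat.cast_nonneg _)).trans h3
      have h5 : (Φ.card : ℝ) * 64 ≤ μ * r := by
        have h6 : (Φ.card : ℝ) * (64 * (m + 1) / μ) = (m + 1) * (Φ.card * 64 / μ) := by ring
        rw [h6] at h4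
        have h7 := le_of_mul_le_mul_left h4 (by positivity)
        rw [div_le_iff₀ hμ] at h7
        linarith
      calc ∑ j ∈ Φ, ((C j).card : ℝ) ≤ ∑ j ∈ Φ, 2 * (n / r) :=
            Finset.sum_le_sum fun j _ => hC.up j
        _ = (Φ.card * 64) * (n / r / 32) := by
            rw [Finset.sum_const, nsmul_eq_mul]; ring
        _ ≤ (μ * r) * (n / r / 32) := mul_le_mul_of_nonneg_right h5 (by positivity)
        _ = μ * n / 32 := by field_simp
        _ ≤ _ := by
            have : 0 < μ * n := by positivity
            linarith
    obtain ⟨e, h3, h4, h5, h6⟩ := hS.exists_clique_through h2 i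
    exact ⟨e, ⟨h3, h4, h5⟩, by omega, h6⟩
  obtain ⟨E, hE, hEload⟩ := hκ
  set κ : ι → Finset ι := fun i => insert i (E i) with hκ_def
  have hκmem : ∀ i, i ∈ κ i := fun i => Finset.mem_insert_self _ _
  have hκcard : ∀ i, (κ i).card = m + 1 := fun i => by
    rw [hκ_def]
    simp only
    rw [Finset.card_insert_of_notMem (hE i (Finset.mem_univ _)).1, (hE i (Finset.mem_univ _)).2.1]
  have hκcl : ∀ i, R.IsClique (κ i : Set ι) := fun i => by
    rw [hκ_def, Finset.coe_insert]
    exact (hE i (Finset.mem_univ _)).2.2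
  set P : ι → Finset V := typical G C κ d with hP
  have hPC : ∀ i, P i ⊆ C i := fun i => Finset.filter_subset _ _
  have hββ : β ^ 2 ≤ β := by nlinarith
  have hβd' : (m + 1) * β ≤ d / 2 := by
    rw [le_div_iff₀ (by positivity)] at hβd
    linarith
  have hβd2 : β ≤ d / 2 := by nlinarith
  have hβμ' : (m + 1) * β ≤ μ / 64 := by
    rw [le_div_iff₀ (by positivity)] at hβμ
    linarith
  have hsd : ∀ i, ((C i \ P i).card : ℝ) ≤ m * β * (C i).card := fun i => by
    refine (Clusters.card_sdiff_typical_le hβ (by linarith) (hκmem i) (hκcard i)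
      (hκcl i)).trans ?_
    have : (β ^ 2 * (C i).card : ℝ) ≤ β * (C i).card :=
      mul_le_mul_of_nonneg_right hββ (hcpos i).le
    nlinarith
  have hPcard : ∀ i, ((C i).card : ℝ) = (P i).card + (C i \ P i).card := fun i => by
    have := Finset.card_sdiff_add_card_eq_card (hPC i)
    rw [← Nat.cast_add, add_comm, this]
  have hPle : ∀ i, ((P i).card : ℝ) ≤ (C i).card := fun i =>
    Nat.cast_le.2 (Finset.card_le_card (hPC i))
  have hmβ : (m : ℝ) * β ≤ 1 / 2 := by
    nlinarith
  have hPhalf : ∀ i, ((C i).card : ℝ) / 2 ≤ (P i).card := fun i => by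
    have h1 := hsd i
    have h2 := hPcard i
    have h3 := mul_le_mul_of_nonneg_right hmβ (hcpos i).le
    linarith
  have hdegP : ∀ v j, 3 / 2 * d * (C j).card ≤ ((C j).filter (G.Adj v ·)).card →
      d * (P j).card ≤ ((P j).filter (G.Adj v ·)).card := by
    intro v j hv
    have h1 : (C j).filter (G.Adj v ·) ⊆ (P j).filter (G.Adj v ·) ∪ (C j \ P j) := by
      intro u hu
      rw [Finset.mem_filter] at hu
      by_cases huP : u ∈ P j
      · exact Finset.mem_union_left _ (Finset.mem_filter.2 ⟨huP, hu.2⟩)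
      · exact Finset.mem_union_right _ (Finset.mem_sdiff.2 ⟨hu.1, huP⟩)
    have h2 := (Finset.card_le_card h1).trans (Finset.card_union_le _ _)
    have h3 : (((C j).filter (G.Adj v ·)).card : ℝ) ≤
        ((P j).filter (G.Adj v ·)).card + (C j \ P j).card := by exact_mod_cast h2
    have h4 := hsd j
    have h5 : (m : ℝ) * β * (C j).card ≤ d / 2 * (C j).card :=
      mul_le_mul_of_nonneg_right (by nlinarith) (hcpos j).le
    have h6 : d * (P j).card ≤ d * (C j).card := mul_le_mul_of_nonneg_left (hPle j) hd.le
    linarith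
  -- cliques for atypical vertices
  set A : Finset V := Finset.univ.filter fun v => ∀ i, v ∉ P i with hA
  have hAcard : (A.card : ℝ) ≤ (m + 2) * β * n := by
    have h1 : A ⊆ (Finset.univ.filter fun v => ∀ i, v ∉ C i) ∪
        Finset.univ.biUnion fun i => C i \ P i := by
      intro v hv
      have hv := (Finset.mem_filter.1 hv).2
      by_cases h : ∀ i, v ∉ C i
      · exact Finset.mem_union_left _ (Finset.mem_filter.2 ⟨Finset.mem_univ _, h⟩)
      · push Not at h
        obtain ⟨i, hi⟩ := h
        exact Finset.mem_union_right _ (Finset.mem_biUnion.2 ⟨i, Finset.mem_univ _,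
          Finset.mem_sdiff.2 ⟨hi, hv i⟩⟩)
    have h2 := (Finset.card_le_card h1).trans ((Finset.card_union_le _ _).trans
      (Nat.add_le_add_left Finset.card_biUnion_le _))
    have h3 : (A.card : ℝ) ≤ (Finset.univ.filter fun v => ∀ i, v ∉ C i).card +
        ∑ i, ((C i \ P i).card : ℝ) := by exact_mod_cast h2
    have h4 : ∑ i, ((C i \ P i).card : ℝ) ≤ m * β * n := by
      refine (Finset.sum_le_sum fun i _ => hsd i).trans ?_
      rw [← Finset.mul_sum]
      exact mul_le_mul_of_nonneg_left hC.sum_card_le (by positivity)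
    have h5 := hC.miss
    linarith
  have hβδ' : (m + 1) * ((m + 2) * β) ≤ μ * δ / 32 := by
    rw [le_div_iff₀ (by positivity)] at hβδ
    linarith
  obtain ⟨F, hF, hFload⟩ := exists_selection_bounded_load A (fun v e => e.card = m + 1 ∧
      R.IsClique (e : Set ι) ∧ ∃ z ∈ e, ∀ j ∈ e, j ≠ z →
        2 * d * (C j).card ≤ ((C j).filter (G.Adj v ·)).card) (m + 1)
      (fun j => ⌊δ * (P j).card⌋₊) (by
    intro v hv Φ hΦ
    refine hC.exists_clique_of_vertex hS hd.le hs (hdeg v) ?_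
    have h1 : ∀ j, δ / 4 * (C j).card ≤ (⌊δ * (P j).card⌋₊ : ℝ) := by
      intro j
      have h2 := Nat.lt_floor_add_one (δ * ((P j).card : ℝ))
      have h3 : δ * (((C j).card : ℝ) / 2) ≤ δ * (P j).card :=
        mul_le_mul_of_nonneg_left (hPhalf j) hδ.le
      have h4 : 1 ≤ δ / 4 * (C j).card := by
        have h5 := hC.low j
        rw [div_le_iff₀ hδ] at hn
        have h6 : 4 ≤ δ * (n / r / 2) := by
          rw [← mul_div_assoc, ← mul_div_assoc, le_div_iff₀ (by norm_num), le_div_iff₀ hr0]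
          linarith
        have h7 := mul_le_mul_of_nonneg_left h5 hδ.le
        linarith
      linarith
    have h2 : ∑ j ∈ Φ, δ / 4 * ((C j).card : ℝ) ≤ (m + 1) * A.card := by
      refine (Finset.sum_le_sum fun j _ => h1 j).trans ?_
      exact_mod_cast hΦ
    rw [← Finset.mul_sum] at h2
    have h3 : ((m : ℝ) + 1) * A.card ≤ (m + 1) * ((m + 2) * β * n) :=
      mul_le_mul_of_nonneg_left hAcard (by positivity)
    have h4 : (m + 1) * ((m + 2) * β) * n ≤ μ * δ / 32 * n :=
      mul_le_mul_of_nonneg_right hβδ' hnpos.le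
    have h5 : δ / 4 * ∑ j ∈ Φ, ((C j).card : ℝ) ≤ δ / 4 * (μ / 4 * n / 2) := by linarith
    exact le_of_mul_le_mul_left h5 (by positivity))
  have hF' : ∀ v, ∃ z, v ∈ A → z ∈ F v ∧ ∀ j ∈ F v, j ≠ z →
      2 * d * (C j).card ≤ ((C j).filter (G.Adj v ·)).card := by
    intro v
    by_cases hv : v ∈ A
    · obtain ⟨-, -, z, hz1, hz2⟩ := hF v hv
      exact ⟨z, fun _ => ⟨hz1, hz2⟩⟩
    · have : ∃ i, v ∈ P i := by
        by_contra hcon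
        push Not at hcon
        exact hv (Finset.mem_filter.2 ⟨Finset.mem_univ _, hcon⟩)
      exact ⟨this.choose, fun h => absurd h hv⟩
  choose z hz using hF'
  have huniq : ∀ v i j, v ∈ P i → v ∈ P j → i = j := fun v i j hi hj => by
    by_contra hij
    exact Finset.disjoint_left.1 (hC.disj i j hij) (hPC i hi) (hPC j hj)
  have hhK : ∀ v, ∃ x : ι × Finset ι, (∀ i, v ∈ P i → x.1 = i ∧ x.2 = κ i) ∧
      ((∀ i, v ∉ P i) → x = (z v, F v)) := by
    intro v
    by_cases h : ∃ i, v ∈ P i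
    · obtain ⟨i, hi⟩ := h
      refine ⟨(i, κ i), fun j hj => ?_, fun h => absurd hi (h i)⟩
      rw [huniq v i j hi hj]
      exact ⟨rfl, rfl⟩
    · push Not at h
      exact ⟨(z v, F v), fun i hi => absurd hi (h i), fun _ => rfl⟩
  choose hK hK1 hK2 using hhK
  have hcases : ∀ v, (∃ i, v ∈ P i ∧ hK v = (i, κ i)) ∨ (v ∈ A ∧ hK v = (z v, F v)) := by
    intro v
    by_cases h : ∃ i, v ∈ P i
    · obtain ⟨i, hi⟩ := h
      exact Or.inl ⟨i, hi, Prod.ext (hK1 v i hi).1 (hK1 v i hi).2⟩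
    · push Not at h
      exact Or.inr ⟨Finset.mem_filter.2 ⟨Finset.mem_univ _, h⟩, hK2 v h⟩
  refine ⟨R, P, fun v => (hK v).1, fun v => (hK v).2, κ, ⟨fun i v hv => (hK1 v i hv).1,
    fun i v hv => (hK1 v i hv).2, ?_, ?_, ?_, ?_, ?_, ?_, ?_, ?_, ?_, ?_, ?_⟩⟩
  · intro v
    rcases hcases v with ⟨i, hi, h⟩ | ⟨hv, h⟩
    · rw [h]; exact hκcl i
    · rw [h]; exact (hF v hv).2.1
  · intro v
    rcases hcases v with ⟨i, hi, h⟩ | ⟨hv, h⟩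
    · rw [h]; exact hκcard i
    · rw [h]; exact (hF v hv).1
  · intro v
    rcases hcases v with ⟨i, hi, h⟩ | ⟨hv, h⟩
    · rw [h]; exact hκmem i
    · rw [h]; exact (hz v hv).1
  · intro v j hj hjh
    rcases hcases v with ⟨i, hi, h⟩ | ⟨hv, h⟩
    · rw [h] at hj hjh
      exact hdegP v j ((Finset.mem_filter.1 hi).2 j hj hjh)
    · rw [h] at hj hjh
      refine hdegP v j (le_trans ?_ ((hz v hv).2 j hj hjh))
      have := mul_pos hd (hcpos j)
      linarith
  · intro j
    have h1 : (Finset.univ.filter fun i => j ∈ κ i) ⊆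
        insert j (Finset.univ.filter fun i => j ∈ E i) := by
      intro i hi
      rcases Finset.mem_insert.1 (Finset.mem_filter.1 hi).2 with rfl | h
      · exact Finset.mem_insert_self _ _
      · exact Finset.mem_insert_of_mem (Finset.mem_filter.2 ⟨Finset.mem_univ _, h⟩)
    have h2 := (Finset.card_le_card h1).trans (Finset.card_insert_le _ _)
    have h3 := hEload j
    have h4 : 1 ≤ C₀ := by
      have : (0 : ℝ) ≤ 64 * (m + 1) / μ := by positivity
      have : (1 : ℝ) ≤ C₀ := by linarith
      exact_mod_cast this
    omega
  · intro j
    have h1 : (Finset.univ.filter fun v => v ∉ P (hK v).1 ∧ j ∈ (hK v).2) ⊆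
        A.filter fun v => j ∈ F v := by
      intro v hv
      have hv := (Finset.mem_filter.1 hv).2
      rcases hcases v with ⟨i, hi, h⟩ | ⟨hvA, h⟩
      · rw [h] at hv
        exact absurd hi hv.1
      · rw [h] at hv
        exact Finset.mem_filter.2 ⟨hvA, hv.2⟩
    have h2 := (Finset.card_le_card h1).trans (hFload j)
    exact (Nat.cast_le.2 h2).trans (Nat.floor_le (by positivity))
  · intro i j hij B hB hBc
    have h1 : β ^ 2 * (C j).card ≤ B.card := by
      refine le_trans ?_ hBc
      have h2 : β ^ 2 * (C j).card ≤ ε / 2 * (C j).card :=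
        mul_le_mul_of_nonneg_right (by linarith) (hcpos j).le
      have h3 := mul_le_mul_of_nonneg_left (hPhalf j) hε.le
      linarith
    have h2 := card_low_degree_le (D := d) hij.2.1 (by positivity) (by linarith [hij.2.2])
      (hB.trans (hPC j)) h1
    have h3 : (((P i).filter fun u => ((B.filter fun z => G.Adj u z).card : ℝ) < d * B.card).card
        : ℝ) ≤ (((C i).filter fun u => ((B.filter fun z => G.Adj u z).card : ℝ) <
          d * B.card).card : ℝ) :=
      Nat.cast_le.2 (Finset.card_le_card (Finset.filter_subset_filter _ (hPC i)))
    have h4 : β ^ 2 * (C i).card ≤ ε / 2 * (C i).card :=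
      mul_le_mul_of_nonneg_right (by linarith) (hcpos i).le
    have h5 := mul_le_mul_of_nonneg_left (hPhalf i) hε.le
    linarith
  · intro i j
    have h1 := hC.up i
    have h2 := hC.low j
    have h3 := hPle i
    have h4 := hPhalf j
    linarith
  · intro i
    have h1 := hC.low i
    have h2 := hPhalf i
    have h3 : n / r ≤ 4 * (P i).card := by linarith
    rw [div_le_iff₀ hr0] at h3
    have h4 : (4 * r) * ((P i).card : ℝ) ≤ r₀ * (P i).card :=
      mul_le_mul_of_nonneg_right hrr₀ (Nat.cast_nonneg _)
    have h5 : n ≤ r₀ * (P i).card := by linarith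
    rw [hn_def, ← Nat.cast_mul] at h5
    exact Nat.cast_le.1 h5
  · intro T hT
    refine hS.degCondW hχ hχ' (ρ := μ / 32) (by positivity) (fun j => ?_) (by linarith) hχm
    have h1 := hT j
    have h2 := hPcard j
    have h3 := hsd j
    have h4 : (m : ℝ) * β * (C j).card ≤ μ / 64 * (C j).card :=
      mul_le_mul_of_nonneg_right (by nlinarith) (hcpos j).le
    have h5 : μ / 64 * (P j).card ≤ μ / 64 * (C j).card :=
      mul_le_mul_of_nonneg_left (hPle j) (by positivity)
    have h6 : (0 : ℝ) ≤ (C j \ P j).card := Nat.cast_nonneg _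
    rw [abs_le] at h1 ⊢
    constructor <;> linarith
  · exact fun hm2 x y => hS.coClq_connected hm2 x y

end Frame

/-- Graphs with a strong degree sequence contain frames. -/
theorem exists_frame_of_degSeqStrong {χ μ : ℝ} (hχ : 1 < χ) (hμ : 0 < μ) {m : ℕ}
    (hm : ⌈χ⌉₊ = m + 1) :
    ∃ (χ' d δ' : ℝ) (C₀ : ℕ), χ ≤ χ' ∧ χ' ≤ m + 1 ∧ (χ' = m + 1 ∨ χ < χ') ∧ 0 < d ∧ d ≤ 1 ∧
      0 < δ' ∧ ∀ δ ε : ℝ, 0 < δ → 0 < ε → ∃ r₀ n₀ : ℕ, ∀ (V : Type) [Fintype V]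
        (G : SimpleGraph V), n₀ ≤ Fintype.card V → DegSeqStrong G χ μ →
        ∃ (ι : Type) (_ : Fintype ι) (R : SimpleGraph ι) (P : ι → Finset V) (h : V → ι)
          (K : V → Finset ι) (κ : ι → Finset ι), Fintype.card ι ≤ r₀ ∧
          Frame G R P h K κ m χ' d δ' δ ε C₀ r₀ := by
  have hm1 : (1 : ℝ) ≤ m := by
    have h1 := Nat.lt_ceil.2 (show ((1 : ℕ) : ℝ) < χ by simpa using hχ)
    rw [hm] at h1
    exact_mod_cast (show 1 ≤ m by omega)
  have hχm : χ ≤ m + 1 := by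
    have := Nat.le_ceil χ
    rw [hm] at this
    exact_mod_cast this
  have hmχ : (m : ℝ) < χ := by
    have := Nat.ceil_lt_add_one (show 0 ≤ χ by linarith)
    rw [hm] at this
    push_cast at this
    linarith
  have hd : 0 < min (μ / 16) (1 / 4 : ℝ) := by positivity
  obtain ⟨d, hd_def⟩ : ∃ d, d = min (μ / 16) (1 / 4 : ℝ) := ⟨_, rfl⟩
  rw [← hd_def] at hd
  have hdμ : d ≤ μ / 16 := hd_def ▸ min_le_left _ _
  have hd4 : d ≤ 1 / 4 := hd_def ▸ min_le_right _ _
  refine ⟨min (m + 1) (χ + μ / 16), d, μ / 64, ⌈64 * (m + 1) / μ + 1⌉₊, le_min hχm (by linarith),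
    min_le_left _ _, ?_, hd, by linarith, by positivity, fun δ ε hδ hε => ?_⟩
  · rcases min_choice ((m : ℝ) + 1) (χ + μ / 16) with h | h
    · exact Or.inl h
    · right; rw [h]; linarith
  obtain ⟨β, hβ0, hβ1, hβd, hβε, hβμ, hβδ⟩ : ∃ β : ℝ, 0 < β ∧ β ≤ 1 / 2 ∧ β ≤ d / (2 * (m + 1)) ∧
      β ≤ ε / 2 ∧ β ≤ μ / (64 * (m + 1)) ∧ β ≤ μ * δ / (32 * (m + 1) * (m + 2)) := by
    refine ⟨min (min (1 / 2) (d / (2 * (m + 1)))) (min (ε / 2) (min (μ / (64 * (m + 1)))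
      (μ * δ / (32 * (m + 1) * (m + 2))))), by positivity, ?_, ?_, ?_, ?_, ?_⟩ <;>
    simp only [min_le_iff, le_refl, true_or, or_true]
  have hβμ' : β ≤ μ / 128 := by
    refine hβμ.trans (div_le_div_of_nonneg_left hμ.le (by norm_num) (by linarith))
  obtain ⟨r₀, hr₀⟩ := exists_clusters β hβ0 (⌈32 / μ⌉₊ + 1) (by omega)
  refine ⟨4 * r₀, max (2 * r₀) (max ⌈2 / μ⌉₊ (max ⌈χ⌉₊ ⌈8 * r₀ / δ⌉₊)), fun V _ G hn hG => ?_⟩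
  rw [max_le_iff, max_le_iff, max_le_iff, Nat.ceil_le, Nat.ceil_le, Nat.ceil_le] at hn
  obtain ⟨hn1, hn2, hn3, hn4⟩ := hn
  obtain ⟨ι, _, C, r, hlr, hrr, hιr, h1, h2, h3, h4, h5⟩ := hr₀ V G hn1
  have hC : Clusters G C β r := ⟨h1, h2, h3, h4, h5⟩
  have hlr' : 32 / μ + 1 ≤ r := by
    have h6 : ((⌈32 / μ⌉₊ + 1 : ℕ) : ℝ) ≤ r := Nat.cast_le.2 hlr
    have h7 := Nat.le_ceil (32 / μ)
    push_cast at h6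
    linarith
  have hμ32 : 0 < 32 / μ := by positivity
  have hr1 : (1 : ℝ) ≤ r := by linarith
  have hr2 : 2 / (r : ℝ) ≤ μ / 16 := by
    rw [div_le_iff₀ (by linarith)]
    have h8 : 32 / μ ≤ r := by linarith
    rw [div_le_iff₀ hμ] at h8
    linarith
  have hrr' : (r : ℝ) ≤ r₀ := Nat.cast_le.2 hrr
  have hS := hC.strongW (D := 2 * d) hβ0 hβ1 (by linarith) (by linarith) hG hχ hμ hn2 hn3 hm
    (by nlinarith)
  obtain ⟨R, P, h, K, κ, hF⟩ := hC.exists_frame hS hβ0 hd (by linarith) (by linarith)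
    (fun v => by
      obtain ⟨v', hv', h⟩ := hG.exists_degree hχ hμ hn2 hn3 (Finset.singleton_nonempty v)
      rw [Finset.mem_singleton] at hv'
      subst hv'
      refine le_trans ?_ h
      rw [hm, add_mul]
      refine add_le_add_left (le_min ?_ ?_) _
      · push_cast
        have : (0 : ℝ) ≤ (χ - (m + 1 - 1)) * (({v'} : Finset V).card : ℝ) :=
          mul_nonneg (by linarith) (Nat.cast_nonneg _)
        have h9 : ((m : ℝ) + 1 - 2) = m - 1 := by ring
        rw [h9]
        linarith
      · refine mul_le_mul_of_nonneg_right ?_ (Nat.cast_nonneg _)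
        rw [div_le_iff₀ (by linarith), sub_mul, one_div_mul_cancel (by linarith)]
        linarith)
    hr1 (Nat.cast_le.2 hιr) (r₀ := 4 * r₀) (by push_cast; linarith) hε hδ hβ1 hβd hβε hβμ hβδ
    (Nat.le_ceil _) (le_trans (div_le_div_of_nonneg_right (by linarith) hδ.le) hn4)
    (χ' := min (m + 1) (χ + μ / 16)) (le_min hχm (by linarith)) (min_le_right _ _) (min_le_left _ _)
  exact ⟨ι, inferInstance, R, P, h, K, κ, by omega, hF⟩

section Achieve
variable {W J ι : Type} [Fintype W] [Fintype J] [Fintype ι]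

/-- The tiles in `S` can be mapped homomorphically to `R` such that exactly `ℓ j` vertices are
mapped to each `j`. -/
def Ach (H : SimpleGraph W) (t : W → J) (R : SimpleGraph ι) (S : Finset J) (ℓ : ι → ℤ) : Prop :=
  ∃ a : W → ι, (∀ x y, t x ∈ S → H.Adj x y → R.Adj (a x) (a y)) ∧
    ∀ j, ((Finset.univ.filter fun x => t x ∈ S ∧ a x = j).card : ℤ) = ℓ j

/-- A graph `H` with a decomposition `t` into tiles of size at most `w` and with a colouring `φ`,
where each tile is flexible. -/
structure TileSys (H : SimpleGraph W) (t : W → J) (m w : ℕ) (φ : W → Fin (m + 1)) : Prop where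
  adj : ∀ x y, H.Adj x y → t x = t y
  size : ∀ T, (Finset.univ.filter fun x => t x = T).card ≤ w
  proper : ∀ x y, H.Adj x y → φ x ≠ φ y
  gcd : ∀ T, GcdOne {d | ∃ c : W → Fin (m + 1), (∀ x y, t x = T → H.Adj x y → c x ≠ c y) ∧
    d = (((Finset.univ.filter fun x => t x = T ∧ c x = 0).card : ℤ) -
      (Finset.univ.filter fun x => t x = T ∧ c x = 1).card).natAbs}
  gcd_comp : m = 1 → ∀ T, GcdOne {s | ∃ Q : Finset W, (∀ x ∈ Q, t x = T) ∧
    (∀ x y, H.Adj x y → (x ∈ Q ↔ y ∈ Q)) ∧ s = Q.card}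

/-- Any sufficiently large set of tiles can be used to transfer up to `M` units of load from `u`
to `v`. -/
def Trans (H : SimpleGraph W) (t : W → J) (R : SimpleGraph ι) (N M : ℕ) (u v : ι) : Prop :=
  ∀ S : Finset J, N ≤ S.card → ∃ b : ι → ℤ, ∀ τ : ℤ, |τ| ≤ M →
    Ach H t R S fun j => b j + τ * ((if j = v then 1 else 0) - if j = u then 1 else 0)

variable {H : SimpleGraph W} {t : W → J} {R : SimpleGraph ι} {m w : ℕ} {φ : W → Fin (m + 1)}

theorem Ach.congr {S : Finset J} {ℓ ℓ' : ι → ℤ} (h : Ach H t R S ℓ) (he : ∀ j, ℓ j = ℓ' j) :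
    Ach H t R S ℓ' := by
  rwa [← show ℓ = ℓ' from funext he]

theorem ach_sum [Nonempty ι] (hH : ∀ x y, H.Adj x y → t x = t y) {S : Finset J} {ℓ : J → ι → ℤ}
    (h : ∀ T ∈ S, Ach H t R {T} (ℓ T)) : Ach H t R S fun j => ∑ T ∈ S, ℓ T j := by
  have h' : ∀ T, ∃ a : W → ι, T ∈ S → (∀ x y, t x = T → H.Adj x y → R.Adj (a x) (a y)) ∧
      ∀ j, ((Finset.univ.filter fun x => t x = T ∧ a x = j).card : ℤ) = ℓ T j := by
    intro T
    by_cases hT : T ∈ S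
    · obtain ⟨a, h1, h2⟩ := h T hT
      simp only [Finset.mem_singleton] at h1 h2
      exact ⟨a, fun _ => ⟨h1, h2⟩⟩
    · exact ⟨fun _ => Classical.arbitrary ι, fun h => absurd h hT⟩
  choose a ha using h'
  refine ⟨fun x => a (t x) x, fun x y hx hxy => ?_, fun j => ?_⟩
  · simp only [← hH x y hxy]
    exact (ha _ hx).1 x y rfl hxy
  · rw [Finset.card_eq_sum_card_fiberwise (f := t) (t := S) (fun x hx => by
      simpa using (Finset.mem_filter.1 hx).2.1)]
    push_cast
    refine Finset.sum_congr rfl fun T hT => ?_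
    rw [← (ha T hT).2 j]
    congr 2
    ext x
    simp only [Finset.mem_filter, Finset.mem_univ, true_and]
    constructor
    · rintro ⟨⟨h1, h2⟩, rfl⟩; exact ⟨rfl, h2⟩
    · rintro ⟨rfl, h2⟩; exact ⟨⟨hT, h2⟩, rfl⟩

theorem Ach.union {S S' : Finset J} {ℓ ℓ' : ι → ℤ} (hH : ∀ x y, H.Adj x y → t x = t y)
    (hS : Disjoint S S') (h : Ach H t R S ℓ) (h' : Ach H t R S' ℓ') :
    Ach H t R (S ∪ S') fun j => ℓ j + ℓ' j := by
  obtain ⟨a, ha, hl⟩ := h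
  obtain ⟨a', ha', hl'⟩ := h'
  refine ⟨fun x => if t x ∈ S then a x else a' x, fun x y hx hxy => ?_, fun j => ?_⟩
  · simp only [← hH x y hxy]
    by_cases hxS : t x ∈ S
    · simp only [if_pos hxS]; exact ha x y hxS hxy
    · simp only [if_neg hxS]
      exact ha' x y ((Finset.mem_union.1 hx).resolve_left hxS) hxy
  · show _ = ℓ j + ℓ' j
    rw [← hl j, ← hl' j, ← Nat.cast_add, ← Finset.card_union_of_disjoint]
    · congr 2
      ext x
      simp only [Finset.mem_filter, Finset.mem_univ, true_and, Finset.mem_union]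
      by_cases hxS : t x ∈ S
      · have := Finset.disjoint_left.1 hS hxS
        simp [hxS, this]
      · simp [hxS]
    · rw [Finset.disjoint_left]
      intro x hx hx'
      exact Finset.disjoint_left.1 hS (Finset.mem_filter.1 hx).2.1 (Finset.mem_filter.1 hx').2.1

theorem ach_toggle [Nonempty ι] (hH : ∀ x y, H.Adj x y → t x = t y) {S : Finset J}
    {ℓ ℓ' : J → ι → ℤ} {δ : J → ℤ} {z : ι → ℤ} (h : ∀ T ∈ S, Ach H t R {T} (ℓ T))
    (h' : ∀ T ∈ S, Ach H t R {T} (ℓ' T)) (hz : ∀ T ∈ S, ∀ j, ℓ' T j = ℓ T j + δ T * z j)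
    {U : Finset J} (hU : U ⊆ S) :
    Ach H t R S fun j => ∑ T ∈ S, ℓ T j + (∑ T ∈ U, δ T) * z j := by
  refine (ach_sum (ℓ := fun T => if T ∈ U then ℓ' T else ℓ T) hH fun T hT => ?_).congr fun j => ?_
  · by_cases hTU : T ∈ U
    · simp only [if_pos hTU]; exact h' T hT
    · simp only [if_neg hTU]; exact h T hT
  · have hUS : ∑ T ∈ U, δ T * z j = ∑ T ∈ S, if T ∈ U then δ T * z j else 0 := by
      rw [Finset.sum_ite_mem, Finset.inter_eq_right.2 hU]
    rw [Finset.sum_mul, hUS, ← Finset.sum_add_distrib]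
    refine Finset.sum_congr rfl fun T hT => ?_
    by_cases hTU : T ∈ U
    · simp only [if_pos hTU]; exact hz T hT j
    · simp only [if_neg hTU, add_zero]

theorem ach_colouring {π : Fin (m + 1) → ι} (hπ : Clq R π) {T : J} {c : W → Fin (m + 1)}
    (hc : ∀ x y, t x = T → H.Adj x y → c x ≠ c y) :
    Ach H t R {T} fun j => ((Finset.univ.filter fun x => t x = T ∧ π (c x) = j).card : ℤ) := by
  refine ⟨fun x => π (c x), fun x y hx hxy => hπ _ _ (hc x y (Finset.mem_singleton.1 hx) hxy),
    fun j => ?_⟩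
  simp only [Finset.mem_singleton]

theorem exists_clq_of_coClq (hm : 1 ≤ m) {u v : ι} (h : StrongW.CoClq R (m + 1) u v)
    (huv : u ≠ v) : ∃ π : Fin (m + 1) → ι, Clq R π ∧ π 0 = u ∧ π 1 = v := by
  obtain ⟨e, he, hcl, hu, hv⟩ := h
  have f₀ : Fin (m + 1) ≃ e := (Finset.equivFinOfCardEq he).symm
  set f₁ : Fin (m + 1) ≃ e := (Equiv.swap 0 (f₀.symm ⟨u, hu⟩)).trans f₀ with hf₁
  have h1 : f₁ 0 = ⟨u, hu⟩ := by simp [hf₁]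
  set f₂ : Fin (m + 1) ≃ e := (Equiv.swap 1 (f₁.symm ⟨v, hv⟩)).trans f₁ with hf₂
  have h01 : (0 : Fin (m + 1)) ≠ 1 := by
    have : NeZero m := ⟨by omega⟩
    exact Fin.zero_ne_one'
  have h2 : f₂ 0 = ⟨u, hu⟩ := by
    rw [hf₂, Equiv.trans_apply, Equiv.swap_apply_of_ne_of_ne h01, h1]
    rw [Ne, Equiv.eq_symm_apply, h1]
    exact fun h => huv (congrArg Subtype.val h)
  have h3 : f₂ 1 = ⟨v, hv⟩ := by simp [hf₂]
  refine ⟨fun l => f₂ l, fun a b hab => hcl (f₂ a).2 (f₂ b).2 fun h => hab ?_, ?_, ?_⟩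
  · exact f₂.injective (Subtype.ext h)
  · simp only [h2]
  · simp only [h3]

theorem exists_clq_of_card {e : Finset ι} (he : e.card = m + 1) (hcl : R.IsClique (e : Set ι)) :
    ∃ π : Fin (m + 1) → ι, Clq R π ∧ ∀ l, π l ∈ e := by
  have f₀ : Fin (m + 1) ≃ e := (Finset.equivFinOfCardEq he).symm
  refine ⟨fun l => f₀ l, fun a b hab => hcl (f₀ a).2 (f₀ b).2 fun h => hab ?_, fun l => (f₀ l).2⟩
  exact f₀.injective (Subtype.ext h)

theorem TileSys.exists_ach [Nonempty ι] (hT : TileSys H t m w φ) {π : Fin (m + 1) → ι}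
    (hπ : Clq R π) (S : Finset J) : ∃ b, Ach H t R S b :=
  ⟨_, ach_sum hT.adj fun _ _ => ach_colouring hπ fun x y _ hxy => hT.proper x y hxy⟩

/-- Load can be transferred between two vertices of a clique. -/
theorem TileSys.trans_of_coClq [Nonempty ι] (hT : TileSys H t m w φ) (hm : 1 ≤ m) {u v : ι}
    (h : StrongW.CoClq R (m + 1) u v) (M : ℕ) : Trans H t R (2 * w + 2 * M) M u v := by
  intro S hS
  by_cases huv : u = v
  · subst huv
    obtain ⟨e, he, hcl, -, -⟩ := h
    obtain ⟨π, hπ, -⟩ := exists_clq_of_card he hcl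
    obtain ⟨b, hb⟩ := hT.exists_ach hπ S
    exact ⟨b, fun τ _ => hb.congr fun j => by ring⟩
  obtain ⟨π, hπ, rfl, rfl⟩ := exists_clq_of_coClq hm h huv
  have h01 : (0 : Fin (m + 1)) ≠ 1 := fun h => huv (congrArg π h)
  obtain ⟨δ, hδ, hwin⟩ := exists_signs_window _ w hT.gcd (by
    rintro T d ⟨c, -, rfl⟩
    have h1 : (Finset.univ.filter fun x => t x = T ∧ c x = 0).card ≤ w :=
      (Finset.card_le_card fun x hx => by
        simp only [Finset.mem_filter, Finset.mem_univ, true_and] at hx ⊢; exact hx.1).trans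
        (hT.size T)
    have h2 : (Finset.univ.filter fun x => t x = T ∧ c x = 1).card ≤ w :=
      (Finset.card_le_card fun x hx => by
        simp only [Finset.mem_filter, Finset.mem_univ, true_and] at hx ⊢; exact hx.1).trans
        (hT.size T)
    omega) (2 * M) S hS
  have hc : ∀ T, ∃ c : W → Fin (m + 1), T ∈ S → (∀ x y, t x = T → H.Adj x y → c x ≠ c y) ∧
      δ T = ((Finset.univ.filter fun x => t x = T ∧ c x = 0).card : ℤ) -
      (Finset.univ.filter fun x => t x = T ∧ c x = 1).card := by
    intro T
    by_cases hTS : T ∈ S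
    · obtain ⟨c, hc, hd⟩ := hδ T hTS
      rcases Int.natAbs_eq_natAbs_iff.1 hd with h1 | h1
      · exact ⟨c, fun _ => ⟨hc, h1⟩⟩
      · refine ⟨fun x => Equiv.swap 0 1 (c x), fun _ => ⟨fun x y hx hxy h2 =>
          hc x y hx hxy ((Equiv.swap 0 1).injective h2), ?_⟩⟩
        simp only [Equiv.swap_apply_eq_iff, Equiv.swap_apply_left, Equiv.swap_apply_right]
        rw [h1]; ring
    · exact ⟨φ, fun h => absurd h hTS⟩
  choose c hc using hc
  refine ⟨fun j => ∑ T ∈ S, ((Finset.univ.filter fun x => t x = T ∧ π (c T x) = j).card : ℤ) +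
    M * ((if j = π 1 then 1 else 0) - if j = π 0 then 1 else 0), fun τ hτ => ?_⟩
  rw [abs_le] at hτ
  obtain ⟨U, hU, hUs⟩ := hwin (M + τ) (by omega) (by push_cast; omega)
  refine (ach_toggle (ℓ' := fun T j => ((Finset.univ.filter fun x =>
    t x = T ∧ π (Equiv.swap 0 1 (c T x)) = j).card : ℤ)) (δ := δ)
    (z := fun j => (if j = π 1 then 1 else 0) - if j = π 0 then 1 else 0) hT.adj
    (fun T hTS => ach_colouring hπ (hc T hTS).1)
    (fun T hTS => ach_colouring (c := fun x => Equiv.swap 0 1 (c T x)) hπ fun x y hx hxy h2 =>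
      (hc T hTS).1 x y hx hxy ((Equiv.swap 0 1).injective h2)) (fun T hTS j => ?_) hU).congr
    fun j => ?_
  · rw [(hc T hTS).2]
    by_cases hj : ∃ l, π l = j
    · obtain ⟨l, rfl⟩ := hj
      simp only [hπ.injective.eq_iff, Equiv.swap_apply_eq_iff]
      by_cases hl0 : l = 0
      · subst hl0
        simp only [Equiv.swap_apply_left, if_neg h01, if_true]
        ring
      by_cases hl1 : l = 1
      · subst hl1
        simp only [Equiv.swap_apply_right, if_neg (Ne.symm h01), if_true]
        ring
      · rw [Equiv.swap_apply_of_ne_of_ne hl0 hl1]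
        simp [hl0, hl1]
    · push Not at hj
      simp [hj, Ne.symm (hj 0), Ne.symm (hj 1)]
  · rw [hUs]; ring

end Achieve

section Corrector
set_option linter.unusedSectionVars false
variable {W J ι : Type} [Fintype W] [Fintype J] [Fintype ι]
variable {H : SimpleGraph W} {t : W → J} {R : SimpleGraph ι} {m w : ℕ} {φ : W → Fin (m + 1)}

theorem exists_balanced_signs (D : J → ℤ) (w : ℕ) (hD : ∀ T, |D T| ≤ w) (S : Finset J) :
    ∃ σ : J → Bool, |∑ T ∈ S, if σ T then D T else -D T| ≤ w := by
  induction S using Finset.induction_on with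
  | empty => exact ⟨fun _ => true, by simp⟩
  | insert T S hTS ih =>
    obtain ⟨σ, hσ⟩ := ih
    have h1 : ∀ b : Bool, ∑ T' ∈ insert T S, (if Function.update σ T b T' then D T' else -D T') =
        (if b then D T else -D T) + ∑ T' ∈ S, if σ T' then D T' else -D T' := by
      intro b
      rw [Finset.sum_insert hTS, Function.update_self]
      congr 1
      refine Finset.sum_congr rfl fun T' hT' => ?_
      rw [Function.update_of_ne (fun h => hTS (by rwa [h] at hT'))]
    have h2 := hD T
    rw [abs_le] at h2 hσ
    by_cases h3 : (0 ≤ D T) = (0 ≤ ∑ T' ∈ S, if σ T' then D T' else -D T')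
    · refine ⟨Function.update σ T false, ?_⟩
      rw [h1, abs_le]
      simp only [Bool.false_eq_true, if_false]
      by_cases h4 : 0 ≤ D T
      · have h5 := h3 ▸ h4
        constructor <;> omega
      · have h5 := h3 ▸ h4
        constructor <;> omega
    · refine ⟨Function.update σ T true, ?_⟩
      rw [h1, abs_le]
      simp only [if_true]
      by_cases h4 : 0 ≤ D T
      · have h5 : ¬ 0 ≤ ∑ T' ∈ S, if σ T' then D T' else -D T' := fun h => h3 (by simp [h4, h])
        constructor <;> omega
      · have h5 : 0 ≤ ∑ T' ∈ S, if σ T' then D T' else -D T' := by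
          by_contra h
          exact h3 (by simp [h4, h])
        constructor <;> omega

theorem TileSys.exists_balanced_colouring {φ : W → Fin 2} (hT : TileSys (m := 1) H t w φ)
    (p : W → Prop) : ∃ c : W → Fin 2, (∀ x y, H.Adj x y → c x ≠ c y) ∧
      |((Finset.univ.filter fun x => p x ∧ c x = 0).card : ℤ) -
        (Finset.univ.filter fun x => p x ∧ c x = 1).card| ≤ w := by
  obtain ⟨σ, hσ⟩ := exists_balanced_signs (fun T =>
    ((Finset.univ.filter fun x => t x = T ∧ p x ∧ φ x = 0).card : ℤ) -
      (Finset.univ.filter fun x => t x = T ∧ p x ∧ φ x = 1).card) w (fun T => by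
    have h1 : (Finset.univ.filter fun x => t x = T ∧ p x ∧ φ x = 0).card ≤ w :=
      (Finset.card_le_card fun x hx => by
        simp only [Finset.mem_filter, Finset.mem_univ, true_and] at hx ⊢; exact hx.1).trans
        (hT.size T)
    have h2 : (Finset.univ.filter fun x => t x = T ∧ p x ∧ φ x = 1).card ≤ w :=
      (Finset.card_le_card fun x hx => by
        simp only [Finset.mem_filter, Finset.mem_univ, true_and] at hx ⊢; exact hx.1).trans
        (hT.size T)
    rw [abs_le]
    constructor <;> omega) Finset.univ
  set c : W → Fin 2 := fun x => if σ (t x) then φ x else Equiv.swap 0 1 (φ x) with hc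
  refine ⟨c, fun x y hxy => ?_, ?_⟩
  · simp only [hc, ← hT.adj x y hxy]
    by_cases h : σ (t x)
    · simp only [if_pos h]; exact hT.proper x y hxy
    · simp only [if_neg h]
      exact fun h' => hT.proper x y hxy ((Equiv.swap _ _).injective h')
  · have hfib : ∀ l, ((Finset.univ.filter fun x => p x ∧ c x = l).card : ℤ) =
        ∑ T, ((Finset.univ.filter fun x => t x = T ∧ p x ∧ c x = l).card : ℤ) := by
      intro l
      rw [Finset.card_eq_sum_card_fiberwise (f := t) (t := Finset.univ) (fun x _ => by simp)]
      push_cast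
      refine Finset.sum_congr rfl fun T _ => ?_
      congr 2
      ext x
      simp only [Finset.mem_filter, Finset.mem_univ, true_and]
      tauto
    rw [hfib, hfib, ← Finset.sum_sub_distrib]
    refine le_trans (le_of_eq ?_) hσ
    congr 1
    refine Finset.sum_congr rfl fun T _ => ?_
    by_cases h : σ T
    · have h1 : ∀ l, (Finset.univ.filter fun x => t x = T ∧ p x ∧ c x = l) =
          (Finset.univ.filter fun x => t x = T ∧ p x ∧ φ x = l) := by
        intro l
        refine Finset.filter_congr fun x _ => and_congr_right fun hx => ?_
        simp only [hc, hx, if_pos h]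
      rw [if_pos h, h1, h1]
    · have h1 : ∀ l, (Finset.univ.filter fun x => t x = T ∧ p x ∧ c x = l) =
          (Finset.univ.filter fun x => t x = T ∧ p x ∧ φ x = Equiv.swap 0 1 l) := by
        intro l
        refine Finset.filter_congr fun x _ => and_congr_right fun hx => ?_
        simp only [hc, hx, if_neg h, Equiv.swap_apply_eq_iff]
      rw [if_neg h, h1, h1, Equiv.swap_apply_left, Equiv.swap_apply_right]
      ring

theorem card_filter_fin_two (p : W → Prop) (c : W → Fin 2) (i i' s : ι) :
    ((Finset.univ.filter fun x => p x ∧ (if c x = 0 then i else i') = s).card : ℤ) =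
      (Finset.univ.filter fun x => p x ∧ c x = 0).card * (if s = i then 1 else 0) +
      (Finset.univ.filter fun x => p x ∧ c x = 1).card * (if s = i' then 1 else 0) := by
  rw [Finset.card_filter, Finset.card_filter, Finset.card_filter]
  push_cast
  rw [Finset.sum_mul, Finset.sum_mul, ← Finset.sum_add_distrib]
  refine Finset.sum_congr rfl fun x _ => ?_
  by_cases hp : p x
  · rcases (by omega : c x = 0 ∨ c x = 1) with h | h
    · simp [hp, h, eq_comm]
    · simp [hp, h, eq_comm]
  · simp [hp]

theorem card_filter_fin_two_add (p : W → Prop) (c : W → Fin 2) :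
    (Finset.univ.filter fun x => p x ∧ c x = 0).card +
      (Finset.univ.filter fun x => p x ∧ c x = 1).card = (Finset.univ.filter p).card := by
  rw [← Finset.card_union_of_disjoint]
  · congr 1
    ext x
    simp only [Finset.mem_filter, Finset.mem_univ, true_and, Finset.mem_union]
    have : c x = 0 ∨ c x = 1 := by omega
    tauto
  · rw [Finset.disjoint_left]
    intro x hx hx'
    simp only [Finset.mem_filter, Finset.mem_univ, true_and] at hx hx'
    rw [hx.2] at hx'
    exact absurd hx'.2 (by decide)

/-- Moving unions of components between two edges of `R`. -/
theorem TileSys.exists_ach_edges [Nonempty ι] {φ : W → Fin 2} (hT : TileSys (m := 1) H t w φ)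
    {i i' j j' : ι} (hi : R.Adj i i') (hj : R.Adj j j') (M : ℕ) {S : Finset J}
    (hS : 2 * w + 2 * M ≤ S.card) : ∃ b : ι → ℤ, ∀ τ : ℤ, |τ| ≤ M → ∃ y y' : ℤ,
      |y| ≤ M + w ∧ |y'| ≤ M + w ∧ Ach H t R S fun s => b s +
        τ * ((if s = j then 1 else 0) - if s = i then 1 else 0) +
        y * ((if s = i' then 1 else 0) - if s = i then 1 else 0) +
        y' * ((if s = j' then 1 else 0) - if s = j then 1 else 0) := by
  obtain ⟨δ, hδ, hwin⟩ := exists_signs_window _ w (hT.gcd_comp rfl) (by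
    rintro T d ⟨Q, hQ, -, rfl⟩
    exact (Finset.card_le_card fun x hx => by simpa using hQ x hx).trans (hT.size T))
    (2 * M) S hS
  have hQ : ∀ T, ∃ Q : Finset W, T ∈ S → (∀ x ∈ Q, t x = T) ∧
    (∀ x y, H.Adj x y → (x ∈ Q ↔ y ∈ Q)) ∧ (δ T).natAbs = Q.card := by
    intro T
    by_cases h : T ∈ S
    · obtain ⟨Q, h1⟩ := hδ T h
      exact ⟨Q, fun _ => h1⟩
    · exact ⟨∅, fun h' => absurd h' h⟩
  choose Q hQ using hQ
  set B : ℤ := ∑ T ∈ S, if δ T < 0 then ((Q T).card : ℤ) else 0 with hB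
  set Tot : ℤ := ((Finset.univ.filter fun x => t x ∈ S).card : ℤ) with hTot
  refine ⟨fun s => (Tot - B - M - (Tot - B - M) / 2) * (if s = i then 1 else 0) +
    (Tot - B - M) / 2 * (if s = i' then 1 else 0) +
    (B + M - (B + M) / 2) * (if s = j then 1 else 0) +
    (B + M) / 2 * (if s = j' then 1 else 0), fun τ hτ => ?_⟩
  rw [abs_le] at hτ
  obtain ⟨U, hU, hUs⟩ := hwin (M + τ) (by omega) (by push_cast; omega)
  set g : W → Prop := fun x => x ∈ Q (t x) ∧ (t x ∈ U ↔ 0 ≤ δ (t x)) with hg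
  obtain ⟨p₁, hp₁⟩ : ∃ p : W → Prop, ∀ x, p x ↔ t x ∈ S ∧ ¬ g x := ⟨_, fun _ => Iff.rfl⟩
  obtain ⟨p₂, hp₂⟩ : ∃ p : W → Prop, ∀ x, p x ↔ t x ∈ S ∧ g x := ⟨_, fun _ => Iff.rfl⟩
  obtain ⟨c₁, hc₁, hb₁⟩ := hT.exists_balanced_colouring p₁
  obtain ⟨c₂, hc₂, hb₂⟩ := hT.exists_balanced_colouring p₂
  have e₁ := card_filter_fin_two_add p₁ c₁
  have e₂ := card_filter_fin_two_add p₂ c₂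
  have hcount : ((Finset.univ.filter p₂).card : ℤ) = B + M + τ := by
    have h1 : ∑ T ∈ U, δ T = ∑ T ∈ S, if T ∈ U then δ T else 0 := by
      rw [Finset.sum_ite_mem, Finset.inter_eq_right.2 hU]
    rw [add_assoc, ← hUs, h1, hB, ← Finset.sum_add_distrib,
      Finset.card_eq_sum_card_fiberwise (f := t) (t := S) (fun x hx => by
        simpa using ((hp₂ x).1 (Finset.mem_filter.1 hx).2).1)]
    push_cast
    refine Finset.sum_congr rfl fun T hTS => ?_
    obtain ⟨h2, -, h3⟩ := hQ T hTS
    have h4 : (Finset.univ.filter p₂).filter (fun x => t x = T) =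
        if (T ∈ U ↔ 0 ≤ δ T) then Q T else ∅ := by
      ext x
      simp only [Finset.mem_filter, Finset.mem_univ, true_and, hp₂, hg]
      constructor
      · rintro ⟨⟨-, h5, h6⟩, rfl⟩
        rwa [if_pos h6]
      · intro h5
        by_cases h6 : (T ∈ U ↔ 0 ≤ δ T)
        · rw [if_pos h6] at h5
          have h7 := h2 x h5
          subst h7
          exact ⟨⟨hTS, h5, h6⟩, rfl⟩
        · rw [if_neg h6] at h5
          exact absurd h5 (Finset.notMem_empty _)
    rw [h4]
    have h7 : ((if (T ∈ U ↔ 0 ≤ δ T) then Q T else ∅).card : ℤ) =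
        if (T ∈ U ↔ 0 ≤ δ T) then ((δ T).natAbs : ℤ) else 0 := by
      rw [h3]
      split_ifs
      · rfl
      · simp
    rw [h7, ← h3]
    by_cases h5 : T ∈ U
    · rcases lt_or_ge (δ T) 0 with h6 | h6
      · rw [if_neg (by simp [h5, h6]), if_pos h6, if_pos h5]; omega
      · rw [if_pos (by simp [h5, h6]), if_neg (not_lt.2 h6), if_pos h5]; omega
    · rcases lt_or_ge (δ T) 0 with h6 | h6
      · rw [if_pos (by simp [h5, h6]), if_pos h6, if_neg h5]; omega
      · rw [if_neg (by simp [h5, h6]), if_neg (not_lt.2 h6), if_neg h5]; omega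
  have hcount' : ((Finset.univ.filter p₁).card : ℤ) =
      Tot - (B + M + τ) := by
    rw [hTot, ← hcount, eq_sub_iff_add_eq, ← Nat.cast_add, ← Finset.card_union_of_disjoint]
    · congr 2
      ext x
      simp only [Finset.mem_filter, Finset.mem_univ, true_and, Finset.mem_union, hp₁, hp₂]
      tauto
    · rw [Finset.disjoint_left]
      intro x hx hx'
      exact ((hp₁ x).1 (Finset.mem_filter.1 hx).2).2 ((hp₂ x).1 (Finset.mem_filter.1 hx').2).2
  rw [abs_le] at hb₁ hb₂
  beta_reduce at e₁ e₂
  set n₁₀ := (Finset.univ.filter fun x => p₁ x ∧ c₁ x = 0).card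
  set n₁₁ := (Finset.univ.filter fun x => p₁ x ∧ c₁ x = 1).card
  set n₂₀ := (Finset.univ.filter fun x => p₂ x ∧ c₂ x = 0).card
  set n₂₁ := (Finset.univ.filter fun x => p₂ x ∧ c₂ x = 1).card
  refine ⟨n₁₁ - (Tot - B - M) / 2, n₂₁ - (B + M) / 2, by rw [abs_le]; constructor <;> omega,
    by rw [abs_le]; constructor <;> omega,
    fun x => if g x then (if c₂ x = 0 then j else j') else (if c₁ x = 0 then i else i'),
    fun x y hx hxy => ?_, fun s => ?_⟩
  · have h1 : g x ↔ g y := by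
      simp only [hg, ← hT.adj x y hxy, (hQ (t x) hx).2.1 x y hxy]
    by_cases hgx : g x
    · have h2 := hc₂ x y hxy
      simp only [if_pos hgx, if_pos (h1.1 hgx)]
      by_cases h3 : c₂ x = 0
      · rw [if_pos h3, if_neg (by omega)]; exact hj
      · rw [if_neg h3, if_pos (by omega)]; exact hj.symm
    · have h2 := hc₁ x y hxy
      simp only [if_neg hgx, if_neg (fun h => hgx (h1.2 h))]
      by_cases h3 : c₁ x = 0
      · rw [if_pos h3, if_neg (by omega)]; exact hi
      · rw [if_neg h3, if_pos (by omega)]; exact hi.symm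
  · have h1 : ((Finset.univ.filter fun x => t x ∈ S ∧
        (if g x then (if c₂ x = 0 then j else j') else (if c₁ x = 0 then i else i')) = s).card : ℤ)
        = (Finset.univ.filter fun x => p₁ x ∧ (if c₁ x = 0 then i else i') = s).card +
        (Finset.univ.filter fun x => p₂ x ∧ (if c₂ x = 0 then j else j') = s).card := by
      rw [← Nat.cast_add, ← Finset.card_union_of_disjoint]
      · congr 2
        ext x
        simp only [Finset.mem_filter, Finset.mem_univ, true_and, Finset.mem_union, hp₁, hp₂]
        by_cases hgx : g x <;> simp [hgx]
      · rw [Finset.disjoint_left]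
        intro x hx hx'
        exact ((hp₁ x).1 (Finset.mem_filter.1 hx).2.1).2 ((hp₂ x).1 (Finset.mem_filter.1 hx').2.1).2
    rw [h1, card_filter_fin_two p₁, card_filter_fin_two p₂]
    have h2 : (n₁₀ : ℤ) = Tot - (B + M + τ) - n₁₁ := by omega
    have h3 : (n₂₀ : ℤ) = B + M + τ - n₂₁ := by omega
    change (n₁₀ : ℤ) * _ + n₁₁ * _ + (n₂₀ * _ + n₂₁ * _) = _
    rw [h2, h3]
    ring

end Corrector

section Corrector
set_option linter.unusedSectionVars false
variable {W J ι : Type} [Fintype W] [Fintype J] [Fintype ι]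
variable {H : SimpleGraph W} {t : W → J} {R : SimpleGraph ι} {m w : ℕ} {φ : W → Fin (m + 1)}

theorem exists_split_card {S : Finset J} {N N' : ℕ} (h : N + N' ≤ S.card) :
    ∃ S₁ S₂ : Finset J, S = S₁ ∪ S₂ ∧ Disjoint S₁ S₂ ∧ N ≤ S₁.card ∧ N' ≤ S₂.card := by
  obtain ⟨S₁, h1, h2⟩ := Finset.exists_subset_card_eq (s := S) (n := N) (by omega)
  refine ⟨S₁, S \ S₁, (Finset.union_sdiff_of_subset h1).symm, Finset.disjoint_sdiff, h2.ge, ?_⟩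
  rw [Finset.card_sdiff_of_subset h1]
  omega

theorem Trans.mono {N N' M : ℕ} {u v : ι} (h : Trans H t R N M u v) (hN : N ≤ N') :
    Trans H t R N' M u v := fun S hS => h S (hN.trans hS)

theorem Trans.comp (hH : ∀ x y, H.Adj x y → t x = t y) {N N' M : ℕ} {u v x : ι}
    (h : Trans H t R N M u v) (h' : Trans H t R N' M v x) : Trans H t R (N + N') M u x := by
  intro S hS
  obtain ⟨S₁, S₂, rfl, hd, h1, h2⟩ := exists_split_card hS
  obtain ⟨b, hb⟩ := h S₁ h1
  obtain ⟨b', hb'⟩ := h' S₂ h2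
  exact ⟨fun j => b j + b' j, fun τ hτ => ((hb τ hτ).union hH hd (hb' τ hτ)).congr fun j => by ring⟩

theorem coClq_two_of_adj {i j : ι} (h : R.Adj i j) : StrongW.CoClq R (1 + 1) i j := by
  refine ⟨{i, j}, Finset.card_pair h.ne, ?_, by simp, by simp⟩
  intro a ha b hb hab
  simp only [Finset.coe_insert, Finset.coe_singleton, Set.mem_insert_iff,
    Set.mem_singleton_iff] at ha hb
  rcases ha with rfl | rfl <;> rcases hb with rfl | rfl
  · exact absurd rfl hab
  · exact h
  · exact h.symm
  · exact absurd rfl hab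

theorem TileSys.trans_of_adj [Nonempty ι] {φ : W → Fin 2} (hT : TileSys (m := 1) H t w φ)
    {i i' j j' : ι} (hi : R.Adj i i') (hj : R.Adj j j') (M : ℕ) :
    Trans H t R (10 * w + 8 * M) M i j := by
  intro S hS
  obtain ⟨S₁, S', rfl, hd, h1, h'⟩ := exists_split_card (N := 2 * w + 2 * M)
    (N' := (2 * w + 2 * (M + w)) + (2 * w + 2 * (M + w))) (S := S) (by omega)
  obtain ⟨S₂, S₃, rfl, hd', h2, h3⟩ := exists_split_card h'
  obtain ⟨b, hb⟩ := hT.exists_ach_edges hi hj M h1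
  obtain ⟨b₂, hb₂⟩ := hT.trans_of_coClq le_rfl (coClq_two_of_adj hi.symm) (M + w) S₂ h2
  obtain ⟨b₃, hb₃⟩ := hT.trans_of_coClq le_rfl (coClq_two_of_adj hj.symm) (M + w) S₃ h3
  refine ⟨fun s => b s + (b₂ s + b₃ s), fun τ hτ => ?_⟩
  obtain ⟨y, y', hy, hy', ha⟩ := hb τ hτ
  exact (ha.union hT.adj hd ((hb₂ y (by exact_mod_cast hy)).union hT.adj hd'
    (hb₃ y' (by exact_mod_cast hy')))).congr fun s => by ring

theorem TileSys.trans_of_chain [Nonempty ι] (hT : TileSys H t m w φ) (hm : 1 ≤ m) {x y : ι}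
    (h : ∃ b z b', StrongW.CoClq R (m + 1) x b ∧ StrongW.CoClq R (m + 1) b z ∧
      StrongW.CoClq R (m + 1) z b' ∧ StrongW.CoClq R (m + 1) b' y) (M : ℕ) :
    Trans H t R (10 * w + 8 * M) M x y := by
  obtain ⟨b, z, b', h1, h2, h3, h4⟩ := h
  exact ((((hT.trans_of_coClq hm h1 M).comp hT.adj (hT.trans_of_coClq hm h2 M)).comp hT.adj
    (hT.trans_of_coClq hm h3 M)).comp hT.adj (hT.trans_of_coClq hm h4 M)).mono (by omega)

theorem TileSys.trans [Nonempty ι] (hT : TileSys H t m w φ) (hm : 1 ≤ m)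
    (hconn : 2 ≤ m → ∀ x y, ∃ b z b', StrongW.CoClq R (m + 1) x b ∧ StrongW.CoClq R (m + 1) b z ∧
      StrongW.CoClq R (m + 1) z b' ∧ StrongW.CoClq R (m + 1) b' y)
    (hadj : ∀ i, ∃ j, R.Adj i j) (M : ℕ) (x y : ι) : Trans H t R (10 * w + 8 * M) M x y := by
  rcases hm.eq_or_lt with rfl | h2
  · obtain ⟨x', hx⟩ := hadj x
    obtain ⟨y', hy⟩ := hadj y
    exact hT.trans_of_adj hx hy M
  · exact hT.trans_of_chain hm (hconn h2 x y) M

/-- A large set of tiles can correct any small imbalance. -/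
theorem TileSys.exists_corrector [Nonempty ι] (hT : TileSys H t m w φ) {M N : ℕ}
    (htr : ∀ x y, Trans H t R N M x y) {π : Fin (m + 1) → ι} (hπ : Clq R π)
    {S : Finset J} (hS : Fintype.card ι * N ≤ S.card) :
    ∃ b : ι → ℤ, ∀ err : ι → ℤ, ∑ j, err j = 0 → (∀ j, |err j| ≤ M) →
      Ach H t R S fun j => b j + err j := by
  have i₀ : ι := Classical.arbitrary ι
  have key : ∀ (I : Finset ι) (S : Finset J), I.card * N ≤ S.card → ∃ b : ι → ℤ, ∀ err : ι → ℤ,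
      (∀ j, |err j| ≤ M) → Ach H t R S fun j => b j +
        ∑ i ∈ I, err i * ((if j = i then 1 else 0) - if j = i₀ then 1 else 0) := by
    intro I
    induction I using Finset.induction_on with
    | empty =>
      intro S _
      obtain ⟨b, hb⟩ := hT.exists_ach hπ S
      exact ⟨b, fun err _ => hb.congr fun j => by simp⟩
    | insert i I hi ih =>
      intro S hS
      rw [Finset.card_insert_of_notMem hi, add_mul, one_mul] at hS
      obtain ⟨S₁, S₂, rfl, hd, h1, h2⟩ := exists_split_card hS
      obtain ⟨b, hb⟩ := ih S₁ h1
      obtain ⟨b', hb'⟩ := htr i₀ i S₂ h2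
      refine ⟨fun j => b j + b' j, fun err herr => ((hb err herr).union hT.adj hd
        (hb' _ (herr i))).congr fun j => ?_⟩
      rw [Finset.sum_insert hi]
      ring
  obtain ⟨b, hb⟩ := key Finset.univ S hS
  refine ⟨b, fun err h0 herr => (hb err herr).congr fun j => ?_⟩
  congr 1
  simp only [mul_sub, Finset.sum_sub_distrib, ← Finset.sum_mul, h0, zero_mul, sub_zero]
  simp

end Corrector

section MainTiles

theorem sum_perm_apply_comm {m : ℕ} {θ : Equiv.Perm (Fin (m + 1)) → ℝ} {a b : Fin (m + 1)}
    (hθ : ∀ σ, θ (σ * Equiv.swap a b) = θ σ) (N : Fin (m + 1) → ℝ) :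
    ∑ σ, θ σ * N (σ a) = ∑ σ, θ σ * N (σ b) := by
  rw [← Equiv.sum_comp (Equiv.mulRight (Equiv.swap a b)) fun σ => θ σ * N (σ a)]
  refine Finset.sum_congr rfl fun σ _ => ?_
  simp only [Equiv.coe_mulRight, hθ, Equiv.Perm.mul_apply, Equiv.swap_apply_left]

theorem sum_sum_perm {m : ℕ} (θ : Equiv.Perm (Fin (m + 1)) → ℝ) (N : Fin (m + 1) → ℝ) :
    ∑ l, ∑ σ, θ σ * N (σ l) = (∑ σ, θ σ) * ∑ l, N l := by
  rw [Finset.sum_comm, Finset.sum_mul]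
  refine Finset.sum_congr rfl fun σ _ => ?_
  rw [← Finset.mul_sum, Equiv.sum_comp σ N]

/-- If some colour class is small, then a suitable random permutation of the colours makes the
expected size of colour class `0` proportional to `1 - m / χ`, and that of all other colour classes
proportional to `1 / χ`. -/
theorem exists_perm_weights {m : ℕ} (hm : 1 ≤ m) {χ : ℝ} (hχ : m < χ) (hχ' : χ ≤ m + 1)
    {N : Fin (m + 1) → ℝ} (hN : ∀ l, 0 ≤ N l) {l₀ : Fin (m + 1)}
    (hl₀ : N l₀ ≤ (1 - m / χ) * ∑ l, N l) :
    ∃ θ : Equiv.Perm (Fin (m + 1)) → ℝ, (∀ σ, 0 ≤ θ σ) ∧ ∑ σ, θ σ = 1 ∧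
      ∀ l, ∑ σ, θ σ * N (σ l) = colWt m χ l * ∑ l, N l := by
  have hm0 : (0 : ℝ) < m := by exact_mod_cast hm
  have hχ0 : 0 < χ := hm0.trans hχ
  set tot := ∑ l, N l with htot
  have htot0 : 0 ≤ tot := Finset.sum_nonneg fun l _ => hN l
  set u : Equiv.Perm (Fin (m + 1)) → ℝ := fun _ => (Fintype.card (Equiv.Perm (Fin (m + 1))) : ℝ)⁻¹
    with hu
  set M := (Finset.univ.filter fun σ : Equiv.Perm (Fin (m + 1)) => σ 0 = l₀).card with hM
  have hM0 : (0 : ℝ) < M := by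
    rw [hM, Nat.cast_pos, Finset.card_pos]
    exact ⟨Equiv.swap 0 l₀, by simp⟩
  set s : Equiv.Perm (Fin (m + 1)) → ℝ := fun σ => if σ 0 = l₀ then (M : ℝ)⁻¹ else 0 with hs
  have hu1 : ∑ σ, u σ = 1 := by
    simp only [hu, Finset.sum_const, Finset.card_univ, nsmul_eq_mul]
    exact mul_inv_cancel₀ (by exact_mod_cast Fintype.card_ne_zero)
  have hs1 : ∑ σ, s σ = 1 := by
    simp only [hs]
    rw [← Finset.sum_filter, Finset.sum_const, nsmul_eq_mul, ← hM]
    exact mul_inv_cancel₀ hM0.ne'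
  have hu0 : ∑ σ, u σ * N (σ 0) = tot / (m + 1) := by
    have h := sum_sum_perm u N
    rw [Finset.sum_congr rfl fun l _ => sum_perm_apply_comm (a := l) (b := 0) (fun σ => rfl) N,
      hu1, one_mul, Finset.sum_const, Finset.card_univ, Fintype.card_fin, nsmul_eq_mul] at h
    push_cast at h
    field_simp
    linarith
  have hs0 : ∑ σ, s σ * N (σ 0) = N l₀ := by
    have : ∀ σ, s σ * N (σ 0) = s σ * N l₀ := by
      intro σ
      simp only [hs]
      split_ifs with h
      · rw [h]
      · simp
    rw [Finset.sum_congr rfl fun σ _ => this σ, ← Finset.sum_mul, hs1, one_mul]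
  have hc : (1 - m / χ) * tot ≤ tot / (m + 1) := by
    rw [div_eq_mul_inv tot, mul_comm tot]
    refine mul_le_mul_of_nonneg_right ?_ htot0
    rw [sub_le_comm, le_div_iff₀ hχ0]
    have h1 : (1 - ((m : ℝ) + 1)⁻¹) * (m + 1) = m := by field_simp; ring
    have h2 : ((m : ℝ) + 1)⁻¹ ≤ 1 := inv_le_one_of_one_le₀ (by linarith)
    nlinarith
  obtain ⟨lam, h0, h1, hlam⟩ : ∃ lam : ℝ, 0 ≤ lam ∧ lam ≤ 1 ∧
      lam * (tot / (m + 1)) + (1 - lam) * N l₀ = (1 - m / χ) * tot := by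
    rcases eq_or_lt_of_le (hl₀.trans hc) with h | h
    · exact ⟨0, le_rfl, zero_le_one, by linarith⟩
    · refine ⟨((1 - m / χ) * tot - N l₀) / (tot / (m + 1) - N l₀),
        div_nonneg (by linarith) (by linarith), (div_le_one (by linarith)).2 (by linarith), ?_⟩
      have : tot / (m + 1) - N l₀ ≠ 0 := by linarith
      linear_combination div_mul_cancel₀ ((1 - m / χ) * tot - N l₀) this
  set θ : Equiv.Perm (Fin (m + 1)) → ℝ := fun σ => lam * u σ + (1 - lam) * s σ with hθ
  have hθ1 : ∑ σ, θ σ = 1 := by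
    simp only [hθ, Finset.sum_add_distrib, ← Finset.mul_sum, hu1, hs1]; ring
  have hX0 : ∑ σ, θ σ * N (σ 0) = (1 - m / χ) * tot := by
    rw [← hlam, ← hu0, ← hs0, Finset.mul_sum, Finset.mul_sum, ← Finset.sum_add_distrib]
    exact Finset.sum_congr rfl fun σ _ => by simp only [hθ]; ring
  refine ⟨θ, fun σ => ?_, hθ1, fun l => ?_⟩
  · have : 0 ≤ u σ := by simp only [hu]; positivity
    have : 0 ≤ s σ := by simp only [hs]; split_ifs <;> positivity
    have : 0 ≤ 1 - lam := by linarith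
    simp only [hθ]; positivity
  · unfold colWt
    split_ifs with hl
    · rw [hl, hX0]
    · have hall : ∀ l' : Fin (m + 1), l' ≠ 0 → ∑ σ, θ σ * N (σ l') = ∑ σ, θ σ * N (σ l) := by
        intro l' hl'
        refine sum_perm_apply_comm (fun σ => ?_) N
        simp only [hθ, hs, hu, Equiv.Perm.mul_apply,
          Equiv.swap_apply_of_ne_of_ne (Ne.symm hl') (Ne.symm hl)]
      have h := sum_sum_perm θ N
      rw [hθ1, one_mul, Fin.sum_univ_succ, hX0,
        Finset.sum_congr rfl fun l' _ => hall _ (Fin.succ_ne_zero l'), Finset.sum_const,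
        Finset.card_univ, Fintype.card_fin, nsmul_eq_mul, ← htot] at h
      have h2 : (m : ℝ) * ∑ σ, θ σ * N (σ l) = m / χ * tot := by linear_combination h
      field_simp at h2 ⊢
      linarith
/-- The number of ways to map the colour classes of a tile to `r` vertices. -/
def cfgCard (r m : ℕ) : ℕ := r ^ (m + 1) * (m + 1).factorial

/-- The error bound for the assignment of tiles, in terms of the maximum order of a tile. -/
def mainErr (r m : ℕ) : ℕ := cfgCard r m * (m + 1) * ((m + 1) * cfgCard r m + 1)

variable {W J ι : Type} [Fintype W] [Fintype J] [Fintype ι]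
variable {H : SimpleGraph W} {t : W → J} {R : SimpleGraph ι} {m w : ℕ} {φ : W → Fin (m + 1)}

/-- If `T` satisfies the degree condition, then the tiles can be mapped to the reduced graph such
that about `T j` vertices are mapped to each `j`. -/
theorem TileSys.exists_approx [Nonempty ι] (hT : TileSys H t m w φ) (hm : 1 ≤ m) {χ : ℝ}
    (hχ : m < χ) (hχ' : χ ≤ m + 1) (S : Finset J) {D : ι → ℝ} (hD0 : ∀ j, 0 ≤ D j)
    (hD : DegCondW R D m χ) (hsum : ∑ j, D j = ((Finset.univ.filter fun x => t x ∈ S).card : ℝ))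
    (hpos : 0 < (Finset.univ.filter fun x => t x ∈ S).card)
    {l₀ : Fin (m + 1)} (hα : ((Finset.univ.filter fun x => t x ∈ S ∧ φ x = l₀).card : ℝ) ≤
      (1 - m / χ) * (Finset.univ.filter fun x => t x ∈ S).card) :
    ∃ ℓ : ι → ℤ, Ach H t R S ℓ ∧
      ∀ j, |(ℓ j : ℝ) - D j| ≤ (mainErr (Fintype.card ι) m : ℝ) * w := by
  obtain ⟨ω, hω0, hω, hωD⟩ := exists_fractional_tiling R D hD0 m χ hχ hχ' hD
  set u : J → Fin (m + 1) → ℝ := fun T l =>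
    if T ∈ S then ((Finset.univ.filter fun x => t x = T ∧ φ x = l).card : ℝ) else 0 with hu
  set n : ℝ := ((Finset.univ.filter fun x => t x ∈ S).card : ℝ) with hn
  have hn0 : 0 < n := by rw [hn]; exact_mod_cast hpos
  set N : Fin (m + 1) → ℝ := fun l => ∑ T, u T l with hN
  have hNl : ∀ l, N l = ((Finset.univ.filter fun x => t x ∈ S ∧ φ x = l).card : ℝ) := by
    intro l
    rw [Finset.card_eq_sum_card_fiberwise (f := t) (t := S) (fun x hx => by
      simpa using (Finset.mem_filter.1 hx).2.1)]
    push_cast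
    simp only [hN, hu, Finset.sum_ite_mem, Finset.univ_inter]
    refine Finset.sum_congr rfl fun T hT => ?_
    congr 2
    ext x
    simp only [Finset.mem_filter, Finset.mem_univ, true_and]
    constructor
    · rintro ⟨rfl, h2⟩; exact ⟨⟨hT, h2⟩, rfl⟩
    · rintro ⟨⟨h1, h2⟩, rfl⟩; exact ⟨rfl, h2⟩
  have hNsum : ∑ l, N l = n := by
    rw [hn, Finset.card_eq_sum_card_fiberwise (f := φ) (t := Finset.univ) (fun x hx => by simp)]
    push_cast
    refine Finset.sum_congr rfl fun l _ => ?_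
    rw [hNl, Finset.filter_filter]
  obtain ⟨θ, hθ0, hθ1, hθ⟩ := exists_perm_weights hm hχ hχ' (N := N) (l₀ := l₀)
    (fun l => by rw [hNl]; positivity) (by rw [hNl, hNsum]; exact hα)
  rw [hNsum] at hθ
  have hωsum : ∑ π, ω π = n := by
    rw [← hsum, ← Finset.sum_congr rfl fun j _ => hωD j, Finset.sum_comm]
    refine Finset.sum_congr rfl fun π _ => ?_
    rw [← Finset.mul_sum, Finset.sum_comm]
    simp only [← Finset.mul_sum, Finset.sum_ite_eq, Finset.mem_univ, if_true, mul_one, sum_colWt]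
  let Cfg := (Fin (m + 1) → ι) × Equiv.Perm (Fin (m + 1))
  have hCfg : Fintype.card Cfg = cfgCard (Fintype.card ι) m := by
    simp [Cfg, cfgCard, Fintype.card_prod, Fintype.card_perm]
  set p : Cfg → ℝ := fun c => ω c.1 / n * θ c.2 with hp
  have hp0 : ∀ c, 0 ≤ p c := fun c => mul_nonneg (div_nonneg (hω0 _) hn0.le) (hθ0 _)
  have hp1 : ∑ c, p c = 1 := by
    rw [Fintype.sum_prod_type]
    simp only [hp, ← Finset.mul_sum, hθ1, mul_one, ← Finset.sum_div, hωsum]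
    exact div_self hn0.ne'
  have hsub : ∀ f : Cfg → ℝ, ∑ c, p c * f c = ∑ c : {c : Cfg // p c ≠ 0}, p c * f c := by
    intro f
    rw [← Finset.sum_subtype (Finset.univ.filter fun c => p c ≠ 0) (by simp) fun c => p c * f c]
    refine (Finset.sum_filter_of_ne fun c _ hc => ?_).symm
    exact left_ne_zero_of_mul hc
  have hp1' : ∑ c : {c : Cfg // p c ≠ 0}, p c = 1 := by
    have := hsub fun _ => 1
    simp only [mul_one] at this
    rw [← this, hp1]
  obtain ⟨f, hf⟩ := exists_proportional_split u w (fun T l => by simp only [hu]; positivity)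
    (fun T l => by
      simp only [hu]
      split_ifs
      · exact_mod_cast (Finset.card_le_card fun x => by simp +contextual).trans (hT.size T)
      · positivity) (Nat.cast_nonneg w) (fun c : {c : Cfg // p c ≠ 0} => p c) (fun c => hp0 c) hp1'
  set a : W → ι := fun x => (f (t x)).1.1 ((f (t x)).1.2.symm (φ x)) with ha
  refine ⟨fun j => ((Finset.univ.filter fun x => t x ∈ S ∧ a x = j).card : ℤ), ⟨a, ?_, fun j => rfl⟩,
    fun j => ?_⟩
  · intro x y hx hxy
    have hcl : Clq R (f (t x)).1.1 := hω _ fun h => (f (t x)).2 (by simp only [hp, h]; simp)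
    simp only [ha, ← hT.adj x y hxy]
    exact hcl _ _ fun h => hT.proper x y hxy ((Equiv.injective _) h)
  · have hload : ((Finset.univ.filter fun x => t x ∈ S ∧ a x = j).card : ℝ) =
        ∑ c : {c : Cfg // p c ≠ 0}, ∑ l, (if c.1.1 l = j then 1 else 0) *
          ∑ T, (if f T = c then u T (c.1.2 l) else 0) := by
      have h1 : ∀ T, (∑ c : {c : Cfg // p c ≠ 0}, ∑ l, (if c.1.1 l = j then 1 else 0) *
          (if f T = c then u T (c.1.2 l) else 0)) =
          if T ∈ S then ((Finset.univ.filter fun x => t x = T ∧ a x = j).card : ℝ) else 0 := by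
        intro T
        rw [Finset.sum_eq_single (f T) (fun c _ hc => by simp [hc.symm]) (by simp)]
        simp only [if_true, hu]
        split_ifs with hTS
        · rw [Finset.card_eq_sum_card_fiberwise (f := fun x => (f T).1.2.symm (φ x))
            (t := Finset.univ) (fun x hx => by simp)]
          push_cast
          refine Finset.sum_congr rfl fun l _ => ?_
          rw [Finset.filter_filter]
          split_ifs with hl
          · rw [one_mul]
            congr 2
            ext x
            simp only [Finset.mem_filter, Finset.mem_univ, true_and, ha, Equiv.symm_apply_eq]
            constructor
            · rintro ⟨rfl, h⟩
              refine ⟨⟨rfl, ?_⟩, h⟩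
              rw [h, Equiv.symm_apply_apply, hl]
            · rintro ⟨⟨rfl, -⟩, h⟩; exact ⟨rfl, h⟩
          · rw [zero_mul, eq_comm, Nat.cast_eq_zero, Finset.card_eq_zero, Finset.filter_eq_empty_iff]
            rintro x - ⟨⟨rfl, h⟩, h'⟩
            simp only [ha, h'] at h
            exact hl h
        · simp
      have h2 : ∀ c : {c : Cfg // p c ≠ 0}, (∑ l, (if c.1.1 l = j then (1 : ℝ) else 0) *
          ∑ T, (if f T = c then u T (c.1.2 l) else 0)) =
          ∑ T, ∑ l, (if c.1.1 l = j then 1 else 0) * (if f T = c then u T (c.1.2 l) else 0) := by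
        intro c
        rw [Finset.sum_comm]
        simp only [Finset.mul_sum]
      rw [Finset.sum_congr rfl fun c _ => h2 c, Finset.sum_comm, Finset.sum_congr rfl fun T _ => h1 T,
        Finset.sum_ite_mem, Finset.univ_inter,
        Finset.card_eq_sum_card_fiberwise (f := t) (t := S) (fun x hx => by
          simpa using (Finset.mem_filter.1 hx).2.1)]
      push_cast
      refine Finset.sum_congr rfl fun T hT => ?_
      congr 2
      ext x
      simp only [Finset.mem_filter, Finset.mem_univ, true_and]
      constructor
      · rintro ⟨⟨h1, h2⟩, rfl⟩; exact ⟨rfl, h2⟩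
      · rintro ⟨rfl, h2⟩; exact ⟨⟨hT, h2⟩, rfl⟩
    have hexp : D j = ∑ c : {c : Cfg // p c ≠ 0}, ∑ l, (if c.1.1 l = j then 1 else 0) *
        (p c * N (c.1.2 l)) := by
      have h1 : ∀ c : {c : Cfg // p c ≠ 0}, (∑ l, (if c.1.1 l = j then 1 else 0) *
          (p c * N (c.1.2 l))) = p c * ∑ l, (if c.1.1 l = j then 1 else 0) * N (c.1.2 l) := by
        intro c
        rw [Finset.mul_sum]
        exact Finset.sum_congr rfl fun l _ => by ring
      rw [Finset.sum_congr rfl fun c _ => h1 c,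
        ← hsub fun c => ∑ l, (if c.1 l = j then 1 else 0) * N (c.2 l), Fintype.sum_prod_type,
        ← hωD j]
      refine Finset.sum_congr rfl fun π _ => ?_
      simp only [hp, mul_assoc, ← Finset.mul_sum]
      rw [div_mul_eq_mul_div, mul_div_assoc]
      congr 1
      rw [eq_div_iff hn0.ne', Finset.sum_mul]
      simp only [Finset.mul_sum]
      rw [Finset.sum_comm]
      refine Finset.sum_congr rfl fun l _ => ?_
      rw [mul_right_comm, ← hθ l, Finset.sum_mul]
      exact Finset.sum_congr rfl fun σ _ => by ring
    have hcard : Fintype.card {c : Cfg // p c ≠ 0} ≤ cfgCard (Fintype.card ι) m :=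
      (Fintype.card_subtype_le _).trans hCfg.le
    have hcard' : (Fintype.card {c : Cfg // p c ≠ 0} : ℝ) ≤ cfgCard (Fintype.card ι) m := by
      exact_mod_cast hcard
    rw [Int.cast_natCast, hload, hexp, ← Finset.sum_sub_distrib]
    simp only [← Finset.sum_sub_distrib, ← mul_sub]
    refine (Finset.abs_sum_le_sum_abs _ _).trans ((Finset.sum_le_sum fun c _ =>
      (Finset.abs_sum_le_sum_abs _ _).trans (Finset.sum_le_sum (g := fun _ =>
        (((m + 1 : ℕ) : ℝ) * cfgCard (Fintype.card ι) m + 1) * w) fun l _ => ?_)).trans ?_)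
    · have h := hf c (c.1.2 l)
      rw [Fintype.card_fin] at h
      have h3 : (((m + 1 : ℕ) : ℝ) * Fintype.card {c : Cfg // p c ≠ 0} + 1) * w ≤
          (((m + 1 : ℕ) : ℝ) * cfgCard (Fintype.card ι) m + 1) * w := by gcongr
      split_ifs
      · rw [one_mul]
        refine le_trans (le_of_eq ?_) (h.trans h3)
        congr!
      · rw [zero_mul, abs_zero]; positivity
    · simp only [Finset.sum_const, Finset.card_univ, Fintype.card_fin, nsmul_eq_mul]
      unfold mainErr
      push_cast
      rw [← mul_assoc, ← mul_assoc]
      gcongr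
end MainTiles

section Grouping
variable {J : Type} [Fintype J]

theorem exists_subset_sum_between {sz : J → ℕ} {w : ℕ} (hw : ∀ T, sz T ≤ w) {g : ℕ} {A : Finset J}
    (hA : g ≤ ∑ T ∈ A, sz T) : ∃ B ⊆ A, g ≤ ∑ T ∈ B, sz T ∧ ∑ T ∈ B, sz T ≤ g + w := by
  induction A using Finset.induction_on with
  | empty => exact ⟨∅, subset_rfl, hA, by simp⟩
  | insert T A hT ih =>
    by_cases h : g ≤ ∑ T ∈ A, sz T
    · obtain ⟨B, hB, h1⟩ := ih h
      exact ⟨B, hB.trans (Finset.subset_insert _ _), h1⟩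
    · refine ⟨_, subset_rfl, hA, ?_⟩
      rw [Finset.sum_insert hT]
      have := hw T
      omega

/-- Items of bounded size can be grouped such that the total sizes of the groups are prescribed up
to a bounded error. -/
theorem exists_grouping {Λ : Type} [Fintype Λ] {sz : J → ℕ} {w : ℕ} (hw : ∀ T, sz T ≤ w)
    {g : Λ → ℕ} (hg : ∑ l, (g l + w) ≤ ∑ T, sz T) : ∃ f : J → Option Λ, ∀ l,
      g l ≤ ∑ T ∈ Finset.univ.filter (fun T => f T = some l), sz T ∧
      ∑ T ∈ Finset.univ.filter (fun T => f T = some l), sz T ≤ g l + w := by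
  have key : ∀ I : Finset Λ, ∃ f : J → Option Λ, (∀ T l, f T = some l → l ∈ I) ∧ ∀ l ∈ I,
      g l ≤ ∑ T ∈ Finset.univ.filter (fun T => f T = some l), sz T ∧
      ∑ T ∈ Finset.univ.filter (fun T => f T = some l), sz T ≤ g l + w := by
    intro I
    induction I using Finset.induction_on with
    | empty => exact ⟨fun _ => none, by simp, by simp⟩
    | insert l₀ I hl₀ ih =>
      obtain ⟨f, hf1, hf2⟩ := ih
      have htot : ∑ T, sz T = ∑ T ∈ Finset.univ.filter (fun T => f T = none), sz T +
          ∑ l ∈ I, ∑ T ∈ Finset.univ.filter (fun T => f T = some l), sz T := by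
        rw [← Finset.sum_fiberwise Finset.univ f sz, Fintype.sum_option]
        congr 1
        refine (Finset.sum_subset (Finset.subset_univ I) fun l _ hl => ?_).symm
        rw [Finset.filter_eq_empty_iff.2 fun T _ hT => hl (hf1 T l hT), Finset.sum_empty]
      have h1 : ∑ l ∈ I, ∑ T ∈ Finset.univ.filter (fun T => f T = some l), sz T ≤
          ∑ l ∈ I, (g l + w) := Finset.sum_le_sum fun l hl => (hf2 l hl).2
      have h2 : ∑ l ∈ insert l₀ I, (g l + w) ≤ ∑ l, (g l + w) :=
        Finset.sum_le_sum_of_subset (Finset.subset_univ _)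
      rw [Finset.sum_insert hl₀] at h2
      obtain ⟨B, hB, hB1, hB2⟩ := exists_subset_sum_between hw (g := g l₀)
        (A := Finset.univ.filter fun T => f T = none) (by omega)
      have hBn : ∀ T ∈ B, f T = none := fun T hT => (Finset.mem_filter.1 (hB hT)).2
      refine ⟨fun T => if T ∈ B then some l₀ else f T, fun T l hT => ?_, fun l hl => ?_⟩
      · beta_reduce at hT
        by_cases h : T ∈ B
        · rw [if_pos h] at hT
          rw [← Option.some_injective _ hT]; exact Finset.mem_insert_self _ _
        · rw [if_neg h] at hT
          exact Finset.mem_insert_of_mem (hf1 T l hT)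
      · rcases Finset.mem_insert.1 hl with rfl | hl
        · have : (Finset.univ.filter fun T => (if T ∈ B then some l else f T) = some l) = B := by
            ext T
            simp only [Finset.mem_filter, Finset.mem_univ, true_and]
            constructor
            · intro h
              by_contra hT
              rw [if_neg hT] at h
              exact hl₀ (hf1 T l h)
            · intro h; rw [if_pos h]
          rw [this]
          exact ⟨hB1, hB2⟩
        · have : (Finset.univ.filter fun T => (if T ∈ B then some l₀ else f T) = some l) =
              Finset.univ.filter fun T => f T = some l := by
            ext T
            simp only [Finset.mem_filter, Finset.mem_univ, true_and]
            by_cases h : T ∈ B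
            · rw [if_pos h, hBn T h]
              simp only [Option.some.injEq, reduceCtorEq, iff_false]
              rintro rfl; exact hl₀ hl
            · rw [if_neg h]
          rw [this]
          exact hf2 l hl
  obtain ⟨f, -, hf⟩ := key Finset.univ
  exact ⟨f, fun l => hf l (Finset.mem_univ l)⟩

variable {W ι : Type} [Fintype W] {H : SimpleGraph W} {R : SimpleGraph ι} {m : ℕ}
  {φ : W → Fin (m + 1)}

/-- A graph with a proper colouring can be mapped to a clique such that many vertices are mapped to
a given vertex of the clique. -/
theorem exists_hom_clique (hφ : ∀ x y, H.Adj x y → φ x ≠ φ y) {e : Finset ι}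
    (he : e.card = m + 1) (hcl : R.IsClique (e : Set ι)) {i : ι} (hi : i ∈ e) (A : Finset W) :
    ∃ a : W → ι, (∀ x, a x ∈ e) ∧ (∀ x y, H.Adj x y → R.Adj (a x) (a y)) ∧
      A.card ≤ (m + 1) * (A.filter fun x => a x = i).card := by
  obtain ⟨l, -, hl⟩ := Finset.exists_le_of_sum_le (s := Finset.univ)
    (f := fun _ : Fin (m + 1) => A.card) (g := fun l => (m + 1) * (A.filter fun x => φ x = l).card)
    Finset.univ_nonempty (by
      rw [← Finset.mul_sum, ← Finset.card_eq_sum_card_fiberwise fun x _ => Finset.mem_univ _]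
      simp)
  have f₀ : Fin (m + 1) ≃ e := (Finset.equivFinOfCardEq he).symm
  set f₁ : Fin (m + 1) ≃ e := (Equiv.swap l (f₀.symm ⟨i, hi⟩)).trans f₀ with hf₁
  have h1 : f₁ l = ⟨i, hi⟩ := by simp [hf₁]
  refine ⟨fun x => f₁ (φ x), fun x => (f₁ _).2, fun x y hxy => hcl (f₁ _).2 (f₁ _).2 fun h =>
    hφ x y hxy (f₁.injective (Subtype.ext h)), hl.trans (Nat.mul_le_mul_left _ ?_)⟩
  refine Finset.card_le_card fun x hx => ?_
  rw [Finset.mem_filter] at hx ⊢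
  exact ⟨hx.1, by simp only [hx.2, h1]⟩

/-- A graph of bounded degree contains a large set of vertices whose closed neighbourhoods are
disjoint and not adjacent to each other. -/
theorem exists_separated {D : ℕ} (hD : ∀ u, (nb H u).card ≤ D) (A : Finset W) :
    ∃ Y ⊆ A, (∀ y ∈ Y, ∀ y' ∈ Y, y ≠ y' → ∀ u ∈ blk H y, ∀ v ∈ blk H y', u ≠ v ∧ ¬ H.Adj u v) ∧
      A.card ≤ (D + 1) ^ 3 * Y.card := by
  obtain ⟨Y, hY, hmax⟩ := (A.powerset.filter fun Y => ∀ y ∈ Y, ∀ y' ∈ Y, y ≠ y' →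
    ∀ u ∈ blk H y, ∀ v ∈ blk H y', u ≠ v ∧ ¬ H.Adj u v).exists_max_image Finset.card
    ⟨∅, by simp⟩
  simp only [Finset.mem_filter, Finset.mem_powerset] at hY hmax
  refine ⟨Y, hY.1, hY.2, ?_⟩
  have hself : ∀ u, u ∈ blk H u := fun u => Finset.mem_insert_self _ _
  have hsymm : ∀ u v, v ∈ blk H u → u ∈ blk H v := by
    intro u v h
    rcases Finset.mem_insert.1 h with rfl | h
    · exact hself _
    · exact Finset.mem_insert_of_mem (mem_nb.2 (mem_nb.1 h).symm)
  have hcov : A ⊆ Y.biUnion fun y => (blk H y).biUnion fun u => (blk H u).biUnion fun v =>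
      blk H v := by
    intro x hx
    simp only [Finset.mem_biUnion]
    by_cases hxY : x ∈ Y
    · exact ⟨x, hxY, x, hself x, x, hself x, hself x⟩
    by_contra hcon
    push Not at hcon
    have hsep : ∀ y ∈ Y, ∀ u ∈ blk H y, ∀ v ∈ blk H x, u ≠ v ∧ ¬ H.Adj u v := by
      intro y hy u hu v hv
      refine ⟨?_, fun huv => ?_⟩
      · rintro rfl
        exact hcon y hy u hu u (hself u) (hsymm _ _ hv)
      · exact hcon y hy u hu v (Finset.mem_insert_of_mem (mem_nb.2 huv)) (hsymm _ _ hv)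
    have h := hmax (insert x Y) ⟨Finset.insert_subset hx hY.1, ?_⟩
    · rw [Finset.card_insert_of_notMem hxY] at h
      omega
    · intro y hy y' hy' hne u hu v hv
      rcases Finset.mem_insert.1 hy with rfl | hyY
      · rcases Finset.mem_insert.1 hy' with rfl | hy'
        · exact (hne rfl).elim
        · have := hsep y' hy' v hv u hu
          exact ⟨this.1.symm, fun h => this.2 h.symm⟩
      · rcases Finset.mem_insert.1 hy' with rfl | hyY'
        · exact hsep y hyY u hu v hv
        · exact hY.2 y hyY y' hyY' hne u hu v hv
  have hb := card_blk_le hD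
  calc A.card ≤ _ := Finset.card_le_card hcov
    _ ≤ Y.card * ((D + 1) * ((D + 1) * (D + 1))) :=
      Finset.card_biUnion_le_card_mul _ _ _ fun y _ =>
        (Finset.card_biUnion_le_card_mul _ _ _ fun u _ =>
          (Finset.card_biUnion_le_card_mul _ _ _ fun v _ => hb v).trans
            (Nat.mul_le_mul_right _ (hb u))).trans (Nat.mul_le_mul_right _ (hb y))
    _ = (D + 1) ^ 3 * Y.card := by ring
end Grouping

section Assignment
variable {W J ι : Type} [Fintype W] [Fintype J] [Fintype ι]
variable {H : SimpleGraph W} {t : W → J} {R : SimpleGraph ι} {m w : ℕ} {φ : W → Fin (m + 1)}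

theorem card_filter_tile_mem (t : W → J) (S : Finset J) :
    (Finset.univ.filter fun x => t x ∈ S).card =
      ∑ T ∈ S, (Finset.univ.filter fun x => t x = T).card := by
  rw [Finset.card_eq_sum_card_fiberwise (f := t) (t := S) (fun x hx => by
    simpa using (Finset.mem_filter.1 hx).2)]
  refine Finset.sum_congr rfl fun T hT => congrArg _ ?_
  ext x
  simp only [Finset.mem_filter, Finset.mem_univ, true_and, and_iff_right_iff_imp]
  rintro rfl; exact hT

/-- The number of vertices that are needed to correct the error in the assignment of tiles. -/
def corrSize (r m w : ℕ) : ℕ := r * (10 * w + 8 * (mainErr r m * w)) * w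

theorem exists_class_le {S : Finset W} (φ : W → Fin (m + 1)) :
    ∃ l, ((S.filter fun x => φ x = l).card : ℝ) ≤ (1 - m / (m + 1)) * S.card := by
  obtain ⟨l, -, hl⟩ := Finset.exists_le_of_sum_le (s := Finset.univ)
    (g := fun _ : Fin (m + 1) => (1 - (m : ℝ) / (m + 1)) * S.card)
    (f := fun l => ((S.filter fun x => φ x = l).card : ℝ)) Finset.univ_nonempty (by
      rw [← Nat.cast_sum, ← Finset.card_eq_sum_card_fiberwise fun x _ => Finset.mem_univ _]
      simp only [Finset.sum_const, Finset.card_univ, Fintype.card_fin, nsmul_eq_mul]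
      push_cast
      refine le_of_eq ?_
      field_simp
      ring)
  exact ⟨l, hl⟩

/-- The tiles can be mapped to the reduced graph with prescribed loads, in such a way that certain
groups of tiles of prescribed order are mapped to given cliques. -/
theorem TileSys.exists_assignment [Nonempty ι] (hT : TileSys H t m w φ) (hm : 1 ≤ m) (hw : 0 < w)
    {χ : ℝ} (hχ : m < χ) (hχ' : χ ≤ m + 1)
    (hconn : 2 ≤ m → ∀ x y, ∃ b z b', StrongW.CoClq R (m + 1) x b ∧ StrongW.CoClq R (m + 1) b z ∧
      StrongW.CoClq R (m + 1) z b' ∧ StrongW.CoClq R (m + 1) b' y)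
    (hadj : ∀ i, ∃ j, R.Adj i j) (hclq : ∃ π : Fin (m + 1) → ι, Clq R π)
    {L : Type} [Fintype L] {e : L → Finset ι} {pt : L → ι} (hecard : ∀ l, (e l).card = m + 1)
    (hecl : ∀ l, R.IsClique (e l : Set ι)) (hpt : ∀ l, pt l ∈ e l) (g : L → ℕ) {U β : ι → ℕ}
    (hU : ∑ j, U j = Fintype.card W) (hβU : ∀ j, β j < U j)
    (hβ : ∀ j, ∑ l ∈ Finset.univ.filter (fun l => j ∈ e l), (g l + w) +
      (corrSize (Fintype.card ι) m w + w) ≤ β j)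
    (hdeg : ∀ D : ι → ℝ, (∀ j, (U j : ℝ) - β j ≤ D j ∧ D j ≤ U j) → DegCondW R D m χ)
    (hα : χ = m + 1 ∨ ((Finset.univ.filter fun x => φ x = 0).card : ℝ) ≤
      (1 - m / χ) * ∑ j, ((U j : ℝ) - β j)) :
    ∃ (f : J → Option L) (a : W → ι), (∀ x y, H.Adj x y → R.Adj (a x) (a y)) ∧
      (∀ j, (Finset.univ.filter fun x => a x = j).card = U j) ∧
      (∀ x l, f (t x) = some l → a x ∈ e l) ∧
      (∀ l, g l ≤ (Finset.univ.filter fun x => f (t x) = some l).card) ∧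
      (∀ l, (Finset.univ.filter fun x => f (t x) = some l).card ≤ g l + w) ∧
      ∀ l, (Finset.univ.filter fun x => f (t x) = some l).card ≤
        (m + 1) * (Finset.univ.filter fun x => f (t x) = some l ∧ a x = pt l).card := by
  set r := Fintype.card ι with hr
  set M := mainErr r m * w with hM
  set sz : J → ℕ := fun T => (Finset.univ.filter fun x => t x = T).card with hsz
  have hszsum : ∑ T, sz T = Fintype.card W := by
    rw [← card_filter_tile_mem t Finset.univ]
    simp
  have hcap : ∑ l, (g l + w) + (corrSize r m w + w) ≤ Fintype.card W := by
    calc ∑ l, (g l + w) + (corrSize r m w + w) ≤ ∑ j, (∑ l ∈ Finset.univ.filter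
          (fun l => j ∈ e l), (g l + w)) + ∑ _j : ι, (corrSize r m w + w) := by
          refine add_le_add ?_ ?_
          · simp only [Finset.sum_filter]
            rw [Finset.sum_comm]
            refine Finset.sum_le_sum fun l _ => ?_
            rw [← Finset.sum_filter]
            exact Finset.single_le_sum (f := fun _ => g l + w) (fun _ _ => Nat.zero_le _)
              (Finset.mem_filter.2 ⟨Finset.mem_univ (pt l), hpt l⟩)
          · rw [Finset.sum_const, Finset.card_univ, smul_eq_mul]
            exact Nat.le_mul_of_pos_left _ Fintype.card_pos
      _ ≤ ∑ j, U j := by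
          rw [← Finset.sum_add_distrib]
          exact Finset.sum_le_sum fun j _ => (hβ j).trans (hβU j).le
      _ = _ := hU
  obtain ⟨f', hf'⟩ := exists_grouping hT.size
    (g := fun o : Option L => o.elim (corrSize r m w) g) (by
      rw [Fintype.sum_option]
      simp only [Option.elim]
      have := hszsum
      simp only [hsz] at this
      omega)
  set f : J → Option L := fun T => (f' T).join with hf
  have hff : ∀ T l, f T = some l ↔ f' T = some (some l) := fun T l => by
    simp only [hf, Option.join_eq_some_iff]
  set Sc : Finset J := Finset.univ.filter fun T => f' T = some none with hSc
  set Sm : Finset J := Finset.univ.filter fun T => f' T = none with hSm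
  have hScm : Disjoint Sc Sm := by
    rw [Finset.disjoint_left]
    intro T h1 h2
    rw [hSc, Finset.mem_filter] at h1
    rw [hSm, Finset.mem_filter] at h2
    rw [h1.2] at h2
    exact absurd h2.2 (by simp)
  have hgrp : ∀ T, T ∉ Sc ∪ Sm ↔ ∃ l, f T = some l := by
    intro T
    simp only [hSc, hSm, Finset.mem_union, Finset.mem_filter, Finset.mem_univ, true_and, hff]
    rcases f' T with _ | _ | l <;> simp
  have hgl : ∀ l, (Finset.univ.filter fun x => f (t x) = some l).card =
      ∑ T ∈ Finset.univ.filter (fun T => f' T = some (some l)),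
        (Finset.univ.filter fun x => t x = T).card := by
    intro l
    rw [← card_filter_tile_mem]
    simp only [hff, Finset.mem_filter, Finset.mem_univ, true_and]
  have hg1 : ∀ l, g l ≤ (Finset.univ.filter fun x => f (t x) = some l).card := fun l => by
    rw [hgl]; convert (hf' (some l)).1; rfl
  have hg2 : ∀ l, (Finset.univ.filter fun x => f (t x) = some l).card ≤ g l + w := fun l => by
    rw [hgl]; convert (hf' (some l)).2; rfl
  have hc1 : corrSize r m w ≤ (Finset.univ.filter fun x => t x ∈ Sc).card := by
    rw [card_filter_tile_mem, hSc]; convert (hf' none).1; rfl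
  have hc2 : (Finset.univ.filter fun x => t x ∈ Sc).card ≤ corrSize r m w + w := by
    rw [card_filter_tile_mem, hSc]; convert (hf' none).2; rfl
  have hSccard : r * (10 * w + 8 * M) ≤ Sc.card := by
    have h1 : (Finset.univ.filter fun x => t x ∈ Sc).card ≤ Sc.card * w := by
      rw [card_filter_tile_mem]
      exact Finset.sum_le_card_nsmul _ _ _ fun T _ => hT.size T
    exact Nat.le_of_mul_le_mul_right (hc1.trans h1) hw
  choose al hal1 hal2 hal3 using fun l => exists_hom_clique hT.proper (hecard l) (hecl l) (hpt l)
    (Finset.univ.filter fun x => f (t x) = some l)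
  set a₀ : W → ι := fun x => (f (t x)).elim (Classical.arbitrary ι) fun l => al l x with ha₀
  have ha₀l : ∀ x l, f (t x) = some l → a₀ x = al l x := fun x l h => by
    simp only [ha₀, h, Option.elim]
  set gl : ι → ℕ := fun j => (Finset.univ.filter fun x => t x ∉ Sc ∪ Sm ∧ a₀ x = j).card with hgl'
  have hglβ : ∀ j, gl j ≤ ∑ l ∈ Finset.univ.filter (fun l => j ∈ e l), (g l + w) := by
    intro j
    refine (Finset.card_le_card (t := (Finset.univ.filter fun l => j ∈ e l).biUnion fun l =>
      Finset.univ.filter fun x => f (t x) = some l) fun x hx => ?_).trans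
      (Finset.card_biUnion_le.trans (Finset.sum_le_sum fun l _ => hg2 l))
    simp only [Finset.mem_filter, Finset.mem_univ, true_and, Finset.mem_biUnion] at hx ⊢
    obtain ⟨l, hl⟩ := (hgrp _).1 hx.1
    refine ⟨l, ?_, hl⟩
    rw [← hx.2, ha₀l x l hl]
    exact hal1 l x
  obtain ⟨π, hπ⟩ := hclq
  obtain ⟨b, hb⟩ := hT.exists_corrector (hT.trans hm hconn hadj M) hπ hSccard
  have hb' : ∀ j, ((Finset.univ.filter fun x => t x ∈ Sc).card : ℤ) = ∑ j, b j ∧ 0 ≤ b j ∧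
      b j ≤ (Finset.univ.filter fun x => t x ∈ Sc).card := by
    intro j
    obtain ⟨c, -, hc⟩ := hb (fun _ => 0) (by simp) (by simp)
    simp only [add_zero] at hc
    refine ⟨?_, ?_, ?_⟩
    · rw [Finset.card_eq_sum_card_fiberwise (f := c) (t := Finset.univ) fun x _ => Finset.mem_univ _]
      push_cast
      exact Finset.sum_congr rfl fun j _ => by rw [← hc j, Finset.filter_filter]
    · rw [← hc j]; positivity
    · rw [← hc j, Nat.cast_le]
      exact Finset.card_le_card fun x hx => by
        simp only [Finset.mem_filter, Finset.mem_univ, true_and] at hx ⊢; exact hx.1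
  have htot : (Finset.univ.filter fun x => t x ∈ Sm).card +
      (Finset.univ.filter fun x => t x ∈ Sc).card + ∑ j, gl j = Fintype.card W := by
    have h1 : ∑ j, gl j = (Finset.univ.filter fun x => t x ∉ Sc ∪ Sm).card := by
      rw [Finset.card_eq_sum_card_fiberwise (f := a₀) (t := Finset.univ)
        fun x _ => Finset.mem_univ _]
      exact Finset.sum_congr rfl fun j _ => by rw [Finset.filter_filter]
    have h2 : (Finset.univ.filter fun x => t x ∈ Sc ∪ Sm).card =
        (Finset.univ.filter fun x => t x ∈ Sc).card +
        (Finset.univ.filter fun x => t x ∈ Sm).card := by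
      simp only [card_filter_tile_mem]
      exact Finset.sum_union hScm
    have h3 := Finset.card_filter_add_card_filter_not (s := (Finset.univ : Finset W))
      (fun x => t x ∈ Sc ∪ Sm)
    rw [Finset.card_univ] at h3
    omega
  set D : ι → ℝ := fun j => (U j : ℝ) - gl j - b j with hD
  have hDb : ∀ j, (U j : ℝ) - β j ≤ D j ∧ D j ≤ U j := by
    intro j
    obtain ⟨-, h1, h2⟩ := hb' j
    have h3 : b j ≤ (corrSize r m w + w : ℕ) := h2.trans (by exact_mod_cast hc2)
    have h4 : (gl j : ℤ) + b j ≤ β j := by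
      have := (add_le_add_left (hglβ j) (corrSize r m w + w)).trans (hβ j)
      zify at this h3
      linarith
    have h4' : (gl j : ℝ) + b j ≤ β j := by exact_mod_cast h4
    have h1' : (0 : ℝ) ≤ b j := by exact_mod_cast h1
    have : (0 : ℝ) ≤ gl j := Nat.cast_nonneg _
    simp only [hD]
    constructor <;> linarith
  have hDsum : ∑ j, D j = ((Finset.univ.filter fun x => t x ∈ Sm).card : ℝ) := by
    have h1 : ∑ j, (b j : ℝ) = ((Finset.univ.filter fun x => t x ∈ Sc).card : ℝ) := by
      rw [← Int.cast_sum, ← (hb' (Classical.arbitrary ι)).1, Int.cast_natCast]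
    have h2 := hU.trans htot.symm
    have h3 : (∑ j, (U j : ℝ)) = ((Finset.univ.filter fun x => t x ∈ Sm).card : ℝ) +
      ((Finset.univ.filter fun x => t x ∈ Sc).card : ℝ) + ∑ j, (gl j : ℝ) := by exact_mod_cast h2
    simp only [hD, Finset.sum_sub_distrib, h1, h3]
    ring
  have hβU' : ∀ j, (0 : ℝ) < (U j : ℝ) - β j := fun j => sub_pos.2 (by exact_mod_cast hβU j)
  have hDpos : ∀ j, 0 < D j := fun j => (hβU' j).trans_le (hDb j).1
  have hmpos : 0 < (Finset.univ.filter fun x => t x ∈ Sm).card := by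
    have : 0 < ∑ j, D j := Finset.sum_pos (fun j _ => hDpos j) Finset.univ_nonempty
    rw [hDsum] at this
    exact_mod_cast this
  obtain ⟨l₀, hl₀⟩ : ∃ l₀, ((Finset.univ.filter fun x => t x ∈ Sm ∧ φ x = l₀).card : ℝ) ≤
      (1 - m / χ) * (Finset.univ.filter fun x => t x ∈ Sm).card := by
    rcases hα with h | h
    · obtain ⟨l₀, h0⟩ := exists_class_le (S := Finset.univ.filter fun x => t x ∈ Sm) φ
      rw [Finset.filter_filter] at h0
      exact ⟨l₀, by rw [h]; exact h0⟩
    · refine ⟨0, le_trans ?_ (h.trans ?_)⟩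
      · exact_mod_cast Finset.card_le_card fun x hx => by
          simp only [Finset.mem_filter, Finset.mem_univ, true_and] at hx ⊢; exact hx.2
      · rw [← hDsum]
        refine mul_le_mul_of_nonneg_left (Finset.sum_le_sum fun j _ => (hDb j).1) ?_
        rw [sub_nonneg, div_le_one ((Nat.cast_nonneg m).trans_lt hχ)]
        exact hχ.le
  obtain ⟨ℓ, hℓ, hℓD⟩ := hT.exists_approx hm hχ hχ' Sm (fun j => (hDpos j).le) (hdeg D hDb) hDsum
    hmpos hl₀
  set err : ι → ℤ := fun j => U j - gl j - b j - ℓ j with herr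
  have herrM : ∀ j, |err j| ≤ M := by
    intro j
    have h := hℓD j
    rw [abs_sub_comm] at h
    simp only [hD] at h
    have : |(err j : ℝ)| ≤ M := by
      simp only [herr, hM]
      push_cast
      exact h
    exact_mod_cast this
  have hℓsum : ∑ j, ℓ j = ((Finset.univ.filter fun x => t x ∈ Sm).card : ℤ) := by
    obtain ⟨c, -, hc⟩ := hℓ
    rw [Finset.card_eq_sum_card_fiberwise (f := c) (t := Finset.univ) fun x _ => Finset.mem_univ _]
    push_cast
    exact Finset.sum_congr rfl fun j _ => by rw [← hc j, Finset.filter_filter]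
  have herr0 : ∑ j, err j = 0 := by
    have h2 := hU.trans htot.symm
    zify at h2
    simp only [herr, Finset.sum_sub_distrib, hℓsum, h2, ← (hb' (Classical.arbitrary ι)).1]
    ring
  obtain ⟨a', ha'1, ha'2⟩ := Ach.union hT.adj hScm (hb err herr0 herrM) hℓ
  have haeq : ∀ x l, f (t x) = some l → (if t x ∈ Sc ∪ Sm then a' x else a₀ x) = al l x := by
    intro x l h
    rw [if_neg ((hgrp _).2 ⟨l, h⟩), ha₀l x l h]
  refine ⟨f, fun x => if t x ∈ Sc ∪ Sm then a' x else a₀ x, fun x y hxy => ?_, fun j => ?_,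
    fun x l h => ?_, hg1, hg2, fun l => ?_⟩
  · beta_reduce
    by_cases h : t x ∈ Sc ∪ Sm
    · rw [if_pos h, if_pos (hT.adj x y hxy ▸ h)]
      exact ha'1 x y h hxy
    · obtain ⟨l, hl⟩ := (hgrp _).1 h
      rw [haeq x l hl, haeq y l (hT.adj x y hxy ▸ hl)]
      exact hal2 l x y hxy
  · have h1 := ha'2 j
    have h2 : (Finset.univ.filter fun x => (if t x ∈ Sc ∪ Sm then a' x else a₀ x) = j).card =
        (Finset.univ.filter fun x => t x ∈ Sc ∪ Sm ∧ a' x = j).card + gl j := by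
      rw [hgl', ← Finset.card_union_of_disjoint]
      · congr 1
        ext x
        simp only [Finset.mem_filter, Finset.mem_univ, true_and, Finset.mem_union (a := x)]
        by_cases h : t x ∈ Sc ∪ Sm
        · simp only [h, if_true, true_and, not_true, false_and, or_false]
        · simp only [h, if_false, false_and, not_false_iff, true_and, false_or]
      · rw [Finset.disjoint_left]
        intro x hx hx'
        exact (Finset.mem_filter.1 hx').2.1 (Finset.mem_filter.1 hx).2.1
    zify
    rw [h2]
    push_cast
    rw [h1]
    simp only [herr]
    ring
  · beta_reduce
    rw [haeq x l h]
    exact hal1 l x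
  · refine (hal3 l).trans (Nat.mul_le_mul_left _ (Finset.card_le_card fun x hx => ?_))
    simp only [Finset.mem_filter, Finset.mem_univ, true_and] at hx ⊢
    exact ⟨hx.1, by rw [haeq x l hx.1]; exact hx.2⟩
end Assignment

section Layout
variable {W J ι : Type} [Fintype W] [Fintype J] [Fintype ι]
variable {H : SimpleGraph W} {t : W → J} {R : SimpleGraph ι} {m w : ℕ} {φ : W → Fin (m + 1)}

/-- The tiles can be mapped to the reduced graph with prescribed loads, together with sets `X` of
reserved vertices and `Y` of absorbing vertices. -/
theorem TileSys.exists_layout [Nonempty ι] (hT : TileSys H t m w φ) (hm : 1 ≤ m) (hw : 0 < w)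
    {D : ℕ} (hD : ∀ u, (nb H u).card ≤ D) {χ : ℝ} (hχ : m < χ) (hχ' : χ ≤ m + 1)
    (hconn : 2 ≤ m → ∀ x y, ∃ b z b', StrongW.CoClq R (m + 1) x b ∧ StrongW.CoClq R (m + 1) b z ∧
      StrongW.CoClq R (m + 1) z b' ∧ StrongW.CoClq R (m + 1) b' y)
    (hadj : ∀ i, ∃ j, R.Adj i j) {κ : ι → Finset ι} (hκcard : ∀ i, (κ i).card = m + 1)
    (hκcl : ∀ i, R.IsClique (κ i : Set ι)) (hκ : ∀ i, i ∈ κ i) {Θ : Finset (ι × Finset ι)}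
    (hΘcard : ∀ τ ∈ Θ, τ.2.card = m + 1) (hΘcl : ∀ τ ∈ Θ, R.IsClique (τ.2 : Set ι))
    (hΘ : ∀ τ ∈ Θ, τ.1 ∈ τ.2) (q : ι × Finset ι → ℕ) (ξ : ι → ℕ) {U γ ζ : ι → ℕ}
    (hU : ∑ j, U j = Fintype.card W) (hβU : ∀ j, γ j + ζ j < U j)
    (hγ : ∀ j, ∑ τ ∈ Θ.filter (fun τ => j ∈ τ.2), ((m + 1) * ((D + 1) ^ 3 * q τ) + w) ≤ γ j)
    (hζ : ∀ j, ∑ i ∈ Finset.univ.filter (fun i => j ∈ κ i), ((m + 1) * ξ i + w) +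
      (corrSize (Fintype.card ι) m w + w) ≤ ζ j)
    (hdeg : ∀ D : ι → ℝ, (∀ j, (U j : ℝ) - (γ j + ζ j) ≤ D j ∧ D j ≤ U j) → DegCondW R D m χ)
    (hα : χ = m + 1 ∨ ((Finset.univ.filter fun x => φ x = 0).card : ℝ) ≤
      (1 - m / χ) * ∑ j, ((U j : ℝ) - (γ j + ζ j))) :
    ∃ (a : W → ι) (X Y Z : Finset W) (ty : W → Finset ι),
      (∀ ⦃x y⦄, H.Adj x y → R.Adj (a x) (a y)) ∧
      (∀ j, (Finset.univ.filter fun x => a x = j).card = U j) ∧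
      Disjoint X Z ∧ (∀ x ∈ X, ∀ y ∈ X, ¬ H.Adj x y) ∧ (∀ x y, t x = t y → x ∈ Z → y ∈ Z) ∧
      (∀ i, (Z.filter fun x => a x = i).card ≤ γ i) ∧ Y ⊆ Z ∧
      (∀ y ∈ Y, ∀ x, H.Adj y x → a x ∈ ty y) ∧
      (∀ y ∈ Y, ∀ y' ∈ Y, y ≠ y' → ∀ u ∈ blk H y, ∀ v ∈ blk H y', u ≠ v ∧ ¬ H.Adj u v) ∧
      (∀ i, (X.filter fun x => a x = i).card = ξ i) ∧
      ∀ τ ∈ Θ, q τ ≤ (Y.filter fun y => a y = τ.1 ∧ ty y = τ.2).card := by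
  let e : Θ ⊕ ι → Finset ι := Sum.elim (fun τ => τ.1.2) κ
  let pt : Θ ⊕ ι → ι := Sum.elim (fun τ => τ.1.1) id
  let g : Θ ⊕ ι → ℕ := Sum.elim (fun τ => (m + 1) * ((D + 1) ^ 3 * q τ.1)) fun i => (m + 1) * ξ i
  have i₀ : ι := Classical.arbitrary ι
  obtain ⟨f, a, ha1, ha2, ha3, hf1, hf2, hf3⟩ := hT.exists_assignment hm hw hχ hχ' hconn hadj
    ((exists_clq_of_card (hκcard i₀) (hκcl i₀)).imp fun _ h => h.1) (e := e) (pt := pt)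
    (by rintro (τ | i); exacts [hΘcard τ.1 τ.2, hκcard i])
    (by rintro (τ | i); exacts [hΘcl τ.1 τ.2, hκcl i])
    (by rintro (τ | i); exacts [hΘ τ.1 τ.2, hκ i]) g (U := U) (β := fun j => γ j + ζ j) hU hβU
    (fun j => by
      have h1 : ∑ l ∈ Finset.univ.filter (fun l => j ∈ e l), (g l + w) =
          ∑ τ ∈ Θ.filter (fun τ => j ∈ τ.2), ((m + 1) * ((D + 1) ^ 3 * q τ) + w) +
          ∑ i ∈ Finset.univ.filter (fun i => j ∈ κ i), ((m + 1) * ξ i + w) := by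
        simp only [Finset.sum_filter]
        rw [Fintype.sum_sum_type, ← Finset.sum_coe_sort Θ]
        rfl
      rw [h1]
      have := hγ j
      have := hζ j
      beta_reduce
      omega) (by push_cast; exact hdeg) (by push_cast; exact hα)
  replace hf1 : ∀ l, g l ≤ (Finset.univ.filter fun x => f (t x) = some l).card :=
    fun l => by convert hf1 l
  replace hf2 : ∀ l, (Finset.univ.filter fun x => f (t x) = some l).card ≤ g l + w :=
    fun l => by convert hf2 l
  replace hf3 : ∀ l, (Finset.univ.filter fun x => f (t x) = some l).card ≤
      (m + 1) * (Finset.univ.filter fun x => f (t x) = some l ∧ a x = pt l).card :=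
    fun l => by convert hf3 l
  have hR : ∀ x y, H.Adj x y → a x ≠ a y := fun x y hxy => (ha1 x y hxy).ne
  have hX : ∀ i, ∃ X ⊆ Finset.univ.filter fun x => f (t x) = some (Sum.inr i) ∧ a x = i,
      X.card = ξ i := fun i => Finset.exists_subset_card_eq
    (Nat.le_of_mul_le_mul_left ((hf1 (Sum.inr i)).trans (hf3 (Sum.inr i))) (Nat.succ_pos m))
  choose X hX1 hX2 using hX
  have hX1' : ∀ i, ∀ x ∈ X i, f (t x) = some (Sum.inr i) ∧ a x = i := fun i x hx =>
    (Finset.mem_filter.1 (hX1 i hx)).2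
  choose Y hY1 hY2 hY3 using fun τ : Θ => exists_separated hD
    (Finset.univ.filter fun x => f (t x) = some (Sum.inl τ) ∧ a x = τ.1.1)
  have hY1' : ∀ τ, ∀ x ∈ Y τ, f (t x) = some (Sum.inl τ) ∧ a x = τ.1.1 := fun τ x hx =>
    (Finset.mem_filter.1 (hY1 τ hx)).2
  let ty : W → Finset ι := fun x => ((f (t x)).elim ∅ e)
  have hty : ∀ x l, f (t x) = some l → ty x = e l := fun x l h => by simp only [ty, h, Option.elim]
  have hblk : ∀ y, ∀ u ∈ blk H y, t u = t y := by
    intro y u hu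
    rcases Finset.mem_insert.1 hu with rfl | hu
    · rfl
    · exact (hT.adj _ _ (mem_nb.1 hu)).symm
  refine ⟨a, Finset.univ.biUnion X, Finset.univ.biUnion Y,
    Finset.univ.filter fun x => ∃ τ, f (t x) = some (Sum.inl τ), ty, fun x y => ha1 x y, ha2, ?_, ?_,
    ?_, fun i => ?_, ?_, ?_, ?_, fun i => ?_, fun τ hτ => ?_⟩
  · rw [Finset.disjoint_left]
    intro x hx hx'
    obtain ⟨i, -, hi⟩ := Finset.mem_biUnion.1 hx
    obtain ⟨-, τ, hτ⟩ := Finset.mem_filter.1 hx'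
    rw [(hX1' i x hi).1] at hτ
    simp at hτ
  · intro x hx y hy hxy
    obtain ⟨i, -, hi⟩ := Finset.mem_biUnion.1 hx
    obtain ⟨j, -, hj⟩ := Finset.mem_biUnion.1 hy
    have h1 := (hX1' i x hi).1
    rw [hT.adj x y hxy, (hX1' j y hj).1] at h1
    have hij : j = i := by simpa using h1
    exact hR x y hxy (by rw [(hX1' i x hi).2, (hX1' j y hj).2, hij])
  · intro x y hxy hx
    simpa only [Finset.mem_filter, Finset.mem_univ, true_and, hxy] using hx
  · refine le_trans ((Finset.card_le_card (t := (Finset.univ.filter fun τ : Θ => i ∈ τ.1.2).biUnion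
      fun τ => Finset.univ.filter fun x => f (t x) = some (Sum.inl τ)) fun x hx => ?_).trans
      (Finset.card_biUnion_le.trans (Finset.sum_le_sum fun τ _ => hf2 (Sum.inl τ)))) (le_trans ?_ (hγ i))
    · simp only [Finset.mem_filter, Finset.mem_univ, true_and, Finset.mem_biUnion] at hx ⊢
      obtain ⟨⟨τ, hτ⟩, rfl⟩ := hx
      exact ⟨τ, ha3 x _ hτ, hτ⟩
    · simp only [Finset.sum_filter]
      rw [← Finset.sum_coe_sort Θ]
      rfl
  · intro x hx
    obtain ⟨τ, -, hτ⟩ := Finset.mem_biUnion.1 hx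
    exact Finset.mem_filter.2 ⟨Finset.mem_univ _, τ, (hY1' τ x hτ).1⟩
  · intro y hy x hxy
    obtain ⟨τ, -, hτ⟩ := Finset.mem_biUnion.1 hy
    have h := (hY1' τ y hτ).1
    rw [hty y _ h]
    exact ha3 x _ (hT.adj y x hxy ▸ h)
  · intro y hy y' hy' hne u hu v hv
    obtain ⟨τ, -, hτ⟩ := Finset.mem_biUnion.1 hy
    obtain ⟨τ', -, hτ'⟩ := Finset.mem_biUnion.1 hy'
    by_cases h : τ = τ'
    · subst h
      exact hY2 τ y hτ y' hτ' hne u hu v hv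
    · have htuv : t u ≠ t v := by
        intro huv
        rw [hblk y u hu, hblk y' v hv] at huv
        have h1 := (hY1' τ y hτ).1
        rw [huv, (hY1' τ' y' hτ').1] at h1
        exact h (by simpa using h1.symm)
      exact ⟨fun h => htuv (congrArg t h), fun h => htuv (hT.adj u v h)⟩
  · rw [← hX2 i]
    congr 1
    ext x
    simp only [Finset.mem_filter, Finset.mem_biUnion, Finset.mem_univ, true_and]
    constructor
    · rintro ⟨⟨j, hj⟩, rfl⟩
      rwa [(hX1' j x hj).2]
    · intro hx
      exact ⟨⟨i, hx⟩, (hX1' i x hx).2⟩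
  · have h1 := (hf1 (Sum.inl ⟨τ, hτ⟩)).trans (hf3 (Sum.inl ⟨τ, hτ⟩))
    have h2 : (D + 1) ^ 3 * q τ ≤ _ := Nat.le_of_mul_le_mul_left h1 (Nat.succ_pos m)
    have h3 := Nat.le_of_mul_le_mul_left (h2.trans (hY3 ⟨τ, hτ⟩)) (by positivity)
    refine h3.trans (Finset.card_le_card fun y hy => ?_)
    have hy' := hY1' _ y hy
    exact Finset.mem_filter.2 ⟨Finset.mem_biUnion.2 ⟨_, Finset.mem_univ _, hy⟩, hy'.2,
      hty y _ hy'.1⟩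
end Layout

section FrameEmbedding

/-- The proportion of vertices in tiles with a special role, in units of `δ`. -/
def loadConst (m D A C₀ : ℕ) : ℕ :=
  (m + 1) * (D + 1) ^ 3 * A * (1 + 17 * C₀) + (m + 1) * (17 * C₀) + 2

/-- A bound for the number of pairs of a vertex and a set of vertices. -/
def typeCard (r : ℕ) : ℕ := r * 2 ^ r

/-- A bound for the number of vertices that are lost because tiles cannot be split. -/
def slackConst (m D A r w L₀ : ℕ) : ℕ :=
  typeCard r * ((m + 1) * (D + 1) ^ 3 * A * L₀ + w) + r * w + corrSize r m w + w + 1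

variable {V W J ι : Type} [Fintype V] [Fintype W] [Fintype J] [Fintype ι]
variable {G : SimpleGraph V} {H : SimpleGraph W} {t : W → J} {R : SimpleGraph ι} {m w : ℕ}
  {φ : W → Fin (m + 1)} {P : ι → Finset V} {h : V → ι} {K : V → Finset ι} {κ : ι → Finset ι}
  {χ d δ' δ ε : ℝ} {C₀ r₀ : ℕ}

theorem sum_card_atypical_le (P : ι → Finset V) (h : V → ι) (K : V → Finset ι)
    (Θ : Finset (ι × Finset ι)) (j : ι) :
    ∑ τ ∈ Θ.filter (fun τ => j ∈ τ.2),
      (Finset.univ.filter fun v => v ∉ P (h v) ∧ h v = τ.1 ∧ K v = τ.2).card ≤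
    (Finset.univ.filter fun v => v ∉ P (h v) ∧ j ∈ K v).card := by
  rw [Finset.card_eq_sum_card_fiberwise (f := fun v => (h v, K v))
    (t := Finset.univ.filter fun τ => j ∈ τ.2)
    (fun v hv => by simpa using (Finset.mem_filter.1 hv).2.2)]
  refine (Finset.sum_le_sum_of_subset (Finset.filter_subset_filter _ (Finset.subset_univ Θ))).trans
    (Finset.sum_le_sum fun τ hτ => Finset.card_le_card fun v hv => ?_)
  simp only [Finset.mem_filter, Finset.mem_univ, true_and] at hv hτ ⊢
  exact ⟨⟨hv.1, by rw [hv.2.2]; exact hτ⟩, Prod.ext hv.2.1 hv.2.2⟩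

theorem sum_ite_eq_clique_le (κ : ι → Finset ι) (ξ : ι → ℕ) (Θ : Finset (ι × Finset ι)) (j : ι) :
    ∑ τ ∈ Θ.filter (fun τ => j ∈ τ.2), (if τ.2 = κ τ.1 then ξ τ.1 else 0) ≤
      ∑ i ∈ Finset.univ.filter (fun i => j ∈ κ i), ξ i := by
  rw [← Finset.sum_filter]
  refine (Finset.sum_image (f := ξ) (g := Prod.fst) ?_).symm.le.trans
    (Finset.sum_le_sum_of_subset fun i hi => ?_)
  · rintro ⟨i, S⟩ hS ⟨i', S'⟩ hS' (rfl : i = i')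
    simp only [Finset.coe_filter, Set.mem_ofPred_eq] at hS hS'
    exact Prod.ext rfl (hS.2.trans hS'.2.symm)
  · obtain ⟨⟨i', S⟩, hS, rfl⟩ := Finset.mem_image.1 hi
    simp only [Finset.mem_filter] at hS
    simp only [Finset.mem_filter, Finset.mem_univ, true_and]
    exact hS.2 ▸ hS.1.2

set_option maxHeartbeats 1000000 in
/-- A graph with a frame contains all graphs that have the same order, bounded degree, and a
decomposition into small flexible tiles. -/
theorem Frame.exists_embedding (hF : Frame G R P h K κ m χ d δ' δ ε C₀ r₀)
    (hT : TileSys H t m w φ) (hm : 1 ≤ m) (hw : 0 < w) {D : ℕ} (hD1 : 1 ≤ D)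
    (hD : ∀ u, (nb H u).card ≤ D) (hχ : m < χ) (hχ' : χ ≤ m + 1) (hd0 : 0 < d) (hd1 : d ≤ 1)
    (hδ : 0 < δ) (hε : 0 < ε) (hV : 0 < Fintype.card V) (hVW : Fintype.card V = Fintype.card W)
    {A L₀ : ℕ} (hA : 4 ≤ (d ^ D * d ^ D / 3) ^ (D + 1) * A)
    (hL₀ : Real.log (Fintype.card (Option (V × (Fin D → Option V)))) ≤ L₀)
    (hε1 : ε * (1 + D) ≤ d ^ D * δ / 2) (hε2 : D * ε ≤ d ^ D * d ^ D / 3)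
    (hδ1 : loadConst m D A C₀ * δ ≤ d ^ D * d ^ D / 3) (hδ2 : loadConst m D A C₀ * δ ≤ δ')
    (hα : χ = m + 1 ∨ ((Finset.univ.filter fun x => φ x = 0).card : ℝ) ≤
      (1 - m / χ) * ((1 - loadConst m D A C₀ * δ) * Fintype.card V))
    (hs : (r₀ : ℝ) * slackConst m D A (Fintype.card ι) w L₀ ≤ d ^ D * δ / 2 * Fintype.card V) :
    ∃ F : W → V, Function.Injective F ∧ ∀ ⦃u v⦄, H.Adj u v → G.Adj (F u) (F v) := by
  obtain ⟨v₀⟩ := Fintype.card_pos_iff.1 hV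
  have : Nonempty ι := ⟨h v₀⟩
  have hdD0 : 0 < d ^ D := pow_pos hd0 D
  have hdD : d ^ D ≤ 1 := pow_le_one₀ hd0.le hd1
  have hdd : d ^ D * d ^ D ≤ d ^ D := mul_le_of_le_one_left hdD0.le hdD
  set p : ι → ℝ := fun i => ((P i).card : ℝ) with hp
  have hP0 : ∀ i, 0 < (P i).card := fun i => by
    have := hF.size i
    by_contra h0
    rw [Nat.eq_zero_of_not_pos h0] at this
    omega
  have hp0 : ∀ i, 0 < p i := fun i => by simp only [hp]; exact_mod_cast hP0 i
  have hr₀ : 0 < (r₀ : ℝ) := by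
    have := hF.size (h v₀)
    rcases Nat.eq_zero_or_pos r₀ with h0 | h0
    · rw [h0] at this; omega
    · exact_mod_cast h0
  have hslack : ∀ i, (slackConst m D A (Fintype.card ι) w L₀ : ℝ) ≤ d ^ D * δ / 2 * p i := by
    intro i
    have h1 : (Fintype.card V : ℝ) ≤ r₀ * p i := by simp only [hp]; exact_mod_cast hF.size i
    have h2 : d ^ D * δ / 2 * Fintype.card V ≤ d ^ D * δ / 2 * (r₀ * p i) := by gcongr
    have h3 := hs.trans h2
    have h4 : (r₀ : ℝ) * slackConst m D A (Fintype.card ι) w L₀ ≤ r₀ * (d ^ D * δ / 2 * p i) := by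
      linarith
    exact le_of_mul_le_mul_left h4 hr₀
  have hslack' : ∀ i, (slackConst m D A (Fintype.card ι) w L₀ : ℝ) ≤ δ * p i := by
    intro i
    refine (hslack i).trans ?_
    have := mul_pos hδ (hp0 i)
    nlinarith
  have hone : ∀ i, 1 ≤ δ * p i := fun i => le_trans (by
    rw [slackConst]; exact_mod_cast Nat.le_add_left _ _) (hslack' i)
  have hwi : ∀ i, (w : ℝ) ≤ d ^ D * δ / 2 * p i := fun i => le_trans (by
    rw [slackConst]; norm_cast; omega) (hslack i)
  have hPne : ∀ i, (P i).Nonempty := fun i => Finset.card_pos.1 (hP0 i)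
  choose v hv using hPne
  have hκcl : ∀ i, R.IsClique (κ i : Set ι) := fun i => hF.KP i _ (hv i) ▸ hF.clq (v i)
  have hκcard : ∀ i, (κ i).card = m + 1 := fun i => hF.KP i _ (hv i) ▸ hF.card_K (v i)
  have hκ : ∀ i, i ∈ κ i := fun i => by
    have := hF.mem_K (v i)
    rwa [hF.KP i _ (hv i), hF.hP i _ (hv i)] at this
  have hadj : ∀ i, ∃ j, R.Adj i j := fun i => by
    obtain ⟨j, hj, hji⟩ := Finset.exists_mem_ne (s := κ i) (by rw [hκcard]; omega) i
    exact ⟨j, hκcl i (hκ i) hj hji.symm⟩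
  set U : ι → ℕ := fun i => (Finset.univ.filter fun v => h v = i).card with hU
  set B : ℝ := (loadConst m D A C₀ : ℝ) * δ with hB
  have hB3 : B ≤ 1 / 3 := by linarith
  have hPU : ∀ i, (P i).card ≤ U i := fun i => Finset.card_le_card fun v hv => by
    simpa using hF.hP i v hv
  have hUP : ∀ i, (U i : ℝ) ≤ p i + δ * p i := fun i => by
    have h1 : U i ≤ (P i).card + (Finset.univ.filter fun v => v ∉ P (h v) ∧ i ∈ K v).card := by
      refine le_trans (Finset.card_le_card fun v hv => ?_) (Finset.card_union_le _ _)
      have hvi : h v = i := by simpa using hv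
      by_cases hvP : v ∈ P i
      · exact Finset.mem_union_left _ hvP
      · refine Finset.mem_union_right _ ?_
        simp only [Finset.mem_filter, Finset.mem_univ, true_and]
        exact ⟨by rwa [hvi], hvi ▸ hF.mem_K v⟩
    have h2 : (U i : ℝ) ≤ (P i).card +
      ((Finset.univ.filter fun v => v ∉ P (h v) ∧ i ∈ K v).card : ℝ) := by exact_mod_cast h1
    have := hF.atyp i
    simp only [hp]
    linarith
  have hB2 : 2 * δ ≤ B := by
    have h1 : (2 : ℝ) ≤ loadConst m D A C₀ := by
      rw [loadConst]; exact_mod_cast Nat.le_add_left _ _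
    rw [hB]
    exact mul_le_mul_of_nonneg_right h1 hδ.le
  have hδ13 : δ ≤ 1 / 3 := by linarith
  set ξ : ι → ℕ := fun i => U i - (P i).card + ⌈δ * p i⌉₊ with hξ
  have hceil : ∀ i, ⌈δ * p i⌉₊ ≤ (P i).card := fun i => Nat.ceil_le.2 (by
    have := hp0 i
    have : δ * p i ≤ p i := by nlinarith
    simpa only [hp] using this)
  have hξp : ∀ i, (ξ i : ℝ) ≤ 2 * (δ * p i) + 1 := fun i => by
    have h1 := hUP i
    have h2 := (Nat.ceil_lt_add_one (mul_pos hδ (hp0 i)).le).le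
    simp only [hξ]
    rw [Nat.cast_add, Nat.cast_sub (hPU i)]
    simp only [hp] at h1 h2 ⊢
    linarith
  have hξ17 : ∀ i j, (ξ i : ℝ) ≤ 17 * (δ * p j) := fun i j => by
    have h1 : p i ≤ 8 * p j := hF.ratio i j
    have h2 := mul_le_mul_of_nonneg_left h1 hδ.le
    have := hξp i
    have := hone j
    linarith
  have hξs : ∀ j, ((∑ i ∈ Finset.univ.filter (fun i => j ∈ κ i), ξ i : ℕ) : ℝ) ≤
      C₀ * (17 * (δ * p j)) := fun j => by
    rw [Nat.cast_sum]
    refine (Finset.sum_le_card_nsmul _ _ _ fun i _ => hξ17 i j).trans ?_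
    rw [nsmul_eq_mul]
    have : 0 ≤ 17 * (δ * p j) := by linarith [hone j]
    exact mul_le_mul_of_nonneg_right (by exact_mod_cast hF.load j) this
  set Θ : Finset (ι × Finset ι) := Finset.univ.image fun v => (h v, K v) with hΘ
  set N : ι × Finset ι → ℕ := fun τ =>
    (Finset.univ.filter fun v => v ∉ P (h v) ∧ h v = τ.1 ∧ K v = τ.2).card with hN
  set q : ι × Finset ι → ℕ := fun τ =>
    A * (N τ + (if τ.2 = κ τ.1 then ξ τ.1 else 0) + L₀) with hq
  set γ : ι → ℕ := fun j =>
    ∑ τ ∈ Θ.filter (fun τ => j ∈ τ.2), ((m + 1) * ((D + 1) ^ 3 * q τ) + w) with hγ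
  set ζ : ι → ℕ := fun j => ∑ i ∈ Finset.univ.filter (fun i => j ∈ κ i), ((m + 1) * ξ i + w) +
      (corrSize (Fintype.card ι) m w + w) with hζ
  have hload : ∀ j, ((γ j : ℝ) + ζ j) ≤ B * p j := by
    intro j
    have h1 := sum_card_atypical_le P h K Θ j
    have h2 := sum_ite_eq_clique_le κ ξ Θ j
    have h3 : (Θ.filter fun τ => j ∈ τ.2).card ≤ typeCard (Fintype.card ι) := by
      refine (Finset.card_le_univ _).trans_eq ?_
      rw [Fintype.card_prod, Fintype.card_finset, typeCard]
    have h4 : (Finset.univ.filter fun i => j ∈ κ i).card ≤ Fintype.card ι := Finset.card_le_univ _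
    set E := (m + 1) * (D + 1) ^ 3 * A with hE
    have h5 : γ j + ζ j + 1 ≤ E * (∑ τ ∈ Θ.filter (fun τ => j ∈ τ.2), N τ +
        ∑ τ ∈ Θ.filter (fun τ => j ∈ τ.2), (if τ.2 = κ τ.1 then ξ τ.1 else 0)) +
        (m + 1) * ∑ i ∈ Finset.univ.filter (fun i => j ∈ κ i), ξ i +
        slackConst m D A (Fintype.card ι) w L₀ := by
      have h6 : γ j = E * (∑ τ ∈ Θ.filter (fun τ => j ∈ τ.2), N τ +
          ∑ τ ∈ Θ.filter (fun τ => j ∈ τ.2), (if τ.2 = κ τ.1 then ξ τ.1 else 0)) +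
          (Θ.filter fun τ => j ∈ τ.2).card * (E * L₀ + w) := by
        rw [← Finset.sum_add_distrib, Finset.mul_sum, ← smul_eq_mul, ← Finset.sum_const,
          ← Finset.sum_add_distrib]
        refine Finset.sum_congr rfl fun τ _ => ?_
        simp only [hq, hE]
        ring
      have h7 : ζ j = (m + 1) * ∑ i ∈ Finset.univ.filter (fun i => j ∈ κ i), ξ i +
          (Finset.univ.filter fun i => j ∈ κ i).card * w +
          (corrSize (Fintype.card ι) m w + w) := by
        simp only [hζ]
        rw [Finset.sum_add_distrib, Finset.mul_sum, Finset.sum_const, smul_eq_mul]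
      have h8 := Nat.mul_le_mul_right (E * L₀ + w) h3
      have h9 := Nat.mul_le_mul_right w h4
      rw [h6, h7, slackConst, ← hE]
      omega
    have h6 : γ j + ζ j ≤ E * ((Finset.univ.filter fun v => v ∉ P (h v) ∧ j ∈ K v).card +
        ∑ i ∈ Finset.univ.filter (fun i => j ∈ κ i), ξ i) +
        (m + 1) * ∑ i ∈ Finset.univ.filter (fun i => j ∈ κ i), ξ i +
        slackConst m D A (Fintype.card ι) w L₀ := by
      have := Nat.mul_le_mul_left E (Nat.add_le_add h1 h2)
      linarith
    have h7 : ((γ j : ℝ) + ζ j) ≤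
        E * (((Finset.univ.filter fun v => v ∉ P (h v) ∧ j ∈ K v).card : ℝ) +
        ((∑ i ∈ Finset.univ.filter (fun i => j ∈ κ i), ξ i : ℕ) : ℝ)) +
        (m + 1) * ((∑ i ∈ Finset.univ.filter (fun i => j ∈ κ i), ξ i : ℕ) : ℝ) +
        slackConst m D A (Fintype.card ι) w L₀ := by exact_mod_cast h6
    have h8 := hF.atyp j
    have h9 := hξs j
    have h10 := hslack' j
    calc ((γ j : ℝ) + ζ j) ≤ E * (δ * p j + C₀ * (17 * (δ * p j))) +
          (m + 1) * (C₀ * (17 * (δ * p j))) + δ * p j := by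
          refine h7.trans ?_
          gcongr
      _ ≤ B * p j := by
          have : (loadConst m D A C₀ : ℝ) = E * (1 + 17 * C₀) + (m + 1) * (17 * C₀) + 2 := by
            rw [loadConst, hE]; push_cast; ring
          rw [hB, this]
          have := mul_pos hδ (hp0 j)
          nlinarith
  have hpU : ∀ j, p j ≤ U j := fun j => by simp only [hp]; exact_mod_cast hPU j
  have hB0 : 0 ≤ B := by linarith
  have hsumP : ∑ j, p j ≤ Fintype.card V := by
    refine (Finset.sum_le_sum fun j _ => hpU j).trans_eq ?_
    rw [← Nat.cast_sum, ← Finset.card_univ, Finset.card_eq_sum_card_fiberwise (f := h)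
      (t := Finset.univ) (fun v _ => by simp)]
  have hsumU : ∑ j, U j = Fintype.card W := by
    rw [← hVW, ← Finset.card_univ, Finset.card_eq_sum_card_fiberwise (f := h)
      (t := Finset.univ) (fun v _ => by simp)]
  obtain ⟨a, X, Y, Z, ty, ha, haU, hXZ, hXind, hZt, hZγ, hYZ, hYty, hYd, hXξ, hYq⟩ :=
    hT.exists_layout hm hw hD hχ hχ' hF.conn hadj hκcard hκcl hκ (Θ := Θ)
      (by
        intro τ hτ
        obtain ⟨u, -, rfl⟩ := Finset.mem_image.1 hτ
        exact hF.card_K u)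
      (by
        intro τ hτ
        obtain ⟨u, -, rfl⟩ := Finset.mem_image.1 hτ
        exact hF.clq u)
      (by
        intro τ hτ
        obtain ⟨u, -, rfl⟩ := Finset.mem_image.1 hτ
        exact hF.mem_K u) q ξ (U := U) (γ := γ) (ζ := ζ) hsumU
      (fun j => by
        have h1 := hload j
        have h2 := hpU j
        have h3 : ((γ j : ℝ) + ζ j) < U j := by
          have := hp0 j
          nlinarith
        exact_mod_cast h3)
      (fun j => le_rfl) (fun j => le_rfl)
      (fun T hT' => hF.deg_cond T fun j => by
        have h1 := hload j
        have h2 := hpU j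
        have h3 := hUP j
        have h4 := (hT' j).1
        have h5 := (hT' j).2
        have h6 := hp0 j
        have h7 : B * p j ≤ δ' * p j := mul_le_mul_of_nonneg_right hδ2 h6.le
        have h8 : δ * p j ≤ B * p j := mul_le_mul_of_nonneg_right (by linarith) h6.le
        simp only [hp] at h1 h2 h3 h7 h8
        rw [abs_le]
        constructor <;> linarith)
      (hα.imp_right fun hα => hα.trans (by
        have hm0 : 0 ≤ 1 - (m : ℝ) / χ := by
          have : (0 : ℝ) ≤ m := Nat.cast_nonneg m
          rw [sub_nonneg, div_le_one (by linarith)]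
          exact hχ.le
        refine mul_le_mul_of_nonneg_left ?_ hm0
        rw [Finset.sum_sub_distrib, ← Nat.cast_sum, hsumU, ← hVW]
        have h1 : ∑ j, ((γ j : ℝ) + ζ j) ≤ B * ∑ j, p j := by
          rw [Finset.mul_sum]
          exact Finset.sum_le_sum fun j _ => hload j
        have h2 := mul_le_mul_of_nonneg_left hsumP hB0
        linarith))
  have hc0 : 0 < d ^ D * d ^ D / 3 := by positivity
  have hD0 : (1 : ℝ) ≤ D := by exact_mod_cast hD1
  have hY : ∀ v, (N (h v, K v) : ℝ) + (if K v = κ (h v) then (ξ (h v) : ℝ) else 0) + L₀ ≤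
      (d ^ D * d ^ D / 3) ^ (D + 1) / 4 *
        (Y.filter fun y => a y = h v ∧ ty y = K v).card := by
    intro v
    have h1 := hYq (h v, K v) (Finset.mem_image.2 ⟨v, Finset.mem_univ v, rfl⟩)
    have h2 : (A : ℝ) * (N (h v, K v) + (if K v = κ (h v) then (ξ (h v) : ℝ) else 0) + L₀) ≤
        (Y.filter fun y => a y = h v ∧ ty y = K v).card := by
      refine le_trans (le_of_eq ?_) (Nat.cast_le.2 h1)
      simp only [hq]
      push_cast
      rfl
    have h3 : (0 : ℝ) ≤ N (h v, K v) + (if K v = κ (h v) then (ξ (h v) : ℝ) else 0) + L₀ := by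
      split_ifs <;> positivity
    have h4 : 1 ≤ (d ^ D * d ^ D / 3) ^ (D + 1) / 4 * A := by linarith
    have h5 : 0 ≤ (d ^ D * d ^ D / 3) ^ (D + 1) / 4 := by positivity
    calc _ ≤ (d ^ D * d ^ D / 3) ^ (D + 1) / 4 * A * _ := le_mul_of_one_le_left h3 h4
      _ ≤ _ := by rw [mul_assoc]; exact mul_le_mul_of_nonneg_left h2 h5
  refine _root_.Paper.exists_embedding hF.reg hε hd0 hd1 hc0 (by linarith) (by linarith) hD1 hD ha
    h K κ hF.hP hF.KP (fun i => ⟨v i, hv i⟩) hF.deg haU t (fun x y hxy => hT.adj x y hxy)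
    (w := w) (fun j => by exact_mod_cast hT.size j) X Y Z hXZ hXind hZt (γ := B) ?_ hYZ ty hYty hYd
    (δ := δ) ?_ ?_ ?_ ?_ ?_ ?_ ?_
  · intro i
    have h1 : ((Z.filter fun v => a v = i).card : ℝ) ≤ γ i := by exact_mod_cast hZγ i
    have h2 := hload i
    have : (0 : ℝ) ≤ ζ i := Nat.cast_nonneg _
    simp only [hp] at h2
    linarith
  · intro i
    have h1 : (Finset.univ.filter fun v => v ∉ X ∧ a v = i).card + ξ i = U i := by
      rw [← hXξ i, ← haU i, ← Finset.card_union_of_disjoint]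
      · congr 1
        ext x
        simp only [Finset.mem_union, Finset.mem_filter, Finset.mem_univ, true_and]
        tauto
      · rw [Finset.disjoint_left]
        intro x hx hx'
        exact (Finset.mem_filter.1 hx).2.1 (Finset.mem_filter.1 hx').1
    have h2 := hceil i
    have h3 : (Finset.univ.filter fun v => v ∉ X ∧ a v = i).card + ⌈δ * p i⌉₊ = (P i).card := by
      have := hPU i
      simp only [hξ] at h1
      omega
    have h4 : ((Finset.univ.filter fun v => v ∉ X ∧ a v = i).card : ℝ) + ⌈δ * p i⌉₊ =
      (P i).card := by exact_mod_cast h3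
    have h5 := Nat.le_ceil (δ * p i)
    simp only [hp] at h4 h5
    linarith
  · linarith
  · have : ε ≤ D * ε := le_mul_of_one_le_left hε.le hD0
    linarith
  · intro i
    have h1 := mul_le_mul_of_nonneg_right hε1 (hp0 i).le
    have h2 := hwi i
    simp only [hp] at h1 h2
    linarith
  · have : 0 < d ^ D * δ := by positivity
    have : 0 ≤ ε * D := by positivity
    linarith
  · intro v
    have h1 := hY v
    rw [hXξ]
    have h2 : (0 : ℝ) ≤ L₀ := Nat.cast_nonneg _
    refine ((le_add_of_nonneg_right h2).trans h1).trans' (le_of_eq ?_)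
    simp only [hN]
    congr 3
    refine Finset.filter_congr fun u _ => ?_
    rw [and_congr_left_iff]
    rintro ⟨h3, -⟩
    rw [h3]
  · intro v
    have h1 := hY v
    have h2 : (0 : ℝ) ≤ N (h v, K v) := Nat.cast_nonneg _
    have h3 : (0 : ℝ) ≤ (if K v = κ (h v) then (ξ (h v) : ℝ) else 0) := by
      split_ifs <;> positivity
    linarith
end FrameEmbedding

section Tiles
variable {W : Type} [Fintype W] {H : SimpleGraph W} {m : ℕ}

theorem GcdOne.mono {S S' : Set ℕ} (h : GcdOne S) (hS : S ⊆ S') : GcdOne S' :=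
  h.imp fun _ hT => ⟨hT.1.trans hS, hT.2⟩

theorem chromNum_le_of_colorable {k : ℕ} (h : H.Colorable k) : chromNum H ≤ k :=
  ENat.toNat_le_of_le_coe h.chromaticNumber_le

theorem colorable_chromNum {k : ℕ} (h : H.Colorable k) : H.Colorable (chromNum H) := by
  obtain ⟨j, hj⟩ : ∃ j : ℕ, H.chromaticNumber = j :=
    ⟨_, (ENat.coe_toNat (ne_top_of_le_ne_top (ENat.coe_ne_top k) h.chromaticNumber_le)).symm⟩
  rw [chromNum, hj, ENat.toNat_coe, ← SimpleGraph.chromaticNumber_le_iff_colorable, hj]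

theorem two_mul_alphaNat_le {k : ℕ} (h : H.Colorable k) (h2 : 2 ≤ chromNum H) :
    ∃ C, ProperCol H (chromNum H) C ∧ (∃ i < chromNum H, classCard C i = alphaNat H) ∧
      2 * alphaNat H ≤ Fintype.card W := by
  obtain ⟨c⟩ := colorable_chromNum h
  have hne : {a | ∃ C, ProperCol H (chromNum H) C ∧ a = minClassCard C (chromNum H)}.Nonempty :=
    ⟨_, fun x => (c x : ℕ), ⟨fun x => (c x).2, fun u v huv h => c.valid huv (Fin.ext h)⟩, rfl⟩
  obtain ⟨C, hC, hCa⟩ := Nat.sInf_mem hne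
  have hne' : {a | ∃ i < chromNum H, a = classCard C i}.Nonempty := ⟨_, 0, by omega, rfl⟩
  obtain ⟨i, hi, hia⟩ := Nat.sInf_mem hne'
  have hle : ∀ j < chromNum H, alphaNat H ≤ classCard C j := fun j hj =>
    hCa.le.trans (Nat.sInf_le ⟨j, hj, rfl⟩)
  refine ⟨C, hC, ⟨i, hi, ?_⟩, ?_⟩
  · rw [← hia]; exact hCa.symm
  · have h0 := hle 0 (by omega)
    have h1 := hle 1 (by omega)
    have h3 : classCard C 0 + classCard C 1 ≤ Fintype.card W := by
      rw [classCard, classCard, ← Set.ncard_union_eq (by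
        rw [Set.disjoint_left]
        intro x hx hx'
        simp only [Set.mem_ofPred_eq] at hx hx'
        omega), ← Nat.card_eq_fintype_card]
      exact Set.ncard_le_card _
    omega

/-- A graph with critical chromatic number at most `χ` has a colouring with one small class. -/
theorem exists_coloring_small_class [Nonempty W] (hH : H.Colorable (m + 1)) (hm : 1 ≤ m) {χ : ℝ}
    (hχ : m < χ) (hcr : critR H ≤ χ) :
    ∃ φ : W → Fin (m + 1), (∀ x y, H.Adj x y → φ x ≠ φ y) ∧
      ((Finset.univ.filter fun x => φ x = 0).card : ℝ) ≤ (1 - m / χ) * Fintype.card W := by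
  have hm0 : (1 : ℝ) ≤ m := by exact_mod_cast hm
  have hχ0 : 0 < χ := by linarith
  rcases Nat.lt_or_ge m (chromNum H) with hc | hc
  · have hcm : chromNum H = m + 1 := le_antisymm (chromNum_le_of_colorable hH) hc
    obtain ⟨C, hC, ⟨i, hi, hia⟩, h2⟩ := two_mul_alphaNat_le hH (by omega)
    rw [hcm] at hC hi
    refine ⟨fun x => Equiv.swap 0 ⟨i, hi⟩ ⟨C x, hC.1 x⟩, fun x y hxy h => ?_, ?_⟩
    · exact hC.2 hxy (Fin.ext_iff.1 ((Equiv.swap _ _).injective h))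
    · have h3 : (Finset.univ.filter fun x =>
          Equiv.swap (0 : Fin (m + 1)) ⟨i, hi⟩ ⟨C x, hC.1 x⟩ = 0).card = alphaNat H := by
        rw [← hia, classCard, ← Set.ncard_coe_finset]
        congr 1
        ext x
        simp only [Finset.coe_filter, Finset.mem_univ, true_and, Set.mem_ofPred_eq]
        rw [Equiv.swap_apply_eq_iff, Equiv.swap_apply_left, Fin.ext_iff]
      rw [h3]
      have hN : (0 : ℝ) < Fintype.card W := by exact_mod_cast Fintype.card_pos
      have h4 : 2 * (alphaNat H : ℝ) ≤ Fintype.card W := by exact_mod_cast h2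
      have h5 : alphaR H ≤ 1 / 2 := by
        rw [alphaR, div_le_iff₀ hN]; linarith
      rw [critR, hcm, div_le_iff₀ (by linarith)] at hcr
      push_cast at hcr
      have h6 : (m : ℝ) / χ ≤ 1 - alphaR H := by
        rw [div_le_iff₀ hχ0]; linarith
      have h7 : (alphaNat H : ℝ) = alphaR H * Fintype.card W := by
        rw [alphaR, div_mul_cancel₀ _ hN.ne']
      rw [h7]
      exact mul_le_mul_of_nonneg_right (by linarith) hN.le
  · obtain ⟨c⟩ := (colorable_chromNum hH).mono hc
    refine ⟨fun x => (c x).succ, fun x y hxy h => c.valid hxy (Fin.succ_injective _ h), ?_⟩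
    rw [Finset.filter_false_of_mem (fun x _ => Fin.succ_ne_zero _), Finset.card_empty,
      Nat.cast_zero]
    have : (m : ℝ) / χ ≤ 1 := (div_le_one hχ0).2 hχ.le
    exact mul_nonneg (by linarith) (Nat.cast_nonneg _)

theorem card_filter_mem_eq_classCard {p : Set W} (C : p → ℕ) (i : ℕ) (c : W → Prop)
    (hc : ∀ x : p, c x ↔ C x = i) :
    (Finset.univ.filter fun x => x ∈ p ∧ c x).card = classCard C i := by
  rw [classCard, ← Set.ncard_image_of_injective _ Subtype.val_injective, ← Set.ncard_coe_finset]
  congr 1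
  ext x
  simp only [Finset.coe_filter, Finset.mem_univ, true_and, Set.mem_ofPred_eq, Set.mem_image,
    Subtype.exists, exists_and_right, exists_eq_right]
  exact ⟨fun h => ⟨h.1, (hc ⟨x, h.1⟩).1 h.2⟩, fun ⟨h, h'⟩ => ⟨h, (hc ⟨x, h⟩).2 h'⟩⟩

/-- The tiles of a tiling form a tile system. -/
theorem exists_tileSys [Nonempty W] {w χ : ℝ} (hm : 1 ≤ m) (hT : IsTiling H (TileFcr (m + 1) w))
    (hχ : m < χ) (hcr : critR H ≤ χ) :
    ∃ (J : Type) (_ : Fintype J) (t : W → J) (φ : W → Fin (m + 1)), TileSys H t m ⌊w⌋₊ φ ∧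
      ((Finset.univ.filter fun x => φ x = 0).card : ℝ) ≤ (1 - m / χ) * Fintype.card W := by
  obtain ⟨P, ⟨-, hP⟩, hPadj, hPt⟩ := hT
  choose p hp hpu using fun x => hP x
  have hmem : ∀ x, ∀ T ∈ P, x ∈ T ↔ p x = T := fun x T hT =>
    ⟨fun h => (hpu x T ⟨hT, h⟩).symm, fun h => h ▸ (hp x).2⟩
  have hadj : ∀ x y, H.Adj x y → p x = p y := fun x y hxy => by
    by_contra h
    exact hPadj _ (hp x).1 _ (hp y).1 h _ (hp x).2 _ (hp y).2 hxy
  have hcol : H.Colorable (m + 1) := by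
    have : ∀ T : P, ∃ c : T.1 → Fin (m + 1), ∀ x y, (H.induce T.1).Adj x y → c x ≠ c y :=
      fun T => by
        obtain ⟨c⟩ := (hPt T.1 T.2).2.1
        exact ⟨c, fun x y hxy => c.valid hxy⟩
    choose c hc using this
    refine ⟨SimpleGraph.Coloring.mk (fun x => c ⟨p x, (hp x).1⟩ ⟨x, (hp x).2⟩) ?_⟩
    intro x y hxy
    have h1 := hc ⟨p x, (hp x).1⟩ ⟨x, (hp x).2⟩ ⟨y, (hmem _ _ (hp x).1).2 (hadj x y hxy).symm⟩ hxy
    have h2 : ∀ (T : P) (h : y ∈ T.1), T.1 = p y → c T ⟨y, h⟩ = c ⟨p y, (hp y).1⟩ ⟨y, (hp y).2⟩ := by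
      rintro ⟨T, hT⟩ h (rfl : T = p y)
      rfl
    rwa [h2 _ _ (hadj x y hxy)] at h1
  obtain ⟨φ, hφ, hφ0⟩ := exists_coloring_small_class hcol hm hχ hcr
  refine ⟨P, Fintype.ofFinite P, fun x => ⟨p x, (hp x).1⟩, φ, ⟨fun x y hxy =>
    Subtype.ext (hadj x y hxy), ?_, hφ, ?_, ?_⟩, hφ0⟩
  · rintro ⟨T, hT⟩
    refine Nat.le_floor (le_trans (le_of_eq ?_) (hPt T hT).2.2)
    rw [Fintype.card_subtype]
    congr! 3 with x
    exact Subtype.ext_iff.trans (hmem x T hT).symm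
  · rintro ⟨T, hT⟩
    have hcT := (hPt T hT).2.1
    have hD : GcdOne (DSet (H.induce T)) := by
      rcases (hPt T hT).1 with h | h
      exacts [h.2.1, h.2]
    refine hD.mono ?_
    rintro d ⟨C, hC, rfl⟩
    have hC' : ∀ x, C x < m + 1 := fun x => (hC.1 x).trans_le (chromNum_le_of_colorable hcT)
    refine ⟨fun x => if h : x ∈ T then ⟨C ⟨x, h⟩, hC' _⟩ else 0, fun x y hx hxy => ?_, ?_⟩
    · have hxT : x ∈ T := (hmem x T hT).2 (Subtype.ext_iff.1 hx)
      have hyT : y ∈ T := (hmem y T hT).2 ((hadj x y hxy).symm.trans (Subtype.ext_iff.1 hx))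
      simp only [dif_pos hxT, dif_pos hyT]
      exact fun h => hC.2 (u := ⟨x, hxT⟩) (v := ⟨y, hyT⟩) hxy (Fin.ext_iff.1 h)
    · have h1 : ∀ i : Fin (m + 1), (Finset.univ.filter fun x => (⟨p x, (hp x).1⟩ : P) = ⟨T, hT⟩ ∧
          (if h : x ∈ T then (⟨C ⟨x, h⟩, hC' _⟩ : Fin (m + 1)) else 0) = i).card =
          classCard C i := by
        intro i
        rw [← card_filter_mem_eq_classCard C i (fun x => (if h : x ∈ T then
          (⟨C ⟨x, h⟩, hC' _⟩ : Fin (m + 1)) else 0) = i)]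
        · congr! 3 with x
          exact Subtype.ext_iff.trans (hmem x T hT).symm
        · rintro ⟨x, hx⟩
          simp only [dif_pos hx, Fin.ext_iff]
      have h2 := h1 0
      rw [Fin.val_zero] at h2
      have h3 := h1 1
      rw [Fin.val_one', Nat.mod_eq_of_lt (by omega)] at h3
      have h4 : ∀ a b : ℕ, a = classCard C 0 → b = classCard C 1 →
          ((classCard C 0 : ℤ) - classCard C 1).natAbs = ((a : ℤ) - b).natAbs := by
        rintro _ _ rfl rfl
        rfl
      exact h4 _ _ (by convert h2) (by convert h3)
  · rintro rfl ⟨T, hT⟩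
    have hcT := (hPt T hT).2.1
    have hD : GcdOne (compOrders (H.induce T)) := by
      rcases (hPt T hT).1 with h | h
      · exact h.2.2
      · have := h.1.trans hcT.chromaticNumber_le
        norm_num at this
    refine hD.mono ?_
    rintro d ⟨c, rfl⟩
    refine ⟨Finset.univ.filter fun x => ∃ h : x ∈ T, (⟨x, h⟩ : T) ∈ c.supp, ?_, ?_, ?_⟩
    · intro x hx
      obtain ⟨h, -⟩ := (Finset.mem_filter.1 hx).2
      exact Subtype.ext ((hmem x T hT).1 h)
    · have key : ∀ x y, H.Adj x y → (∃ h : x ∈ T, (⟨x, h⟩ : T) ∈ c.supp) →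
          ∃ h : y ∈ T, (⟨y, h⟩ : T) ∈ c.supp := by
        rintro x y hxy ⟨h, hc⟩
        have hyT : y ∈ T := (hmem y T hT).2 ((hadj x y hxy).symm.trans ((hmem x T hT).1 h))
        refine ⟨hyT, ?_⟩
        have hadj' : (H.induce T).Adj ⟨x, h⟩ ⟨y, hyT⟩ := hxy
        exact (c.mem_supp_congr_adj hadj').1 hc
      intro x y hxy
      simp only [Finset.mem_filter, Finset.mem_univ, true_and]
      exact ⟨key x y hxy, key y x hxy.symm⟩
    · rw [← Set.ncard_image_of_injective _ Subtype.val_injective, ← Set.ncard_coe_finset]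
      congr 1
      ext x
      simp
end Tiles

section Numerics

theorem slackConst_le {m D A r r₀ w L₀ : ℕ} (hr : r ≤ r₀) :
    slackConst m D A r w L₀ ≤ (typeCard r₀ * ((m + 1) * (D + 1) ^ 3 * A + 1) + r₀ +
      r₀ * (10 + 8 * mainErr r₀ m) + 2) * (w ^ 2 + L₀ + 1) := by
  have h1 : typeCard r ≤ typeCard r₀ :=
    Nat.mul_le_mul hr (Nat.pow_le_pow_right (by norm_num) hr)
  have h2 : cfgCard r m ≤ cfgCard r₀ m := Nat.mul_le_mul_right _ (Nat.pow_le_pow_left hr _)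
  have h3 : mainErr r m ≤ mainErr r₀ m := by
    rw [mainErr, mainErr]
    gcongr
  have hw : w ≤ w ^ 2 := Nat.le_self_pow (by norm_num) w
  have hw1 : w ≤ w ^ 2 + L₀ + 1 := by omega
  have hL : L₀ ≤ w ^ 2 + L₀ + 1 := by omega
  have h4 : corrSize r m w ≤ r₀ * (10 + 8 * mainErr r₀ m) * (w ^ 2 + L₀ + 1) := by
    calc corrSize r m w = r * (10 + 8 * mainErr r m) * w ^ 2 := by rw [corrSize]; ring
      _ ≤ r₀ * (10 + 8 * mainErr r₀ m) * (w ^ 2 + L₀ + 1) := by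
        gcongr
        omega
  calc slackConst m D A r w L₀ ≤
      typeCard r₀ * ((m + 1) * (D + 1) ^ 3 * A * (w ^ 2 + L₀ + 1) + (w ^ 2 + L₀ + 1)) +
        r₀ * (w ^ 2 + L₀ + 1) + r₀ * (10 + 8 * mainErr r₀ m) * (w ^ 2 + L₀ + 1) +
        (w ^ 2 + L₀ + 1) + (w ^ 2 + L₀ + 1) := by
        rw [slackConst]
        gcongr
        omega
    _ = _ := by ring

open Filter in
theorem eventually_floor_sqrt_div_log_sq_le {c : ℝ} (hc : 0 < c) :
    ∀ᶠ n : ℕ in atTop, (⌊Real.sqrt n / Real.log n⌋₊ : ℝ) ^ 2 ≤ c * n := by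
  have h1 : ∀ᶠ n : ℕ in atTop, 1 / c + 1 ≤ Real.log n :=
    (Real.tendsto_log_atTop.comp tendsto_natCast_atTop_atTop).eventually_ge_atTop _
  filter_upwards [h1] with n hn
  have hc' : 0 < 1 / c := by positivity
  have hl : 0 < Real.log n := by linarith
  have h2 : (⌊Real.sqrt n / Real.log n⌋₊ : ℝ) ≤ Real.sqrt n / Real.log n :=
    Nat.floor_le (by positivity)
  have hn0 : (0 : ℝ) ≤ n := Nat.cast_nonneg n
  calc (⌊Real.sqrt n / Real.log n⌋₊ : ℝ) ^ 2 ≤ (Real.sqrt n / Real.log n) ^ 2 := by gcongr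
    _ = n / Real.log n ^ 2 := by rw [div_pow, Real.sq_sqrt hn0]
    _ ≤ c * n := by
      rw [div_le_iff₀ (by positivity)]
      have h3 : 1 / c ≤ Real.log n ^ 2 := by nlinarith
      rw [div_le_iff₀ hc] at h3
      nlinarith

open Filter in
theorem eventually_ceil_log_le (D : ℕ) {c : ℝ} (hc : 0 < c) :
    ∀ᶠ n : ℕ in atTop, (⌈(D : ℝ) * Real.log (n + 1)⌉₊ : ℝ) ≤ c * n := by
  have h0 : 0 < c / (4 * (D + 1)) := by positivity
  have h1 : ∀ᶠ n : ℕ in atTop, ‖Real.log ((n : ℝ) + 1)‖ ≤ c / (4 * (D + 1)) * ‖(n : ℝ) + 1‖ :=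
    (tendsto_atTop_add_const_right _ 1 tendsto_natCast_atTop_atTop).eventually
      (Real.isLittleO_log_id_atTop.def h0)
  have h2 : ∀ᶠ n : ℕ in atTop, 1 + 2 / c ≤ (n : ℝ) :=
    tendsto_natCast_atTop_atTop.eventually_ge_atTop _
  filter_upwards [h1, h2] with n h1 h2
  have hc' : 0 < 2 / c := by positivity
  have hl : 0 ≤ Real.log ((n : ℝ) + 1) := Real.log_nonneg (by linarith)
  rw [Real.norm_of_nonneg hl, Real.norm_of_nonneg (by linarith)] at h1
  have h3 := (Nat.ceil_lt_add_one (mul_nonneg (Nat.cast_nonneg (α := ℝ) D) hl)).le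
  have h4 : (D : ℝ) * Real.log (n + 1) ≤ (D + 1) * (c / (4 * (D + 1)) * ((n : ℝ) + 1)) := by
    gcongr
    linarith
  have h5 : ((D : ℝ) + 1) * (c / (4 * (D + 1)) * ((n : ℝ) + 1)) = c / 4 * (n + 1) := by
    field_simp
  have h6 : c * (2 / c) = 2 := by field_simp
  have h7 : c * (1 + 2 / c) ≤ c * n := mul_le_mul_of_nonneg_left h2 hc.le
  rw [h5] at h4
  linarith

theorem log_card_option_le (n D : ℕ) :
    Real.log (Fintype.card (Option (Fin n × (Fin D → Option (Fin n))))) ≤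
      ⌈((D + 1 : ℕ) : ℝ) * Real.log (n + 1)⌉₊ := by
  have h1 : Fintype.card (Option (Fin n × (Fin D → Option (Fin n)))) ≤ (n + 1) ^ (D + 1) := by
    rw [← Nat.card_eq_fintype_card, Finite.card_option, Nat.card_prod, Nat.card_fun,
      Finite.card_option, Nat.card_fin, Nat.card_fin]
    have := Nat.one_le_pow D (n + 1) (by omega)
    rw [pow_succ, Nat.mul_add, mul_one, mul_comm n]
    omega
  have h2 : (0 : ℝ) < Fintype.card (Option (Fin n × (Fin D → Option (Fin n)))) := by
    exact_mod_cast Fintype.card_pos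
  refine le_trans ?_ (Nat.le_ceil _)
  rw [← Real.log_pow]
  exact Real.log_le_log h2 (by exact_mod_cast h1)

end Numerics

/-- Theorem 1.3 (degree sequence version of the extended Kühn–Osthus theorem). -/
theorem extended_KO_deg_seq (χ Δ μ : ℝ) (hχ : 1 < χ) (hΔ : 1 < Δ) (hμ : 0 < μ) :
    ∃ n₀ : ℕ, ∀ n : ℕ, n₀ ≤ n → ∀ H G : SimpleGraph (Fin n),
      IsTiling H (TileFcr ⌈χ⌉₊ (Real.sqrt n / Real.log n)) →
      critR H ≤ χ →
      (∀ v, (ndeg H v : ℝ) ≤ Δ) →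
      DegSeqStrong G χ μ →
      ContainsCopy G H := by
  have hceil : 1 < ⌈χ⌉₊ := Nat.lt_ceil.2 (by simpa using hχ)
  obtain ⟨m, hm⟩ : ∃ m, ⌈χ⌉₊ = m + 1 := ⟨⌈χ⌉₊ - 1, by omega⟩
  have hm1 : 1 ≤ m := by omega
  have hmχ : (m : ℝ) < χ := Nat.lt_ceil.1 (by omega)
  obtain ⟨χ', d, δ', C₀, hχχ', hχ'm, hor, hd0, hd1, hδ', hframe⟩ :=
    exists_frame_of_degSeqStrong hχ hμ hm
  set D : ℕ := ⌊Δ⌋₊ with hD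
  have hD1 : 1 ≤ D := Nat.le_floor (by exact_mod_cast hΔ.le)
  have hD0 : (0 : ℝ) < D := by exact_mod_cast hD1
  have hm0 : (0 : ℝ) < m := by exact_mod_cast hm1
  set c : ℝ := d ^ D * d ^ D / 3 with hc
  have hc0 : 0 < c := by positivity
  set A : ℕ := ⌈4 / c ^ (D + 1)⌉₊ with hA
  have hA4 : 4 ≤ c ^ (D + 1) * A := by
    have := Nat.le_ceil (4 / c ^ (D + 1))
    rwa [div_le_iff₀' (by positivity)] at this
  set L : ℝ := (loadConst m D A C₀ : ℝ) with hL
  have hL0 : 0 < L := by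
    rw [hL, loadConst]
    positivity
  obtain ⟨η, hη0, hη⟩ : ∃ η : ℝ, 0 < η ∧
      (χ' = m + 1 ∨ 1 - m / χ ≤ (1 - m / χ') * (1 - η)) := by
    rcases hor with h | h
    · exact ⟨1, one_pos, Or.inl h⟩
    · have h1 : (m : ℝ) / χ < 1 := (div_lt_one (by linarith)).2 hmχ
      have h2 : (m : ℝ) / χ' < m / χ := div_lt_div_of_pos_left hm0 (by linarith) h
      have h3 : 0 < 1 - m / χ' := by linarith
      refine ⟨(m / χ - m / χ') / (1 - m / χ'), div_pos (by linarith) h3, Or.inr ?_⟩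
      rw [mul_sub, mul_one, mul_div_cancel₀ _ h3.ne']
      linarith
  set δ : ℝ := min (min c δ') η / L with hδ
  have hδL : L * δ = min (min c δ') η := mul_div_cancel₀ _ hL0.ne'
  have hδ0 : 0 < δ := div_pos (lt_min (lt_min hc0 hδ') hη0) hL0
  set ε : ℝ := min (d ^ D * δ / 2 / (1 + D)) (c / D) with hε
  have hε0 : 0 < ε := lt_min (by positivity) (by positivity)
  obtain ⟨r₀, n₀, hframe⟩ := hframe δ ε hδ0 hε0
  set C : ℕ := typeCard r₀ * ((m + 1) * (D + 1) ^ 3 * A + 1) + r₀ +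
      r₀ * (10 + 8 * mainErr r₀ m) + 2 with hC
  set s : ℝ := d ^ D * δ / 2 / (3 * (r₀ + 1) * C) with hs
  have hC0 : (0 : ℝ) < C := by exact_mod_cast (show 0 < C by omega)
  have hs0 : 0 < s := by positivity
  have hev : ∀ᶠ n : ℕ in Filter.atTop, n₀ ≤ n ∧ 1 ≤ n ∧
      (⌊Real.sqrt n / Real.log n⌋₊ : ℝ) ^ 2 ≤ s * n ∧
      (⌈((D + 1 : ℕ) : ℝ) * Real.log (n + 1)⌉₊ : ℝ) ≤ s * n ∧ 1 / s ≤ (n : ℝ) := by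
    filter_upwards [Filter.eventually_ge_atTop n₀, Filter.eventually_ge_atTop 1,
      eventually_floor_sqrt_div_log_sq_le hs0, eventually_ceil_log_le (D + 1) hs0,
      tendsto_natCast_atTop_atTop.eventually_ge_atTop (1 / s)] with n h1 h2 h3 h4 h5
    exact ⟨h1, h2, h3, h4, h5⟩
  obtain ⟨n₁, hn₁⟩ := Filter.eventually_atTop.1 hev
  refine ⟨n₁, fun n hn H G hH hcr hdeg hG => ?_⟩
  obtain ⟨hn₀, hn1, hw, hlog, hns⟩ := hn₁ n hn
  have : NeZero n := ⟨by omega⟩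
  rw [hm] at hH
  obtain ⟨J, _, t, φ, hT, hφ⟩ := exists_tileSys hm1 hH hmχ hcr
  obtain ⟨ι, _, R, P, h, K, κ, hιr, hF⟩ := hframe (Fin n) G (by rwa [Fintype.card_fin]) hG
  rw [div_le_iff₀ hs0] at hns
  have hwpos : 0 < ⌊Real.sqrt n / Real.log n⌋₊ :=
    lt_of_lt_of_le (Finset.card_pos.2 ⟨(0 : Fin n), by simp⟩) (hT.size (t 0))
  rw [Fintype.card_fin] at hφ
  refine hF.exists_embedding hT hm1 hwpos hD1 (fun u => ?_) (by linarith) hχ'm hd0 hd1 hδ0 hε0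
    (by rwa [Fintype.card_fin]) rfl hA4 (log_card_option_le n D) ?_ ?_ ?_ ?_ ?_ ?_
  · rw [nb, ← ndeg_eq_card]
    exact Nat.le_floor (hdeg u)
  · have := min_le_left (d ^ D * δ / 2 / (1 + D)) (c / D)
    rwa [← hε, le_div_iff₀ (by positivity)] at this
  · have := min_le_right (d ^ D * δ / 2 / (1 + D)) (c / D)
    rwa [← hε, le_div_iff₀' hD0] at this
  · rw [hδL]
    exact (min_le_left _ _).trans (min_le_left _ _)
  · rw [hδL]
    exact (min_le_left _ _).trans (min_le_right _ _)
  · refine hη.imp_right fun hη => hφ.trans ?_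
    have h1 : (m : ℝ) / χ' ≤ 1 := (div_le_one (by linarith)).2 (by linarith)
    have h2 : L * δ ≤ η := hδL.le.trans (min_le_right _ _)
    rw [Fintype.card_fin, ← mul_assoc]
    refine mul_le_mul_of_nonneg_right (hη.trans ?_) (Nat.cast_nonneg n)
    exact mul_le_mul_of_nonneg_left (by linarith) (by linarith)
  · rw [Fintype.card_fin]
    have h1 : (slackConst m D A (Fintype.card ι) ⌊Real.sqrt n / Real.log n⌋₊
        ⌈((D + 1 : ℕ) : ℝ) * Real.log (n + 1)⌉₊ : ℝ) ≤ C * (3 * (s * n)) := by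
      refine (Nat.cast_le.2 (slackConst_le hιr)).trans ?_
      rw [← hC]
      push_cast at hlog ⊢
      refine mul_le_mul_of_nonneg_left ?_ hC0.le
      linarith
    have h2 : ((r₀ : ℝ) + 1) * (C * (3 * (s * n))) = d ^ D * δ / 2 * n := by
      rw [hs]
      field_simp
    rw [← h2]
    exact mul_le_mul (by linarith) h1 (Nat.cast_nonneg _) (by positivity)

end Paper
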